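/- For every real k > 0 there exists a constant M(k) > 0 such that for every real x > 1, the sum over all odd squarefree integers n with 1 ≤ n ≤ x of max{βx(Bₙ), βy(Bₙ)}^k is strictly less than M(k) times the number of odd squarefree integers n with 1 ≤ n ≤ x (the sum being computed in [0,∞], with the convention ∞^k = ∞). -/

import Mathlib

open scoped ENNReal

/-- `u 0, …, u (N-1)` is a non-trivial arithmetic progression. -/
def IsNontrivAP {F : Type*} [Field F] {N : ℕ} (u : Fin N → F) : Prop :=
  ∃ a b : F, b ≠ 0 ∧ ∀ i : Fin N, u i = a + (((i : ℕ) + 1 : ℕ) : F) * b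

/-- The congruent number curve `Bₙ : y² = x³ − n²x` over `ℚ`. -/
def CongruentCurve (n : ℕ) : WeierstrassCurve ℚ :=
  ⟨0, 0, 0, -(n : ℚ) ^ 2, 0⟩

/-- `βx(W) ∈ ℕ ∪ {∞}`: the supremum of lengths of sequences of affine rational points of `W`
whose `x`-coordinates form a non-trivial arithmetic progression. -/
noncomputable def betaX (W : WeierstrassCurve ℚ) : ℕ∞ :=
  ⨆ N ∈ {N : ℕ | ∃ x y : Fin N → ℚ,
    (∀ i, W.toAffine.Nonsingular (x i) (y i)) ∧ IsNontrivAP x}, (N : ℕ∞)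

/-- `βy(W) ∈ ℕ ∪ {∞}`: the supremum of lengths of sequences of affine rational points of `W`
whose `y`-coordinates form a non-trivial arithmetic progression. -/
noncomputable def betaY (W : WeierstrassCurve ℚ) : ℕ∞ :=
  ⨆ N ∈ {N : ℕ | ∃ x y : Fin N → ℚ,
    (∀ i, W.toAffine.Nonsingular (x i) (y i)) ∧ IsNontrivAP y}, (N : ℕ∞)

namespace AC
open WeierstrassCurve

abbrev Ec (n : ℕ) : Affine ℚ := (CongruentCurve n).toAffine

/-- height of a rational number -/
def hq (u : ℚ) : ℕ := max u.num.natAbs u.den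

lemma one_le_hq (u : ℚ) : 1 ≤ hq u := le_max_of_le_right u.pos

lemma hq_le_of_eq_div {u : ℚ} {a b : ℤ} {M : ℕ} (hb : b ≠ 0) (h : u * b = a)
    (ha' : a.natAbs ≤ M) (hb' : b.natAbs ≤ M) : hq u ≤ M := by
  have h1 : u.num * b = a * u.den := by
    have hu := Rat.num_div_den u
    have hd : (u.den : ℚ) ≠ 0 := by exact_mod_cast u.den_nz
    have : (u.num : ℚ) * b = a * u.den := by
      rw [← h]
      nth_rw 2 [← hu]
      field_simp
    exact_mod_cast this
  have h2 : (u.den : ℤ) ∣ b := by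
    have : (u.den : ℤ) ∣ u.num * b := ⟨a, by rw [h1]; ring⟩
    refine (IsCoprime.dvd_of_dvd_mul_left ?_ this)
    have := u.reduced
    rw [Int.isCoprime_iff_gcd_eq_one]
    rw [Int.gcd_comm]; exact this
  obtain ⟨k, rfl⟩ := h2
  have hk : k ≠ 0 := by rintro rfl; simp at hb
  have hd : (u.den : ℤ) ≠ 0 := by exact_mod_cast u.den_nz
  have h3 : a = u.num * k := by
    have : (u.den : ℤ) * a = u.den * (u.num * k) := by linear_combination -h1
    exact mul_left_cancel₀ hd this
  subst h3
  have hk1 : 1 ≤ k.natAbs := by omega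
  unfold hq
  simp only [Int.natAbs_mul, Int.natAbs_natCast] at ha' hb'
  refine max_le ?_ ?_ <;> nlinarith

lemma hq_root {α β : ℚ} {A B C : ℤ} {M : ℕ} (hA : A ≠ 0) (h1 : A * (α + β) = B)
    (h2 : A * (α * β) = C) (hAM : A.natAbs ≤ M) (hBM : B.natAbs ≤ M) (hCM : C.natAbs ≤ M) :
    hq α * hq β ≤ 2 * M := by
  obtain ⟨r, s, hs, rs, hr⟩ : ∃ r s : ℤ, 0 < s ∧ IsCoprime r s ∧ α = r / s ∧ hq α = max r.natAbs s.natAbs := by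
    refine ⟨α.num, α.den, by exact_mod_cast α.pos, ?_, ?_, rfl⟩
    · rw [Int.isCoprime_iff_gcd_eq_one]; exact α.reduced
    · exact_mod_cast (Rat.num_div_den α).symm
  obtain ⟨r', s', hs', rs', hr'⟩ : ∃ r s : ℤ, 0 < s ∧ IsCoprime r s ∧ β = r / s ∧ hq β = max r.natAbs s.natAbs := by
    refine ⟨β.num, β.den, by exact_mod_cast β.pos, ?_, ?_, rfl⟩
    · rw [Int.isCoprime_iff_gcd_eq_one]; exact β.reduced
    · exact_mod_cast (Rat.num_div_den β).symm
  have hsq : (s : ℚ) ≠ 0 := by exact_mod_cast hs.ne'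
  have hsq' : (s' : ℚ) ≠ 0 := by exact_mod_cast hs'.ne'
  have e1 : A * (r * s' + r' * s) = B * (s * s') := by
    have : (A : ℚ) * (r * s' + r' * s) = B * (s * s') := by
      rw [← h1, hr.1, hr'.1]; field_simp
    exact_mod_cast this
  have e2 : A * (r * r') = C * (s * s') := by
    have : (A : ℚ) * (r * r') = C * (s * s') := by
      rw [← h2, hr.1, hr'.1]; field_simp
    exact_mod_cast this
  have d1 : s ∣ A := by
    have f1 : s ∣ A * r' := by
      refine rs.symm.dvd_of_dvd_mul_left (y := r) ⟨C * s', by linear_combination e2⟩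
    have f2 : s ∣ A * s' := by
      refine rs.symm.dvd_of_dvd_mul_left (y := r) ⟨B * s' - A * r', by linear_combination e1⟩
    obtain ⟨p, q, hpq⟩ := rs'
    have : A = p * (A * r') + q * (A * s') := by linear_combination (-A) * hpq
    rw [this]; exact dvd_add (f1.mul_left _) (f2.mul_left _)
  obtain ⟨A', rfl⟩ := d1
  have e1' : A' * (r * s' + r' * s) = B * s' :=
    mul_left_cancel₀ hs.ne' (by linear_combination e1)
  have e2' : A' * (r * r') = C * s' :=
    mul_left_cancel₀ hs.ne' (by linear_combination e2)
  have d2 : s' ∣ A' := by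
    have f1 : s' ∣ A' * r := by
      refine rs'.symm.dvd_of_dvd_mul_left (y := r') ⟨C, by linear_combination e2'⟩
    have f2 : s' ∣ A' * s := by
      refine rs'.symm.dvd_of_dvd_mul_left (y := r') ⟨B - A' * r, by linear_combination e1'⟩
    obtain ⟨p, q, hpq⟩ := rs
    have : A' = p * (A' * r) + q * (A' * s) := by linear_combination (-A') * hpq
    rw [this]; exact dvd_add (f1.mul_left _) (f2.mul_left _)
  obtain ⟨k, rfl⟩ := d2
  have e1'' : B = k * (r * s' + r' * s) :=
    mul_left_cancel₀ hs'.ne' (by linear_combination -e1')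
  have e2'' : C = k * (r * r') :=
    mul_left_cancel₀ hs'.ne' (by linear_combination -e2')
  have hk : 1 ≤ |k| := by
    have : k ≠ 0 := by rintro rfl; simp at hA
    exact Int.one_le_abs this
  subst e1'' e2''
  have g1 : s * s' ≤ M := by
    have : |s * (s' * k)| ≤ M := by zify at hAM; exact hAM
    have e : |s * (s' * k)| = s * s' * |k| := by rw [abs_mul, abs_mul, abs_of_pos hs, abs_of_pos hs']; ring
    have : 0 < s * s' := by positivity
    nlinarith
  have g2 : |r * s' + r' * s| ≤ M := by
    have : |k * (r * s' + r' * s)| ≤ M := by zify at hBM; exact hBM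
    rw [abs_mul] at this
    have := abs_nonneg (r * s' + r' * s)
    nlinarith
  have g3 : |r| * |r'| ≤ M := by
    have : |k * (r * r')| ≤ M := by zify at hCM; exact hCM
    rw [abs_mul, abs_mul] at this
    have : 0 ≤ |r| * |r'| := by positivity
    nlinarith
  rw [hr.2, hr'.2]
  zify
  rw [abs_of_pos hs, abs_of_pos hs']
  have t1 : |r| * s' ≤ |r * s' + r' * s| + |r'| * s := by
    have := abs_sub (r * s' + r' * s) (r' * s)
    have e : r * s' + r' * s - r' * s = r * s' := by ring
    rw [e, abs_mul, abs_mul, abs_of_pos hs, abs_of_pos hs'] at this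
    exact this
  have t2 : |r'| * s ≤ |r * s' + r' * s| + |r| * s' := by
    have := abs_sub (r * s' + r' * s) (r * s')
    have e : r * s' + r' * s - r * s' = r' * s := by ring
    rw [e, abs_mul, abs_mul, abs_of_pos hs, abs_of_pos hs'] at this
    exact this
  have n1 := abs_nonneg r
  have n2 := abs_nonneg r'
  rcases le_total |r| s with a | a <;> rcases le_total |r'| s' with b | b
  · rw [max_eq_right a, max_eq_right b]; linarith
  · rw [max_eq_right a, max_eq_left b]
    have : |r| * s' ≤ s * s' := by nlinarith
    linarith
  · rw [max_eq_left a, max_eq_right b]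
    have : |r'| * s ≤ s * s' := by nlinarith
    linarith
  · rw [max_eq_left a, max_eq_left b]; linarith

lemma exists_rs (u : ℚ) : ∃ r s : ℤ, 0 < s ∧ IsCoprime r s ∧ u = r / s ∧ |r| ≤ hq u ∧ s ≤ hq u ∧
    (hq u : ℤ) = max |r| s := by
  refine ⟨u.num, u.den, by exact_mod_cast u.pos, ?_, ?_, ?_, ?_, ?_⟩
  · rw [Int.isCoprime_iff_gcd_eq_one]; exact u.reduced
  · exact_mod_cast (Rat.num_div_den u).symm
  · unfold hq; push_cast; exact le_max_left _ _
  · unfold hq; push_cast; exact le_max_right _ _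
  · unfold hq; push_cast; rfl

lemma hq_addsub {u v α β : ℚ} (huv : u ≠ v) (h1 : (u - v) ^ 2 * (α + β) = 2 * (u * v - 1) * (u + v))
    (h2 : (u - v) ^ 2 * (α * β) = (u * v + 1) ^ 2) :
    hq α * hq β ≤ 16 * hq u ^ 2 * hq v ^ 2 := by
  obtain ⟨r, s, hs, -, rfl, hr, hs2, -⟩ := exists_rs u
  obtain ⟨r', s', hs', -, rfl, hr', hs2', -⟩ := exists_rs v
  set m := hq (r / s : ℚ)
  set m' := hq (r' / s' : ℚ)
  have hsq : (s : ℚ) ≠ 0 := by exact_mod_cast hs.ne'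
  have hsq' : (s' : ℚ) ≠ 0 := by exact_mod_cast hs'.ne'
  have nr := abs_nonneg r
  have nr' := abs_nonneg r'
  have key := hq_root (α := α) (β := β) (A := (r * s' - r' * s) ^ 2)
    (B := 2 * (r * r' - s * s') * (r * s' + r' * s)) (C := (r * r' + s * s') ^ 2) (M := 8 * m ^ 2 * m' ^ 2)
    ?_ ?_ ?_ ?_ ?_ ?_
  · linarith
  · intro h
    apply huv
    have : r * s' - r' * s = 0 := by simpa using h
    rw [div_eq_div_iff hsq hsq']
    have : r * s' = r' * s := by linarith
    exact_mod_cast this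
  · push_cast
    field_simp at h1
    linear_combination h1
  · push_cast
    field_simp at h2
    linear_combination h2
  all_goals
    zify
    have a1 : |r * s'| ≤ m * m' := by rw [abs_mul, abs_of_pos hs']; gcongr
    have a2 : |r' * s| ≤ m * m' := by rw [abs_mul, abs_of_pos hs, mul_comm]; gcongr
    have a3 : |r * r'| ≤ m * m' := by rw [abs_mul]; gcongr
    have a4 : |s * s'| ≤ m * m' := by rw [abs_mul, abs_of_pos hs, abs_of_pos hs']; gcongr
    have b1 : |r * s' - r' * s| ≤ 2 * (m * m') := (abs_sub _ _).trans (by linarith)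
    have b2 : |r * s' + r' * s| ≤ 2 * (m * m') := (abs_add_le _ _).trans (by linarith)
    have b3 : |r * r' - s * s'| ≤ 2 * (m * m') := (abs_sub _ _).trans (by linarith)
    have b4 : |r * r' + s * s'| ≤ 2 * (m * m') := (abs_add_le _ _).trans (by linarith)
  · rw [abs_pow]
    calc |r * s' - r' * s| ^ 2 ≤ (2 * (m * m' : ℤ)) ^ 2 := by gcongr
      _ ≤ _ := by nlinarith [sq_nonneg (m * m' : ℤ)]
  · rw [abs_mul, abs_mul]
    calc |2| * |r * r' - s * s'| * |r * s' + r' * s| ≤ 2 * (2 * (m * m')) * (2 * (m * m' : ℤ)) := by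
          gcongr; norm_num
      _ ≤ _ := by nlinarith [sq_nonneg (m * m' : ℤ)]
  · rw [abs_pow]
    calc |r * r' + s * s'| ^ 2 ≤ (2 * (m * m' : ℤ)) ^ 2 := by gcongr
      _ ≤ _ := by nlinarith [sq_nonneg (m * m' : ℤ)]

/-- doubling -/
lemma hq_double {u α : ℚ} (h0 : u ^ 3 - u ≠ 0) (h : 4 * (u ^ 3 - u) * α = (u ^ 2 + 1) ^ 2) :
    hq u ^ 4 ≤ 64 * hq α ∧ hq α ≤ 16 * hq u ^ 4 := by
  obtain ⟨r, s, hs, rs, rfl, hr, hs2, hmax⟩ := exists_rs u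
  set m := hq (r / s : ℚ)
  have hsq : (s : ℚ) ≠ 0 := by exact_mod_cast hs.ne'
  have e0 : (4 * r * s * (r ^ 2 - s ^ 2) : ℚ) * α = (r ^ 2 + s ^ 2) ^ 2 := by
    field_simp at h
    linear_combination h
  have D0 : 4 * r * s * (r ^ 2 - s ^ 2) ≠ 0 := by
    intro hh
    apply h0
    have : (4 * r * s * (r ^ 2 - s ^ 2) : ℚ) = 0 := by exact_mod_cast hh
    field_simp
    have h4 : (r : ℚ) * (r ^ 2 - s ^ 2) * (4 * s) = 0 := by linear_combination this
    rcases mul_eq_zero.mp h4 with h5 | h5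
    · linear_combination h5
    · exfalso; apply hsq; linarith
  have nr := abs_nonneg r
  have m0 : (0:ℤ) ≤ m := by positivity
  have q1 : r ^ 2 ≤ m ^ 2 := by rw [← sq_abs r]; gcongr
  have q2 : s ^ 2 ≤ m ^ 2 := by gcongr
  constructor
  · -- lower
    obtain ⟨a, b, hb, ab, rfl, ha, hb2, -⟩ := exists_rs α
    set m' := hq (a / b : ℚ)
    have hbq : (b : ℚ) ≠ 0 := by exact_mod_cast hb.ne'
    have e : 4 * r * s * (r ^ 2 - s ^ 2) * a = (r ^ 2 + s ^ 2) ^ 2 * b := by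
      have : (4 * r * s * (r ^ 2 - s ^ 2) : ℚ) * a = (r ^ 2 + s ^ 2) ^ 2 * b := by
        rw [← e0]; field_simp
      exact_mod_cast this
    have d1 : b ∣ 4 * r * s * (r ^ 2 - s ^ 2) := by
      apply ab.symm.dvd_of_dvd_mul_right (z := a)
      exact ⟨(r ^ 2 + s ^ 2) ^ 2, by linear_combination e⟩
    obtain ⟨d, hd⟩ := d1
    have hN : (r ^ 2 + s ^ 2) ^ 2 = d * a := by
      apply mul_right_cancel₀ hb.ne'
      rw [← e, hd]; ring
    have hd64 : d ∣ 64 := by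
      have cr : IsCoprime d r := by
        have : IsCoprime ((r ^ 2 + s ^ 2) ^ 2) r := by
          have h1 : IsCoprime (s ^ 4) r := rs.symm.pow_left
          have : (r ^ 2 + s ^ 2) ^ 2 = s ^ 4 + r * (r ^ 3 + 2 * r * s ^ 2) := by ring
          rw [this]; exact h1.add_mul_left_left _
        rw [hN] at this; exact this.of_mul_left_left
      have cs : IsCoprime d s := by
        have : IsCoprime ((r ^ 2 + s ^ 2) ^ 2) s := by
          have h1 : IsCoprime (r ^ 4) s := rs.pow_left
          have : (r ^ 2 + s ^ 2) ^ 2 = r ^ 4 + s * (s ^ 3 + 2 * s * r ^ 2) := by ring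
          rw [this]; exact h1.add_mul_left_left _
        rw [hN] at this; exact this.of_mul_left_left
      have f1 : d ∣ 4 * (r ^ 2 - s ^ 2) := by
        apply cr.dvd_of_dvd_mul_left
        apply cs.dvd_of_dvd_mul_left
        exact ⟨b, by linear_combination hd⟩
      have f2 : d ∣ (r ^ 2 * s ^ 2) * 64 := by
        have : (r ^ 2 * s ^ 2) * 64 = 16 * (d * a) - (4 * (r ^ 2 - s ^ 2)) * (4 * (r ^ 2 - s ^ 2)) := by
          rw [← hN]; ring
        rw [this]
        exact dvd_sub ((dvd_mul_right _ _).mul_left _) (f1.mul_left _)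
      exact (IsCoprime.mul_right cr.pow_right cs.pow_right).dvd_of_dvd_mul_left f2
    have hd' : |d| ≤ 64 := by
      have := Int.le_of_dvd (by norm_num) ((abs_dvd d 64).mpr hd64)
      exact this
    have hm : (m : ℤ) ^ 4 ≤ (r ^ 2 + s ^ 2) ^ 2 := by
      have : (m : ℤ) ^ 2 ≤ r ^ 2 + s ^ 2 := by
        rw [hmax]
        rcases le_total |r| s with a | a
        · rw [max_eq_right a]; nlinarith [sq_nonneg r]
        · rw [max_eq_left a, sq_abs]; nlinarith [sq_nonneg s]
      calc (m : ℤ) ^ 4 = (m ^ 2) ^ 2 := by ring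
        _ ≤ _ := by gcongr
    have : (r ^ 2 + s ^ 2) ^ 2 ≤ 64 * (m' : ℤ) := by
      rw [hN]
      calc d * a ≤ |d * a| := le_abs_self _
        _ = |d| * |a| := abs_mul _ _
        _ ≤ 64 * m' := by gcongr
    zify; linarith
  · apply hq_le_of_eq_div (a := (r ^ 2 + s ^ 2) ^ 2) (b := 4 * r * s * (r ^ 2 - s ^ 2)) D0
    · push_cast; linear_combination e0
    · zify
      rw [abs_of_nonneg (by positivity)]
      calc (r ^ 2 + s ^ 2) ^ 2 ≤ ((m:ℤ) ^ 2 + m ^ 2) ^ 2 := by gcongr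
        _ ≤ _ := by nlinarith [sq_nonneg ((m:ℤ)^2)]
    · zify
      have : |r ^ 2 - s ^ 2| ≤ 2 * (m:ℤ) ^ 2 := by
        refine (abs_sub _ _).trans ?_
        rw [abs_of_nonneg (sq_nonneg r), abs_of_nonneg (sq_nonneg s)]; linarith
      calc |4 * r * s * (r ^ 2 - s ^ 2)| = 4 * |r| * s * |r ^ 2 - s ^ 2| := by
            rw [abs_mul, abs_mul, abs_mul, abs_of_pos hs]; norm_num
        _ ≤ 4 * m * m * (2 * m ^ 2) := by gcongr
        _ ≤ _ := by nlinarith [sq_nonneg ((m:ℤ)^2)]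
end AC

namespace AC
open WeierstrassCurve WeierstrassCurve.Affine

/-- naive height of the twisted x-coordinate -/
def ht {n : ℕ} : (Ec n).Point → ℕ
  | .zero => 1
  | .some x _ _ => hq (x / n)

@[simp] lemma ht_zero {n : ℕ} : ht (0 : (Ec n).Point) = 1 := rfl
@[simp] lemma ht_some {n : ℕ} {x y : ℚ} (h : (Ec n).Nonsingular x y) : ht (.some x y h) = hq (x / n) := rfl

lemma ht_pos {n : ℕ} (P : (Ec n).Point) : 1 ≤ ht P := by
  cases P with
  | zero => exact le_rfl
  | some x y h => exact one_le_hq _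

lemma Ec_eq {n : ℕ} {x y : ℚ} (h : (Ec n).Nonsingular x y) : y ^ 2 = x ^ 3 - n ^ 2 * x := by
  have := h.1
  rw [Affine.equation_iff] at this
  simp [CongruentCurve] at this
  linear_combination this

lemma Ec_nonsing {n : ℕ} (hn : n ≠ 0) {x y : ℚ} (h : y ^ 2 = x ^ 3 - n ^ 2 * x) : (Ec n).Nonsingular x y := by
  rw [Affine.nonsingular_iff, Affine.equation_iff]
  have hn' : (n : ℚ) ≠ 0 := by exact_mod_cast hn
  refine ⟨by simp [CongruentCurve]; linear_combination h, ?_⟩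
  simp [CongruentCurve]
  by_cases hy : y = 0
  · left
    subst hy
    intro h2
    have h3 : x * (x ^ 2 - n ^ 2) = 0 := by linear_combination -h
    rcases mul_eq_zero.mp h3 with h4 | h4
    · subst h4; simp at h2; exact hn h2
    · have : (n : ℚ) ^ 2 = 0 := by linear_combination (-3 / 2) * h4 - (1 / 2) * h2
      exact hn' (by simpa using this)
  · right; intro h2; apply hy; linarith

@[simp] lemma Ec_negY {n : ℕ} (x y : ℚ) : (Ec n).negY x y = -y := by simp [negY, CongruentCurve]

lemma ht_neg {n : ℕ} (P : (Ec n).Point) : ht (-P) = ht P := by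
  cases P with
  | zero => rfl
  | some x y h => rw [Point.neg_some]; rfl

lemma ec_neg_some {n : ℕ} {x y : ℚ} (h : (Ec n).Nonsingular x y) (h' : (Ec n).Nonsingular x (-y)) :
    - Point.some x y h = .some x (-y) h' := by
  rw [Point.neg_some]; simp [CongruentCurve]

lemma ec_add_ne {n : ℕ} {x₁ x₂ y₁ y₂ : ℚ} (h₁ : (Ec n).Nonsingular x₁ y₁) (h₂ : (Ec n).Nonsingular x₂ y₂)
    (hx : x₁ ≠ x₂) : ∃ x y, ∃ h : (Ec n).Nonsingular x y, Point.some _ _ h₁ + Point.some _ _ h₂ = .some x y h ∧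
      x = ((y₁ - y₂) / (x₁ - x₂)) ^ 2 - x₁ - x₂ ∧ y = - ((y₁ - y₂) / (x₁ - x₂) * (x - x₁) + y₁) := by
  refine ⟨_, _, _, Point.add_of_X_ne hx, ?_, ?_⟩
  · rw [slope_of_X_ne hx]; simp [addX, CongruentCurve]
  · rw [slope_of_X_ne hx]; simp [addX, addY, negAddY, CongruentCurve]

lemma ec_add_self {n : ℕ} {x₁ y₁ : ℚ} (h₁ : (Ec n).Nonsingular x₁ y₁) (hy : y₁ ≠ 0) :
    ∃ x y, ∃ h : (Ec n).Nonsingular x y, Point.some _ _ h₁ + Point.some _ _ h₁ = .some x y h ∧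
      x = ((3 * x₁ ^ 2 - n ^ 2) / (2 * y₁)) ^ 2 - 2 * x₁ ∧
      y = - ((3 * x₁ ^ 2 - n ^ 2) / (2 * y₁) * (x - x₁) + y₁) := by
  have hy' : y₁ ≠ (Ec n).negY x₁ y₁ := by
    rw [Ec_negY]; intro h; apply hy; linarith
  have hs : (Ec n).slope x₁ x₁ y₁ y₁ = (3 * x₁ ^ 2 - n ^ 2) / (2 * y₁) := by
    rw [slope_of_Y_ne rfl hy', Ec_negY]
    simp [CongruentCurve]; ring
  refine ⟨_, _, _, Point.add_self_of_Y_ne hy', ?_, ?_⟩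
  · rw [hs]; simp [addX, CongruentCurve]; ring
  · rw [hs]; simp [addX, addY, negAddY, CongruentCurve]

lemma ec_add_self_zero {n : ℕ} {x₁ : ℚ} (h₁ : (Ec n).Nonsingular x₁ 0) :
    Point.some _ _ h₁ + Point.some _ _ h₁ = 0 := Point.add_self_of_Y_eq (by simp [CongruentCurve])

lemma ht_two {n : ℕ} (hn : n ≠ 0) (P : (Ec n).Point) : ht P ^ 4 ≤ 64 * ht (P + P) ∧ ht (P + P) ≤ 16 * ht P ^ 4 := by
  have hn' : (n : ℚ) ≠ 0 := by exact_mod_cast hn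
  cases P with
  | zero => change ht (0 : (Ec n).Point) ^ 4 ≤ 64 * ht (0 + 0 : (Ec n).Point) ∧ ht (0 + 0 : (Ec n).Point) ≤ 16 * ht (0 : (Ec n).Point) ^ 4
            simp
  | some x y h =>
    have he := Ec_eq h
    by_cases hy : y = 0
    · subst hy
      rw [ec_add_self_zero, ht_zero, ht_some]
      have h3 : x * ((x - n) * (x + n)) = 0 := by linear_combination -he
      have : hq (x / n) = 1 := by
        rcases mul_eq_zero.mp h3 with h4 | h4
        · subst h4; simp [hq]
        · rcases mul_eq_zero.mp h4 with h4 | h4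
          · have : x = n := by linarith
            subst this; rw [div_self hn']; simp [hq]
          · have : x = -n := by linarith
            subst this; rw [neg_div, div_self hn']; simp [hq]
      rw [this]; norm_num
    · obtain ⟨x', y', h', e, ex, -⟩ := ec_add_self h hy
      rw [e, ht_some, ht_some]
      have hu : (x / n) ^ 3 - x / n = y ^ 2 / n ^ 3 := by
        rw [he]; field_simp
      apply hq_double
      · rw [hu]; positivity
      · rw [hu, ex]
        field_simp
        have : y ^ 4 = (x ^ 3 - n ^ 2 * x) ^ 2 := by rw [← he]; ring
        linear_combination (-32 * x) * he

lemma ht_addsub {n : ℕ} (hn : n ≠ 0) (P Q : (Ec n).Point) :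
    ht (P + Q) * ht (P - Q) ≤ 16 * ht P ^ 2 * ht Q ^ 2 := by
  have hn' : (n : ℚ) ≠ 0 := by exact_mod_cast hn
  by_cases hPQ : P = Q
  · subst hPQ
    rw [sub_self, ht_zero]
    have := (ht_two hn P).2
    calc _ ≤ 16 * ht P ^ 4 := by simpa using this
      _ = _ := by ring
  by_cases hPQ' : P = -Q
  · subst hPQ'
    rw [neg_add_cancel, ht_zero, ht_neg, sub_eq_add_neg]
    have := (ht_two hn (-Q)).2
    rw [ht_neg] at this
    calc _ ≤ 16 * ht Q ^ 4 := by simpa using this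
      _ = _ := by ring
  match P, Q, hPQ, hPQ' with
  | .zero, Q, _, _ =>
    change ht (0 + Q) * ht (0 - Q) ≤ 16 * ht (0 : (Ec n).Point) ^ 2 * ht Q ^ 2
    rw [zero_add, zero_sub, ht_neg, ht_zero]; nlinarith [sq_nonneg (ht Q)]
  | .some x y h, .zero, _, _ =>
    set P := Point.some x y h
    change ht (P + 0) * ht (P - 0) ≤ 16 * ht P ^ 2 * ht (0 : (Ec n).Point) ^ 2
    rw [add_zero, sub_zero, ht_zero]; nlinarith [sq_nonneg (ht P)]
  | .some x y h, .some x' y' h', h1, h2 =>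
    have hx : x ≠ x' := by
      intro hx
      rcases Point.X_eq_iff.mp hx with h3 | h3
      · exact h1 h3
      · exact h2 h3
    have h'' : (Ec n).Nonsingular x' (-y') := by
      apply Ec_nonsing hn; rw [neg_sq]; exact Ec_eq h'
    rw [sub_eq_add_neg, ec_neg_some h' h'']
    obtain ⟨a, b, h3, e3, ea, -⟩ := ec_add_ne h h' hx
    obtain ⟨a', b', h4, e4, ea', -⟩ := ec_add_ne h h'' hx
    rw [e3, e4]
    simp only [ht_some]
    have hx' : x - x' ≠ 0 := sub_ne_zero.mpr hx
    have q1 := Ec_eq h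
    have q2 := Ec_eq h'
    apply hq_addsub
    · intro h; apply hx; field_simp at h; exact h
    · rw [ea, ea']; field_simp
      linear_combination 2 * q1 + 2 * q2
    · have s1 : a * (x - x') ^ 2 = (x + x') * (x * x' - n ^ 2) - 2 * (y * y') := by
        rw [ea]; field_simp; linear_combination q1 + q2
      have s2 : a' * (x - x') ^ 2 = (x + x') * (x * x' - n ^ 2) + 2 * (y * y') := by
        rw [ea']; field_simp; linear_combination q1 + q2
      have s3 : (y * y') ^ 2 = (x ^ 3 - n ^ 2 * x) * (x' ^ 3 - n ^ 2 * x') := by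
        rw [mul_pow, q1, q2]
      have s4 : (x - x') ^ 2 * (a * a') = (x * x' + n ^ 2) ^ 2 := by
        have : (x - x') ^ 2 ≠ 0 := pow_ne_zero _ hx'
        apply mul_right_cancel₀ this
        calc (x - x') ^ 2 * (a * a') * (x - x') ^ 2 = (a * (x - x') ^ 2) * (a' * (x - x') ^ 2) := by ring
          _ = _ := by rw [s1, s2]; linear_combination -4 * s3
      field_simp
      linear_combination s4

/-- A4: gap upper bound -/
lemma ht_add_le_of_common {n : ℕ} (hn : n ≠ 0) {x₁ x₂ y₁ y₂ : ℚ} (h₁ : (Ec n).Nonsingular x₁ y₁)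
    (h₂ : (Ec n).Nonsingular x₂ y₂) (hx : x₁ ≠ x₂) {X₁ X₂ D : ℤ} {M : ℕ} (hD : D ≠ 0)
    (e₁ : x₁ / n * D = X₁) (e₂ : x₂ / n * D = X₂) (b₁ : |X₁| ≤ M) (b₂ : |X₂| ≤ M) (b₃ : |D| ≤ M) :
    ht (Point.some _ _ h₁ + Point.some _ _ h₂) ≤ 6 * M ^ 3 := by
  have hn' : (n : ℚ) ≠ 0 := by exact_mod_cast hn
  have hD' : (D : ℚ) ≠ 0 := by exact_mod_cast hD
  have hx' : x₁ - x₂ ≠ 0 := sub_ne_zero.mpr hx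
  have q1 := Ec_eq h₁
  have q2 := Ec_eq h₂
  obtain ⟨a, b, h3, e3, ea, -⟩ := ec_add_ne h₁ h₂ hx
  rw [e3, ht_some]
  have s1 : a * (x₁ - x₂) ^ 2 = (x₁ + x₂) * (x₁ * x₂ - n ^ 2) - 2 * (y₁ * y₂) := by
    rw [ea]; field_simp; linear_combination q1 + q2
  have c₁ : x₁ = X₁ * n / D := by field_simp at e₁ ⊢; linear_combination e₁
  have c₂ : x₂ = X₂ * n / D := by field_simp at e₂ ⊢; linear_combination e₂
  obtain ⟨w, hw⟩ : ∃ w : ℤ, (w : ℚ) = D ^ 3 * (y₁ * y₂) / n ^ 3 := by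
    have hsq : (D ^ 3 * (y₁ * y₂) / n ^ 3) ^ 2 = (((X₁ ^ 3 - X₁ * D ^ 2) * (X₂ ^ 3 - X₂ * D ^ 2) : ℤ) : ℚ) := by
      have : (y₁ * y₂) ^ 2 = (x₁ ^ 3 - n ^ 2 * x₁) * (x₂ ^ 3 - n ^ 2 * x₂) := by
        rw [mul_pow, q1, q2]
      rw [div_pow, mul_pow, this, c₁, c₂]
      push_cast
      field_simp
    have : IsSquare ((((X₁ ^ 3 - X₁ * D ^ 2) * (X₂ ^ 3 - X₂ * D ^ 2) : ℤ)) : ℚ) := ⟨_, hsq.symm.trans (sq _)⟩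
    rw [Rat.isSquare_intCast_iff] at this
    obtain ⟨w, hw⟩ := this
    rw [hw] at hsq
    have : (D ^ 3 * (y₁ * y₂) / n ^ 3 : ℚ) ^ 2 = (w : ℚ) ^ 2 := by rw [hsq]; push_cast; ring
    rcases sq_eq_sq_iff_eq_or_eq_neg.mp this with h | h
    · exact ⟨w, h.symm⟩
    · exact ⟨-w, by rw [h]; push_cast; ring⟩
  have hw2 : w ^ 2 = (X₁ ^ 3 - X₁ * D ^ 2) * (X₂ ^ 3 - X₂ * D ^ 2) := by
    have : (w : ℚ) ^ 2 = (((X₁ ^ 3 - X₁ * D ^ 2) * (X₂ ^ 3 - X₂ * D ^ 2) : ℤ) : ℚ) := by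
      rw [hw]
      have : (y₁ * y₂) ^ 2 = (x₁ ^ 3 - n ^ 2 * x₁) * (x₂ ^ 3 - n ^ 2 * x₂) := by
        rw [mul_pow, q1, q2]
      rw [div_pow, mul_pow, this, c₁, c₂]
      push_cast
      field_simp
    exact_mod_cast this
  have bd : ∀ X : ℤ, |X| ≤ M → |X ^ 3 - X * D ^ 2| ≤ (M : ℤ) ^ 3 := by
    intro X hX
    have e : X ^ 3 - X * D ^ 2 = X * (X ^ 2 - D ^ 2) := by ring
    have t1 : X ^ 2 ≤ (M : ℤ) ^ 2 := by rw [← sq_abs]; gcongr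
    have t2 : D ^ 2 ≤ (M : ℤ) ^ 2 := by rw [← sq_abs]; gcongr
    have : |X ^ 2 - D ^ 2| ≤ (M : ℤ) ^ 2 := by
      rw [abs_le]; constructor <;> nlinarith [sq_nonneg X, sq_nonneg D]
    rw [e, abs_mul]
    calc |X| * |X ^ 2 - D ^ 2| ≤ M * M ^ 2 := by gcongr
      _ = _ := by ring
  have hwM : |w| ≤ (M : ℤ) ^ 3 := by
    apply abs_le_of_sq_le_sq _ (by positivity)
    rw [hw2]
    calc (X₁ ^ 3 - X₁ * D ^ 2) * (X₂ ^ 3 - X₂ * D ^ 2) ≤ |(X₁ ^ 3 - X₁ * D ^ 2) * (X₂ ^ 3 - X₂ * D ^ 2)| := le_abs_self _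
      _ ≤ (M : ℤ) ^ 3 * M ^ 3 := by rw [abs_mul]; gcongr; exact bd _ b₁; exact bd _ b₂
      _ = _ := by ring
  have hX : X₁ - X₂ ≠ 0 := by
    intro h
    apply hx
    have : X₁ = X₂ := by linarith
    rw [c₁, c₂, this]
  have b4 : |X₁ - X₂| ≤ 2 * M := (abs_sub _ _).trans (by linarith)
  have b5 : |X₁ + X₂| ≤ 2 * M := (abs_add_le _ _).trans (by linarith)
  have b6 : |X₁ * X₂ - D ^ 2| ≤ 2 * M ^ 2 := by
    refine (abs_sub _ _).trans ?_
    rw [abs_mul, abs_pow]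
    have : |X₁| * |X₂| ≤ M * M := by gcongr
    have : |D| ^ 2 ≤ (M:ℤ) ^ 2 := by gcongr
    nlinarith
  apply hq_le_of_eq_div (a := (X₁ + X₂) * (X₁ * X₂ - D ^ 2) - 2 * w) (b := D * (X₁ - X₂) ^ 2)
  · exact mul_ne_zero hD (pow_ne_zero _ hX)
  · push_cast
    rw [hw]
    rw [c₁, c₂] at s1
    field_simp at s1 ⊢
    linear_combination s1
  · zify
    calc _ ≤ |(X₁ + X₂) * (X₁ * X₂ - D ^ 2)| + |2 * w| := abs_sub _ _
      _ = |X₁ + X₂| * |X₁ * X₂ - D ^ 2| + 2 * |w| := by rw [abs_mul, abs_mul]; norm_num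
      _ ≤ (2 * M) * (2 * M ^ 2) + 2 * M ^ 3 := by gcongr
      _ = _ := by ring
  · zify
    rw [abs_mul, abs_pow]
    calc |D| * |X₁ - X₂| ^ 2 ≤ M * (2 * M) ^ 2 := by gcongr
      _ ≤ _ := by nlinarith [pow_nonneg (Int.natCast_nonneg M) 3]

lemma ball_card {n : ℕ} (hn : n ≠ 0) (M : ℕ) : {P : (Ec n).Point | ht P ≤ M}.Finite ∧
    {P : (Ec n).Point | ht P ≤ M}.ncard ≤ 1 + (2 * M + 1) * (M + 1) * 2 := by
  have hn' : (n : ℚ) ≠ 0 := by exact_mod_cast hn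
  let f : (Ec n).Point → Option (ℤ × ℕ × Bool) := fun P => match P with
    | .zero => none
    | .some x y _ => some ((x / n).num, (x / n).den, decide (0 ≤ y))
  let T : Finset (Option (ℤ × ℕ × Bool)) := Finset.insertNone (Finset.Icc (-(M:ℤ)) M ×ˢ Finset.range (M+1) ×ˢ Finset.univ)
  have hf : Function.Injective f := by
    intro P Q hPQ
    match P, Q with
    | .zero, .zero => rfl
    | .zero, .some x y h => simp [f] at hPQ
    | .some x y h, .zero => simp [f] at hPQ
    | .some x y h, .some x' y' h' =>
      simp only [f, Option.some.injEq, Prod.mk.injEq] at hPQ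
      obtain ⟨h1, h2, h3⟩ := hPQ
      have hx : x = x' := by
        have := Rat.ext h1 h2
        field_simp at this; exact this
      subst hx
      have : y ^ 2 = y' ^ 2 := by rw [Ec_eq h, Ec_eq h']
      have : y = y' := by
        rcases sq_eq_sq_iff_eq_or_eq_neg.mp this with h4 | h4
        · exact h4
        · simp only [decide_eq_decide] at h3
          rcases le_total 0 y with h5 | h5
          · have := h3.mp h5; linarith
          · rcases le_total 0 y' with h6 | h6
            · have := h3.mpr h6; linarith
            · linarith
      subst this; rfl
  have hT : ∀ P ∈ {P : (Ec n).Point | ht P ≤ M}, f P ∈ T := by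
    intro P hP
    match P with
    | .zero => simp [f, T]
    | .some x y h =>
      simp only [Set.mem_ofPred_eq, ht_some, hq, max_le_iff] at hP
      simp only [f, T, Finset.some_mem_insertNone, Finset.mem_product, Finset.mem_Icc, Finset.mem_range,
        Finset.mem_univ, and_true]
      omega
  have hfin : {P : (Ec n).Point | ht P ≤ M}.Finite := by
    refine Set.Finite.of_finite_image (f := f) (T.finite_toSet.subset ?_) hf.injOn
    rintro _ ⟨P, hP, rfl⟩; exact hT P hP
  refine ⟨hfin, ?_⟩
  calc _ ≤ (T : Set (Option (ℤ × ℕ × Bool))).ncard := Set.ncard_le_ncard_of_injOn f hT hf.injOn T.finite_toSet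
    _ = T.card := Set.ncard_coe_finset T
    _ ≤ _ := by
      simp [T]
      rw [show ((M:ℤ) + 1 + M).toNat = 2 * M + 1 by omega]
      nlinarith

lemma n_le_ht {n : ℕ} (hn : Squarefree n) {x y : ℚ} (h : (Ec n).Nonsingular x y) (hy : y ≠ 0) :
    n ≤ ht (.some x y h) ^ 4 := by
  have hn0 : n ≠ 0 := hn.ne_zero
  have hn' : (n : ℚ) ≠ 0 := by exact_mod_cast hn0
  rw [ht_some]
  obtain ⟨r, s, hs, -, e, hr, hs2, -⟩ := exists_rs (x / n)
  set m := hq (x / n)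
  have hsq : (s : ℚ) ≠ 0 := by exact_mod_cast hs.ne'
  have hx : x = r * n / s := by field_simp at e ⊢; linear_combination e
  have q := Ec_eq h
  have key : (y * s ^ 2 / n) ^ 2 = ((n * (r * s * (r ^ 2 - s ^ 2)) : ℤ) : ℚ) := by
    rw [div_pow, mul_pow, q, hx]; push_cast; field_simp
  have : IsSquare (((n * (r * s * (r ^ 2 - s ^ 2)) : ℤ) : ℚ)) := ⟨_, key.symm.trans (sq _)⟩
  rw [Rat.isSquare_intCast_iff] at this
  obtain ⟨t, ht⟩ := this
  have nt : (n : ℤ) ∣ t := by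
    have h1 : (n : ℤ) ∣ t ^ 2 := ⟨_, by rw [sq, ← ht]⟩
    have h2 : Squarefree (n : ℤ) := Int.squarefree_natCast.mpr hn
    exact (h2.dvd_pow_iff_dvd two_ne_zero).mp h1
  obtain ⟨t', rfl⟩ := nt
  have hd : r * s * (r ^ 2 - s ^ 2) = n * (t' * t') :=
    mul_left_cancel₀ (a := (n : ℤ)) (by exact_mod_cast hn0) (by linear_combination ht)
  have h0 : r * s * (r ^ 2 - s ^ 2) ≠ 0 := by
    intro h0
    rw [h0] at key
    simp at key
    rcases key with (h1 | h1) | h1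
    · exact hy h1
    · exact hs.ne' h1
    · exact hn0 h1
  have h1 : (n : ℤ) ≤ |r * s * (r ^ 2 - s ^ 2)| := by
    apply Int.le_of_dvd (abs_pos.mpr h0)
    rw [dvd_abs]; exact ⟨_, hd⟩
  have h2 : |r * s * (r ^ 2 - s ^ 2)| ≤ (m:ℤ) ^ 4 := by
    have t1 : r ^ 2 ≤ (m : ℤ) ^ 2 := by rw [← sq_abs]; gcongr
    have t2 : s ^ 2 ≤ (m : ℤ) ^ 2 := by gcongr
    have : |r ^ 2 - s ^ 2| ≤ (m : ℤ) ^ 2 := by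
      rw [abs_le]; constructor <;> nlinarith [sq_nonneg r, sq_nonneg s]
    rw [abs_mul, abs_mul, abs_of_pos hs]
    calc |r| * s * |r ^ 2 - s ^ 2| ≤ m * m * m ^ 2 := by gcongr
      _ = _ := by ring
  zify; linarith
end AC

namespace AC

structure HtAx {G : Type} [AddCommGroup G] (H : G → ℕ) (n S : ℕ) : Prop where
  zero : H 0 = 1
  pos : ∀ P, 1 ≤ H P
  neg : ∀ P, H (-P) = H P
  addsub : ∀ P Q, H (P + Q) * H (P - Q) ≤ 16 * H P ^ 2 * H Q ^ 2
  two : ∀ P, H P ^ 4 ≤ 64 * H (P + P)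
  fin : ∀ M, {P | H P ≤ M}.Finite
  card : ∀ M, {P | H P ≤ M}.ncard ≤ 1 + (2 * M + 1) * (M + 1) * 2
  small : ∀ P, H P ≤ 1 ∨ n ≤ H P ^ 4
  cover : ∃ R : Finset G, R.card ≤ S ∧ ∀ P, ∃ r ∈ R, ∃ Q, P = r + (Q + Q)

variable {G : Type} [AddCommGroup G] {H : G → ℕ} {n S : ℕ}

lemma HtAx.add_le (h : HtAx H n S) (P Q : G) : H (P + Q) ≤ 16 * H P ^ 2 * H Q ^ 2 := by
  have := h.addsub P Q
  have h1 := h.pos (P - Q)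
  nlinarith

lemma HtAx.sub_le (h : HtAx H n S) (P Q : G) : H (P - Q) ≤ 16 * H P ^ 2 * H Q ^ 2 := by
  have := h.addsub P Q
  have h1 := h.pos (P + Q)
  nlinarith

lemma HtAx.S_pos (h : HtAx H n S) : 1 ≤ S := by
  obtain ⟨R, hR, hc⟩ := h.cover
  obtain ⟨r, hr, -⟩ := hc 0
  exact (Finset.card_pos.mpr ⟨r, hr⟩).trans_le hR

lemma HtAx.cov (h : HtAx H n S) (j : ℕ) :
    ∃ R : Finset G, R.card ≤ S ^ j ∧ ∀ P, ∃ r ∈ R, ∃ Q, P = r + 2 ^ j • Q := by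
  classical
  obtain ⟨R₁, hR₁, hc₁⟩ := h.cover
  induction j with
  | zero => exact ⟨{0}, by simp, fun P => ⟨0, by simp, P, by simp⟩⟩
  | succ j ih =>
    obtain ⟨R, hR, hc⟩ := ih
    refine ⟨(R ×ˢ R₁).image (fun x => x.1 + 2 ^ j • x.2), ?_, ?_⟩
    · refine Finset.card_image_le.trans ?_
      rw [Finset.card_product, pow_succ]; gcongr
    · intro P
      obtain ⟨r, hr, Q, rfl⟩ := hc P
      obtain ⟨r', hr', Q', rfl⟩ := hc₁ Q
      refine ⟨r + 2 ^ j • r', Finset.mem_image.mpr ⟨(r, r'), by simp [hr, hr'], rfl⟩, Q', ?_⟩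
      rw [pow_succ, mul_smul, two_smul, smul_add]; abel

lemma HtAx.lower (h : HtAx H n S) (j : ℕ) (Q : G) : H Q ^ (4 ^ j) * 4 ≤ 4 ^ (4 ^ j) * H (2 ^ j • Q) := by
  induction j with
  | zero => simp [mul_comm]
  | succ j ih =>
    have h2 := h.two (2 ^ j • Q)
    have e : (2 ^ j • Q + 2 ^ j • Q) = 2 ^ (j + 1) • Q := by
      rw [pow_succ, mul_comm, mul_smul, two_smul]
    rw [e] at h2
    have h3 : (H Q ^ (4 ^ j) * 4) ^ 4 ≤ (4 ^ (4 ^ j) * H (2 ^ j • Q)) ^ 4 := by gcongr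
    rw [mul_pow, mul_pow, ← pow_mul, ← pow_mul, ← pow_succ] at h3
    have h4 : 4 ^ (4 ^ (j + 1)) * H (2 ^ j • Q) ^ 4 ≤ 4 ^ (4 ^ (j + 1)) * (64 * H (2 ^ (j + 1) • Q)) := by gcongr
    have := h3.trans h4
    linarith

def tiny (H : G → ℕ) (j M : ℕ) : Set G := {Q | H Q ^ (4 ^ j) ≤ 4 ^ (4 ^ j) * (16 * M ^ 4)}

lemma HtAx.tiny_fin (h : HtAx H n S) (j M : ℕ) : (tiny H j M).Finite := by
  refine (h.fin (4 ^ (4 ^ j) * (16 * M ^ 4))).subset ?_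
  intro Q hQ
  exact (Nat.le_self_pow (by positivity) _).trans hQ

lemma HtAx.ball (h : HtAx H n S) (j M : ℕ) : {P | H P ≤ M}.ncard ≤ S ^ j * (tiny H j M).ncard := by
  classical
  obtain ⟨R, hR, hc⟩ := h.cov j
  have hB := h.fin M
  choose r hr q hq using hc
  set B := hB.toFinset
  have hBc : {P | H P ≤ M}.ncard = B.card := Set.ncard_eq_toFinset_card _ hB
  rw [hBc]
  have key : ∀ ρ ∈ R, (B.filter (fun P => r P = ρ)).card ≤ (tiny H j M).ncard := by
    intro ρ _
    rcases (B.filter (fun P => r P = ρ)).eq_empty_or_nonempty with he | ⟨P0, hP0⟩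
    · rw [he]; simp
    · rw [← Set.ncard_coe_finset]
      apply Set.ncard_le_ncard_of_injOn (fun P => q P - q P0) _ _ (h.tiny_fin j M)
      · intro P hP
        simp only [Finset.coe_filter, Set.mem_ofPred_eq] at hP
        simp only [Finset.mem_filter] at hP0
        have e : 2 ^ j • (q P - q P0) = P - P0 := by
          have h1 := hq P
          have h2 := hq P0
          rw [hP.2] at h1; rw [hP0.2] at h2
          rw [smul_sub]
          calc _ = (ρ + 2 ^ j • q P) - (ρ + 2 ^ j • q P0) := by abel
            _ = _ := by rw [← h1, ← h2]
        have h3 := h.lower j (q P - q P0)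
        rw [e] at h3
        have h4 := h.sub_le P P0
        have h5 : H P ≤ M := by have := hP.1; simpa [B] using this
        have h6 : H P0 ≤ M := by have := hP0.1; simpa [B] using this
        have h7 : H (P - P0) ≤ 16 * M ^ 4 := h4.trans (by
          calc 16 * H P ^ 2 * H P0 ^ 2 ≤ 16 * M ^ 2 * M ^ 2 := by gcongr
            _ = _ := by ring)
        show H (q P - q P0) ^ (4 ^ j) ≤ _
        calc H (q P - q P0) ^ (4 ^ j) ≤ H (q P - q P0) ^ (4 ^ j) * 4 := by omega
          _ ≤ 4 ^ 4 ^ j * H (P - P0) := h3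
          _ ≤ _ := by gcongr
      · intro P hP P' hP' e
        simp only [Finset.coe_filter, Set.mem_ofPred_eq] at hP hP'
        have e' : q P = q P' := by simpa using e
        rw [hq P, hq P', hP.2, hP'.2, e']
  calc B.card = ∑ ρ ∈ R, (B.filter (fun P => r P = ρ)).card :=
        Finset.card_eq_sum_card_fiberwise (fun P _ => hr P)
    _ ≤ ∑ ρ ∈ R, (tiny H j M).ncard := Finset.sum_le_sum key
    _ = R.card * (tiny H j M).ncard := by simp
    _ ≤ _ := by gcongr

lemma HtAx.sep (h : HtAx H n S) (P Q : G) : H P ^ 2 * H Q ^ 2 ≤ 2 ^ 8 * (H (P + Q) * H (P - Q)) := by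
  have h1 := h.addsub (P + Q) (P - Q)
  have e1 : P + Q + (P - Q) = P + P := by abel
  have e2 : P + Q - (P - Q) = Q + Q := by abel
  rw [e1, e2] at h1
  have h2 := h.two P
  have h3 := h.two Q
  have h4 : H P ^ 4 * H Q ^ 4 ≤ (64 * H (P + P)) * (64 * H (Q + Q)) := by gcongr
  have h5 : (H P ^ 2 * H Q ^ 2) ^ 2 ≤ (2 ^ 8 * (H (P + Q) * H (P - Q))) ^ 2 := by
    nlinarith
  exact (Nat.pow_le_pow_iff_left two_ne_zero).mp h5

lemma HtAx.large (h : HtAx H n S) {A M : ℕ} (hA : 1 ≤ A) (hM : 2 ^ 160 * A ^ 36 ≤ M) (T : Finset G)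
    (t1 : ∀ P ∈ T, H P ≤ A * M) (t2 : ∀ P ∈ T, M ^ 4 ≤ A * H P ^ 5)
    (t3 : ∀ P ∈ T, ∀ Q ∈ T, P ≠ Q → H (P + Q) ≤ A * M ^ 3) : T.card ≤ S ^ 6 := by
  classical
  have hA36 : 1 ≤ A ^ 36 := Nat.one_le_pow _ _ hA
  have hM160 : 2 ^ 160 ≤ M := by nlinarith
  have hM0 : 0 < M := by omega
  have sep : ∀ P ∈ T, ∀ Q ∈ T, P ≠ Q → M ≤ H (P - Q) ^ 10 := by
    intro P hP Q hQ hPQ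
    have a1 := h.sep P Q
    have a2 := t3 P hP Q hQ hPQ
    have a3 : (H P ^ 2 * H Q ^ 2) ^ 5 ≤ (2 ^ 8 * (A * M ^ 3 * H (P - Q))) ^ 5 := by
      apply Nat.pow_le_pow_left
      refine a1.trans ?_
      gcongr
    have a4 : (M ^ 4) ^ 2 * (M ^ 4) ^ 2 ≤ (A * H P ^ 5) ^ 2 * (A * H Q ^ 5) ^ 2 := by
      gcongr
      · exact t2 P hP
      · exact t2 Q hQ
    have a5 : M ^ 15 * M ≤ M ^ 15 * (2 ^ 40 * A ^ 9 * H (P - Q) ^ 5) := by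
      calc M ^ 15 * M = (M ^ 4) ^ 2 * (M ^ 4) ^ 2 := by ring
        _ ≤ _ := a4
        _ = A ^ 4 * (H P ^ 2 * H Q ^ 2) ^ 5 := by ring
        _ ≤ A ^ 4 * (2 ^ 8 * (A * M ^ 3 * H (P - Q))) ^ 5 := by gcongr
        _ = _ := by ring
    have a6 : M ≤ 2 ^ 40 * A ^ 9 * H (P - Q) ^ 5 := Nat.le_of_mul_le_mul_left a5 (by positivity)
    have a7 : (2 ^ 40 * A ^ 9) ^ 2 ≤ M := by
      refine le_trans ?_ hM
      have : A ^ 18 ≤ A ^ 36 := Nat.pow_le_pow_right hA (by norm_num)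
      calc (2 ^ 40 * A ^ 9) ^ 2 = 2 ^ 80 * A ^ 18 := by ring
        _ ≤ 2 ^ 160 * A ^ 36 := by gcongr <;> norm_num
    have a8 : M * M ≤ M * H (P - Q) ^ 10 := by
      calc M * M ≤ (2 ^ 40 * A ^ 9 * H (P - Q) ^ 5) * (2 ^ 40 * A ^ 9 * H (P - Q) ^ 5) := by gcongr
        _ = (2 ^ 40 * A ^ 9) ^ 2 * H (P - Q) ^ 10 := by ring
        _ ≤ _ := by gcongr
    exact Nat.le_of_mul_le_mul_left a8 hM0
  set Λ := tiny H 6 (M ^ 6) with hΛ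
  have hΛf : Λ.Finite := h.tiny_fin _ _
  have hΛ0 : (0 : G) ∈ Λ := by
    show H 0 ^ (4 ^ 6) ≤ _
    rw [h.zero, one_pow]; exact Nat.one_le_iff_ne_zero.mpr (by positivity)
  have hΛM : ∀ Q ∈ Λ, H Q ^ 4096 ≤ 2 ^ 8196 * M ^ 24 := by
    intro Q hQ
    have this : H Q ^ (4 ^ 6) ≤ 4 ^ (4 ^ 6) * (16 * (M ^ 6) ^ 4) := hQ
    have g : ∀ J : ℕ, 4 ^ J * (16 * (M ^ 6) ^ 4) = 2 ^ (2 * J + 4) * M ^ 24 := by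
      intro J
      rw [pow_add, pow_mul]; norm_num; ring
    rw [g, show (4:ℕ) ^ 6 = 4096 by norm_num] at this
    exact this
  have hlt : ∀ Q ∈ Λ, H Q ≤ M := by
    intro Q hQ
    have h1 := hΛM Q hQ
    have h2 : 2 ^ 8196 * M ^ 24 ≤ M ^ 4096 := by
      calc 2 ^ 8196 * M ^ 24 ≤ (2 ^ 160) ^ 4072 * M ^ 24 := by
            apply Nat.mul_le_mul_right
            rw [← pow_mul]
            exact Nat.pow_le_pow_right (by norm_num) (by norm_num)
        _ ≤ M ^ 4072 * M ^ 24 := by gcongr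
        _ = M ^ 4096 := by rw [← pow_add]
    exact (Nat.pow_le_pow_iff_left (by norm_num)).mp (h1.trans h2)
  have hinj : Set.InjOn (fun x : G × G => x.1 + x.2) ((T : Set G) ×ˢ Λ) := by
    rintro ⟨P, Q⟩ ⟨hP, hQ⟩ ⟨P', Q'⟩ ⟨hP', hQ'⟩ e
    simp only [Finset.mem_coe] at hP hP' hQ hQ' e
    by_cases hPP : P = P'
    · subst hPP; simp at e; rw [e]
    · exfalso
      have b1 := sep P hP P' hP' hPP
      have e2 : P - P' = Q' - Q := by
        rw [sub_eq_sub_iff_add_eq_add, e, add_comm]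
      rw [e2] at b1
      have b2 := h.sub_le Q' Q
      have b3 : M ≤ 2 ^ 40 * (H Q' * H Q) ^ 20 := by
        calc M ≤ _ := b1
          _ ≤ (16 * H Q' ^ 2 * H Q ^ 2) ^ 10 := by gcongr
          _ = _ := by ring
      have b4 : M ^ 4096 ≤ 2 ^ (40 * 4096) * (2 ^ 8196 * M ^ 24) ^ 40 := by
        calc M ^ 4096 ≤ (2 ^ 40 * (H Q' * H Q) ^ 20) ^ 4096 := by gcongr
          _ = 2 ^ (40 * 4096) * (H Q' ^ 4096 * H Q ^ 4096) ^ 20 := by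
            rw [mul_pow, ← pow_mul, ← pow_mul, ← mul_pow, ← pow_mul]
          _ ≤ 2 ^ (40 * 4096) * ((2 ^ 8196 * M ^ 24) * (2 ^ 8196 * M ^ 24)) ^ 20 := by
            gcongr
            · exact hΛM _ hQ'
            · exact hΛM _ hQ
          _ = _ := by rw [← pow_two, ← pow_mul]
      have b5 : M ^ 960 * M ^ 3136 ≤ M ^ 960 * 2 ^ 491680 := by
        calc M ^ 960 * M ^ 3136 = M ^ 4096 := by rw [← pow_add]
          _ ≤ _ := b4
          _ = M ^ 960 * 2 ^ 491680 := by
            rw [mul_pow, ← pow_mul, ← pow_mul, ← mul_assoc, ← pow_add, mul_comm]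
      have b6 : M ^ 3136 ≤ 2 ^ 491680 := Nat.le_of_mul_le_mul_left b5 (by positivity)
      have b7 : (2 ^ 160) ^ 3136 ≤ M ^ 3136 := by gcongr
      have b8 : (2:ℕ) ^ 491680 < (2 ^ 160) ^ 3136 := by
        rw [← pow_mul]
        exact Nat.pow_lt_pow_right (by norm_num) (by norm_num)
      omega
  have hsub : (fun x : G × G => x.1 + x.2) '' ((T : Set G) ×ˢ Λ) ⊆ {P | H P ≤ M ^ 6} := by
    rintro _ ⟨⟨P, Q⟩, ⟨hP, hQ⟩, rfl⟩
    have c1 := h.add_le P Q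
    have c2 := t1 P hP
    have c3 := hlt Q hQ
    have c4 : 16 * A ^ 2 ≤ M ^ 2 := by
      have : 4 * A ≤ M := by
        have : A ≤ A ^ 36 := Nat.le_self_pow (by norm_num) _
        calc 4 * A ≤ 2 ^ 160 * A ^ 36 := by gcongr; norm_num
          _ ≤ M := hM
      calc 16 * A ^ 2 = (4 * A) ^ 2 := by ring
        _ ≤ _ := by gcongr
    calc H (P + Q) ≤ _ := c1
      _ ≤ 16 * (A * M) ^ 2 * M ^ 2 := by gcongr
      _ = (16 * A ^ 2) * M ^ 4 := by ring
      _ ≤ M ^ 2 * M ^ 4 := by gcongr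
      _ = _ := by ring
  have h1 : T.card * Λ.ncard ≤ S ^ 6 * Λ.ncard := by
    calc T.card * Λ.ncard = ((T : Set G) ×ˢ Λ).ncard := by rw [Set.ncard_prod, Set.ncard_coe_finset]
      _ = ((fun x : G × G => x.1 + x.2) '' ((T : Set G) ×ˢ Λ)).ncard := hinj.ncard_image.symm
      _ ≤ _ := Set.ncard_le_ncard hsub (h.fin _)
      _ ≤ _ := h.ball 6 _
  exact Nat.le_of_mul_le_mul_right h1 ((Set.ncard_pos hΛf).mpr ⟨0, hΛ0⟩)

lemma HtAx.smallcase (C c : ℕ) (hC : 1 ≤ C) : ∃ K j : ℕ, 1 ≤ K ∧ ∀ {G : Type} [AddCommGroup G] {H : G → ℕ} {n S : ℕ}, 1 ≤ n →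
    HtAx H n S → {P | H P ≤ C * n ^ c}.ncard ≤ K * S ^ j := by
  obtain ⟨j, hj⟩ : ∃ j, 16 * c + 1 ≤ 4 ^ j := ⟨16 * c + 1, (Nat.lt_pow_self (by norm_num)).le⟩
  set K := 4 ^ (4 ^ j) * (16 * C ^ 4) with hK
  refine ⟨1 + (2 * K + 1) * (K + 1) * 2, j, by omega, ?_⟩
  intro G _ H n S hn h
  refine (h.ball j _).trans ?_
  rw [mul_comm]
  gcongr
  refine le_trans (Set.ncard_le_ncard ?_ (h.fin K)) (h.card K)
  intro Q hQ
  have hQ : H Q ^ (4 ^ j) ≤ 4 ^ (4 ^ j) * (16 * (C * n ^ c) ^ 4) := hQ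
  show H Q ≤ K
  have hK1 : 1 ≤ K := Nat.one_le_iff_ne_zero.mpr (by positivity)
  rcases h.small Q with h1 | h1
  · omega
  · have hQ1 := h.pos Q
    have e : 4 ^ (4 ^ j) * (16 * (C * n ^ c) ^ 4) ≤ K * H Q ^ (16 * c) := by
      calc 4 ^ (4 ^ j) * (16 * (C * n ^ c) ^ 4) = K * n ^ (4 * c) := by rw [hK]; ring
        _ ≤ K * (H Q ^ 4) ^ (4 * c) := by gcongr
        _ = _ := by rw [← pow_mul]; congr 2; ring
    have e2 : H Q ^ (16 * c) * H Q ≤ H Q ^ (16 * c) * K := by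
      calc _ = H Q ^ (16 * c + 1) := by rw [pow_succ]
        _ ≤ H Q ^ (4 ^ j) := Nat.pow_le_pow_right hQ1 hj
        _ ≤ _ := hQ.trans e
        _ = _ := mul_comm _ _
    exact Nat.le_of_mul_le_mul_left e2 (by positivity)

/-- abstract packing bound -/
theorem pack (C c : ℕ) (hC : 1 ≤ C) : ∃ K j : ℕ, 1 ≤ K ∧ ∀ {G : Type} [AddCommGroup G] {H : G → ℕ} {n S : ℕ}, 1 ≤ n →
    HtAx H n S → ∀ (M : ℕ) (T : Finset G), (∀ P ∈ T, H P ≤ C * n ^ c * M) → (∀ P ∈ T, M ^ 4 ≤ C * n ^ c * H P ^ 5) →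
    (∀ P ∈ T, ∀ Q ∈ T, P ≠ Q → H (P + Q) ≤ C * n ^ c * M ^ 3) → T.card ≤ K * S ^ j := by
  obtain ⟨K, j, hK, hs⟩ := HtAx.smallcase (2 ^ 160 * C ^ 37) (37 * c) (Nat.one_le_iff_ne_zero.mpr (by positivity))
  refine ⟨K, j + 6, hK, ?_⟩
  intro G _ H n S hn h M T t1 t2 t3
  have hS := h.S_pos
  rcases le_total (2 ^ 160 * (C * n ^ c) ^ 36) M with hM | hM
  · have hA : 1 ≤ C * n ^ c := Nat.one_le_iff_ne_zero.mpr (by positivity)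
    refine (h.large hA hM T t1 t2 t3).trans ?_
    calc S ^ 6 ≤ S ^ (j + 6) := Nat.pow_le_pow_right hS (by omega)
      _ ≤ _ := Nat.le_mul_of_pos_left _ hK
  · have : T.card ≤ K * S ^ j := by
      refine le_trans ?_ (hs hn h)
      rw [← Set.ncard_coe_finset]
      apply Set.ncard_le_ncard _ (h.fin _)
      intro P hP
      show H P ≤ _
      calc H P ≤ C * n ^ c * M := t1 P hP
        _ ≤ C * n ^ c * (2 ^ 160 * (C * n ^ c) ^ 36) := by gcongr
        _ = _ := by ring
    refine this.trans ?_
    gcongr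
    omega
end AC

namespace AC
open WeierstrassCurve WeierstrassCurve.Affine

lemma clear_den (α β : ℚ) : ∃ A B Z : ℤ, 0 < Z ∧ α * Z = A ∧ β * Z = B ∧ ∃ p q r, p * A + q * B + r * Z = 1 := by
  set A0 : ℤ := α.num * β.den with hA0
  set B0 : ℤ := β.num * α.den with hB0
  set Z0 : ℤ := α.den * β.den with hZ0
  have da : (α.den : ℚ) ≠ 0 := by exact_mod_cast α.den_nz
  have db : (β.den : ℚ) ≠ 0 := by exact_mod_cast β.den_nz
  have hZpos : 0 < Z0 := by
    have := α.pos; have := β.pos; positivity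
  have hα : α * Z0 = A0 := by
    rw [hZ0, hA0]; push_cast
    nth_rw 1 [← Rat.num_div_den α]; field_simp
  have hβ : β * Z0 = B0 := by
    rw [hZ0, hB0]; push_cast
    nth_rw 1 [← Rat.num_div_den β]; field_simp
  set e : ℤ := ((Int.gcd A0 B0 : ℕ) : ℤ) with he
  set d : ℤ := ((Int.gcd e Z0 : ℕ) : ℤ) with hd
  have hdpos : 0 < d := by
    have : 0 < Int.gcd e Z0 := Int.gcd_pos_of_ne_zero_right _ hZpos.ne'
    rw [hd]; exact Int.natCast_pos.mpr this
  have hde : d ∣ e := Int.gcd_dvd_left ..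
  obtain ⟨A, hA⟩ : d ∣ A0 := hde.trans (Int.gcd_dvd_left ..)
  obtain ⟨B, hB⟩ : d ∣ B0 := hde.trans (Int.gcd_dvd_right ..)
  obtain ⟨Z, hZ⟩ : d ∣ Z0 := Int.gcd_dvd_right ..
  have hdq : (d : ℚ) ≠ 0 := by exact_mod_cast hdpos.ne'
  refine ⟨A, B, Z, ?_, ?_, ?_, ?_⟩
  · rw [hZ] at hZpos; exact pos_of_mul_pos_right hZpos hdpos.le
  · rw [hA, hZ] at hα; push_cast at hα
    apply mul_left_cancel₀ hdq; linear_combination hα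
  · rw [hB, hZ] at hβ; push_cast at hβ
    apply mul_left_cancel₀ hdq; linear_combination hβ
  · have b1 := Int.gcd_eq_gcd_ab A0 B0
    have b2 := Int.gcd_eq_gcd_ab e Z0
    rw [← hd] at b2
    rw [← he] at b1
    refine ⟨A0.gcdA B0 * e.gcdA Z0, A0.gcdB B0 * e.gcdA Z0, e.gcdB Z0, ?_⟩
    apply mul_left_cancel₀ hdpos.ne'
    calc _ = (A0 * A0.gcdA B0 + B0 * A0.gcdB B0) * e.gcdA Z0 + Z0 * e.gcdB Z0 := by
          rw [hA, hB, hZ]; ring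
      _ = d * 1 := by rw [← b1, mul_one]; exact b2.symm

lemma lcm_step {L g Z c k : ℕ} (hL : L ∣ Z) (hg : g ∣ Z) (h : Nat.gcd L g ∣ k) {Pr : ℕ} (hP : Pr ∣ L * c) :
    ∃ L', L' ∣ Z ∧ Pr * g ∣ L' * (c * k) ∧ L' = Nat.lcm L g := by
  refine ⟨Nat.lcm L g, Nat.lcm_dvd hL hg, ?_, rfl⟩
  have h1 : L * g ∣ Nat.lcm L g * k := by
    rw [← Nat.gcd_mul_lcm L g, mul_comm]; exact Nat.mul_dvd_mul_left _ h
  calc Pr * g ∣ (L * c) * g := Nat.mul_dvd_mul_right hP _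
    _ = c * (L * g) := by ring
    _ ∣ c * (Nat.lcm L g * k) := Nat.mul_dvd_mul_left _ h1
    _ = _ := by ring

lemma gmd (a b g : ℕ) : Nat.gcd (a * b) g ∣ Nat.gcd a g * Nat.gcd b g := by
  rw [Nat.gcd_comm, Nat.gcd_comm a, Nat.gcd_comm b]; exact Nat.gcd_mul_right_dvd_mul_gcd g a b

lemma gcd_lcm_dvd {a b g m k : ℕ} (h1 : Nat.gcd a g ∣ m) (h2 : Nat.gcd b g ∣ k) : Nat.gcd (Nat.lcm a b) g ∣ m * k := by
  have h : Nat.gcd (Nat.lcm a b) g ∣ Nat.gcd (a * b) g := Nat.gcd_dvd_gcd_of_dvd_left _ (Nat.lcm_dvd_mul a b)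
  refine h.trans ((gmd a b g).trans (Nat.mul_dvd_mul h1 h2))

lemma five {g0 g1 g2 g3 g4 Z : ℕ} (d0 : g0 ∣ Z) (d1 : g1 ∣ Z) (d2 : g2 ∣ Z) (d3 : g3 ∣ Z) (d4 : g4 ∣ Z)
    (h01 : Nat.gcd g0 g1 ∣ 1) (h02 : Nat.gcd g0 g2 ∣ 2) (h03 : Nat.gcd g0 g3 ∣ 3) (h04 : Nat.gcd g0 g4 ∣ 4)
    (h12 : Nat.gcd g1 g2 ∣ 1) (h13 : Nat.gcd g1 g3 ∣ 2) (h14 : Nat.gcd g1 g4 ∣ 3)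
    (h23 : Nat.gcd g2 g3 ∣ 1) (h24 : Nat.gcd g2 g4 ∣ 2) (h34 : Nat.gcd g3 g4 ∣ 1) :
    g0 * g1 * g2 * g3 * g4 ∣ Z * 288 := by
  obtain ⟨L1, a1, b1, rfl⟩ := lcm_step (c := 1) d0 d1 h01 (Pr := g0) (by simp)
  obtain ⟨L2, a2, b2, rfl⟩ := lcm_step a1 d2 (gcd_lcm_dvd h02 h12) b1
  obtain ⟨L3, a3, b3, rfl⟩ := lcm_step a2 d3 (gcd_lcm_dvd (gcd_lcm_dvd h03 h13) h23) b2
  obtain ⟨L4, a4, b4, -⟩ := lcm_step a3 d4 (gcd_lcm_dvd (gcd_lcm_dvd (gcd_lcm_dvd h04 h14) h24) h34) b3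
  norm_num at b4
  exact b4.trans (Nat.mul_dvd_mul_right a4 _)

lemma exists_small_gcd {A B Z : ℤ} (hZ : 0 < Z) (hpq : ∃ p q r, p * A + q * B + r * Z = 1) (k : ℕ) :
    ∃ t, k ≤ t ∧ t < k + 5 ∧ (Int.gcd (A + t * B) Z) ^ 5 ≤ 288 * Z.natAbs := by
  set g : ℕ → ℕ := fun t => Int.gcd (A + t * B) Z with hg
  have hd : ∀ t, g t ∣ Z.natAbs := fun t => Nat.gcd_dvd_right ..
  have hp : ∀ t (i : ℕ), Nat.gcd (g t) (g (t + i)) ∣ i := by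
    intro t i
    obtain ⟨p, q, r, h⟩ := hpq
    set G : ℤ := ((Nat.gcd (g t) (g (t + i)) : ℕ) : ℤ)
    have h1 : G ∣ A + t * B := (Int.natCast_dvd_natCast.mpr (Nat.gcd_dvd_left ..)).trans (Int.gcd_dvd_left ..)
    have h2 : G ∣ A + (t + i : ℕ) * B := (Int.natCast_dvd_natCast.mpr (Nat.gcd_dvd_right ..)).trans (Int.gcd_dvd_left ..)
    have h3 : G ∣ Z := (Int.natCast_dvd_natCast.mpr (Nat.gcd_dvd_left ..)).trans (Int.gcd_dvd_right ..)
    have : G ∣ (i : ℤ) := by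
      have e : (i : ℤ) = p * ((t + i : ℕ) * (A + t * B) - t * (A + (t + i : ℕ) * B)) +
        q * ((A + (t + i : ℕ) * B) - (A + t * B)) + r * i * Z := by
        push_cast; linear_combination (-(i:ℤ)) * h
      rw [e]
      exact dvd_add (dvd_add ((dvd_sub (h1.mul_left _) (h2.mul_left _)).mul_left _) ((dvd_sub h2 h1).mul_left _)) (h3.mul_left _)
    exact Int.natCast_dvd_natCast.mp this
  have key := five (hd k) (hd (k+1)) (hd (k+2)) (hd (k+3)) (hd (k+4)) (hp k 1) (hp k 2) (hp k 3) (hp k 4)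
    (hp (k+1) 1) (hp (k+1) 2) (hp (k+1) 3) (hp (k+2) 1) (hp (k+2) 2) (hp (k+3) 1)
  have hle := Nat.le_of_dvd (by have : 0 < Z.natAbs := by omega
                                positivity) key
  by_contra hcon
  push Not at hcon
  have c : ∀ i < 5, 288 * Z.natAbs < g (k + i) ^ 5 := fun i hi => hcon (k + i) (by omega) (by omega)
  have c0 := c 0 (by norm_num)
  have c1 := c 1 (by norm_num)
  have c2 := c 2 (by norm_num)
  have c3 := c 3 (by norm_num)
  have c4 := c 4 (by norm_num)
  simp only [add_zero] at c0
  have hpos : 0 < 288 * Z.natAbs := by omega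
  have : (288 * Z.natAbs) ^ 5 < (g k * g (k+1) * g (k+2) * g (k+3) * g (k+4)) ^ 5 := by
    calc (288 * Z.natAbs) ^ 5 = (288 * Z.natAbs) * (288 * Z.natAbs) * (288 * Z.natAbs) * (288 * Z.natAbs) * (288 * Z.natAbs) := by ring
      _ < g k ^ 5 * g (k+1) ^ 5 * g (k+2) ^ 5 * g (k+3) ^ 5 * g (k+4) ^ 5 := by gcongr
      _ = _ := by ring
  have := lt_of_pow_lt_pow_left₀ 5 (by positivity) this
  omega

lemma hq_mul_gcd {w : ℚ} {A Z : ℤ} (hZ : 0 < Z) (h : w * Z = A) : max A.natAbs Z.natAbs = hq w * Int.gcd A Z := by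
  obtain ⟨r, s, hs, rs, e, -, -, hm⟩ := exists_rs w
  have hsq : (s : ℚ) ≠ 0 := by exact_mod_cast hs.ne'
  have h1 : r * Z = A * s := by
    have : (r : ℚ) * Z = A * s := by rw [← h, e]; field_simp
    exact_mod_cast this
  obtain ⟨k, rfl⟩ : s ∣ Z := rs.symm.dvd_of_dvd_mul_left (y := r) ⟨A, by rw [h1]; ring⟩
  have h2 : A = r * k := by
    apply mul_right_cancel₀ hs.ne'; linear_combination -h1
  subst h2
  have : Int.gcd (r * k) (s * k) = k.natAbs := by
    rw [Int.gcd_mul_right, Int.isCoprime_iff_gcd_eq_one.mp rs, one_mul]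
  rw [this]
  zify
  rw [hm, abs_mul, abs_mul, abs_of_pos hs, max_mul_of_nonneg _ _ (abs_nonneg k)]

/-- AP core -/
lemma ap_core (α β : ℚ) (q : ℕ) (hq1 : ∀ t : ℕ, t < 5 * q → |α + t * β| ≤ |α|)
    (hq2 : ∀ t : ℕ, t < 5 * q → |t * β| ≤ |α| / 2) :
    ∃ (Z : ℤ) (A : ℕ → ℤ) (M : ℕ) (f : ℕ → ℕ), 0 < Z ∧ (∀ t, (α + t * β) * Z = A t) ∧ Z ≤ M ∧
      (∀ t < 5 * q, |A t| ≤ M) ∧ (∀ k, 5 * k ≤ f k ∧ f k < 5 * k + 5) ∧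
      ∀ k < q, M ^ 4 ≤ 9216 * hq (α + f k * β) ^ 5 := by
  obtain ⟨A, B, Z, hZ, hA, hB, hpq⟩ := clear_den α β
  have hAt : ∀ t : ℕ, (α + t * β) * Z = ((A + t * B : ℤ) : ℚ) := by
    intro t; push_cast; rw [← hA, ← hB]; ring
  have hZq : (0 : ℚ) < Z := by exact_mod_cast hZ
  choose f hf1 hf2 hf3 using fun k => exists_small_gcd hZ hpq (5 * k)
  refine ⟨Z, fun t => A + t * B, max A.natAbs Z.natAbs, f, hZ, hAt, ?_, ?_, fun k => ⟨hf1 k, hf2 k⟩, ?_⟩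
  · push_cast; exact (le_abs_self Z).trans (le_max_right _ _)
  · intro t ht
    have h1 := hq1 t ht
    have : |((A + t * B : ℤ) : ℚ)| ≤ |(A : ℚ)| := by
      rw [← hAt t, ← hA, abs_mul, abs_mul]; gcongr
    push_cast
    refine le_trans ?_ (le_max_left _ _)
    exact_mod_cast this
  · intro k hk
    have ht : f k < 5 * q := by have := hf2 k; omega
    set t := f k
    have e := hq_mul_gcd hZ (hAt t)
    have h2 : |(A : ℚ)| ≤ 2 * |((A + t * B : ℤ) : ℚ)| := by
      rw [← hAt t, ← hA, abs_mul, abs_mul]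
      have h3 := hq2 t ht
      have h4 : |α| ≤ |α + t * β| + |t * β| := by
        have := abs_sub (α + t * β) (t * β); simpa using this
      have : |α| ≤ 2 * |α + t * β| := by linarith
      nlinarith [abs_nonneg (Z : ℚ)]
    have h2' : A.natAbs ≤ 2 * (A + t * B).natAbs := by
      zify; exact_mod_cast h2
    set M := max A.natAbs Z.natAbs with hM
    have hMle : M ≤ 2 * (hq (α + t * β) * Int.gcd (A + t * B) Z) := by
      rw [← e, hM]
      omega
    have hM0 : 0 < M := by rw [hM]; omega
    have h5 : M ^ 4 * M ≤ (9216 * hq (α + t * β) ^ 5) * M := by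
      calc M ^ 4 * M = M ^ 5 := by ring
        _ ≤ (2 * (hq (α + t * β) * Int.gcd (A + t * B) Z)) ^ 5 := by gcongr
        _ = 32 * hq (α + t * β) ^ 5 * (Int.gcd (A + t * B) Z) ^ 5 := by ring
        _ ≤ 32 * hq (α + t * β) ^ 5 * (288 * Z.natAbs) := by gcongr; exact hf3 k
        _ ≤ 32 * hq (α + t * β) ^ 5 * (288 * M) := by gcongr; exact le_max_right _ _
        _ = _ := by ring
    exact Nat.le_of_mul_le_mul_right h5 hM0
end AC

namespace AC
open WeierstrassCurve WeierstrassCurve.Affine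

lemma ap_setup {N : ℕ} (hN : 1 ≤ N) {u : Fin N → ℚ} (hu : IsNontrivAP u) :
    ∃ (α β : ℚ) (σ : ℕ → Fin N), β ≠ 0 ∧ (∀ t < N, u (σ t) = α + t * β) ∧
      ∀ t : ℕ, 4 * t + 1 ≤ N → |α + t * β| ≤ |α| ∧ |t * β| ≤ |α| / 2 := by
  obtain ⟨a, b, hb, h⟩ := hu
  have gen : ∀ α β : ℚ, |α + (N - 1 : ℚ) * β| ≤ |α| → ∀ t : ℕ, 4 * t + 1 ≤ N → |α + t * β| ≤ |α| ∧ |t * β| ≤ |α| / 2 := by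
    intro α β hle t ht
    have h1 : (N - 1 : ℚ) * |β| ≤ 2 * |α| := by
      have h3 : |(N - 1 : ℚ) * β| = (N - 1 : ℚ) * |β| := by
        rw [abs_mul, abs_of_nonneg]; have : (1 : ℚ) ≤ N := by exact_mod_cast hN
        linarith
      have := abs_sub (α + (N - 1 : ℚ) * β) α
      rw [add_sub_cancel_left] at this
      linarith
    have ht' : 4 * (t : ℚ) ≤ N - 1 := by
      have : ((4 * t + 1 : ℕ) : ℚ) ≤ N := by exact_mod_cast ht
      push_cast at this; linarith
    have ht0 : (0 : ℚ) ≤ t := by positivity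
    refine ⟨?_, ?_⟩
    · rcases eq_or_lt_of_le (show (0 : ℚ) ≤ N - 1 by linarith) with h0 | h0
      · have : (t : ℚ) = 0 := by linarith
        rw [this]; simp
      · rw [abs_le]
        have h2 := abs_le.mp hle
        have e : (N - 1 : ℚ) * (α + t * β) = (N - 1 - t) * α + t * (α + (N - 1) * β) := by ring
        have h5 : -|α| ≤ α := neg_abs_le α
        have h6 : α ≤ |α| := le_abs_self α
        constructor
        · have : (N - 1 : ℚ) * (-|α|) ≤ (N - 1 : ℚ) * (α + t * β) := by rw [e]; nlinarith
          exact le_of_mul_le_mul_left this h0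
        · have : (N - 1 : ℚ) * (α + t * β) ≤ (N - 1 : ℚ) * |α| := by rw [e]; nlinarith
          exact le_of_mul_le_mul_left this h0
    · rw [abs_mul, abs_of_nonneg ht0]
      nlinarith [abs_nonneg β]
  rcases le_total |a + N * b| |a + b| with hc | hc
  · refine ⟨a + b, b, fun t => if ht : t < N then ⟨t, ht⟩ else ⟨0, hN⟩, hb, ?_, gen _ _ ?_⟩
    · intro t ht; beta_reduce; rw [dif_pos ht, h]; push_cast; ring
    · rw [show a + b + (N - 1 : ℚ) * b = a + N * b by ring]; exact hc
  · refine ⟨a + N * b, -b, fun t => if ht : t < N then ⟨N - 1 - t, by omega⟩ else ⟨0, hN⟩, by simpa using hb, ?_, gen _ _ ?_⟩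
    · intro t ht; beta_reduce; rw [dif_pos ht, h]
      have : ((N - 1 - t + 1 : ℕ) : ℚ) = N - t := by
        rw [show N - 1 - t + 1 = N - t by omega, Nat.cast_sub ht.le]
      simp only [this]; ring
    · rw [show a + N * b + (N - 1 : ℚ) * -b = a + b by ring]; exact hc

theorem ap_x : ∃ K j : ℕ, 1 ≤ K ∧ ∀ n S : ℕ, 1 ≤ n → HtAx (ht : (Ec n).Point → ℕ) n S →
    ∀ N (x y : Fin N → ℚ), (∀ i, (Ec n).Nonsingular (x i) (y i)) → IsNontrivAP x → N ≤ K * S ^ j := by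
  obtain ⟨K, j, hK, H⟩ := pack 9216 0 (by norm_num)
  refine ⟨36 * K, j, by omega, ?_⟩
  intro n S hn hax N x y hns hap
  have hS := hax.S_pos
  have hKS : 1 ≤ K * S ^ j := Nat.mul_pos hK (pow_pos hS j)
  rcases Nat.eq_zero_or_pos N with rfl | hN
  · omega
  obtain ⟨α, β, σ, hβ, hσ, hb⟩ := ap_setup hN hap
  have hn0 : (n : ℚ) ≠ 0 := by positivity
  set q := (N + 3) / 20 with hqdef
  have hq : ∀ t, t < 5 * q → 4 * t + 1 ≤ N := fun t ht => by omega
  have hnabs : |(n : ℚ)| = n := abs_of_nonneg (by positivity)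
  have hnp : (0 : ℚ) < n := by positivity
  obtain ⟨Z, A, M, f, hZ, hA, hZM, hAM, hf, hM⟩ := ap_core (α / n) (β / n) q
    (fun t ht => by
      rw [show α / n + t * (β / n) = (α + t * β) / n by field_simp, abs_div, abs_div]
      exact div_le_div_of_nonneg_right (hb t (hq t ht)).1 (abs_nonneg _))
    (fun t ht => by
      rw [show t * (β / n) = (t * β) / n by field_simp, abs_div, abs_div, div_right_comm]
      exact div_le_div_of_nonneg_right (hb t (hq t ht)).2 (abs_nonneg _))
  have hf5 : ∀ k < q, f k < 5 * q := fun k hk => by have := hf k; omega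
  have hxk : ∀ k < q, x (σ (f k)) = α + f k * β := fun k hk => hσ _ (by have := hq _ (hf5 k hk); omega)
  have hxk' : ∀ k < q, x (σ (f k)) / n = α / n + f k * (β / n) := fun k hk => by rw [hxk k hk]; field_simp
  have hinj : ∀ k < q, ∀ l < q, k ≠ l → x (σ (f k)) ≠ x (σ (f l)) := by
    intro k hk l hl hkl h
    rw [hxk k hk, hxk l hl] at h
    have h1 : (f k : ℚ) = f l := by
      apply mul_right_cancel₀ hβ; linarith
    have h2 : f k = f l := by exact_mod_cast h1
    have := hf k; have := hf l; omega
  let P : ℕ → (Ec n).Point := fun k => .some _ _ (hns (σ (f k)))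
  have hPinj : Set.InjOn P (Finset.range q) := by
    intro k hk l hl h
    by_contra hkl
    simp only [P, Point.some.injEq] at h
    exact hinj k (by simpa using hk) l (by simpa using hl) hkl h.1
  have hT := H hn hax M ((Finset.range q).image P) ?_ ?_ ?_
  · rw [Finset.card_image_of_injOn hPinj, Finset.card_range] at hT
    have : N ≤ 20 * q + 16 := by omega
    calc N ≤ 20 * q + 16 := this
      _ ≤ 20 * (K * S ^ j) + 16 * (K * S ^ j) := by omega
      _ = _ := by ring
  · intro Q hQ
    obtain ⟨k, hk, rfl⟩ := Finset.mem_image.mp hQ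
    have hk := Finset.mem_range.mp hk
    have : ht (P k) ≤ M := by
      simp only [P, ht_some]
      rw [hxk' k hk]
      refine hq_le_of_eq_div hZ.ne' (hA _) ?_ ?_
      · have := hAM _ (hf5 k hk); zify; exact this
      · zify; rwa [abs_of_pos hZ]
    simp only [pow_zero, mul_one]; omega
  · intro Q hQ
    obtain ⟨k, hk, rfl⟩ := Finset.mem_image.mp hQ
    have hk := Finset.mem_range.mp hk
    simp only [P, ht_some, pow_zero, mul_one]
    rw [hxk' k hk]; exact hM k hk
  · intro Q hQ R hR hQR
    obtain ⟨k, hk, rfl⟩ := Finset.mem_image.mp hQ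
    have hk := Finset.mem_range.mp hk
    obtain ⟨l, hl, rfl⟩ := Finset.mem_image.mp hR
    have hl := Finset.mem_range.mp hl
    have hkl : k ≠ l := by rintro rfl; exact hQR rfl
    have := ht_add_le_of_common (by omega) (hns (σ (f k))) (hns (σ (f l))) (hinj k hk l hl hkl) hZ.ne'
      (by rw [hxk' k hk]; exact hA _) (by rw [hxk' l hl]; exact hA _) (hAM _ (hf5 k hk)) (hAM _ (hf5 l hl))
      (by rwa [abs_of_pos hZ])
    simp only [P, pow_zero, mul_one]
    refine this.trans ?_
    gcongr; norm_num

lemma hq_sq (y : ℚ) : hq (y ^ 2) = hq y ^ 2 := by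
  unfold hq
  rw [Rat.num_pow, Rat.den_pow, Int.natAbs_pow]
  exact ((pow_left_mono 2).map_max (f := fun a : ℕ => a ^ 2)).symm

lemma den_rel {n : ℕ} {x y : ℚ} (h : y ^ 2 = x ^ 3 - n ^ 2 * x) : y.den ^ 2 = x.den ^ 3 := by
  have h1 : x ^ 3 - n ^ 2 * x = ((x.num * (x.num ^ 2 - n ^ 2 * x.den ^ 2) : ℤ) : ℚ) / ((x.den ^ 3 : ℤ) : ℚ) := by
    have : (x.den : ℚ) ≠ 0 := by exact_mod_cast x.den_nz
    have e := Rat.num_div_den x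
    push_cast
    nth_rw 1 2 [← e]
    field_simp
  have hc : IsCoprime x.num (x.den : ℤ) := Int.isCoprime_iff_gcd_eq_one.mpr x.reduced
  have hc2 : IsCoprime (x.num * (x.num ^ 2 - n ^ 2 * x.den ^ 2)) ((x.den : ℤ) ^ 3) := by
    apply IsCoprime.pow_right
    apply IsCoprime.mul_left hc
    have : x.num ^ 2 - n ^ 2 * (x.den : ℤ) ^ 2 = x.num ^ 2 + x.den * (- n ^ 2 * x.den) := by ring
    rw [this]
    exact (IsCoprime.add_mul_left_left (hc.pow_left) _)
  have h2 : ((y ^ 2).den : ℤ) = x.den ^ 3 := by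
    rw [h, h1]
    apply Rat.den_div_eq_of_coprime (by have := x.pos; positivity)
    exact Int.isCoprime_iff_gcd_eq_one.mp hc2
  rw [Rat.den_pow] at h2
  exact_mod_cast h2

lemma hq_y {n : ℕ} (hn : 1 ≤ n) {x y : ℚ} (h : y ^ 2 = x ^ 3 - n ^ 2 * x) : hq y ^ 2 ≤ 2 * n ^ 3 * hq (x / n) ^ 3 := by
  rw [← hq_sq]
  have hn0 : (n : ℚ) ≠ 0 := by positivity
  obtain ⟨r, s, hs, rs, e, hr, hs', -⟩ := exists_rs (x / n)
  have hsq : (s : ℚ) ≠ 0 := by exact_mod_cast hs.ne'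
  have hx : x = n * r / s := by rw [mul_div_assoc, ← e]; field_simp
  set m := hq (x / n)
  have hs2 : |s| ≤ m := by rwa [abs_of_pos hs]
  refine hq_le_of_eq_div (a := n ^ 3 * (r ^ 3 - r * s ^ 2)) (b := s ^ 3) (by positivity) ?_ ?_ ?_
  · rw [h, hx]; push_cast; field_simp
  · zify
    rw [abs_mul]
    calc |(n : ℤ) ^ 3| * |r ^ 3 - r * s ^ 2| ≤ (n : ℤ) ^ 3 * (|r| ^ 3 + |r| * |s| ^ 2) := by
          rw [abs_of_nonneg (by positivity : (0 : ℤ) ≤ (n : ℤ) ^ 3)]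
          gcongr
          refine (abs_sub _ _).trans ?_
          rw [abs_mul, abs_pow, abs_pow]
      _ ≤ (n : ℤ) ^ 3 * ((m : ℤ) ^ 3 + m * (m : ℤ) ^ 2) := by gcongr
      _ = _ := by ring
  · zify
    rw [abs_pow]
    have : (1 : ℤ) ≤ (n : ℤ) ^ 3 := by exact_mod_cast Nat.one_le_pow _ _ hn
    calc |s| ^ 3 ≤ (m : ℤ) ^ 3 := by gcongr
      _ ≤ _ := by nlinarith [pow_nonneg (Int.natCast_nonneg m) 3]

lemma x_bound {n : ℕ} {x y : ℚ} (h : y ^ 2 = x ^ 3 - n ^ 2 * x) : |x| ^ 3 ≤ 8 * n ^ 3 + 2 * y ^ 2 := by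
  have hn : (0 : ℚ) ≤ n := by positivity
  rcases le_total |x| (2 * n) with hc | hc
  · have : |x| ^ 3 ≤ (2 * n : ℚ) ^ 3 := by gcongr
    nlinarith [sq_nonneg y]
  · have h1 : y ^ 2 = |x| ^ 3 - n ^ 2 * |x| := by
      have h2 : |x| ^ 3 - n ^ 2 * |x| = |x ^ 3 - n ^ 2 * x| := by
        rw [show x ^ 3 - n ^ 2 * x = x * (x ^ 2 - n ^ 2) by ring, abs_mul, abs_of_nonneg (a := x ^ 2 - n ^ 2)]
        · rw [← sq_abs x]; ring
        · rw [← sq_abs x]; nlinarith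
      rw [h2, ← h, abs_of_nonneg (sq_nonneg y)]
    have h3 : (n : ℚ) ^ 2 * |x| ≤ |x| ^ 3 / 4 := by
      have : (n : ℚ) ^ 2 ≤ |x| ^ 2 / 4 := by nlinarith
      nlinarith [abs_nonneg x]
    have : (0 : ℚ) ≤ n ^ 3 := by positivity
    nlinarith [pow_nonneg (abs_nonneg x) 3]

lemma xD_bound {n : ℕ} (hn : 1 ≤ n) {x y : ℚ} (h : y ^ 2 = x ^ 3 - n ^ 2 * x) {D0 Z M My : ℕ} {X : ℤ}
    (hX : x * D0 = X) (hD : D0 ^ 3 ≤ Z ^ 2) (hy : |y| * Z ≤ My) (hZ : Z ≤ My) (hM : My ^ 2 ≤ M ^ 3) :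
    |X| ≤ (3 * n * M : ℕ) ∧ D0 ≤ M := by
  have hDM : D0 ^ 3 ≤ M ^ 3 := hD.trans (le_trans (by gcongr) hM)
  have hDM' : D0 ≤ M := le_of_pow_le_pow_left₀ (by norm_num) (by positivity) hDM
  refine ⟨?_, hDM'⟩
  have h1 := x_bound h
  have hMq : (My : ℚ) ^ 2 ≤ M ^ 3 := by exact_mod_cast hM
  have hDq : (D0 : ℚ) ^ 3 ≤ Z ^ 2 := by exact_mod_cast hD
  have hDMq : (D0 : ℚ) ^ 3 ≤ M ^ 3 := by exact_mod_cast hDM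
  have h2 : (|y| * Z) ^ 2 ≤ (My : ℚ) ^ 2 := by gcongr
  rw [mul_pow, sq_abs] at h2
  have hn1 : (1 : ℚ) ≤ (n : ℚ) ^ 3 := by exact_mod_cast Nat.one_le_pow _ _ hn
  have h3 : |(X : ℚ)| ^ 3 ≤ (3 * n * M : ℚ) ^ 3 := by
    rw [← hX, abs_mul, mul_pow, abs_of_nonneg (by positivity : (0:ℚ) ≤ (D0:ℚ))]
    calc |x| ^ 3 * (D0 : ℚ) ^ 3 ≤ (8 * n ^ 3 + 2 * y ^ 2) * (D0 : ℚ) ^ 3 := by gcongr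
      _ = 8 * n ^ 3 * (D0 : ℚ) ^ 3 + 2 * (y ^ 2 * (D0 : ℚ) ^ 3) := by ring
      _ ≤ 8 * n ^ 3 * (M : ℚ) ^ 3 + 2 * (y ^ 2 * (Z : ℚ) ^ 2) := by gcongr
      _ ≤ 8 * n ^ 3 * (M : ℚ) ^ 3 + 2 * (M : ℚ) ^ 3 := by gcongr; linarith
      _ ≤ 27 * n ^ 3 * (M : ℚ) ^ 3 := by
        have : (0 : ℚ) ≤ (M : ℚ) ^ 3 := by positivity
        nlinarith
      _ = _ := by ring
  have h4 := le_of_pow_le_pow_left₀ (by norm_num) (by positivity) h3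
  exact_mod_cast h4

lemma den_dvd_of {y : ℚ} {Z A : ℤ} (h : y * Z = A) : (y.den : ℤ) ∣ Z := by
  have h1 : y.num * Z = A * y.den := by
    have hd : (y.den : ℚ) ≠ 0 := by exact_mod_cast y.den_nz
    have : (y.num : ℚ) * Z = A * y.den := by
      rw [← h]; nth_rw 2 [← Rat.num_div_den y]; field_simp
    exact_mod_cast this
  exact (Int.isCoprime_iff_gcd_eq_one.mpr y.reduced : IsCoprime y.num (y.den : ℤ)).symm.dvd_of_dvd_mul_left (y := y.num) ⟨A, by rw [h1]; ring⟩

lemma mul_den_int {x : ℚ} {D : ℕ} (h : x.den ∣ D) : ∃ X : ℤ, x * D = X := by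
  obtain ⟨k, rfl⟩ := h
  refine ⟨x.num * k, ?_⟩
  have hd : (x.den : ℚ) ≠ 0 := by exact_mod_cast x.den_nz
  push_cast; nth_rw 1 [← Rat.num_div_den x]; field_simp

lemma exists_cube (m : ℕ) (hm : 1 ≤ m) : ∃ M : ℕ, m ^ 2 ≤ M ^ 3 ∧ M ^ 3 ≤ 8 * m ^ 2 := by
  have hex : ∃ M : ℕ, m ^ 2 ≤ M ^ 3 := ⟨m, Nat.pow_le_pow_right hm (by norm_num)⟩
  classical
  refine ⟨Nat.find hex, Nat.find_spec hex, ?_⟩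
  set M := Nat.find hex with hM
  rcases Nat.lt_or_ge M 2 with h | h
  · have : M ^ 3 ≤ 1 ^ 3 := by gcongr; omega
    have := Nat.one_le_pow 2 m hm
    omega
  · have h1 := Nat.find_min hex (m := M - 1) (by omega)
    have h2 : M ≤ 2 * (M - 1) := by omega
    calc M ^ 3 ≤ (2 * (M - 1)) ^ 3 := by gcongr
      _ = 8 * (M - 1) ^ 3 := by ring
      _ ≤ _ := by omega

theorem ap_y : ∃ K j : ℕ, 1 ≤ K ∧ ∀ n S : ℕ, 1 ≤ n → HtAx (ht : (Ec n).Point → ℕ) n S →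
    ∀ N (x y : Fin N → ℚ), (∀ i, (Ec n).Nonsingular (x i) (y i)) → IsNontrivAP y → N ≤ K * S ^ j := by
  obtain ⟨K, j, hK, H⟩ := pack 40960 5 (by norm_num)
  refine ⟨36 * K, j, by omega, ?_⟩
  intro n S hn hax N x y hns hap
  have hS := hax.S_pos
  have hKS : 1 ≤ K * S ^ j := Nat.mul_pos hK (pow_pos hS j)
  rcases Nat.eq_zero_or_pos N with rfl | hN
  · omega
  obtain ⟨α, β, σ, hβ, hσ, hb⟩ := ap_setup hN hap
  have hn0 : (n : ℚ) ≠ 0 := by positivity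
  set q := (N + 3) / 20 with hqdef
  have hq : ∀ t, t < 5 * q → 4 * t + 1 ≤ N := fun t ht => by omega
  obtain ⟨Z, A, My, f, hZ, hA, hZM, hAM, hf, hMy⟩ := ap_core α β q
    (fun t ht => (hb t (hq t ht)).1) (fun t ht => (hb t (hq t ht)).2)
  have hf5 : ∀ k < q, f k < 5 * q := fun k hk => by have := hf k; omega
  have hyk : ∀ k < q, y (σ (f k)) = α + f k * β := fun k hk => hσ _ (by have := hq _ (hf5 k hk); omega)
  have hinj : ∀ k < q, ∀ l < q, k ≠ l → x (σ (f k)) ≠ x (σ (f l)) := by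
    intro k hk l hl hkl h
    have e1 := Ec_eq (hns (σ (f k)))
    have e2 := Ec_eq (hns (σ (f l)))
    rw [h, ← e2] at e1
    have hne : f k ≠ f l := by have := hf k; have := hf l; omega
    rcases sq_eq_sq_iff_eq_or_eq_neg.mp e1 with h1 | h1
    · rw [hyk k hk, hyk l hl] at h1
      have h1 : (f k : ℚ) = f l := by
        apply mul_right_cancel₀ hβ; linarith
      exact hne (by exact_mod_cast h1)
    · rw [hyk k hk, hyk l hl] at h1
      have b1 := (hb _ (hq _ (hf5 k hk))).2
      have b2 := (hb _ (hq _ (hf5 l hl))).2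
      have h2 : 2 * α = -(f k * β) - f l * β := by linarith
      have h3 : |2 * α| ≤ |α| := by
        rw [h2]; refine (abs_sub _ _).trans ?_
        rw [abs_neg]; linarith
      rw [abs_mul, abs_two] at h3
      have h4 : |α| = 0 := by linarith [abs_nonneg α]
      rw [h4] at b1 b2
      have z1 : (f k : ℚ) * β = 0 := abs_eq_zero.mp (le_antisymm (by simpa using b1) (abs_nonneg _))
      have z2 : (f l : ℚ) * β = 0 := abs_eq_zero.mp (le_antisymm (by simpa using b2) (abs_nonneg _))
      have z1 : f k = 0 := by have := (mul_eq_zero.mp z1).resolve_right hβ; exact_mod_cast this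
      have z2 : f l = 0 := by have := (mul_eq_zero.mp z2).resolve_right hβ; exact_mod_cast this
      omega
  have hMy1 : 1 ≤ My := by omega
  obtain ⟨M, hM1, hM2⟩ := exists_cube My hMy1
  obtain ⟨Zn, rfl⟩ : ∃ Zn : ℕ, Z = Zn := ⟨Z.toNat, by omega⟩
  have hZn : Zn ≤ My := by exact_mod_cast hZM
  have hyA : ∀ k < q, y (σ (f k)) * ((Zn : ℤ) : ℚ) = A (f k) := fun k hk => by rw [hyk k hk]; exact hA _
  have hyb : ∀ k < q, |y (σ (f k))| * Zn ≤ My := by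
    intro k hk
    have := hyA k hk
    have h2 := hAM _ (hf5 k hk)
    have h3 : |(A (f k) : ℚ)| ≤ My := by exact_mod_cast h2
    rw [← this, abs_mul] at h3
    simpa using h3
  have hden : ∀ k < q, (y (σ (f k))).den ∣ Zn := fun k hk => by
    have := den_dvd_of (hyA k hk); exact_mod_cast this
  let P : ℕ → (Ec n).Point := fun k => .some _ _ (hns (σ (f k)))
  have hPinj : Set.InjOn P (Finset.range q) := by
    intro k hk l hl h
    by_contra hkl
    simp only [P, Point.some.injEq] at h
    exact hinj k (by simpa using hk) l (by simpa using hl) hkl h.1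
  have hn5 : ∀ i ≤ 5, n ^ i ≤ n ^ 5 := fun i hi => Nat.pow_le_pow_right hn hi
  have hZpos : 0 < Zn := by exact_mod_cast hZ
  have hT := H hn hax M ((Finset.range q).image P) ?_ ?_ ?_
  · rw [Finset.card_image_of_injOn hPinj, Finset.card_range] at hT
    have : N ≤ 20 * q + 16 := by omega
    calc N ≤ 20 * q + 16 := this
      _ ≤ 20 * (K * S ^ j) + 16 * (K * S ^ j) := by omega
      _ = _ := by ring
  · intro Q hQ
    obtain ⟨k, hk, rfl⟩ := Finset.mem_image.mp hQ
    have hk := Finset.mem_range.mp hk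
    have hE := Ec_eq (hns (σ (f k)))
    have hd := den_rel hE
    obtain ⟨X, hX⟩ := mul_den_int (dvd_refl (x (σ (f k))).den)
    have hle : (x (σ (f k))).den ^ 3 ≤ Zn ^ 2 := by
      rw [← hd]; gcongr; exact Nat.le_of_dvd hZpos (hden k hk)
    obtain ⟨b1, b2⟩ := xD_bound hn hE hX hle (hyb k hk) hZn hM1
    have : ht (P k) ≤ 3 * n * M := by
      simp only [P, ht_some]
      refine hq_le_of_eq_div (a := X) (b := n * (x (σ (f k))).den) ?_ ?_ ?_ ?_
      · have := (x (σ (f k))).pos; positivity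
      · push_cast; rw [← hX]; field_simp
      · zify; exact_mod_cast b1
      · rw [Int.natAbs_mul]; simp only [Int.natAbs_natCast]; nlinarith
    refine this.trans ?_
    gcongr
    · norm_num
    · simpa using hn5 1 (by norm_num)
  · intro Q hQ
    obtain ⟨k, hk, rfl⟩ := Finset.mem_image.mp hQ
    have hk := Finset.mem_range.mp hk
    simp only [P, ht_some]
    have hE := Ec_eq (hns (σ (f k)))
    have h1 := hq_y hn hE
    have h2 := hMy k hk
    rw [← hyk k hk] at h2
    set hh := AC.hq (x (σ (f k)) / n)
    set hy := AC.hq (y (σ (f k)))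
    have h3 : (M ^ 4) ^ 3 ≤ (40960 * n ^ 5 * hh ^ 5) ^ 3 := by
      calc (M ^ 4) ^ 3 = (M ^ 3) ^ 4 := by ring
        _ ≤ (8 * My ^ 2) ^ 4 := by gcongr
        _ = 8 ^ 4 * (My ^ 4) ^ 2 := by ring
        _ ≤ 8 ^ 4 * (9216 * hy ^ 5) ^ 2 := by gcongr
        _ = 8 ^ 4 * 9216 ^ 2 * (hy ^ 2) ^ 5 := by ring
        _ ≤ 8 ^ 4 * 9216 ^ 2 * (2 * n ^ 3 * hh ^ 3) ^ 5 := by gcongr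
        _ = (8 ^ 4 * 9216 ^ 2 * 32) * (n ^ 15 * hh ^ 15) := by ring
        _ ≤ 40960 ^ 3 * (n ^ 15 * hh ^ 15) := by gcongr; norm_num
        _ = _ := by ring
    exact le_of_pow_le_pow_left₀ (by norm_num) (by positivity) h3
  · intro Q hQ R hR hQR
    obtain ⟨k, hk, rfl⟩ := Finset.mem_image.mp hQ
    have hk := Finset.mem_range.mp hk
    obtain ⟨l, hl, rfl⟩ := Finset.mem_image.mp hR
    have hl := Finset.mem_range.mp hl
    have hkl : k ≠ l := by rintro rfl; exact hQR rfl
    have hEk := Ec_eq (hns (σ (f k)))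
    have hEl := Ec_eq (hns (σ (f l)))
    set D0 := Nat.lcm (x (σ (f k))).den (x (σ (f l))).den with hD0
    have hD0pos : 0 < D0 := Nat.lcm_pos (Rat.pos _) (Rat.pos _)
    have hle : D0 ^ 3 ≤ Zn ^ 2 := by
      apply Nat.le_of_dvd (by positivity)
      rw [hD0, ← Nat.pow_lcm_pow, ← den_rel hEk, ← den_rel hEl, Nat.pow_lcm_pow]
      exact pow_dvd_pow_of_dvd (Nat.lcm_dvd (hden k hk) (hden l hl)) 2
    obtain ⟨X, hX⟩ := mul_den_int (Nat.dvd_lcm_left (x (σ (f k))).den (x (σ (f l))).den)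
    obtain ⟨Y, hY⟩ := mul_den_int (Nat.dvd_lcm_right (x (σ (f k))).den (x (σ (f l))).den)
    obtain ⟨b1, b2⟩ := xD_bound hn hEk hX hle (hyb k hk) hZn hM1
    obtain ⟨c1, c2⟩ := xD_bound hn hEl hY hle (hyb l hl) hZn hM1
    have := ht_add_le_of_common (by omega) (hns (σ (f k))) (hns (σ (f l))) (hinj k hk l hl hkl)
      (X₁ := X) (X₂ := Y) (D := n * D0) (M := 3 * n * M) (by positivity)
      (by push_cast; rw [← hX, ← hD0]; field_simp) (by push_cast; rw [← hY, ← hD0]; field_simp) b1 c1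
      (by rw [abs_of_nonneg (by positivity)]
          have : n * D0 ≤ 3 * n * M := by nlinarith
          exact_mod_cast this)
    refine this.trans ?_
    calc 6 * (3 * n * M) ^ 3 = 162 * n ^ 3 * M ^ 3 := by ring
      _ ≤ _ := by
        gcongr
        · norm_num
        · norm_num
end AC

namespace AC
open WeierstrassCurve WeierstrassCurve.Affine

lemma halve {n : ℕ} (hn : n ≠ 0) {x y a b c : ℚ} (h : (Ec n).Nonsingular x y)
    (ha : a ^ 2 = x) (hb : b ^ 2 = x - n) (hc : c ^ 2 = x + n) (habc : a * b * c = -y) :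
    ∃ Q : (Ec n).Point, Point.some x y h = Q + Q := by
  have hn' : (n : ℚ) ≠ 0 := by exact_mod_cast hn
  set X := x + a * b + a * c + b * c with hX
  set Y := -((a + b) * (a + c) * (b + c)) with hY
  have e1 : X = (a + b) * (a + c) := by rw [hX, ← ha]; ring
  have e2 : X - n = (a + b) * (b + c) := by rw [hX]; linear_combination -hb
  have e3 : X + n = (a + c) * (b + c) := by rw [hX]; linear_combination -hc
  have hE : Y ^ 2 = X ^ 3 - n ^ 2 * X := by
    have : X ^ 3 - n ^ 2 * X = X * (X - n) * (X + n) := by ring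
    rw [this, e2, e3, e1, hY]; ring
  have hab : a + b ≠ 0 := fun h0 => hn' (by have : a = -b := by linarith
                                            rw [this] at ha; linear_combination hb - ha)
  have hac : a + c ≠ 0 := fun h0 => hn' (by have : a = -c := by linarith
                                            rw [this] at ha; linear_combination ha - hc)
  have hbc : b + c ≠ 0 := fun h0 => hn' (by have : b = -c := by linarith
                                            rw [this] at hb; linear_combination (hb - hc) / 2)
  have hY0 : Y ≠ 0 := by
    rw [hY]; exact neg_ne_zero.mpr (mul_ne_zero (mul_ne_zero hab hac) hbc)
  have hns := Ec_nonsing hn hE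
  obtain ⟨x', y', h', he, hx', hy'⟩ := ec_add_self hns hY0
  have hl : (3 * X ^ 2 - n ^ 2) / (2 * Y) = -(a + b + c) := by
    rw [div_eq_iff (by simpa using hY0)]
    have : 3 * X ^ 2 - n ^ 2 = X * (X - n) + X * (X + n) + (X - n) * (X + n) := by ring
    rw [this, e2, e3, e1, hY]; ring
  rw [hl] at hx' hy'
  have hxx : x' = x := by rw [hx', hX]; linear_combination ha + hb + hc
  have hyy : y' = y := by
    rw [hy', hxx, hX, hY]; linear_combination -habc
  refine ⟨.some X Y hns, ?_⟩
  rw [he]; subst hxx hyy; rfl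

lemma same_class {n : ℕ} (hn : n ≠ 0) {x₁ y₁ x₂ y₂ : ℚ} (h₁ : (Ec n).Nonsingular x₁ y₁) (h₂ : (Ec n).Nonsingular x₂ y₂)
    (hy₁ : y₁ ≠ 0) (hy₂ : y₂ ≠ 0) (s1 : IsSquare (x₁ * x₂)) (s2 : IsSquare ((x₁ - n) * (x₂ - n))) :
    ∃ Q : (Ec n).Point, Point.some _ _ h₁ = Point.some _ _ h₂ + (Q + Q) := by
  have E1 := Ec_eq h₁
  have E2 := Ec_eq h₂
  have nz : ∀ {x y : ℚ}, y ^ 2 = x ^ 3 - n ^ 2 * x → y ≠ 0 → x ≠ 0 ∧ x - n ≠ 0 ∧ x + n ≠ 0 := by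
    intro x y h hy
    have : x * (x - n) * (x + n) ≠ 0 := by
      rw [show x * (x - n) * (x + n) = y ^ 2 by rw [h]; ring]; exact pow_ne_zero 2 hy
    exact ⟨left_ne_zero_of_mul (left_ne_zero_of_mul this), right_ne_zero_of_mul (left_ne_zero_of_mul this), right_ne_zero_of_mul this⟩
  obtain ⟨a1, a2, a3⟩ := nz E1 hy₁
  obtain ⟨b1, b2, b3⟩ := nz E2 hy₂
  have h2' : (Ec n).Nonsingular x₂ (-y₂) := Ec_nonsing hn (by rw [neg_sq]; exact E2)
  have hneg := ec_neg_some h₂ h2'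
  by_cases hx : x₁ = x₂
  · subst hx
    have : y₁ ^ 2 = y₂ ^ 2 := by rw [E1, E2]
    rcases sq_eq_sq_iff_eq_or_eq_neg.mp this with rfl | rfl
    · exact ⟨0, by simp⟩
    · refine ⟨.some _ _ h₁, ?_⟩
      rw [← hneg]; abel
  · obtain ⟨x, y, h, he, hX, hY⟩ := ec_add_ne h₁ h2' hx
    set l := (y₁ - -y₂) / (x₁ - x₂) with hl
    have hd : x₁ - x₂ ≠ 0 := sub_ne_zero.mpr hx
    have hl' : l * (x₁ - x₂) = y₁ + y₂ := by rw [hl]; field_simp; ring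
    have E3 := Ec_eq h
    -- key identity
    have id2 : (x₁ - x₂) * (x₁ * x₂ + x₁ * x + x₂ * x + n ^ 2 + 2 * l * (y₁ - l * x₁)) = 0 := by
      rw [hX]
      linear_combination E1 - E2 + (-y₂ + y₁ - l * (x₁ - x₂)) * hl'
    have id2' : x₁ * x₂ + x₁ * x + x₂ * x + n ^ 2 + 2 * l * (y₁ - l * x₁) = 0 := (mul_eq_zero.mp id2).resolve_left hd
    have id3 : x₁ * x₂ * x = (y₁ - l * x₁) ^ 2 := by
      rw [hX] at id2' ⊢
      linear_combination x₁ * id2' - E1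
    have key : ∀ e : ℚ, e ^ 3 = n ^ 2 * e → (x₁ - e) * (x₂ - e) * (x - e) = (y₁ + l * (e - x₁)) ^ 2 := by
      intro e he
      have : x = l ^ 2 - x₁ - x₂ := hX
      linear_combination id3 - e * id2' - he + e ^ 2 * this
    have sq : ∀ e : ℚ, e ^ 3 = n ^ 2 * e → IsSquare ((x₁ - e) * (x₂ - e)) → x₁ - e ≠ 0 → x₂ - e ≠ 0 → ∃ r : ℚ, r ^ 2 = x - e := by
      rintro e he ⟨w, hw⟩ n1 n2
      have hw0 : w ≠ 0 := by rintro rfl; exact mul_ne_zero n1 n2 (by simpa using hw)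
      refine ⟨(y₁ + l * (e - x₁)) / w, ?_⟩
      rw [div_pow, ← key e he, hw]; field_simp
    have s3 : IsSquare ((x₁ + n) * (x₂ + n)) := by
      obtain ⟨u, hu⟩ := s1
      obtain ⟨v, hv⟩ := s2
      have huv : u * v ≠ 0 := by
        rintro h0
        have : (x₁ * x₂) * ((x₁ - n) * (x₂ - n)) = (u * v) * (u * v) := by rw [hu, hv]; ring
        rw [h0] at this
        exact mul_ne_zero (mul_ne_zero a1 b1) (mul_ne_zero a2 b2) (by simpa using this)
      refine ⟨y₁ * y₂ / (u * v), ?_⟩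
      rw [div_mul_div_comm, eq_div_iff (mul_ne_zero huv huv)]
      calc (x₁ + n) * (x₂ + n) * (u * v * (u * v)) = (x₁ + n) * (x₂ + n) * (u * u) * (v * v) := by ring
        _ = y₁ ^ 2 * y₂ ^ 2 := by rw [← hu, ← hv, E1, E2]; ring
        _ = _ := by ring
    obtain ⟨a, ha⟩ := sq 0 (by simp) (by simpa using s1) (by simpa using a1) (by simpa using b1)
    obtain ⟨b, hb⟩ := sq n (by ring) s2 a2 b2
    obtain ⟨c, hc⟩ := sq (-n) (by ring) (by simpa using s3) (by simpa using a3) (by simpa using b3)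
    rw [sub_zero] at ha
    rw [sub_neg_eq_add] at hc
    have hfin : ∃ Q : (Ec n).Point, Point.some x y h = Q + Q := by
      have : (a * b * c) ^ 2 = y ^ 2 := by
        rw [mul_pow, mul_pow, ha, hb, hc, E3]; ring
      rcases sq_eq_sq_iff_eq_or_eq_neg.mp this with h0 | h0
      · exact halve hn h (a := -a) (by rw [neg_sq]; exact ha) hb hc (by linear_combination -h0)
      · exact halve hn h ha hb hc h0
    obtain ⟨Q, hQ⟩ := hfin
    refine ⟨Q, ?_⟩
    rw [← hQ, ← he, ← hneg]; abel
end AC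

namespace AC

/-- unit part Legendre symbol -/
noncomputable def ep (p : ℕ) (r : ℤ) : ℤ := jacobiSym (r / (p : ℤ) ^ padicValInt p r) p

lemma val_ep {p : ℕ} (hp : p.Prime) {r t : ℤ} {k : ℕ} (h : r = (p : ℤ) ^ k * t) (ht : ¬ (p : ℤ) ∣ t) :
    padicValInt p r = k ∧ ep p r = jacobiSym t p := by
  have := Fact.mk hp
  have hp0 : (p : ℤ) ≠ 0 := by exact_mod_cast hp.ne_zero
  have ht0 : t ≠ 0 := by rintro rfl; exact ht (dvd_zero _)
  have hv : padicValInt p r = k := by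
    rw [h, padicValInt.mul (pow_ne_zero _ hp0) ht0, padicValInt.eq_zero_of_not_dvd ht, add_zero]
    unfold padicValInt
    rw [Int.natAbs_pow, Int.natAbs_natCast, padicValNat.prime_pow]
  refine ⟨hv, ?_⟩
  rw [ep, hv, h, Int.mul_ediv_cancel_left _ (pow_ne_zero _ hp0)]

lemma exists_unit {p : ℕ} (hp : p.Prime) {r : ℤ} (hr : r ≠ 0) : ∃ t, r = (p : ℤ) ^ padicValInt p r * t ∧ ¬ (p : ℤ) ∣ t := by
  have hfin : FiniteMultiplicity (p : ℤ) r := Int.finiteMultiplicity_iff.mpr ⟨by simpa using hp.one_lt.ne', hr⟩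
  obtain ⟨t, h1, h2⟩ := hfin.exists_eq_pow_mul_and_not_dvd
  have := (val_ep hp h1 h2).1
  exact ⟨t, by rw [this]; exact h1, h2⟩

lemma ep_mul {p : ℕ} (hp : p.Prime) {r s : ℤ} (hr : r ≠ 0) (hs : s ≠ 0) : ep p (r * s) = ep p r * ep p s := by
  obtain ⟨t, h1, h2⟩ := exists_unit hp hr
  obtain ⟨u, h3, h4⟩ := exists_unit hp hs
  have hpp : Prime (p : ℤ) := Nat.prime_iff_prime_int.mp hp
  have : ¬ (p : ℤ) ∣ t * u := fun h => (hpp.dvd_or_dvd h).elim h2 h4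
  rw [(val_ep hp h1 h2).2, (val_ep hp h3 h4).2, ← jacobiSym.mul_left]
  refine (val_ep hp (k := padicValInt p r + padicValInt p s) ?_ this).2
  nth_rw 1 [h1, h3]; ring

lemma ep_unit {p : ℕ} (hp : p.Prime) {t : ℤ} (ht : ¬ (p : ℤ) ∣ t) : ep p t = jacobiSym t p :=
  (val_ep hp (k := 0) (by simp) ht).2

lemma ep_self {p : ℕ} (hp : p.Prime) : ep p p = 1 := by
  have : ¬ (p : ℤ) ∣ 1 := fun h => hp.one_lt.ne' (by exact_mod_cast Int.natAbs_dvd_natAbs.mpr h |> Nat.dvd_one.mp)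
  rw [(val_ep hp (k := 1) (t := 1) (by simp) this).2]; simp

lemma ep_one {p : ℕ} (hp : p.Prime) : ep p 1 = 1 := by
  have : ¬ (p : ℤ) ∣ 1 := fun h => hp.one_lt.ne' (by exact_mod_cast Int.natAbs_dvd_natAbs.mpr h |> Nat.dvd_one.mp)
  rw [ep_unit hp this]; simp

lemma J_sq {p : ℕ} (hp : p.Prime) {t : ℤ} (ht : ¬ (p : ℤ) ∣ t) : jacobiSym t p ^ 2 = 1 := by
  apply jacobiSym.sq_one
  rw [Int.gcd_comm]
  exact (Int.isCoprime_iff_gcd_eq_one.mp ((Nat.prime_iff_prime_int.mp hp).coprime_iff_not_dvd.mpr ht))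

lemma ep_sq {p : ℕ} (hp : p.Prime) {r : ℤ} (hr : r ≠ 0) : ep p r ^ 2 = 1 := by
  obtain ⟨t, h1, h2⟩ := exists_unit hp hr
  rw [(val_ep hp h1 h2).2]; exact J_sq hp h2

lemma ep_pow {p : ℕ} (hp : p.Prime) {r : ℤ} (hr : r ≠ 0) (k : ℕ) : ep p (r ^ k) = ep p r ^ k := by
  induction k with
  | zero => simp [ep_one hp]
  | succ k ih => rw [pow_succ, ep_mul hp (pow_ne_zero _ hr) hr, ih, pow_succ]

lemma ep_prod {p : ℕ} (hp : p.Prime) (T : Finset ℕ) (f : ℕ → ℤ) (hf : ∀ q ∈ T, f q ≠ 0) :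
    ep p (∏ q ∈ T, f q) = ∏ q ∈ T, ep p (f q) := by
  induction T using Finset.induction_on with
  | empty => simp [ep_one hp]
  | insert a T ha ih =>
    rw [Finset.prod_insert ha, Finset.prod_insert ha, ep_mul hp (hf _ (by simp)) (Finset.prod_ne_zero_iff.mpr fun q hq => hf q (by simp [hq])),
      ih fun q hq => hf q (by simp [hq])]

lemma pm_pow {s : ℤ} (hs : s ^ 2 = 1) {a b : ℕ} (h : a % 2 = b % 2) : s ^ a = s ^ b := by
  rw [← Nat.div_add_mod a 2, ← Nat.div_add_mod b 2, h, pow_add, pow_add, pow_mul, pow_mul, hs]; simp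

lemma pm_val {s : ℤ} (hs : s ^ 2 = 1) (k : ℕ) : s ^ ((k : ZMod 2)).val = s ^ k := by
  apply pm_pow hs; rw [ZMod.val_natCast]; simp

lemma ep_factor {p n : ℕ} (hp : p.Prime) {r : ℤ} (hr : r ≠ 0) (hn : n ≠ 0) (h2n : Odd n)
    (heven : ∀ q : ℕ, q.Prime → q ≠ 2 → ¬ q ∣ n → Even (padicValInt q r)) :
    ep p r = ep p r.sign * (ep p 2 ^ padicValInt 2 r * ∏ q ∈ n.primeFactors, ep p q ^ padicValInt q r) := by
  classical
  have hn2 : 2 ∉ n.primeFactors := fun h => by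
    have := Nat.dvd_of_mem_primeFactors h
    rw [← Nat.not_even_iff_odd] at h2n; exact h2n (even_iff_two_dvd.mpr this)
  have hq0 : ∀ q : ℕ, q.Prime → (q : ℤ) ≠ 0 := fun q hq => by exact_mod_cast hq.ne_zero
  have h1 : r = r.sign * (r.natAbs : ℤ) := (Int.sign_mul_natAbs r).symm
  have hna : r.natAbs ≠ 0 := by simpa using hr
  have h2 : (r.natAbs : ℤ) = ∏ q ∈ r.natAbs.primeFactors, (q : ℤ) ^ padicValInt q r := by
    conv_lhs => rw [← Nat.prod_factorization_pow_eq_self hna]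
    rw [Finsupp.prod, Nat.support_factorization]
    push_cast
    refine Finset.prod_congr rfl fun q hq => ?_
    rw [Nat.factorization_def _ (Nat.prime_of_mem_primeFactors hq)]; rfl
  have h3 : ep p (r.natAbs : ℤ) = ∏ q ∈ r.natAbs.primeFactors, ep p q ^ padicValInt q r := by
    rw [h2, ep_prod hp _ _ fun q hq => pow_ne_zero _ (hq0 q (Nat.prime_of_mem_primeFactors hq))]
    refine Finset.prod_congr rfl fun q hq => ep_pow hp (hq0 q (Nat.prime_of_mem_primeFactors hq)) _
  conv_lhs => rw [h1]
  rw [ep_mul hp (by simpa using hr) (by exact_mod_cast hna), h3]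
  congr 1
  have h4 : ep p 2 ^ padicValInt 2 r * ∏ q ∈ n.primeFactors, ep p q ^ padicValInt q r =
      ∏ q ∈ insert 2 n.primeFactors, ep p q ^ padicValInt q r := by
    rw [Finset.prod_insert hn2]; simp
  rw [h4]
  set T := r.natAbs.primeFactors ∪ insert 2 n.primeFactors with hT
  trans ∏ q ∈ T, ep p q ^ padicValInt q r
  · refine Finset.prod_subset (Finset.subset_union_left) fun q hq hq' => ?_
    have hqp : q.Prime := by
      rcases Finset.mem_union.mp hq with h | h
      · exact Nat.prime_of_mem_primeFactors h
      · rcases Finset.mem_insert.mp h with rfl | h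
        · exact Nat.prime_two
        · exact Nat.prime_of_mem_primeFactors h
    have : ¬ q ∣ r.natAbs := fun h => hq' (Nat.mem_primeFactors.mpr ⟨hqp, h, hna⟩)
    rw [padicValInt.eq_zero_of_not_dvd (fun h => this (Int.natCast_dvd.mp h)), pow_zero]
  · symm
    refine Finset.prod_subset (Finset.subset_union_right) fun q hq hq' => ?_
    have hqp : q.Prime := by
      rcases Finset.mem_union.mp hq with h | h
      · exact Nat.prime_of_mem_primeFactors h
      · exact absurd h hq'
    have hq2 : q ≠ 2 := fun h => hq' (by simp [h])
    have hqn : ¬ q ∣ n := fun h => hq' (Finset.mem_insert_of_mem (Nat.mem_primeFactors.mpr ⟨hqp, h, hn⟩))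
    obtain ⟨k, hk⟩ := heven q hqp hq2 hqn
    rw [hk, ← two_mul, pow_mul, ep_sq hp (hq0 q hqp), one_pow]

section
variable {n p : ℕ} {r z a : ℤ}

lemma v_even (hp : p.Prime) (hr : r ≠ 0) {c : ℤ} (hc : ¬ (p : ℤ) ∣ c) (h : r * c = a ^ 2) :
    Even (padicValInt p r) := by
  have := Fact.mk hp
  have hc0 : c ≠ 0 := by rintro rfl; exact hc (dvd_zero _)
  have ha : a ≠ 0 := by rintro rfl; exact mul_ne_zero hr hc0 (by rw [h]; simp)
  have := congrArg (padicValInt p) h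
  rw [padicValInt.mul hr hc0, sq, padicValInt.mul ha ha, padicValInt.eq_zero_of_not_dvd hc] at this
  exact ⟨_, by simpa using this⟩

lemma even1 (hp : p.Prime) (hp2 : p ≠ 2) (hpn : ¬ p ∣ n) (ha : a ≠ 0) (hrz : IsCoprime r z)
    (h : r * (r - n * z ^ 2) * (r + n * z ^ 2) = a ^ 2) : Even (padicValInt p r) ∧ Even (padicValInt p (r - n * z ^ 2)) := by
  have hpp : Prime (p : ℤ) := Nat.prime_iff_prime_int.mp hp
  have hpn' : ¬ (p : ℤ) ∣ n := fun h => hpn (by exact_mod_cast h)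
  have h0 : r * (r - n * z ^ 2) * (r + n * z ^ 2) ≠ 0 := by rw [h]; exact pow_ne_zero 2 ha
  have hr0 := left_ne_zero_of_mul (left_ne_zero_of_mul h0)
  have hρ0 := right_ne_zero_of_mul (left_ne_zero_of_mul h0)

  have nd : (p : ℤ) ∣ r → ¬ (p : ℤ) ∣ n * z ^ 2 := fun h1 h2 => by
    rcases hpp.dvd_or_dvd h2 with h3 | h3
    · exact hpn' h3
    · exact hpp.not_isUnit (hrz.isUnit_of_dvd' h1 (hpp.dvd_of_dvd_pow h3))
  constructor
  · by_cases hd : (p : ℤ) ∣ r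
    · refine v_even hp hr0 (c := (r - n * z ^ 2) * (r + n * z ^ 2)) ?_ (by rw [← h]; ring)
      intro h1
      rcases hpp.dvd_or_dvd h1 with h1 | h1
      · exact nd hd (by have := dvd_sub hd h1; simpa using this)
      · exact nd hd (by have := dvd_sub h1 hd; simpa using this)
    · rw [padicValInt.eq_zero_of_not_dvd hd]; simp
  · by_cases hd : (p : ℤ) ∣ r - n * z ^ 2
    · refine v_even hp hρ0 (c := r * (r + n * z ^ 2)) ?_ (by rw [← h]; ring)
      have hndr : ¬ (p : ℤ) ∣ r := fun h1 => nd h1 (by have := dvd_sub h1 hd; simpa using this)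
      intro h1
      rcases hpp.dvd_or_dvd h1 with h1 | h1
      · exact hndr h1
      · have h2 : (p : ℤ) ∣ 2 * r := by have := dvd_add hd h1; rwa [show r - n * z ^ 2 + (r + n * z ^ 2) = 2 * r by ring] at this
        rcases hpp.dvd_or_dvd h2 with h3 | h3
        · exact hp2 ((Nat.prime_dvd_prime_iff_eq hp Nat.prime_two).mp (by exact_mod_cast h3))
        · exact hndr h3
    · rw [padicValInt.eq_zero_of_not_dvd hd]; simp

lemma J_congr {t u : ℤ} (h : (p : ℤ) ∣ t - u) : jacobiSym t p = jacobiSym u p :=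
  jacobiSym.mod_left' (Int.ModEq.symm (Int.modEq_iff_dvd.mpr h))

end
end AC

namespace AC
section
variable {n p m : ℕ} {r z a : ℤ}

lemma local_cond (hp : p.Prime) (hp2 : p ≠ 2) (hnm : n = p * m) (hpm : ¬ p ∣ m) (ha : a ≠ 0) (hrz : IsCoprime r z)
    (h : r * (r - n * z ^ 2) * (r + n * z ^ 2) = a ^ 2) :
    ep p r = jacobiSym m p ^ padicValInt p r * jacobiSym (-1) p ^ padicValInt p (r - n * z ^ 2) ∧
    ep p (r - n * z ^ 2) = jacobiSym m p ^ padicValInt p (r - n * z ^ 2) * jacobiSym (-1) p ^ padicValInt p (r - n * z ^ 2) *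
      jacobiSym 2 p ^ padicValInt p r := by
  have := Fact.mk hp
  have hpp : Prime (p : ℤ) := Nat.prime_iff_prime_int.mp hp
  have hp0 : (p : ℤ) ≠ 0 := hpp.ne_zero
  have hpm' : ¬ (p : ℤ) ∣ m := fun h => hpm (by exact_mod_cast h)
  have hp1 : ¬ (p : ℤ) ∣ -1 := fun h => hpp.not_isUnit (isUnit_of_dvd_unit h (by norm_num))
  have hp2' : ¬ (p : ℤ) ∣ 2 := fun h3 => hp2 ((Nat.prime_dvd_prime_iff_eq hp Nat.prime_two).mp (by exact_mod_cast h3))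
  have h0 : r * (r - n * z ^ 2) * (r + n * z ^ 2) ≠ 0 := by rw [h]; exact pow_ne_zero 2 ha
  have hr0 := left_ne_zero_of_mul (left_ne_zero_of_mul h0)
  have hρ0 := right_ne_zero_of_mul (left_ne_zero_of_mul h0)
  have hσ0 := right_ne_zero_of_mul h0
  have hprod : ep p r * ep p (r - n * z ^ 2) * ep p (r + n * z ^ 2) = 1 := by
    rw [← ep_mul hp hr0 hρ0, ← ep_mul hp (mul_ne_zero hr0 hρ0) hσ0, h, ep_pow hp ha, ep_sq hp ha]
  have hval : padicValInt p r + padicValInt p (r - n * z ^ 2) + padicValInt p (r + n * z ^ 2) = 2 * padicValInt p a := by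
    rw [← padicValInt.mul hr0 hρ0, ← padicValInt.mul (mul_ne_zero hr0 hρ0) hσ0, h, sq, padicValInt.mul ha ha]; ring
  have jm := J_sq hp hpm'
  have j1 := J_sq hp hp1
  have j2 := J_sq hp hp2'
  have hps : (p : ℤ) ∣ n * z ^ 2 := by rw [hnm]; push_cast; exact ⟨m * z ^ 2, by ring⟩
  by_cases hd : (p : ℤ) ∣ r
  swap
  · have hd1 : ¬ (p : ℤ) ∣ r - n * z ^ 2 := fun h1 => hd (by have := dvd_add h1 hps; simpa using this)
    have hd2 : ¬ (p : ℤ) ∣ r + n * z ^ 2 := fun h1 => hd (by have := dvd_sub h1 hps; simpa using this)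
    rw [ep_unit hp hd, ep_unit hp hd1, ep_unit hp hd2,
      J_congr (t := r - n * z ^ 2) (u := r) (by simpa using hps), J_congr (t := r + n * z ^ 2) (u := r) (by simpa using hps)] at hprod
    have e1 : jacobiSym r p = 1 := by
      have := J_sq hp hd
      rw [sq] at this; rw [this, one_mul] at hprod; exact hprod
    rw [padicValInt.eq_zero_of_not_dvd hd, padicValInt.eq_zero_of_not_dvd hd1, ep_unit hp hd, ep_unit hp hd1,
      J_congr (t := r - n * z ^ 2) (u := r) (by simpa using hps), e1]
    simp
  obtain ⟨r1, rfl⟩ := hd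
  have hz : ¬ (p : ℤ) ∣ z := fun h1 => hpp.not_isUnit (hrz.isUnit_of_dvd' (Dvd.intro _ rfl) h1)
  set s : ℤ := m * z ^ 2 with hs
  have hns : (n : ℤ) * z ^ 2 = p * s := by rw [hnm, hs]; push_cast; ring
  have hpsn : ¬ (p : ℤ) ∣ s := fun h1 => (hpp.dvd_or_dvd h1).elim hpm' fun h2 => hz (hpp.dvd_of_dvd_pow h2)
  have Js : jacobiSym s p = jacobiSym m p := by
    rw [hs, jacobiSym.mul_left, jacobiSym.pow_left, J_sq hp hz, mul_one]
  rw [hns] at hprod hval hρ0 hσ0 ⊢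
  rw [← mul_sub] at hprod hval hρ0 ⊢
  rw [← mul_add] at hprod hval hσ0
  have hr1 := right_ne_zero_of_mul hr0
  have hρ1 := right_ne_zero_of_mul hρ0
  have hσ1 := right_ne_zero_of_mul hσ0
  have hvp : padicValInt p (p : ℤ) = 1 := padicValInt.self hp.one_lt
  rw [ep_mul hp hp0 hr1, ep_mul hp hp0 hρ1, ep_mul hp hp0 hσ1, ep_self hp, one_mul, one_mul, one_mul] at hprod
  rw [padicValInt.mul hp0 hr1, padicValInt.mul hp0 hρ1, padicValInt.mul hp0 hσ1, hvp] at hval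
  rw [ep_mul hp hp0 hr1, ep_mul hp hp0 hρ1, ep_self hp, one_mul, one_mul, padicValInt.mul hp0 hr1, padicValInt.mul hp0 hρ1, hvp]
  by_cases hd : (p : ℤ) ∣ r1
  · have hd1 : ¬ (p : ℤ) ∣ r1 - s := fun h1 => hpsn (by have := dvd_sub hd h1; simpa using this)
    have hd2 : ¬ (p : ℤ) ∣ r1 + s := fun h1 => hpsn (by have := dvd_sub h1 hd; simpa using this)
    rw [padicValInt.eq_zero_of_not_dvd hd1] at hval ⊢
    rw [padicValInt.eq_zero_of_not_dvd hd2] at hval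
    have e1 : ep p (r1 - s) = jacobiSym (-1) p * jacobiSym m p := by
      rw [ep_unit hp hd1, J_congr (u := -1 * s) (by simpa using hd), jacobiSym.mul_left, Js]
    have e2 : ep p (r1 + s) = jacobiSym m p := by
      rw [ep_unit hp hd2, J_congr (u := s) (by simpa using hd), Js]
    rw [e1, e2] at hprod
    rw [e1, pm_pow jm (show (1 + padicValInt p r1) % 2 = 0 % 2 by omega), pm_pow j2 (show (1 + padicValInt p r1) % 2 = 0 % 2 by omega)]
    have e3 := ep_sq hp hr1
    constructor
    · simp only [pow_zero, add_zero, pow_one, one_mul]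
      calc ep p r1 = ep p r1 * (jacobiSym (-1) p ^ 2) * (jacobiSym m p ^ 2) := by rw [j1, jm]; ring
        _ = (ep p r1 * (jacobiSym (-1) p * jacobiSym m p) * jacobiSym m p) * jacobiSym (-1) p := by ring
        _ = _ := by rw [hprod, one_mul]
    · simp only [pow_zero, add_zero, pow_one, mul_one]; ring
  · have v1 := padicValInt.eq_zero_of_not_dvd hd
    rw [v1] at hval ⊢
    by_cases hd1 : (p : ℤ) ∣ r1 - s
    · have hd2 : ¬ (p : ℤ) ∣ r1 + s := fun h1 => by
        have := dvd_add hd1 h1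
        rw [show r1 - s + (r1 + s) = 2 * r1 by ring] at this
        exact (hpp.dvd_or_dvd this).elim hp2' hd
      rw [padicValInt.eq_zero_of_not_dvd hd2] at hval
      have e1 : ep p r1 = jacobiSym m p := by rw [ep_unit hp hd, J_congr hd1, Js]
      have e2 : ep p (r1 + s) = jacobiSym 2 p * jacobiSym m p := by
        rw [ep_unit hp hd2, J_congr (u := 2 * s) (by rw [show r1 + s - 2 * s = r1 - s by ring]; exact hd1), jacobiSym.mul_left, Js]
      rw [e1, e2] at hprod
      rw [pm_pow jm (show (1 + padicValInt p (r1 - s)) % 2 = 0 % 2 by omega), pm_pow j1 (show (1 + padicValInt p (r1 - s)) % 2 = 0 % 2 by omega)]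
      simp only [pow_zero, add_zero, pow_one, one_mul, mul_one]
      refine ⟨e1, ?_⟩
      calc ep p (r1 - s) = ep p (r1 - s) * (jacobiSym 2 p ^ 2) * (jacobiSym m p ^ 2) := by rw [j2, jm]; ring
        _ = (jacobiSym m p * ep p (r1 - s) * (jacobiSym 2 p * jacobiSym m p)) * jacobiSym 2 p := by ring
        _ = _ := by rw [hprod, one_mul]
    · have v2 := padicValInt.eq_zero_of_not_dvd hd1
      rw [v2] at hval ⊢
      have hd2 : (p : ℤ) ∣ r1 + s := by
        by_contra hcon
        rw [padicValInt.eq_zero_of_not_dvd hcon] at hval; omega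
      simp only [add_zero, pow_one]
      refine ⟨?_, ?_⟩
      · rw [ep_unit hp hd, J_congr (u := -1 * s) (by simpa using hd2), jacobiSym.mul_left, Js]; ring
      · rw [ep_unit hp hd1, J_congr (u := -1 * 2 * s) (by rw [show r1 - s - -1 * 2 * s = r1 + s by ring]; exact hd2), jacobiSym.mul_left, jacobiSym.mul_left, Js]; ring
end
end AC

namespace AC
open WeierstrassCurve WeierstrassCurve.Affine

/-- The local condition at `p` in the `i`-th coordinate. -/
def cnd {I : Type} (ci cj : (I → ZMod 2) → I → ℕ) (n : ℕ) (u : n.primeFactors → I → ZMod 2)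
    (p : n.primeFactors) (i : I) : ℤ :=
  jacobiSym (-1) p ^ ci (u p) i * jacobiSym 2 p ^ cj (u p) i *
    ∏ q : n.primeFactors, jacobiSym ((q : ℕ) : ℤ) p ^ (u p i + u q i).val

open Classical in
/-- Number of solutions of the system of local conditions. -/
noncomputable def Zset {I : Type} [Fintype I] (ci cj : (I → ZMod 2) → I → ℕ) (n : ℕ) :
    Finset (n.primeFactors → I → ZMod 2) :=
  Finset.univ.filter fun u : n.primeFactors → I → ZMod 2 => ∀ p i, cnd ci cj n u p i = 1
noncomputable def Zc {I : Type} [Fintype I] (ci cj : (I → ZMod 2) → I → ℕ) (n : ℕ) : ℕ := (Zset ci cj n).card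
lemma mem_Zset {I : Type} [Fintype I] (ci cj : (I → ZMod 2) → I → ℕ) (n : ℕ) (u) :
    u ∈ Zset ci cj n ↔ ∀ p i, cnd ci cj n u p i = 1 := by
  unfold Zset; simp only [Finset.mem_filter, Finset.mem_univ, true_and]

def ciT (τ : Fin 4 → ZMod 2) (w : Fin 2 → ZMod 2) (i : Fin 2) : ℕ :=
  if i = 0 then (τ 0).val + (w 1).val else (τ 2).val + (w 1).val
def cjT (τ : Fin 4 → ZMod 2) (w : Fin 2 → ZMod 2) (i : Fin 2) : ℕ :=
  if i = 0 then (τ 1).val else (τ 3).val + (w 0).val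

def sgz (c : ℤ) : ZMod 2 := if c < 0 then 1 else 0

lemma ep_sign {p : ℕ} (hp : p.Prime) {c : ℤ} (hc : c ≠ 0) : ep p c.sign = jacobiSym (-1) p ^ (sgz c).val := by
  have hpp : Prime (p : ℤ) := Nat.prime_iff_prime_int.mp hp
  have hp1 : ¬ (p : ℤ) ∣ -1 := fun h => hpp.not_isUnit (isUnit_of_dvd_unit h (by norm_num))
  rcases lt_or_gt_of_ne hc with h | h
  · rw [Int.sign_eq_neg_one_of_neg h, ep_unit hp hp1, sgz, if_pos h, show (1 : ZMod 2).val = 1 from rfl, pow_one]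
  · rw [Int.sign_eq_one_of_pos h, ep_one hp, sgz, if_neg (by omega)]; simp

lemma gen_cond {n p m : ℕ} (hn : Squarefree n) (h2n : Odd n) (hp : p.Prime) (hp2 : p ≠ 2) (hnm : n = p * m) (hpm : ¬ p ∣ m) {c : ℤ} (hc : c ≠ 0)
    (heven : ∀ q : ℕ, q.Prime → q ≠ 2 → ¬ q ∣ n → Even (padicValInt q c)) :
    jacobiSym (-1) p ^ (sgz c).val * jacobiSym 2 p ^ ((padicValInt 2 c : ℕ) : ZMod 2).val *
      ∏ q : n.primeFactors, jacobiSym ((q : ℕ) : ℤ) p ^ (((padicValInt p c : ℕ) : ZMod 2) + ((padicValInt q c : ℕ) : ZMod 2)).val =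
      ep p c * jacobiSym m p ^ padicValInt p c := by
  have hpp : Prime (p : ℤ) := Nat.prime_iff_prime_int.mp hp
  have hpm' : ¬ (p : ℤ) ∣ m := fun h => hpm (by exact_mod_cast h)
  have hp2' : ¬ (p : ℤ) ∣ 2 := fun h3 => hp2 ((Nat.prime_dvd_prime_iff_eq hp Nat.prime_two).mp (by exact_mod_cast h3))
  have hm0 : (m : ℤ) ≠ 0 := by rintro h; exact hpm' (by rw [h]; simp)
  have hJm : jacobiSym m p = ∏ q ∈ n.primeFactors, ep p q := by
    rw [← ep_unit hp hpm', ← one_mul (ep p m), ← ep_self hp, ← ep_mul hp hpp.ne_zero hm0,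
      ← ep_prod hp _ _ fun q hq => by exact_mod_cast (Nat.prime_of_mem_primeFactors hq).ne_zero]
    congr 1
    have := Nat.prod_primeFactors_of_squarefree hn
    rw [← Nat.cast_prod, this, hnm]; push_cast; ring
  rw [ep_factor hp hc hn.ne_zero h2n heven, ep_sign hp hc, ep_unit hp hp2', hJm, pm_val (J_sq hp hp2'), ← Finset.prod_pow]
  rw [mul_assoc, mul_assoc, mul_assoc, ← Finset.prod_mul_distrib, ← Finset.prod_coe_sort n.primeFactors]
  congr 2
  refine Finset.prod_congr rfl fun q _ => ?_
  have hq := Nat.prime_of_mem_primeFactors q.2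
  by_cases hqp : (q : ℕ) = p
  · rw [hqp, ep_self hp]
    have : ((padicValInt p c : ℕ) : ZMod 2) + ((padicValInt p c : ℕ) : ZMod 2) = 0 := CharTwo.add_self_eq_zero _
    rw [this]; simp
  · have hnd : ¬ (p : ℤ) ∣ ((q : ℕ) : ℤ) := fun h => hqp ((Nat.prime_dvd_prime_iff_eq hp hq).mp (by exact_mod_cast h)).symm
    rw [ep_unit hp hnd, ← pow_add, ← Nat.cast_add, pm_val (J_sq hp hnd), add_comm]

/-- key of an `x`-coordinate. -/
noncomputable def keyT (n : ℕ) (x : ℚ) : Fin 4 → ZMod 2 :=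
  ![sgz x.num, (padicValInt 2 x.num : ℕ), sgz (x.num - n * x.den), (padicValInt 2 (x.num - n * x.den) : ℕ)]
noncomputable def keyU (n : ℕ) (x : ℚ) (p : n.primeFactors) : Fin 2 → ZMod 2 :=
  ![(padicValInt p x.num : ℕ), (padicValInt p (x.num - n * x.den) : ℕ)]

lemma point_int {n : ℕ} {x y : ℚ} (h : y ^ 2 = x ^ 3 - n ^ 2 * x) (hy : y ≠ 0) : ∃ z a : ℤ, a ≠ 0 ∧ z ≠ 0 ∧ (x.den : ℤ) = z ^ 2 ∧
    IsCoprime x.num z ∧ x.num * (x.num - n * z ^ 2) * (x.num + n * z ^ 2) = a ^ 2 := by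
  have hd := den_rel h
  have hx0 := x.pos
  obtain ⟨t, ht⟩ : x.den ∣ y.den := by
    have : x.den ^ 2 ∣ y.den ^ 2 := ⟨x.den, by rw [hd]; ring⟩
    exact (Nat.pow_dvd_pow_iff (by norm_num)).mp this
  have ht2 : x.den = t ^ 2 := by
    rw [ht] at hd
    have : x.den ^ 2 * t ^ 2 = x.den ^ 2 * x.den := by rw [← mul_pow, hd]; ring
    exact (Nat.eq_of_mul_eq_mul_left (by positivity) this).symm
  have hc : IsCoprime x.num (x.den : ℤ) := Int.isCoprime_iff_gcd_eq_one.mpr x.reduced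
  have ht2' : (x.den : ℤ) = (t : ℤ) ^ 2 := by exact_mod_cast ht2
  refine ⟨t, y.num, by simpa using hy, ?_, ht2', ?_, ?_⟩
  · intro h0; rw [h0] at ht2'; simp at ht2'
  · rw [ht2'] at hc
    exact hc.of_isCoprime_of_dvd_right (Dvd.intro_left _ (pow_succ (t:ℤ) 1).symm)
  · rw [← ht2']
    have hxd : (x.den : ℚ) ≠ 0 := by positivity
    have hyd : (y.den : ℚ) ≠ 0 := by have := y.pos; positivity
    have e1 : (x.num : ℚ) = x * x.den := (Rat.mul_den_eq_num x).symm
    have e2 : (y.num : ℚ) = y * y.den := (Rat.mul_den_eq_num y).symm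
    have hdq : (y.den : ℚ) ^ 2 = x.den ^ 3 := by exact_mod_cast hd
    have : (x.num * (x.num - n * x.den) * (x.num + n * x.den) : ℚ) = (y.num : ℚ) ^ 2 := by
      rw [e1, e2, mul_pow, hdq, h]; ring
    exact_mod_cast this

lemma key_valid {n : ℕ} (hn : Squarefree n) (h2n : Odd n) {x y : ℚ} (h : y ^ 2 = x ^ 3 - n ^ 2 * x) (hy : y ≠ 0)
    (p : n.primeFactors) (i : Fin 2) : cnd (ciT (keyT n x)) (cjT (keyT n x)) n (keyU n x) p i = 1 := by
  obtain ⟨z, a, ha, hz, hd, hc, he⟩ := point_int h hy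
  have hp := Nat.prime_of_mem_primeFactors p.2
  have hpn := Nat.dvd_of_mem_primeFactors p.2
  obtain ⟨m, hnm⟩ := hpn
  have hp2 : (p : ℕ) ≠ 2 := by
    intro h2; rw [h2] at hnm; rw [hnm] at h2n
    exact absurd h2n (by simp)
  have hpm : ¬ (p : ℕ) ∣ m := by
    rintro ⟨k, rfl⟩
    exact hp.one_lt.ne' (Nat.isUnit_iff.mp (hn p ⟨k, hnm.trans (by ring)⟩))
  have h0 : x.num * (x.num - n * z ^ 2) * (x.num + n * z ^ 2) ≠ 0 := by rw [he]; exact pow_ne_zero 2 ha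
  have hr0 := left_ne_zero_of_mul (left_ne_zero_of_mul h0)
  have hρ0 := right_ne_zero_of_mul (left_ne_zero_of_mul h0)
  obtain ⟨l1, l2⟩ := local_cond hp hp2 hnm hpm ha hc he
  have ev : ∀ q : ℕ, q.Prime → q ≠ 2 → ¬ q ∣ n → _ := fun q hq h2 hqn => even1 hq h2 hqn ha hc he
  have g1 := gen_cond hn h2n hp hp2 hnm hpm hr0 (fun q hq h2 hqn => (ev q hq h2 hqn).1)
  have g2 := gen_cond hn h2n hp hp2 hnm hpm hρ0 (fun q hq h2 hqn => (ev q hq h2 hqn).2)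
  have hpp : Prime ((p : ℕ) : ℤ) := Nat.prime_iff_prime_int.mp hp
  have hpm' : ¬ ((p : ℕ) : ℤ) ∣ m := fun h => hpm (by exact_mod_cast h)
  have hp1 : ¬ ((p : ℕ) : ℤ) ∣ -1 := fun h => hpp.not_isUnit (isUnit_of_dvd_unit h (by norm_num))
  have hp2' : ¬ ((p : ℕ) : ℤ) ∣ 2 := fun h3 => hp2 ((Nat.prime_dvd_prime_iff_eq hp Nat.prime_two).mp (by exact_mod_cast h3))
  have e1 := ep_sq hp hr0
  have e2 := ep_sq hp hρ0
  have j1 := J_sq hp hp1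
  have j2 := J_sq hp hp2'
  unfold cnd
  fin_cases i
  · simp only [ciT, cjT, keyT, keyU, hd, Fin.zero_eta, if_true, Matrix.cons_val_zero, Matrix.cons_val_one]
    rw [pow_add, pm_val j1]
    calc _ = (jacobiSym (-1) p ^ (sgz x.num).val * jacobiSym 2 p ^ ((padicValInt 2 x.num : ℕ) : ZMod 2).val *
      ∏ q : n.primeFactors, jacobiSym ((q : ℕ) : ℤ) p ^ (((padicValInt p x.num : ℕ) : ZMod 2) + ((padicValInt q x.num : ℕ) : ZMod 2)).val) *
        jacobiSym (-1) p ^ padicValInt p (x.num - n * z ^ 2) := by ring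
      _ = ep p x.num * ep p x.num := by rw [g1]; nth_rw 3 [l1]; ring
      _ = 1 := by rw [← sq, e1]
  · simp only [ciT, cjT, keyT, keyU, hd, Fin.mk_one, Matrix.cons_val_zero, Matrix.cons_val_one, Matrix.cons_val, one_ne_zero, if_false]
    rw [pow_add, pow_add, pm_val j1, pm_val j2 (padicValInt p x.num)]
    calc _ = (jacobiSym (-1) p ^ (sgz (x.num - n * z ^ 2)).val * jacobiSym 2 p ^ ((padicValInt 2 (x.num - n * z ^ 2) : ℕ) : ZMod 2).val *
      ∏ q : n.primeFactors, jacobiSym ((q : ℕ) : ℤ) p ^ (((padicValInt p (x.num - n * z ^ 2) : ℕ) : ZMod 2) + ((padicValInt q (x.num - n * z ^ 2) : ℕ) : ZMod 2)).val) *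
        jacobiSym (-1) p ^ padicValInt p (x.num - n * z ^ 2) * jacobiSym 2 p ^ padicValInt p x.num := by ring
      _ = ep p (x.num - n * z ^ 2) * ep p (x.num - n * z ^ 2) := by rw [g2]; nth_rw 3 [l2]; ring
      _ = 1 := by rw [← sq, e2]

lemma isSquare_of_even {c : ℤ} (hc : 0 < c) (h : ∀ q : ℕ, q.Prime → Even (padicValInt q c)) : IsSquare c := by
  obtain ⟨k, rfl⟩ : ∃ k : ℕ, c = k := ⟨c.toNat, by omega⟩
  have hk : 0 < k := by exact_mod_cast hc
  obtain ⟨a, b, hab, ha⟩ := Nat.sq_mul_squarefree k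
  have hb : b ≠ 0 := by rintro rfl; simp at hab; omega
  have : a = 1 := by
    by_contra ha1
    obtain ⟨q, hq, hqa⟩ := Nat.exists_prime_and_dvd ha1
    have := Fact.mk hq
    have h1 := h q hq
    rw [padicValInt.of_nat, ← hab, padicValNat.mul (pow_ne_zero _ hb) ha.ne_zero, padicValNat.pow] at h1
    have h2 : padicValNat q a = 1 := by
      have h3 := ha.natFactorization_le_one q
      rw [Nat.factorization_def _ hq] at h3
      have h4 := one_le_padicValNat_of_dvd ha.ne_zero hqa
      omega
    rw [h2, Nat.even_iff] at h1; omega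
  subst this
  refine ⟨b, ?_⟩
  rw [← hab]; push_cast; ring

lemma sgz_pos {c d : ℤ} (hc : c ≠ 0) (hd : d ≠ 0) (h : sgz c = sgz d) : 0 < c * d := by
  unfold sgz at h
  rcases lt_or_gt_of_ne hc with h1 | h1 <;> rcases lt_or_gt_of_ne hd with h2 | h2
  · exact mul_pos_of_neg_of_neg h1 h2
  · rw [if_pos h1, if_neg (by omega)] at h; exact absurd h (by decide)
  · rw [if_neg (by omega), if_pos h2] at h; exact absurd h (by decide)
  · exact mul_pos h1 h2

lemma sq_of_key {n : ℕ} (hn : n ≠ 0) {c d : ℤ} (hc : c ≠ 0) (hd : d ≠ 0) (h : sgz c = sgz d)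
    (h2 : ((padicValInt 2 c : ℕ) : ZMod 2) = (padicValInt 2 d : ℕ))
    (hp : ∀ p : n.primeFactors, ((padicValInt p c : ℕ) : ZMod 2) = (padicValInt p d : ℕ))
    (ec : ∀ q : ℕ, q.Prime → q ≠ 2 → ¬ q ∣ n → Even (padicValInt q c))
    (ed : ∀ q : ℕ, q.Prime → q ≠ 2 → ¬ q ∣ n → Even (padicValInt q d)) : IsSquare (c * d) := by
  apply isSquare_of_even (sgz_pos hc hd h)
  intro q hq
  have := Fact.mk hq
  rw [padicValInt.mul hc hd]
  have par : ∀ a b : ℕ, (a : ZMod 2) = b → Even (a + b) := by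
    intro a b hab
    rw [ZMod.natCast_eq_natCast_iff'] at hab
    rw [Nat.even_iff]; omega
  by_cases hq2 : q = 2
  · subst hq2; exact par _ _ h2
  by_cases hqn : q ∣ n
  · exact par _ _ (hp ⟨q, Nat.mem_primeFactors.mpr ⟨hq, hqn, hn⟩⟩)
  · exact (ec q hq hq2 hqn).add (ed q hq hq2 hqn)

lemma key_inj {n : ℕ} (hn : n ≠ 0) {x₁ y₁ x₂ y₂ : ℚ} (E₁ : y₁ ^ 2 = x₁ ^ 3 - n ^ 2 * x₁) (E₂ : y₂ ^ 2 = x₂ ^ 3 - n ^ 2 * x₂)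
    (hy₁ : y₁ ≠ 0) (hy₂ : y₂ ≠ 0) (hT : keyT n x₁ = keyT n x₂) (hU : keyU n x₁ = keyU n x₂) :
    IsSquare (x₁ * x₂) ∧ IsSquare ((x₁ - n) * (x₂ - n)) := by
  obtain ⟨z, a, ha, hz, hd, hc, he⟩ := point_int E₁ hy₁
  obtain ⟨z', a', ha', hz', hd', hc', he'⟩ := point_int E₂ hy₂
  have h0 : x₁.num * (x₁.num - n * z ^ 2) * (x₁.num + n * z ^ 2) ≠ 0 := by rw [he]; exact pow_ne_zero 2 ha
  have hr0 := left_ne_zero_of_mul (left_ne_zero_of_mul h0)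
  have hρ0 := right_ne_zero_of_mul (left_ne_zero_of_mul h0)
  have h0' : x₂.num * (x₂.num - n * z' ^ 2) * (x₂.num + n * z' ^ 2) ≠ 0 := by rw [he']; exact pow_ne_zero 2 ha'
  have hr0' := left_ne_zero_of_mul (left_ne_zero_of_mul h0')
  have hρ0' := right_ne_zero_of_mul (left_ne_zero_of_mul h0')
  have t : ∀ i, _ := fun i => congrFun hT i
  have t0 := t 0
  have t1 := t 1
  have t2 := t 2
  have t3 := t 3
  have u0 : ∀ p, _ := fun p => congrFun (congrFun hU p) 0
  have u1 : ∀ p, _ := fun p => congrFun (congrFun hU p) 1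
  simp only [keyT, keyU, hd, hd', Matrix.cons_val_zero, Matrix.cons_val_one, Matrix.cons_val] at t0 t1 t2 t3 u0 u1
  have s1 := sq_of_key hn hr0 hr0' t0 t1 u0 (fun q hq h2 hqn => (even1 hq h2 hqn ha hc he).1)
    (fun q hq h2 hqn => (even1 hq h2 hqn ha' hc' he').1)
  have s2 := sq_of_key hn hρ0 hρ0' t2 t3 u1 (fun q hq h2 hqn => (even1 hq h2 hqn ha hc he).2)
    (fun q hq h2 hqn => (even1 hq h2 hqn ha' hc' he').2)
  have hzq : (z : ℚ) ≠ 0 := by exact_mod_cast hz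
  have hzq' : (z' : ℚ) ≠ 0 := by exact_mod_cast hz'
  have e1 : (x₁.num : ℚ) = x₁ * z ^ 2 := by
    rw [← Rat.mul_den_eq_num x₁]; congr 1; exact_mod_cast hd
  have e2 : (x₂.num : ℚ) = x₂ * z' ^ 2 := by
    rw [← Rat.mul_den_eq_num x₂]; congr 1; exact_mod_cast hd'
  obtain ⟨w, hw⟩ := s1
  obtain ⟨w', hw'⟩ := s2
  constructor
  · refine ⟨w / (z * z'), ?_⟩
    have : (x₁.num * x₂.num : ℚ) = w * w := by exact_mod_cast hw
    rw [div_mul_div_comm, ← this, e1, e2]; field_simp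
  · refine ⟨w' / (z * z'), ?_⟩
    have : ((x₁.num - n * z ^ 2) * (x₂.num - n * z' ^ 2) : ℚ) = w' * w' := by exact_mod_cast hw'
    rw [div_mul_div_comm, ← this, e1, e2]; field_simp

/-- The Selmer bound. -/
noncomputable def Sel (n : ℕ) : ℕ := (∑ τ : Fin 4 → ZMod 2, Zc (ciT τ) (cjT τ) n) + 4

lemma cover {n : ℕ} (hn : Squarefree n) (h2n : Odd n) :
    ∃ R : Finset (Ec n).Point, R.card ≤ Sel n ∧ ∀ P, ∃ r ∈ R, ∃ Q, P = r + (Q + Q) := by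
  classical
  have hn0 := hn.ne_zero
  let Key := (τ : Fin 4 → ZMod 2) × (n.primeFactors → Fin 2 → ZMod 2)
  let T : Finset Key := Finset.univ.sigma fun τ => Zset (ciT τ) (cjT τ) n
  have hTc : T.card = ∑ τ : Fin 4 → ZMod 2, Zc (ciT τ) (cjT τ) n := Finset.card_sigma _ _
  let good : Key → (Ec n).Point → Prop := fun k P => ∃ x y h, P = Point.some x y h ∧ y ≠ 0 ∧ (⟨keyT n x, keyU n x⟩ : Key) = k
  let pt : Key → (Ec n).Point := fun k => if h : ∃ P, good k P then h.choose else 0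
  have z1 : (Ec n).Nonsingular 0 0 := Ec_nonsing hn0 (by ring)
  have z2 : (Ec n).Nonsingular n 0 := Ec_nonsing hn0 (by ring)
  have z3 : (Ec n).Nonsingular (-n) 0 := Ec_nonsing hn0 (by ring)
  let R0 : Finset (Ec n).Point := {0, Point.some _ _ z1, Point.some _ _ z2, Point.some _ _ z3}
  refine ⟨T.image pt ∪ R0, ?_, ?_⟩
  · refine (Finset.card_union_le _ _).trans ?_
    rw [Sel, ← hTc]
    exact add_le_add Finset.card_image_le Finset.card_le_four
  · intro P
    have triv : P ∈ R0 → ∃ r ∈ T.image pt ∪ R0, ∃ Q, P = r + (Q + Q) := fun h => ⟨P, Finset.mem_union_right _ h, 0, by simp⟩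
    cases P with
    | zero => exact triv (by simp only [R0, Finset.mem_insert]; left; rfl)
    | some x y h =>
      have E := Ec_eq h
      by_cases hy : y = 0
      · subst hy
        have : x * (x - n) * (x + n) = 0 := by
          have : x * (x - n) * (x + n) = x ^ 3 - n ^ 2 * x := by ring
          rw [this, ← E]; ring
        apply triv
        simp only [R0, Finset.mem_insert, Finset.mem_singleton]
        rcases mul_eq_zero.mp this with h1 | h1
        · rcases mul_eq_zero.mp h1 with h1 | h1
          · subst h1; simp
          · have : x = n := by linarith
            subst this; simp
        · have : x = -n := by linarith
          subst this; simp
      · set k : Key := ⟨keyT n x, keyU n x⟩ with hk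
        have hkT : k ∈ T := Finset.mem_sigma.mpr ⟨Finset.mem_univ _, (mem_Zset _ _ _ _).mpr (key_valid hn h2n E hy)⟩
        have hex : ∃ P, good k P := ⟨_, x, y, h, rfl, hy, rfl⟩
        have hpt : good k (pt k) := by
          simp only [pt]; rw [dif_pos hex]; exact hex.choose_spec
        refine ⟨pt k, Finset.mem_union_left _ (Finset.mem_image_of_mem _ hkT), ?_⟩
        obtain ⟨x', y', h', hP, hy', hkk⟩ := hpt
        rw [hP]
        rw [hk, Sigma.mk.injEq] at hkk
        obtain ⟨s1, s2⟩ := key_inj hn0 E (Ec_eq h') hy hy' hkk.1.symm (eq_of_heq hkk.2.symm)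
        exact same_class hn0 h h' hy hy' s1 s2

theorem htax {n : ℕ} (hn : Squarefree n) (h2n : Odd n) : HtAx (ht : (Ec n).Point → ℕ) n (Sel n) where
  zero := ht_zero
  pos := ht_pos
  neg := ht_neg
  addsub := ht_addsub hn.ne_zero
  two := fun P => (ht_two hn.ne_zero P).1
  fin := fun M => (ball_card hn.ne_zero M).1
  card := fun M => (ball_card hn.ne_zero M).2
  small := by
    intro P
    cases P with
    | zero => left; exact le_refl 1
    | some x y h =>
      by_cases hy : y = 0
      · left
        subst hy
        have E := Ec_eq h
        have hn0 : (n : ℚ) ≠ 0 := by exact_mod_cast hn.ne_zero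
        have : x * (x - n) * (x + n) = 0 := by
          have : x * (x - n) * (x + n) = x ^ 3 - n ^ 2 * x := by ring
          rw [this, ← E]; ring
        rw [ht_some]
        rcases mul_eq_zero.mp this with h1 | h1
        · rcases mul_eq_zero.mp h1 with h1 | h1
          · subst h1; simp [hq]
          · have : x = n := by linarith
            rw [this, div_self hn0]; simp [hq]
        · have : x = -n := by linarith
          rw [this, neg_div, div_self hn0]; simp [hq]
      · right; exact n_le_ht hn h hy
  cover := cover hn h2n

theorem beta_bound : ∃ K j : ℕ, ∀ n : ℕ, Squarefree n → Odd n →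
    max (betaX (CongruentCurve n)) (betaY (CongruentCurve n)) ≤ ((K * Sel n ^ j : ℕ) : ℕ∞) := by
  obtain ⟨K1, j1, hK1, H1⟩ := ap_x
  obtain ⟨K2, j2, hK2, H2⟩ := ap_y
  refine ⟨max K1 K2, max j1 j2, fun n hn h2n => ?_⟩
  have hax := htax hn h2n
  have hS := hax.S_pos
  have hn1 : 1 ≤ n := Nat.one_le_iff_ne_zero.mpr hn.ne_zero
  apply max_le
  · refine iSup₂_le fun N hN => ?_
    obtain ⟨x, y, hns, hap⟩ := hN
    have := H1 n _ hn1 hax N x y hns hap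
    have h2 : K1 * Sel n ^ j1 ≤ max K1 K2 * Sel n ^ max j1 j2 :=
      Nat.mul_le_mul (le_max_left _ _) (Nat.pow_le_pow_right hS (le_max_left _ _))
    exact_mod_cast this.trans h2
  · refine iSup₂_le fun N hN => ?_
    obtain ⟨x, y, hns, hap⟩ := hN
    have := H2 n _ hn1 hax N x y hns hap
    have h2 : K2 * Sel n ^ j2 ≤ max K1 K2 * Sel n ^ max j1 j2 :=
      Nat.mul_le_mul (le_max_right _ _) (Nat.pow_le_pow_right hS (le_max_right _ _))
    exact_mod_cast this.trans h2
end AC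

namespace AC

/-- A quadratic character attached to `i, j, E`. -/
def psi (i j E : ℕ) (m : ℕ) : ℤ := ZMod.χ₄ m ^ i * ZMod.χ₈ m ^ j * jacobiSym m E

lemma psi_mul (i j E a b : ℕ) : psi i j E (a * b) = psi i j E a * psi i j E b := by
  unfold psi
  push_cast
  rw [map_mul, map_mul, jacobiSym.mul_left]; ring

lemma psi_one (i j E : ℕ) : psi i j E 1 = 1 := by
  unfold psi; simp

lemma psi_abs (i j E a : ℕ) : |psi i j E a| ≤ 1 := by
  unfold psi
  have h4 : ∀ x : ZMod 4, |ZMod.χ₄ x| ≤ 1 := by decide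
  have h8 : ∀ x : ZMod 8, |ZMod.χ₈ x| ≤ 1 := by decide
  rw [abs_mul, abs_mul, abs_pow, abs_pow]
  refine mul_le_one₀ (mul_le_one₀ (pow_le_one₀ (abs_nonneg _) (h4 _)) (by positivity) (pow_le_one₀ (abs_nonneg _) (h8 _))) (abs_nonneg _) ?_
  rcases jacobiSym.trichotomy a E with h | h | h <;> rw [h] <;> norm_num

lemma psi_congr (i j E : ℕ) {a b : ℕ} (h : a ≡ b [MOD 8 * E]) : psi i j E a = psi i j E b := by
  unfold psi
  have h8 : (a : ZMod 8) = b := (ZMod.natCast_eq_natCast_iff _ _ _).mpr (h.of_mul_right E)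
  have h4 : (a : ZMod 4) = b := (ZMod.natCast_eq_natCast_iff _ _ _).mpr ((h.of_mul_right E).of_dvd (by norm_num))
  have hE : a ≡ b [MOD E] := h.of_mul_left 8
  rw [h8, h4]
  congr 1
  apply jacobiSym.mod_left'
  exact_mod_cast hE

lemma exists_neg {E : ℕ} (hE : Odd E) (hs : ¬ IsSquare E) (i j : ℕ) :
    ∃ a : ℕ, Nat.Coprime a (8 * E) ∧ psi i j E a = -1 := by
  have hE0 : E ≠ 0 := by rintro rfl; simp at hE
  obtain ⟨p, hp, hpo⟩ : ∃ p : ℕ, p.Prime ∧ ¬ Even (padicValNat p E) := by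
    by_contra hcon
    push Not at hcon
    have h := isSquare_of_even (c := (E : ℤ)) (by positivity) fun q hq => by
      rw [padicValInt.of_nat]; simpa using hcon q hq
    obtain ⟨w, hw⟩ := h
    refine hs ⟨w.natAbs, ?_⟩
    zify; rw [hw]; simp [abs_mul_abs_self]
  obtain ⟨k, E', hpE, hk⟩ := Nat.exists_eq_pow_mul_and_not_dvd hE0 p hp.ne_one
  have := Fact.mk hp
  have hE'0 : E' ≠ 0 := by rintro rfl; simp at hpE
  have hkv : padicValNat p E = k := by
    rw [hk, padicValNat.mul (pow_ne_zero _ hp.ne_zero) hE'0, padicValNat.prime_pow, padicValNat.eq_zero_of_not_dvd hpE, add_zero]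
  rw [hkv, Nat.not_even_iff_odd] at hpo
  have hpE2 : p ≠ 2 := by
    rintro rfl
    rw [hk] at hE
    have := (Nat.odd_mul.mp hE).1
    rcases hpo with ⟨l, rfl⟩
    rw [pow_succ] at this
    exact absurd this (by simp)
  obtain ⟨c, hc⟩ := FiniteField.exists_nonsquare (F := ZMod p) (by rwa [ZMod.ringChar_zmod_n])
  have hcop : Nat.Coprime p (8 * E') := by
    apply Nat.Coprime.mul_right _ ((Nat.Prime.coprime_iff_not_dvd hp).mpr hpE)
    rw [Nat.Prime.coprime_iff_not_dvd hp]
    intro h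
    rw [show 8 = 2 ^ 3 by norm_num] at h
    exact hpE2 ((Nat.prime_dvd_prime_iff_eq hp Nat.prime_two).mp (hp.dvd_of_dvd_pow h))
  obtain ⟨a, ha1, ha2⟩ := Nat.chineseRemainder hcop c.val 1
  have hac : (a : ZMod p) = c := by
    rw [(ZMod.natCast_eq_natCast_iff _ _ _).mpr ha1]; simp
  have hJp : jacobiSym a p = -1 := by
    rw [← jacobiSym.legendreSym.to_jacobiSym, legendreSym, Int.cast_natCast, hac, quadraticChar_neg_one_iff_not_isSquare]
    exact hc
  have hpa : Nat.Coprime a p := by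
    rw [Nat.coprime_comm, Nat.Prime.coprime_iff_not_dvd hp, ← ZMod.natCast_eq_zero_iff, hac]
    rintro rfl; exact hc (by simp)
  have ha8 : Nat.Coprime a (8 * E') := by
    have := ha2.gcd_eq
    rw [Nat.gcd_one_left] at this
    exact this
  have h8 : (a : ZMod 8) = 1 := by
    have := (ZMod.natCast_eq_natCast_iff a 1 8).mpr (ha2.of_mul_right E'); simpa using this
  have h4 : (a : ZMod 4) = 1 := by
    have := (ZMod.natCast_eq_natCast_iff a 1 4).mpr ((ha2.of_mul_right E').of_dvd (by norm_num)); simpa using this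
  have hJE : jacobiSym a E' = 1 := by
    rw [← jacobiSym.one_left E']
    apply jacobiSym.mod_left'
    exact_mod_cast ha2.of_mul_left 8
  refine ⟨a, ?_, ?_⟩
  · rw [hk]
    have h1 := Nat.Coprime.coprime_mul_right_right ha8
    have h2 := Nat.Coprime.coprime_mul_left_right ha8
    exact Nat.Coprime.mul_right h1 (Nat.Coprime.mul_right (hpa.pow_right k) h2)
  · unfold psi
    have := NeZero.mk hE'0
    have h3 : NeZero (p ^ k) := ⟨pow_ne_zero _ hp.ne_zero⟩
    rw [h8, h4, hk, jacobiSym.mul_right, jacobiSym.pow_right, hJp, hJE, hpo.neg_one_pow]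
    simp

lemma period_sum {q : ℕ} (hq : q ≠ 0) (f : ℕ → ℤ) (hf : ∀ a b, a ≡ b [MOD q] → f a = f b) (h1 : ∀ a, |f a| ≤ 1)
    (h0 : ∑ m ∈ Finset.range q, f m = 0) (M : ℕ) : |∑ m ∈ Finset.range M, f m| ≤ q := by
  have hk : ∀ k, ∑ m ∈ Finset.range (q * k), f m = 0 := by
    intro k
    induction k with
    | zero => simp
    | succ k ih =>
      rw [mul_add, mul_one, Finset.sum_range_add, ih, zero_add, ← h0]
      refine Finset.sum_congr rfl fun m _ => hf _ _ ?_
      simp [Nat.ModEq]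
  have hM := Nat.div_add_mod M q
  rw [← hM, Finset.sum_range_add, hk, zero_add]
  refine (Finset.abs_sum_le_sum_abs _ _).trans ((Finset.sum_le_sum fun m _ => h1 _).trans ?_)
  simp
  exact_mod_cast (Nat.mod_lt M (Nat.pos_of_ne_zero hq)).le

lemma psi_sum {E : ℕ} (hE : Odd E) (hs : ¬ IsSquare E) (i j M : ℕ) :
    |∑ m ∈ Finset.range M, psi i j E m| ≤ 8 * E := by
  have hE0 : E ≠ 0 := by rintro rfl; simp at hE
  have hq : 8 * E ≠ 0 := by positivity
  have key := period_sum hq (psi i j E) (fun a b h => psi_congr i j E h) (psi_abs i j E) ?_ M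
  · exact_mod_cast key
  obtain ⟨a, hac, ha⟩ := exists_neg hE hs i j
  have hne : NeZero (8 * E) := ⟨hq⟩
  have conv : ∑ m ∈ Finset.range (8 * E), psi i j E m = ∑ x : ZMod (8 * E), psi i j E x.val := by
    symm
    refine Finset.sum_bij (fun x _ => x.val) (fun x _ => Finset.mem_range.mpr (ZMod.val_lt x)) (fun x _ y _ h => ZMod.val_injective _ h)
      (fun m hm => ⟨(m : ZMod (8 * E)), Finset.mem_univ _, ZMod.val_cast_of_lt (Finset.mem_range.mp hm)⟩) (fun _ _ => rfl)
  rw [conv]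
  have hp : ∑ x : ZMod (8 * E), psi i j E ((ZMod.unitOfCoprime a hac : ZMod (8 * E)) * x).val = ∑ x : ZMod (8 * E), psi i j E x.val :=
    Fintype.sum_equiv (Units.mulLeft (ZMod.unitOfCoprime a hac)) _ _ fun x => rfl
  have hn : ∀ x : ZMod (8 * E), psi i j E ((ZMod.unitOfCoprime a hac : ZMod (8 * E)) * x).val = - psi i j E x.val := by
    intro x
    rw [← neg_one_mul, ← ha, ← psi_mul]
    apply psi_congr
    rw [ZMod.coe_unitOfCoprime, ← ZMod.natCast_eq_natCast_iff]
    simp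
  simp only [hn, Finset.sum_neg_distrib] at hp
  linarith

end AC

namespace AC
open Finset

/-- divisor moments -/
noncomputable def Ld (j N : ℕ) : ℝ := ∑ a ∈ Ico 1 N, (a.divisors.card : ℝ) ^ j / a

lemma card_div_mul (a b : ℕ) : (a * b).divisors.card ≤ a.divisors.card * b.divisors.card := by
  rw [Nat.divisors_mul]; exact Finset.card_mul_le

lemma Ld_nonneg (j N : ℕ) : 0 ≤ Ld j N := sum_nonneg fun _ _ => by positivity

lemma Ld_succ (j N : ℕ) : Ld (j + 1) N ≤ Ld j N ^ 2 := by
  classical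
  have e : Ld j N ^ 2 = ∑ x ∈ Ico 1 N ×ˢ Ico 1 N, ((x.1.divisors.card : ℝ) ^ j / x.1) * ((x.2.divisors.card : ℝ) ^ j / x.2) := by
    rw [sq, Ld, Finset.sum_mul_sum, Finset.sum_product]
  rw [e]
  set g : ℕ × ℕ → ℝ := fun x => ((x.1.divisors.card : ℝ) ^ j / x.1) * ((x.2.divisors.card : ℝ) ^ j / x.2) with hg
  have hg0 : ∀ x, 0 ≤ g x := fun x => by positivity
  calc Ld (j + 1) N ≤ ∑ a ∈ Ico 1 N, ∑ x ∈ Ico 1 N ×ˢ Ico 1 N with x.1 * x.2 = a, g x := by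
        refine sum_le_sum fun a ha => ?_
        have ha' := mem_Ico.mp ha
        have hs : a.divisorsAntidiagonal ⊆ {x ∈ Ico 1 N ×ˢ Ico 1 N | x.1 * x.2 = a} := by
          intro x hx
          rw [Nat.mem_divisorsAntidiagonal] at hx
          have h0 : x.1 * x.2 ≠ 0 := by rw [hx.1]; exact hx.2
          have h1 := Nat.pos_of_ne_zero (left_ne_zero_of_mul h0)
          have h2 := Nat.pos_of_ne_zero (right_ne_zero_of_mul h0)
          have h3 := Nat.le_mul_of_pos_right x.1 h2
          have h4 := Nat.le_mul_of_pos_left x.2 h1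
          simp only [mem_filter, mem_product, mem_Ico]
          refine ⟨⟨⟨h1, ?_⟩, ⟨h2, ?_⟩⟩, hx.1⟩ <;> omega
        refine le_trans ?_ (sum_le_sum_of_subset_of_nonneg hs fun x _ _ => hg0 x)
        have hc : (a.divisors.card : ℝ) = ∑ x ∈ a.divisorsAntidiagonal, (1 : ℝ) := by
          rw [sum_const, nsmul_eq_mul, mul_one, ← Nat.map_div_right_divisors, card_map]
        rw [pow_succ, hc, mul_sum, sum_div]
        refine sum_le_sum fun x hx => ?_
        rw [Nat.mem_divisorsAntidiagonal] at hx
        rw [hg, ← hc]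
        beta_reduce
        rw [div_mul_div_comm, ← mul_pow, ← hx.1]
        push_cast
        rw [mul_one]
        gcongr
        exact_mod_cast card_div_mul x.1 x.2
    _ = ∑ x ∈ Ico 1 N ×ˢ Ico 1 N with x.1 * x.2 ∈ Ico 1 N, g x := sum_fiberwise_eq_sum_filter _ _ _ _
    _ ≤ _ := sum_le_sum_of_subset_of_nonneg (filter_subset _ _) fun x _ _ => hg0 x

lemma harm_le (N : ℕ) : ∑ a ∈ Ico 1 (N + 1), (1 : ℝ) / a ≤ 1 + Real.log N := by
  have h := harmonic_le_one_add_log N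
  rw [harmonic_eq_sum_Icc] at h
  push_cast at h
  simpa [← Finset.Ico_add_one_right_eq_Icc, one_div] using h

lemma Ld3 (N : ℕ) : Ld 3 (N + 1) ≤ (1 + Real.log N) ^ 8 := by
  have h0 : Ld 0 (N + 1) ≤ 1 + Real.log N := by simpa [Ld] using harm_le N
  have hn := Ld_nonneg
  calc Ld 3 (N + 1) ≤ Ld 2 (N + 1) ^ 2 := Ld_succ _ _
    _ ≤ (Ld 1 (N + 1) ^ 2) ^ 2 := by gcongr; exacts [hn _ _, Ld_succ _ _]
    _ ≤ ((Ld 0 (N + 1) ^ 2) ^ 2) ^ 2 := by gcongr; exacts [hn _ _, Ld_succ _ _]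
    _ ≤ (((1 + Real.log N) ^ 2) ^ 2) ^ 2 := by gcongr; exact hn _ _
    _ = _ := by ring

lemma sum_d3 (N : ℕ) : ∑ a ∈ Ico 1 (N + 1), (a.divisors.card : ℝ) ^ 3 ≤ N * (1 + Real.log N) ^ 8 := by
  refine le_trans ?_ (mul_le_mul_of_nonneg_left (Ld3 N) (Nat.cast_nonneg _))
  rw [Ld, mul_sum]
  refine sum_le_sum fun a ha => ?_
  have ha' := mem_Ico.mp ha
  have h1 : (0 : ℝ) < a := by exact_mod_cast ha'.1
  have h2 : (a : ℝ) ≤ N := by exact_mod_cast Nat.lt_succ_iff.mp ha'.2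
  rw [mul_div_assoc', le_div_iff₀ h1, mul_comm]
  gcongr

/-- quadruples from `I` with product `m` -/
def Qd (I : Finset ℕ) (m : ℕ) : Finset (ℕ × ℕ × ℕ × ℕ) :=
  {x ∈ I ×ˢ I ×ˢ I ×ˢ I | x.1 * x.2.1 * x.2.2.1 * x.2.2.2 = m}

lemma Qd_card_le {I : Finset ℕ} {m : ℕ} (hm : m ≠ 0) : (Qd I m).card ≤ m.divisors.card ^ 3 := by
  have : (Qd I m).card ≤ (m.divisors ×ˢ m.divisors ×ˢ m.divisors).card := by
    refine card_le_card_of_injOn (fun x => (x.1, x.2.1, x.2.2.1)) ?_ ?_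
    · intro x hx
      simp only [Qd, coe_filter, mem_product, Set.mem_ofPred_eq] at hx
      simp only [coe_product, Set.mem_prod, mem_coe, Nat.mem_divisors]
      have h := hx.2
      refine ⟨⟨?_, hm⟩, ⟨?_, hm⟩, ⟨?_, hm⟩⟩
      · exact ⟨x.2.1 * x.2.2.1 * x.2.2.2, by rw [← h]; ring⟩
      · exact ⟨x.1 * x.2.2.1 * x.2.2.2, by rw [← h]; ring⟩
      · exact ⟨x.1 * x.2.1 * x.2.2.2, by rw [← h]; ring⟩
    · rintro ⟨a, b, c, d⟩ hx ⟨a', b', c', d'⟩ hy hxy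
      simp only [Qd, coe_filter, mem_product, Set.mem_ofPred_eq] at hx hy
      simp only [Prod.mk.injEq] at hxy ⊢
      obtain ⟨rfl, rfl, rfl⟩ := hxy
      have h1 := hx.2.trans hy.2.symm
      have : a * b * c ≠ 0 := by
        intro h; rw [h, zero_mul] at hx; exact hm hx.2.symm
      exact ⟨rfl, rfl, rfl, Nat.eq_of_mul_eq_mul_left (Nat.pos_of_ne_zero this) h1⟩
  refine this.trans ?_
  rw [card_product, card_product]; apply le_of_eq; ring

lemma Qd_union {I I₁ I₂ : Finset ℕ} (h1 : I₁ ⊆ I) (h2 : I₂ ⊆ I) (hd : Disjoint I₁ I₂) (m : ℕ) :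
    (Qd I₁ m).card + (Qd I₂ m).card ≤ (Qd I m).card := by
  classical
  rw [← card_union_of_disjoint]
  · apply card_le_card
    intro x hx
    simp only [Qd, mem_union, mem_filter, mem_product] at hx ⊢
    rcases hx with ⟨⟨a, b, c, d⟩, e⟩ | ⟨⟨a, b, c, d⟩, e⟩
    · exact ⟨⟨h1 a, h1 b, h1 c, h1 d⟩, e⟩
    · exact ⟨⟨h2 a, h2 b, h2 c, h2 d⟩, e⟩
  · rw [disjoint_left]
    intro x hx hy
    simp only [Qd, mem_filter, mem_product] at hx hy
    exact disjoint_left.mp hd hx.1.1 hy.1.1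

/-- top coefficient -/
noncomputable def topc (α : ℕ → ℝ) (I : Finset ℕ) (m : ℕ) : ℝ :=
  ∑ x ∈ Qd I m, α x.1 * α x.2.1 * α x.2.2.1 * α x.2.2.2

lemma topc_abs {α : ℕ → ℝ} (hα : ∀ a, |α a| ≤ 1) (I : Finset ℕ) (m : ℕ) : |topc α I m| ≤ (Qd I m).card := by
  refine (abs_sum_le_sum_abs _ _).trans ((sum_le_sum fun x _ => ?_).trans (b := ∑ x ∈ Qd I m, (1 : ℝ)) ?_)
  · rw [abs_mul, abs_mul, abs_mul]
    have h := fun t : ℝ => abs_nonneg t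
    exact mul_le_one₀ (mul_le_one₀ (mul_le_one₀ (hα _) (h _) (hα _)) (h _) (hα _)) (h _) (hα _)
  · simp

lemma sum_Qd {M : ℕ} {I : Finset ℕ} (hM : ∀ a ∈ I, ∀ b ∈ I, ∀ c ∈ I, ∀ d ∈ I, a * b * c * d < M) (g : ℕ × ℕ × ℕ × ℕ → ℝ) :
    ∑ m ∈ range M, ∑ x ∈ Qd I m, g x = ∑ x ∈ I ×ˢ I ×ˢ I ×ˢ I, g x := by
  classical
  unfold Qd
  rw [sum_fiberwise_eq_sum_filter, filter_true_of_mem]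
  intro x hx
  simp only [mem_product] at hx
  exact mem_range.mpr (hM _ hx.1 _ hx.2.1 _ hx.2.2.1 _ hx.2.2.2)

lemma pow4_sum (I : Finset ℕ) (g : ℕ → ℝ) :
    (∑ a ∈ I, g a) ^ 4 = ∑ x ∈ I ×ˢ I ×ˢ I ×ˢ I, g x.1 * g x.2.1 * g x.2.2.1 * g x.2.2.2 := by
  have e : (∑ a ∈ I, g a) ^ 4 = (∑ a ∈ I, g a) * ((∑ a ∈ I, g a) * ((∑ a ∈ I, g a) * (∑ a ∈ I, g a))) := by ring
  rw [e, sum_mul_sum, sum_product]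
  simp_rw [sum_product, ← mul_sum, mul_assoc, ← mul_sum, ← sum_mul]

lemma topc_sum {α χ : ℕ → ℝ} (hχ : ∀ a b, χ (a * b) = χ a * χ b) {M : ℕ} {I : Finset ℕ}
    (hM : ∀ a ∈ I, ∀ b ∈ I, ∀ c ∈ I, ∀ d ∈ I, a * b * c * d < M) :
    ∑ m ∈ range M, topc α I m * χ m = (∑ a ∈ I, α a * χ a) ^ 4 := by
  rw [pow4_sum, ← sum_Qd hM]
  refine sum_congr rfl fun m _ => ?_
  rw [topc, sum_mul]
  refine sum_congr rfl fun x hx => ?_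
  rw [← (mem_filter.mp hx).2, hχ, hχ, hχ]; ring

lemma holder2 (l : ℕ) (x y : ℝ) : (x + y) ^ 4 ≤ (l + 1) ^ 3 * (x ^ 4 + y ^ 4 / l ^ 3) ∨ l = 0 := by
  rcases Nat.eq_zero_or_pos l with h | h
  · right; exact h
  left
  have hl : (0 : ℝ) < l := by exact_mod_cast h
  set t := y / l with ht
  have hy : y = l * t := by rw [ht]; field_simp
  have e : y ^ 4 / (l : ℝ) ^ 3 = l * t ^ 4 := by rw [hy]; field_simp
  rw [e, hy]
  have c1 : (x + l * t) ^ 2 ≤ (l + 1) * (x ^ 2 + l * t ^ 2) := by nlinarith [mul_nonneg hl.le (sq_nonneg (x - t))]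
  have c2 : (x ^ 2 + l * t ^ 2) ^ 2 ≤ (l + 1) * (x ^ 4 + l * t ^ 4) := by nlinarith [mul_nonneg hl.le (sq_nonneg (x ^ 2 - t ^ 2))]
  calc (x + l * t) ^ 4 = ((x + l * t) ^ 2) ^ 2 := by ring
    _ ≤ ((l + 1) * (x ^ 2 + l * t ^ 2)) ^ 2 := by gcongr
    _ = (l + 1) ^ 2 * (x ^ 2 + l * t ^ 2) ^ 2 := by ring
    _ ≤ (l + 1) ^ 2 * ((l + 1) * (x ^ 4 + l * t ^ 4)) := by gcongr
    _ = _ := by ring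

lemma dyad {α : ℕ → ℝ} (hα : ∀ a, |α a| ≤ 1) (M : ℕ) : ∀ (L s : ℕ),
    (∀ a ∈ Ico s (s + 2 ^ L), ∀ b ∈ Ico s (s + 2 ^ L), ∀ c ∈ Ico s (s + 2 ^ L), ∀ d ∈ Ico s (s + 2 ^ L), a * b * c * d < M) →
    ∃ C : ℕ → ℝ, (∀ m, |C m| ≤ (L + 1) * (Qd (Ico s (s + 2 ^ L)) m).card) ∧
      ∀ χ : ℕ → ℝ, (∀ a b, χ (a * b) = χ a * χ b) →
        (∑ a ∈ Ico s (s + 2 ^ L), α a * χ a) ^ 4 ≤ ∑ m ∈ range M, C m * χ m ∧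
        ∀ K ≤ 2 ^ L, (∑ a ∈ Ico s (s + K), α a * χ a) ^ 4 ≤ (L + 1) ^ 3 * ∑ m ∈ range M, C m * χ m := by
  intro L
  induction L with
  | zero =>
    intro s hM
    rw [pow_zero] at hM ⊢
    refine ⟨topc α (Ico s (s + 1)), ?_, ?_⟩
    · intro m
      have := topc_abs hα (Ico s (s + 1)) m
      push_cast
      linarith
    intro χ hχ
    rw [topc_sum hχ hM]
    refine ⟨le_refl _, fun K hK => ?_⟩
    have : K = 0 ∨ K = 1 := by omega
    rcases this with rfl | rfl
    · simp; positivity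
    · simp
  | succ L ih =>
    intro s hM
    have hp : 2 ^ (L + 1) = 2 ^ L + 2 ^ L := by ring
    have hpos : 0 < 2 ^ L := by positivity
    have s1 : Ico s (s + 2 ^ L) ⊆ Ico s (s + 2 ^ (L + 1)) := Ico_subset_Ico_right (by omega)
    have s2 : Ico (s + 2 ^ L) (s + 2 ^ L + 2 ^ L) ⊆ Ico s (s + 2 ^ (L + 1)) := Ico_subset_Ico (by omega) (by omega)
    have hd : Disjoint (Ico s (s + 2 ^ L)) (Ico (s + 2 ^ L) (s + 2 ^ L + 2 ^ L)) := Ico_disjoint_Ico_consecutive _ _ _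
    obtain ⟨C1, b1, h1⟩ := ih s fun a ha b hb c hc d hd => hM a (s1 ha) b (s1 hb) c (s1 hc) d (s1 hd)
    obtain ⟨C2, b2, h2⟩ := ih (s + 2 ^ L) fun a ha b hb c hc d hd => hM a (s2 ha) b (s2 hb) c (s2 hc) d (s2 hd)
    refine ⟨fun m => topc α (Ico s (s + 2 ^ (L + 1))) m + C1 m + C2 m, ?_, ?_⟩
    · intro m
      have ht := topc_abs hα (Ico s (s + 2 ^ (L + 1))) m
      have hu : ((Qd (Ico s (s + 2 ^ L)) m).card : ℝ) + (Qd (Ico (s + 2 ^ L) (s + 2 ^ L + 2 ^ L)) m).card ≤ (Qd (Ico s (s + 2 ^ (L + 1))) m).card := by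
        exact_mod_cast Qd_union s1 s2 hd m
      have hL : (0 : ℝ) ≤ L + 1 := by positivity
      calc |topc α (Ico s (s + 2 ^ (L + 1))) m + C1 m + C2 m| ≤ |topc α (Ico s (s + 2 ^ (L + 1))) m| + |C1 m| + |C2 m| := abs_add_three _ _ _
        _ ≤ _ := by
          have := mul_le_mul_of_nonneg_left hu hL
          push_cast
          linarith [b1 m, b2 m]
    · intro χ hχ
      obtain ⟨t1, k1⟩ := h1 χ hχ
      obtain ⟨t2, k2⟩ := h2 χ hχ
      have e : ∑ m ∈ range M, (topc α (Ico s (s + 2 ^ (L + 1))) m + C1 m + C2 m) * χ m =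
          (∑ a ∈ Ico s (s + 2 ^ (L + 1)), α a * χ a) ^ 4 + ∑ m ∈ range M, C1 m * χ m + ∑ m ∈ range M, C2 m * χ m := by
        rw [← topc_sum hχ hM, ← sum_add_distrib, ← sum_add_distrib]
        exact sum_congr rfl fun m _ => by ring
      rw [e]
      set T := (∑ a ∈ Ico s (s + 2 ^ (L + 1)), α a * χ a) ^ 4
      set S1 := ∑ m ∈ range M, C1 m * χ m
      set S2 := ∑ m ∈ range M, C2 m * χ m
      have hT : 0 ≤ T := by positivity
      have hS1 : 0 ≤ S1 := le_trans (by positivity) t1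
      have hS2 : 0 ≤ S2 := le_trans (by positivity) t2
      refine ⟨by linarith, fun K hK => ?_⟩
      push_cast
      rcases le_total K (2 ^ L) with h | h
      · refine (k1 K h).trans ?_
        gcongr
        · linarith
        · linarith
      · obtain ⟨K', rfl⟩ := Nat.exists_eq_add_of_le h
        have hK' := k2 K' (by omega)
        rw [← add_assoc, ← sum_Ico_consecutive _ (show s ≤ s + 2 ^ L by omega) (show s + 2 ^ L ≤ s + 2 ^ L + K' by omega)]
        have hh := (holder2 (L + 1) (∑ a ∈ Ico s (s + 2 ^ L), α a * χ a) (∑ a ∈ Ico (s + 2 ^ L) (s + 2 ^ L + K'), α a * χ a)).resolve_right (by omega)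
        push_cast at hh
        refine hh.trans (mul_le_mul_of_nonneg_left ?_ (by positivity))
        have : (∑ a ∈ Ico (s + 2 ^ L) (s + 2 ^ L + K'), α a * χ a) ^ 4 / ((L : ℝ) + 1) ^ 3 ≤ S2 := by
          rw [div_le_iff₀ (by positivity)]; linarith
        linarith

lemma sqf_mul_sq {b b' : ℕ} (hb : Squarefree b) (hb' : Squarefree b') (h : IsSquare (b * b')) : b = b' := by
  apply Nat.eq_of_factorization_eq hb.ne_zero hb'.ne_zero
  intro p
  obtain ⟨w, hw⟩ := h
  have hw0 : w ≠ 0 := by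
    rintro rfl; simp at hw
    rcases hw with h | h
    · exact hb.ne_zero h
    · exact hb'.ne_zero h
  have h1 := congrArg (fun m => m.factorization p) hw
  simp only [Nat.factorization_mul hb.ne_zero hb'.ne_zero, Nat.factorization_mul hw0 hw0, Finsupp.add_apply] at h1
  have h2 := hb.natFactorization_le_one p
  have h3 := hb'.natFactorization_le_one p
  omega

end AC

namespace AC
open Finset

lemma pow4_card {ι : Type*} (s : Finset ι) (x : ι → ℝ) : (∑ i ∈ s, x i) ^ 4 ≤ (s.card : ℝ) ^ 3 * ∑ i ∈ s, x i ^ 4 := by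
  have h1 := sq_sum_le_card_mul_sum_sq (s := s) (f := x)
  have h2 := sq_sum_le_card_mul_sum_sq (s := s) (f := fun i => x i ^ 2)
  have h3 : ∑ i ∈ s, (x i ^ 2) ^ 2 = ∑ i ∈ s, x i ^ 4 := sum_congr rfl fun i _ => by ring
  rw [h3] at h2
  have h0 : 0 ≤ ∑ i ∈ s, x i ^ 2 := sum_nonneg fun i _ => sq_nonneg _
  calc (∑ i ∈ s, x i) ^ 4 = ((∑ i ∈ s, x i) ^ 2) ^ 2 := by ring
    _ ≤ (s.card * ∑ i ∈ s, x i ^ 2) ^ 2 := by gcongr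
    _ = s.card ^ 2 * (∑ i ∈ s, x i ^ 2) ^ 2 := by ring
    _ ≤ s.card ^ 2 * (s.card * ∑ i ∈ s, x i ^ 4) := by gcongr
    _ = _ := by ring

/-- odd squarefree numbers in `[B, 2 * B)` -/
def OS (B : ℕ) : Finset ℕ := {b ∈ Ico B (2 * B) | Odd b ∧ Squarefree b}

lemma OS_card (B : ℕ) : (OS B).card ≤ B := by
  refine (card_filter_le _ _).trans ?_
  simp; omega

lemma second_factor (B M : ℕ) :
    ∑ m ∈ range M, (∑ b ∈ OS B, (jacobiSym m b : ℝ)) ^ 2 ≤ B * M + 32 * B ^ 4 := by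
  have e : ∀ m ∈ range M, (∑ b ∈ OS B, (jacobiSym m b : ℝ)) ^ 2 = ∑ b ∈ OS B, ∑ b' ∈ OS B, ((jacobiSym m b * jacobiSym m b' : ℤ) : ℝ) := by
    intro m _
    rw [sq, sum_mul_sum]; push_cast; rfl
  rw [sum_congr rfl e, sum_comm]
  have key : ∀ b ∈ OS B, ∑ m ∈ range M, ∑ b' ∈ OS B, ((jacobiSym m b * jacobiSym m b' : ℤ) : ℝ) ≤ M + 32 * B ^ 3 := by
    intro b hb
    rw [sum_comm]
    have k2 : ∀ b' ∈ OS B, ∑ m ∈ range M, ((jacobiSym m b * jacobiSym m b' : ℤ) : ℝ) ≤ (if b' = b then (M : ℝ) else 0) + 32 * B ^ 2 := by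
      intro b' hb'
      simp only [OS, mem_filter, mem_Ico] at hb hb'
      have hb0 := hb.2.2.ne_zero
      have hb0' := hb'.2.2.ne_zero
      split_ifs with h
      · have : ∑ m ∈ range M, ((jacobiSym m b * jacobiSym m b' : ℤ) : ℝ) ≤ ∑ m ∈ range M, (1 : ℝ) := by
          refine sum_le_sum fun m _ => ?_
          have h1 : jacobiSym m b * jacobiSym m b' ≤ 1 := by
            rcases jacobiSym.trichotomy m b with h | h | h <;> rcases jacobiSym.trichotomy m b' with h' | h' | h' <;> rw [h, h'] <;> norm_num
          exact_mod_cast h1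
        refine this.trans ?_
        simp
      · have hE : Odd (b * b') := hb.2.1.mul hb'.2.1
        have hs : ¬ IsSquare (b * b') := fun hs => h (sqf_mul_sq hb.2.2 hb'.2.2 hs).symm
        have h1 := psi_sum hE hs 0 0 M
        have h2 : ∀ m ∈ range M, psi 0 0 (b * b') m = jacobiSym m b * jacobiSym m b' := by
          intro m _
          have := NeZero.mk hb0
          have := NeZero.mk hb0'
          rw [psi, jacobiSym.mul_right]; simp
        rw [sum_congr rfl h2] at h1
        have h3 := (abs_le.mp h1).2
        have h4 : ((∑ m ∈ range M, jacobiSym m b * jacobiSym m b' : ℤ) : ℝ) ≤ ((8 * ((b * b' : ℕ) : ℤ) : ℤ) : ℝ) := by exact_mod_cast h3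
        push_cast at h4 ⊢
        have h5 : (b : ℝ) ≤ 2 * B := by exact_mod_cast hb.1.2.le
        have h6 : (b' : ℝ) ≤ 2 * B := by exact_mod_cast hb'.1.2.le
        have h7 : (b : ℝ) * b' ≤ (2 * B) * (2 * B) := by gcongr
        nlinarith
    refine (sum_le_sum k2).trans ?_
    rw [sum_add_distrib, sum_ite_eq' , if_pos hb, sum_const, nsmul_eq_mul]
    have : ((OS B).card : ℝ) ≤ B := by exact_mod_cast OS_card B
    have h9 : ((OS B).card : ℝ) * (32 * B ^ 2) ≤ B * (32 * B ^ 2) := by gcongr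
    nlinarith
  have e2 : ∑ y ∈ OS B, ∑ x ∈ range M, ∑ b' ∈ OS B, ((jacobiSym x y * jacobiSym x b' : ℤ) : ℝ) ≤ ∑ y ∈ OS B, ((M : ℝ) + 32 * B ^ 3) := sum_le_sum key
  refine e2.trans ?_
  rw [sum_const, nsmul_eq_mul]
  have : ((OS B).card : ℝ) ≤ B := by exact_mod_cast OS_card B
  calc ((OS B).card : ℝ) * (M + 32 * B ^ 3) ≤ B * (M + 32 * B ^ 3) := by gcongr
    _ = _ := by ring

lemma first_factor (N M : ℕ) (hM : ∀ a ∈ Ico 1 (N + 1), ∀ b ∈ Ico 1 (N + 1), ∀ c ∈ Ico 1 (N + 1), ∀ d ∈ Ico 1 (N + 1), a * b * c * d < M) :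
    ∑ m ∈ range M, ((Qd (Ico 1 (N + 1)) m).card : ℝ) ^ 2 ≤ (N * (1 + Real.log N) ^ 8) ^ 4 := by
  set I := Ico 1 (N + 1)
  calc ∑ m ∈ range M, ((Qd I m).card : ℝ) ^ 2 ≤ ∑ m ∈ range M, ∑ x ∈ Qd I m, (x.1.divisors.card : ℝ) ^ 3 * x.2.1.divisors.card ^ 3 * x.2.2.1.divisors.card ^ 3 * x.2.2.2.divisors.card ^ 3 := by
        refine sum_le_sum fun m _ => ?_
        have e0 : ((Qd I m).card : ℝ) ^ 2 = ∑ x ∈ Qd I m, ((Qd I m).card : ℝ) := by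
          rw [sum_const, nsmul_eq_mul, sq]
        rw [e0]
        refine sum_le_sum fun x hx => ?_
        have hx' := (mem_filter.mp hx).2
        have hm : m ≠ 0 := by
          rw [← hx']
          have := (mem_filter.mp hx).1
          simp only [mem_product, I, mem_Ico] at this
          have h1 : 0 < x.1 := by omega
          have h2 : 0 < x.2.1 := by omega
          have h3 : 0 < x.2.2.1 := by omega
          have h4 : 0 < x.2.2.2 := by omega
          positivity
        have h1 := Qd_card_le (I := I) hm
        have h2 : m.divisors.card ≤ x.1.divisors.card * x.2.1.divisors.card * x.2.2.1.divisors.card * x.2.2.2.divisors.card := by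
          rw [← hx']
          refine (card_div_mul _ _).trans (Nat.mul_le_mul_right _ ?_)
          refine (card_div_mul _ _).trans (Nat.mul_le_mul_right _ ?_)
          exact card_div_mul _ _
        have h3 := h1.trans (Nat.pow_le_pow_left h2 3)
        rw [mul_pow, mul_pow, mul_pow] at h3
        exact_mod_cast h3
    _ = (∑ a ∈ I, (a.divisors.card : ℝ) ^ 3) ^ 4 := by rw [sum_Qd hM, pow4_sum]
    _ ≤ _ := pow_le_pow_left₀ (sum_nonneg fun _ _ => by positivity) (sum_d3 N) 4

lemma log_two_pow (L : ℕ) : Real.log ((2 ^ L : ℕ) : ℝ) ≤ L := by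
  push_cast
  rw [Real.log_pow]
  have : Real.log 2 ≤ 1 := by linarith [Real.log_two_lt_d9]
  calc (L : ℝ) * Real.log 2 ≤ L * 1 := by gcongr
    _ = L := mul_one _

lemma bil_core {α : ℕ → ℝ} (hα : ∀ a, |α a| ≤ 1) (L B : ℕ) (hBN : B ≤ 2 ^ L) (K : ℕ → ℕ) (hK : ∀ b ∈ OS B, K b ≤ 2 ^ L) :
    (∑ b ∈ OS B, |∑ a ∈ Ico 1 (1 + K b), α a * (jacobiSym a b : ℝ)|) ^ 8 ≤ 2 ^ 7 * B ^ 7 * (2 ^ L) ^ 8 * ((L : ℝ) + 1) ^ 40 := by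
  set N := 2 ^ L with hN
  have hN1 : 1 ≤ N := Nat.one_le_two_pow
  set M := N ^ 4 + 1 with hMdef
  have hM : ∀ a ∈ Ico 1 (1 + N), ∀ b ∈ Ico 1 (1 + N), ∀ c ∈ Ico 1 (1 + N), ∀ d ∈ Ico 1 (1 + N), a * b * c * d < M := by
    intro a ha b hb c hc d hd
    simp only [mem_Ico] at ha hb hc hd
    have : a * b * c * d ≤ N * N * N * N := by gcongr <;> omega
    rw [hMdef]
    have e : N ^ 4 = N * N * N * N := by ring
    omega
  obtain ⟨C, hC, hχ⟩ := dyad hα M L 1 hM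
  set S := ∑ b ∈ OS B, |∑ a ∈ Ico 1 (1 + K b), α a * (jacobiSym a b : ℝ)| with hS
  have hB : ((OS B).card : ℝ) ≤ B := by exact_mod_cast OS_card B
  have hL : (0 : ℝ) ≤ (L : ℝ) + 1 := by positivity
  have h1 : S ^ 4 ≤ B ^ 3 * (((L : ℝ) + 1) ^ 3 * ∑ m ∈ range M, C m * ∑ b ∈ OS B, (jacobiSym m b : ℝ)) := by
    refine (pow4_card _ _).trans ?_
    have : ∑ b ∈ OS B, |∑ a ∈ Ico 1 (1 + K b), α a * (jacobiSym a b : ℝ)| ^ 4 ≤ ((L : ℝ) + 1) ^ 3 * ∑ m ∈ range M, C m * ∑ b ∈ OS B, (jacobiSym m b : ℝ) := by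
      simp_rw [mul_sum (s := OS B)]
      rw [sum_comm, mul_sum]
      refine sum_le_sum fun b hb => ?_
      rw [show ∀ t : ℝ, |t| ^ 4 = t ^ 4 from fun t => Even.pow_abs (by decide) t]
      exact (hχ (fun m => (jacobiSym m b : ℝ)) (fun a c => by push_cast; rw [jacobiSym.mul_left]; push_cast; ring)).2 (K b) (hK b hb)
    have h0 : 0 ≤ ∑ b ∈ OS B, |∑ a ∈ Ico 1 (1 + K b), α a * (jacobiSym a b : ℝ)| ^ 4 := by positivity
    calc _ ≤ (B : ℝ) ^ 3 * ∑ b ∈ OS B, |∑ a ∈ Ico 1 (1 + K b), α a * (jacobiSym a b : ℝ)| ^ 4 := by gcongr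
      _ ≤ _ := by gcongr
  have h2 : (∑ m ∈ range M, C m * ∑ b ∈ OS B, (jacobiSym m b : ℝ)) ^ 2 ≤
      (((L : ℝ) + 1) ^ 2 * (N * ((L : ℝ) + 1) ^ 8) ^ 4) * (2 ^ 7 * B * N ^ 4) := by
    refine (sum_mul_sq_le_sq_mul_sq _ _ _).trans ?_
    have f1 : ∑ m ∈ range M, C m ^ 2 ≤ ((L : ℝ) + 1) ^ 2 * (N * ((L : ℝ) + 1) ^ 8) ^ 4 := by
      have g1 := first_factor N M (by rw [add_comm N 1]; exact hM)
      have g2 : ∑ m ∈ range M, C m ^ 2 ≤ ((L : ℝ) + 1) ^ 2 * ∑ m ∈ range M, ((Qd (Ico 1 (N + 1)) m).card : ℝ) ^ 2 := by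
        rw [mul_sum]
        refine sum_le_sum fun m _ => ?_
        rw [← mul_pow, ← sq_abs, add_comm N 1]
        gcongr
        exact hC m
      refine g2.trans ?_
      gcongr
      refine g1.trans ?_
      have : 0 ≤ Real.log N := Real.log_natCast_nonneg N
      have mono : ∀ u v : ℝ, 0 ≤ u → u ≤ v → (N * u ^ 8) ^ 4 ≤ (N * v ^ 8) ^ 4 := by
        intro u v hu huv; gcongr
      have := log_two_pow L
      rw [← hN] at this
      exact mono _ _ (by linarith) (by linarith)
    have f2 : ∑ m ∈ range M, (∑ b ∈ OS B, (jacobiSym m b : ℝ)) ^ 2 ≤ 2 ^ 7 * B * N ^ 4 := by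
      refine (second_factor B M).trans ?_
      have hBN' : (B : ℝ) ≤ N := by exact_mod_cast hBN
      have hN1' : (1 : ℝ) ≤ N := by exact_mod_cast hN1
      rw [hMdef]; push_cast
      have a1 : (1 : ℝ) ≤ N ^ 4 := one_le_pow₀ hN1'
      have a2 : (B : ℝ) ^ 3 ≤ N ^ 4 := by
        calc (B : ℝ) ^ 3 ≤ (N : ℝ) ^ 3 := by gcongr
          _ ≤ (N : ℝ) ^ 4 := pow_le_pow_right₀ hN1' (by norm_num)
      have b0 : (0 : ℝ) ≤ B := by positivity
      have := mul_le_mul_of_nonneg_left a1 b0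
      have := mul_le_mul_of_nonneg_left a2 b0
      nlinarith
    gcongr
  have hS0 : 0 ≤ S := by positivity
  calc S ^ 8 = (S ^ 4) ^ 2 := by ring
    _ ≤ (B ^ 3 * (((L : ℝ) + 1) ^ 3 * ∑ m ∈ range M, C m * ∑ b ∈ OS B, (jacobiSym m b : ℝ))) ^ 2 := by gcongr
    _ = B ^ 6 * ((L : ℝ) + 1) ^ 6 * (∑ m ∈ range M, C m * ∑ b ∈ OS B, (jacobiSym m b : ℝ)) ^ 2 := by ring
    _ ≤ B ^ 6 * ((L : ℝ) + 1) ^ 6 * ((((L : ℝ) + 1) ^ 2 * (N * ((L : ℝ) + 1) ^ 8) ^ 4) * (2 ^ 7 * B * N ^ 4)) := by gcongr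
    _ = 2 ^ 7 * B ^ 7 * (N : ℝ) ^ 8 * ((L : ℝ) + 1) ^ 40 := by ring
    _ = _ := by rw [hN]; push_cast; ring

end AC

namespace AC
open Finset

lemma bil_root {α : ℕ → ℝ} (hα : ∀ a, |α a| ≤ 1) (L B : ℕ) (hB1 : 1 ≤ B) (hBN : B ≤ 2 ^ L) (K : ℕ → ℕ) (hK : ∀ b ∈ OS B, K b ≤ 2 ^ L) :
    ∑ b ∈ OS B, |∑ a ∈ Ico 1 (1 + K b), α a * (jacobiSym a b : ℝ)| ≤
      2 * B * (B : ℝ) ^ (-(1 / 8) : ℝ) * 2 ^ L * ((L : ℝ) + 1) ^ 5 := by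
  have h := bil_core hα L B hBN K hK
  have hB0 : (0 : ℝ) < B := by exact_mod_cast hB1
  set t := (B : ℝ) ^ (-(1 / 8) : ℝ) with ht
  have ht0 : 0 ≤ t := by positivity
  have ht8 : t ^ 8 * B = 1 := by
    rw [ht, ← Real.rpow_natCast, ← Real.rpow_mul hB0.le]
    norm_num
    rw [Real.rpow_neg_one]; exact inv_mul_cancel₀ hB0.ne'
  refine (pow_le_pow_iff_left₀ (by positivity) (by positivity) (n := 8) (by norm_num)).mp (h.trans ?_)
  have e : (2 * B * t * 2 ^ L * ((L : ℝ) + 1) ^ 5) ^ 8 = (t ^ 8 * B) * (2 ^ 8 * (B : ℝ) ^ 7 * (2 ^ L) ^ 8 * ((L : ℝ) + 1) ^ 40) := by ring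
  rw [e, ht8, one_mul]
  gcongr
  · norm_num
  · norm_num

lemma block {α : ℕ → ℝ} (hα : ∀ a, |α a| ≤ 1) (Y B : ℕ) (hB1 : 1 ≤ B) (hBY : B * B ≤ Y) :
    ∑ b ∈ OS B, (if b * b ≤ Y then |∑ a ∈ Ico b (Y / b + 1), α a * (jacobiSym a b : ℝ)| else 0) ≤
      16 * Y * (B : ℝ) ^ (-(1 / 8) : ℝ) * ((Nat.log 2 Y : ℝ) + 3) ^ 5 := by
  set n := Y / B with hn
  have hn1 : B ≤ n := (Nat.le_div_iff_mul_le hB1).mpr hBY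
  set L := Nat.log 2 n + 2 with hL
  have h2L : 2 * n ≤ 2 ^ L := by
    have := Nat.lt_pow_succ_log_self (b := 2) (by norm_num) n
    rw [hL, pow_succ]; rw [Nat.succ_eq_add_one] at this; omega
  have h2L' : 2 ^ L ≤ 4 * n := by
    have := Nat.pow_log_le_self 2 (show n ≠ 0 by omega)
    rw [hL, pow_add]; omega
  have r1 := bil_root hα L B hB1 (by omega) (fun b => if b * b ≤ Y then Y / b else 0) (by
    intro b hb
    simp only [OS, mem_filter, mem_Ico] at hb
    split_ifs
    · have : Y / b ≤ Y / B := Nat.div_le_div_left hb.1.1 hB1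
      omega
    · omega)
  have r2 := bil_root hα L B hB1 (by omega) (fun b => if b * b ≤ Y then b - 1 else 0) (by
    intro b hb
    simp only [OS, mem_filter, mem_Ico] at hb
    split_ifs
    · omega
    · omega)
  have hsum : ∑ b ∈ OS B, (if b * b ≤ Y then |∑ a ∈ Ico b (Y / b + 1), α a * (jacobiSym a b : ℝ)| else 0) ≤
      4 * B * (B : ℝ) ^ (-(1 / 8) : ℝ) * 2 ^ L * ((L : ℝ) + 1) ^ 5 := by
    have : ∑ b ∈ OS B, (if b * b ≤ Y then |∑ a ∈ Ico b (Y / b + 1), α a * (jacobiSym a b : ℝ)| else 0) ≤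
       ∑ b ∈ OS B, (|∑ a ∈ Ico 1 (1 + if b * b ≤ Y then Y / b else 0), α a * (jacobiSym a b : ℝ)| +
         |∑ a ∈ Ico 1 (1 + if b * b ≤ Y then b - 1 else 0), α a * (jacobiSym a b : ℝ)|) := by
      refine sum_le_sum fun b hb => ?_
      simp only [OS, mem_filter, mem_Ico] at hb
      split_ifs with h
      · have hb1 : 1 ≤ b := by omega
        have hbY : b ≤ Y / b := (Nat.le_div_iff_mul_le hb1).mpr h
        have e1 : 1 + (b - 1) = b := by omega
        rw [e1, add_comm 1 (Y / b), ← sum_Ico_consecutive _ hb1 (show b ≤ Y / b + 1 by omega)]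
        set u := ∑ a ∈ Ico 1 b, α a * (jacobiSym a b : ℝ)
        set v := ∑ a ∈ Ico b (Y / b + 1), α a * (jacobiSym a b : ℝ)
        have := abs_sub_abs_le_abs_sub v (-u)
        rw [abs_neg, sub_neg_eq_add, add_comm v u] at this
        linarith
      · positivity
    rw [sum_add_distrib] at this
    linarith
  refine hsum.trans ?_
  have hBn : (B : ℝ) * 2 ^ L ≤ 4 * Y := by
    have h1 : B * 2 ^ L ≤ B * (4 * n) := Nat.mul_le_mul_left _ h2L'
    have h2 : B * n ≤ Y := Nat.mul_div_le Y B
    have h3 : B * 2 ^ L ≤ 4 * Y := by nlinarith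
    exact_mod_cast h3
  have hLY : (L : ℝ) + 1 ≤ (Nat.log 2 Y : ℝ) + 3 := by
    have : Nat.log 2 n ≤ Nat.log 2 Y := Nat.log_mono_right (Nat.div_le_self _ _)
    rw [hL]; push_cast
    have : (Nat.log 2 n : ℝ) ≤ Nat.log 2 Y := by exact_mod_cast this
    linarith
  calc 4 * B * (B : ℝ) ^ (-(1 / 8) : ℝ) * 2 ^ L * ((L : ℝ) + 1) ^ 5 = 4 * (B * 2 ^ L) * (B : ℝ) ^ (-(1 / 8) : ℝ) * ((L : ℝ) + 1) ^ 5 := by ring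
    _ ≤ 4 * (4 * Y) * (B : ℝ) ^ (-(1 / 8) : ℝ) * ((Nat.log 2 Y : ℝ) + 3) ^ 5 := by gcongr
    _ = _ := by ring

/-- bilinear sum bound -/
noncomputable def GB (Y z : ℕ) : ℝ := 32 * Y * (z : ℝ) ^ (-(1 / 8) : ℝ) * ((Nat.log 2 Y : ℝ) + 3) ^ 6

lemma half {α β : ℕ → ℝ} (hα : ∀ a, |α a| ≤ 1) (hβ : ∀ a, |β a| ≤ 1) (hβ0 : ∀ b, ¬ (Odd b ∧ Squarefree b) → β b = 0)
    (Y z : ℕ) (hz : 1 ≤ z) :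
    |∑ b ∈ Ioc z Y, ∑ a ∈ Ioc z Y with b ≤ a ∧ a * b ≤ Y, α a * β b * (jacobiSym a b : ℝ)| ≤ GB Y z := by
  set g : ℕ → ℝ := fun b => if b * b ≤ Y then |∑ a ∈ Ico b (Y / b + 1), α a * (jacobiSym a b : ℝ)| else 0 with hg
  have hg0 : ∀ b, 0 ≤ g b := by intro b; rw [hg]; beta_reduce; split_ifs <;> positivity
  set T : Finset ℕ := {b ∈ Ioc z Y | (Odd b ∧ Squarefree b) ∧ b * b ≤ Y} with hT
  have s1 : |∑ b ∈ Ioc z Y, ∑ a ∈ Ioc z Y with b ≤ a ∧ a * b ≤ Y, α a * β b * (jacobiSym a b : ℝ)| ≤ ∑ b ∈ T, g b := by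
    refine (abs_sum_le_sum_abs _ _).trans ?_
    rw [hT, sum_filter]
    refine sum_le_sum fun b hb => ?_
    have hb' := mem_Ioc.mp hb
    by_cases h1 : Odd b ∧ Squarefree b
    · have e : {a ∈ Ioc z Y | b ≤ a ∧ a * b ≤ Y} = Ico b (Y / b + 1) := by
        ext a
        simp only [mem_filter, mem_Ioc, mem_Ico, Nat.lt_succ_iff, Nat.le_div_iff_mul_le (show 0 < b by omega)]
        constructor
        · rintro ⟨_, h, h'⟩; exact ⟨h, by omega⟩
        · rintro ⟨h, h'⟩
          have h'' : a * b ≤ Y := h'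
          refine ⟨⟨by omega, ?_⟩, h, h''⟩
          exact (Nat.le_mul_of_pos_right a (by omega)).trans h''
      rw [e]
      by_cases h2 : b * b ≤ Y
      · rw [if_pos ⟨h1, h2⟩, hg]
        beta_reduce
        rw [if_pos h2]
        have : ∑ a ∈ Ico b (Y / b + 1), α a * β b * (jacobiSym a b : ℝ) = β b * ∑ a ∈ Ico b (Y / b + 1), α a * (jacobiSym a b : ℝ) := by
          rw [mul_sum]; exact sum_congr rfl fun a _ => by ring
        rw [this, abs_mul]
        exact mul_le_of_le_one_left (abs_nonneg _) (hβ b)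
      · rw [if_neg (fun h => h2 h.2), Ico_eq_empty, sum_empty, abs_zero]
        intro h
        exact h2 ((Nat.le_div_iff_mul_le (show 0 < b by omega)).mp (Nat.lt_succ_iff.mp h))
    · rw [if_neg (fun h => h1 h.1)]
      simp [hβ0 b h1]
  refine s1.trans ?_
  have hmaps : ∀ b ∈ T, Nat.log 2 b ∈ range (Nat.log 2 Y + 1) := by
    intro b hb
    have := (mem_Ioc.mp (mem_filter.mp hb).1).2
    exact mem_range.mpr (Nat.lt_succ_of_le (Nat.log_mono_right this))
  rw [← sum_fiberwise_of_maps_to hmaps]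
  have hblk : ∀ j ∈ range (Nat.log 2 Y + 1), ∑ b ∈ T with Nat.log 2 b = j, g b ≤
      32 * Y * (z : ℝ) ^ (-(1 / 8) : ℝ) * ((Nat.log 2 Y : ℝ) + 3) ^ 5 := by
    intro j _
    rcases (filter (fun b => Nat.log 2 b = j) T).eq_empty_or_nonempty with he | ⟨b0, hb0⟩
    · rw [he, sum_empty]; positivity
    · rw [mem_filter, hT, mem_filter, mem_Ioc] at hb0
      obtain ⟨⟨⟨hz0, hY0⟩, hs, hsq⟩, hl⟩ := hb0
      have hlow : ∀ b, b ≠ 0 → Nat.log 2 b = j → 2 ^ j ≤ b ∧ b < 2 * 2 ^ j := by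
        intro b hb hj
        have h1 := Nat.pow_log_le_self 2 hb
        have h2 := Nat.lt_pow_succ_log_self (b := 2) (by norm_num) b
        rw [hj] at h1 h2
        rw [Nat.succ_eq_add_one, pow_succ] at h2
        exact ⟨h1, by omega⟩
      obtain ⟨l1, l2⟩ := hlow b0 (by omega) hl
      have hsub : ({b ∈ T | Nat.log 2 b = j}) ⊆ OS (2 ^ j) := by
        intro b hb
        rw [mem_filter, hT, mem_filter, mem_Ioc] at hb
        obtain ⟨⟨⟨hz1, hY1⟩, hs1, hsq1⟩, hl1⟩ := hb
        rw [OS, mem_filter, mem_Ico]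
        exact ⟨hlow b (by omega) hl1, hs1⟩
      refine (sum_le_sum_of_subset_of_nonneg hsub fun b _ _ => hg0 b).trans ?_
      refine (block hα Y (2 ^ j) Nat.one_le_two_pow ?_).trans ?_
      · exact (Nat.mul_le_mul l1 l1).trans hsq
      · have hz' : (0 : ℝ) < z := by exact_mod_cast hz
        have h3 : ((2 ^ j : ℕ) : ℝ) ^ (-(1 / 8) : ℝ) ≤ 2 * (z : ℝ) ^ (-(1 / 8) : ℝ) := by
          have h4 : (z : ℝ) / 2 ≤ ((2 ^ j : ℕ) : ℝ) := by
            have : z ≤ 2 * 2 ^ j := by omega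
            have : (z : ℝ) ≤ 2 * ((2 ^ j : ℕ) : ℝ) := by exact_mod_cast this
            linarith
          refine (Real.rpow_le_rpow_of_nonpos (by positivity) h4 (by norm_num)).trans ?_
          rw [Real.div_rpow hz'.le (by norm_num), div_eq_mul_inv, mul_comm]
          gcongr
          rw [← Real.rpow_neg (by norm_num), neg_neg]
          calc (2 : ℝ) ^ (1 / 8 : ℝ) ≤ 2 ^ (1 : ℝ) := Real.rpow_le_rpow_of_exponent_le (by norm_num) (by norm_num)
            _ = 2 := Real.rpow_one 2
        calc _ ≤ 16 * Y * (2 * (z : ℝ) ^ (-(1 / 8) : ℝ)) * ((Nat.log 2 Y : ℝ) + 3) ^ 5 := by gcongr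
          _ = _ := by ring
  refine (sum_le_sum hblk).trans ?_
  rw [sum_const, card_range, nsmul_eq_mul, GB]
  push_cast
  have : 0 ≤ 32 * Y * (z : ℝ) ^ (-(1 / 8) : ℝ) * ((Nat.log 2 Y : ℝ) + 3) ^ 5 := by positivity
  nlinarith

lemma recip {a b : ℕ} (ha : Odd a) (hb : Odd b) :
    2 * (jacobiSym a b : ℝ) = jacobiSym b a * (1 + ZMod.χ₄ a + ZMod.χ₄ b - ZMod.χ₄ a * ZMod.χ₄ b) := by
  have key : 2 * jacobiSym a b = jacobiSym b a * (1 + ZMod.χ₄ a + ZMod.χ₄ b - ZMod.χ₄ a * ZMod.χ₄ b) := by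
    have h4 : ∀ c : ℕ, Odd c → (c % 4 = 1 ∧ ZMod.χ₄ c = 1) ∨ (c % 4 = 3 ∧ ZMod.χ₄ c = -1) := by
      intro c hc
      have : c % 4 = 1 ∨ c % 4 = 3 := by rcases hc with ⟨k, rfl⟩; omega
      rcases this with h | h
      · exact Or.inl ⟨h, ZMod.χ₄_nat_one_mod_four h⟩
      · exact Or.inr ⟨h, ZMod.χ₄_nat_three_mod_four h⟩
    rcases h4 a ha with ⟨h, e⟩ | ⟨h, e⟩ <;> rcases h4 b hb with ⟨h', e'⟩ | ⟨h', e'⟩ <;> rw [e, e']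
    · rw [jacobiSym.quadratic_reciprocity_one_mod_four h hb]; ring
    · rw [jacobiSym.quadratic_reciprocity_one_mod_four h hb]; ring
    · rw [jacobiSym.quadratic_reciprocity_one_mod_four h' ha]; ring
    · rw [jacobiSym.quadratic_reciprocity_three_mod_four h h']; ring
  exact_mod_cast key

/-- Lemma B -/
theorem bilinear {α β : ℕ → ℝ} (hα : ∀ a, |α a| ≤ 1) (hβ : ∀ a, |β a| ≤ 1) (hα0 : ∀ b, ¬ (Odd b ∧ Squarefree b) → α b = 0)
    (hβ0 : ∀ b, ¬ (Odd b ∧ Squarefree b) → β b = 0) (Y z : ℕ) (hz : 1 ≤ z) :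
    |∑ a ∈ Ioc z Y, ∑ b ∈ Ioc z Y with a * b ≤ Y, α a * β b * (jacobiSym a b : ℝ)| ≤ 3 * GB Y z := by
  have hc : ∀ a : ℕ, |((ZMod.χ₄ a : ℤ) : ℝ)| ≤ 1 := by
    intro a
    have h4 : ∀ x : ZMod 4, |ZMod.χ₄ x| ≤ 1 := by decide
    exact_mod_cast h4 a
  set χ : ℕ → ℝ := fun a => ((ZMod.χ₄ a : ℤ) : ℝ) with hχ
  have hp : ∀ u v : ℝ, |u| ≤ 1 → |v| ≤ 1 → |u * v| ≤ 1 := fun u v hu hv => by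
    rw [abs_mul]; exact mul_le_one₀ hu (abs_nonneg _) hv
  let T : (ℕ → ℝ) → (ℕ → ℝ) → ℝ := fun A B => ∑ b ∈ Ioc z Y, ∑ a ∈ Ioc z Y with b ≤ a ∧ a * b ≤ Y, A a * B b * (jacobiSym a b : ℝ)
  have split : ∑ a ∈ Ioc z Y, ∑ b ∈ Ioc z Y with a * b ≤ Y, α a * β b * (jacobiSym a b : ℝ) =
      T α β + (1 / 2) * (T β α + T β (fun a => χ a * α a) + T (fun b => χ b * β b) α - T (fun b => χ b * β b) (fun a => χ a * α a)) := by
    have e1 : ∑ a ∈ Ioc z Y, ∑ b ∈ Ioc z Y with a * b ≤ Y, α a * β b * (jacobiSym a b : ℝ) =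
        T α β + ∑ a ∈ Ioc z Y, ∑ b ∈ Ioc z Y with a ≤ b ∧ b * a ≤ Y, α a * β b * (jacobiSym a b : ℝ) := by
      have e2 : T α β = ∑ a ∈ Ioc z Y, ∑ b ∈ Ioc z Y, if b ≤ a ∧ a * b ≤ Y then α a * β b * (jacobiSym a b : ℝ) else 0 := by
        simp only [T, sum_filter]
        rw [sum_comm]
      rw [e2, ← sum_add_distrib]
      refine sum_congr rfl fun a ha => ?_
      rw [sum_filter, sum_filter, ← sum_add_distrib]
      refine sum_congr rfl fun b hb => ?_
      have ha' := mem_Ioc.mp ha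
      rcases lt_trichotomy a b with h | h | h
      · rw [if_neg (show ¬ (b ≤ a ∧ a * b ≤ Y) by omega), zero_add, mul_comm b a]
        simp only [h.le, true_and]
      · subst h
        have : jacobiSym a a = 0 := by
          have := NeZero.mk (show a ≠ 0 by omega)
          rw [jacobiSym.eq_zero_iff_not_coprime]
          simp; omega
        simp [this]
      · rw [if_neg (show ¬ (a ≤ b ∧ b * a ≤ Y) by omega), add_zero]
        simp only [h.le, true_and]
    rw [e1]
    congr 1
    simp only [T]
    rw [← sum_add_distrib, ← sum_add_distrib, ← sum_sub_distrib, mul_sum]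
    refine sum_congr rfl fun a _ => ?_
    rw [← sum_add_distrib, ← sum_add_distrib, ← sum_sub_distrib, mul_sum]
    refine sum_congr rfl fun b _ => ?_
    by_cases h1 : Odd a ∧ Squarefree a
    · by_cases h2 : Odd b ∧ Squarefree b
      · have := recip h1.1 h2.1
        have h3 : (jacobiSym a b : ℝ) = (1 / 2) * (jacobiSym b a * (1 + χ a + χ b - χ a * χ b)) := by
          rw [hχ]; beta_reduce; linarith
        rw [h3]; ring
      · rw [hβ0 b h2]; ring
    · rw [hα0 a h1]; ring
  rw [split]
  have z1 : ∀ f : ℕ → ℝ, (∀ b, ¬ (Odd b ∧ Squarefree b) → f b = 0) → ∀ b, ¬ (Odd b ∧ Squarefree b) → χ b * f b = 0 := fun f hf b hb => by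
    rw [hf b hb, mul_zero]
  have t1 := half hα hβ hβ0 Y z hz
  have t2 := half hβ hα hα0 Y z hz
  have t3 := half hβ (fun a => hp _ _ (hc a) (hα a)) (z1 α hα0) Y z hz
  have t4 := half (fun a => hp _ _ (hc a) (hβ a)) hα hα0 Y z hz
  have t5 := half (fun a => hp _ _ (hc a) (hβ a)) (fun a => hp _ _ (hc a) (hα a)) (z1 α hα0) Y z hz
  rw [abs_le] at *
  constructor <;> simp only [T] <;> linarith [t1.1, t1.2, t2.1, t2.2, t3.1, t3.2, t4.1, t4.2, t5.1, t5.2]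

end AC

namespace AC
open Finset

/-- Primes up to `Y`. -/
def PL (Y : ℕ) : Finset ℕ := (Ioc 0 Y).filter Nat.Prime

lemma mem_PL {Y p : ℕ} : p ∈ PL Y ↔ p.Prime ∧ p ≤ Y := by
  simp only [PL, mem_filter, mem_Ioc]
  exact ⟨fun h => ⟨h.2, h.1.2⟩, fun h => ⟨⟨h.1.pos, h.2⟩, h.1⟩⟩

lemma theta_PL (Y : ℕ) : ∑ p ∈ PL Y, Real.log p ≤ Real.log 4 * Y := by
  have h := Chebyshev.theta_le_log4_mul_x (x := (Y : ℝ)) (by positivity)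
  rw [Chebyshev.theta, Nat.floor_natCast] at h
  exact h

lemma sum_log_primeFactors_le (n : ℕ) (hn : n ≠ 0) : ∑ p ∈ n.primeFactors, Real.log p ≤ Real.log n := by
  rw [← Real.log_prod (fun p hp => by
    have := (Nat.prime_of_mem_primeFactors hp).pos
    positivity)]
  apply Real.log_le_log
  · exact prod_pos fun p hp => by exact_mod_cast (Nat.prime_of_mem_primeFactors hp).pos
  · rw [← Nat.cast_prod]
    exact_mod_cast Nat.le_of_dvd (Nat.pos_of_ne_zero hn) (Nat.prod_primeFactors_dvd n)

lemma mertens1 (Y : ℕ) (hY : 1 ≤ Y) : ∑ p ∈ PL Y, Real.log p / p ≤ Real.log Y + Real.log 4 := by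
  have hY0 : (0 : ℝ) < Y := by exact_mod_cast hY
  have h1 : ∑ p ∈ PL Y, Real.log p * ((Y / p : ℕ) : ℝ) ≤ Y * Real.log Y := by
    calc ∑ p ∈ PL Y, Real.log p * ((Y / p : ℕ) : ℝ)
        = ∑ p ∈ PL Y, ∑ n ∈ Ioc 0 Y with p ∣ n, Real.log p := by
          refine sum_congr rfl fun p _ => ?_
          rw [sum_const, Nat.Ioc_filter_dvd_card_eq_div, nsmul_eq_mul, mul_comm]
      _ = ∑ n ∈ Ioc 0 Y, ∑ p ∈ n.primeFactors, Real.log p := by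
          apply sum_comm'
          intro p n
          simp only [mem_PL, mem_filter, mem_Ioc, Nat.mem_primeFactors]
          constructor
          · rintro ⟨⟨h1, h2⟩, h3, h4⟩
            exact ⟨⟨h1, h4, by omega⟩, h3⟩
          · rintro ⟨⟨h1, h4, h5⟩, h3⟩
            exact ⟨⟨h1, (Nat.le_of_dvd h3.1 h4).trans h3.2⟩, h3, h4⟩
      _ ≤ ∑ n ∈ Ioc 0 Y, Real.log Y := by
          refine sum_le_sum fun n hn => ?_
          have := mem_Ioc.mp hn
          refine (sum_log_primeFactors_le n (by omega)).trans ?_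
          exact Real.log_le_log (by exact_mod_cast this.1) (by exact_mod_cast this.2)
      _ = Y * Real.log Y := by simp
  have h2 : ∑ p ∈ PL Y, Real.log p * ((Y : ℝ) / p) ≤ ∑ p ∈ PL Y, (Real.log p * ((Y / p : ℕ) : ℝ) + Real.log p) := by
    refine sum_le_sum fun p hp => ?_
    have hp0 := (mem_PL.mp hp).1.pos
    have : (Y : ℝ) / p ≤ ((Y / p : ℕ) : ℝ) + 1 := by
      rw [div_le_iff₀ (by exact_mod_cast hp0)]
      have := Nat.lt_div_mul_add (a := Y) hp0
      have : Y ≤ (Y / p + 1) * p := by rw [add_mul]; omega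
      exact_mod_cast this
    have hl : 0 ≤ Real.log p := Real.log_natCast_nonneg p
    nlinarith
  rw [sum_add_distrib] at h2
  have h3 : Y * ∑ p ∈ PL Y, Real.log p / p = ∑ p ∈ PL Y, Real.log p * ((Y : ℝ) / p) := by
    rw [mul_sum]
    refine sum_congr rfl fun p _ => ?_
    ring
  have h4 := theta_PL Y
  refine le_of_mul_le_mul_left ?_ hY0
  rw [h3]; linarith

/-- squarefree numbers up to Y -/
def SF (Y : ℕ) : Finset ℕ := (Ioc 0 Y).filter Squarefree

lemma mem_SF {Y m : ℕ} : m ∈ SF Y ↔ (0 < m ∧ m ≤ Y) ∧ Squarefree m := by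
  simp only [SF, mem_filter, mem_Ioc]

lemma sum_SF_prod_le (g : ℕ → ℝ) (hg : ∀ p, 0 ≤ g p) (Y : ℕ) :
    ∑ m ∈ SF Y, ∏ p ∈ m.primeFactors, g p ≤ ∏ p ∈ PL Y, (1 + g p) := by
  rw [prod_one_add]
  have hinj : Set.InjOn Nat.primeFactors (SF Y : Set ℕ) := by
    intro a ha b hb hab
    have ha' := (mem_SF.mp ha).2
    have hb' := (mem_SF.mp hb).2
    rw [← Nat.prod_primeFactors_of_squarefree ha', ← Nat.prod_primeFactors_of_squarefree hb', hab]
  rw [← sum_image (s := SF Y) (g := Nat.primeFactors) (f := fun t => ∏ p ∈ t, g p) hinj]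
  apply sum_le_sum_of_subset_of_nonneg
  · intro t ht
    obtain ⟨m, hm, rfl⟩ := mem_image.mp ht
    rw [mem_powerset]
    intro p hp
    have hm' := mem_SF.mp hm
    exact mem_PL.mpr ⟨Nat.prime_of_mem_primeFactors hp, (Nat.le_of_mem_primeFactors hp).trans hm'.1.2⟩
  · intro t _ _
    exact prod_nonneg fun p _ => hg p

lemma hall_tenenbaum (f : ℕ → ℝ) (hf0 : ∀ p, 0 ≤ f p) (hf1 : ∀ p, f p ≤ 1) (Y : ℕ) (hY : 1 ≤ Y) :
    ∑ m ∈ SF Y, ∏ p ∈ m.primeFactors, f p ≤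
      4 * Y / (1 + Real.log Y) * Real.exp (∑ p ∈ PL Y, f p / p) := by
  have hY0 : (0 : ℝ) < Y := by exact_mod_cast hY
  have hl0 : 0 ≤ Real.log Y := Real.log_natCast_nonneg Y
  set F : ℕ → ℝ := fun m => ∏ p ∈ m.primeFactors, f p with hF
  have hF0 : ∀ m, 0 ≤ F m := fun m => prod_nonneg fun p _ => hf0 p
  have hA : ∑ m ∈ SF Y, F m * Real.log m ≤ Real.log 4 * Y * ∑ m ∈ SF Y, F m / m := by
    calc ∑ m ∈ SF Y, F m * Real.log m = ∑ m ∈ SF Y, ∑ p ∈ m.primeFactors, F m * Real.log p := by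
          refine sum_congr rfl fun m hm => ?_
          rw [← mul_sum, ← Real.log_prod (fun p hp => by
            have := (Nat.prime_of_mem_primeFactors hp).pos
            positivity), ← Nat.cast_prod, Nat.prod_primeFactors_of_squarefree (mem_SF.mp hm).2]
      _ ≤ ∑ m ∈ SF Y, ∑ p ∈ m.primeFactors, F (m / p) * Real.log p := by
          refine sum_le_sum fun m hm => sum_le_sum fun p hp => ?_
          have hm' := (mem_SF.mp hm).2
          refine mul_le_mul_of_nonneg_right ?_ (Real.log_natCast_nonneg p)
          have hpm := Nat.dvd_of_mem_primeFactors hp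
          have : (m / p).primeFactors ⊆ m.primeFactors := Nat.primeFactors_mono (Nat.div_dvd_of_dvd hpm) hm'.ne_zero
          exact prod_le_prod_of_subset_of_le_one this (fun q _ => hf0 q) (fun q _ _ => hf1 q)
      _ = ∑ x ∈ (SF Y).sigma (fun m => m.primeFactors), F (x.1 / x.2) * Real.log x.2 := by
          rw [sum_sigma]
      _ ≤ ∑ y ∈ (SF Y).sigma (fun m' => PL (Y / m')), F y.1 * Real.log y.2 := by
          have hinj : Set.InjOn (fun x : (_ : ℕ) × ℕ => (⟨x.1 / x.2, x.2⟩ : (_ : ℕ) × ℕ)) ((SF Y).sigma (fun m => m.primeFactors) : Set _) := by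
            rintro ⟨a, p⟩ ha ⟨b, q⟩ hb hab
            simp only [coe_sigma, Set.mem_sigma_iff, mem_coe] at ha hb
            simp only [Sigma.mk.injEq, heq_eq_eq] at hab
            obtain ⟨h1, rfl⟩ := hab
            have e1 := Nat.div_mul_cancel (Nat.dvd_of_mem_primeFactors ha.2)
            have e2 := Nat.div_mul_cancel (Nat.dvd_of_mem_primeFactors hb.2)
            have : a = b := by rw [← e1, ← e2, h1]
            rw [this]
          rw [← sum_image (g := fun x : (_ : ℕ) × ℕ => (⟨x.1 / x.2, x.2⟩ : (_ : ℕ) × ℕ)) (f := fun y : (_ : ℕ) × ℕ => F y.1 * Real.log y.2) hinj]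
          apply sum_le_sum_of_subset_of_nonneg
          · intro y hy
            obtain ⟨⟨m, p⟩, hx, rfl⟩ := mem_image.mp hy
            simp only [mem_sigma] at hx ⊢
            obtain ⟨hm, hp⟩ := hx
            have hm' := mem_SF.mp hm
            have hpd := Nat.dvd_of_mem_primeFactors hp
            have hpp := Nat.prime_of_mem_primeFactors hp
            have hd := Nat.div_dvd_of_dvd hpd
            have hpos : 0 < m / p := Nat.div_pos (Nat.le_of_dvd hm'.1.1 hpd) hpp.pos
            refine ⟨mem_SF.mpr ⟨⟨hpos, (Nat.div_le_self _ _).trans hm'.1.2⟩, hm'.2.squarefree_of_dvd hd⟩, mem_PL.mpr ⟨hpp, ?_⟩⟩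
            rw [Nat.le_div_iff_mul_le hpos, Nat.mul_div_cancel' hpd]
            exact hm'.1.2
          · intro y _ _
            exact mul_nonneg (hF0 _) (Real.log_natCast_nonneg _)
      _ = ∑ m ∈ SF Y, F m * ∑ p ∈ PL (Y / m), Real.log p := by
          rw [sum_sigma]
          exact sum_congr rfl fun m _ => by rw [mul_sum]
      _ ≤ ∑ m ∈ SF Y, F m * (Real.log 4 * (Y / m)) := by
          refine sum_le_sum fun m _ => mul_le_mul_of_nonneg_left ((theta_PL _).trans ?_) (hF0 m)
          exact mul_le_mul_of_nonneg_left Nat.cast_div_le (Real.log_nonneg (by norm_num))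
      _ = Real.log 4 * Y * ∑ m ∈ SF Y, F m / m := by
          rw [mul_sum]
          exact sum_congr rfl fun m _ => by ring
  have hB : ∑ m ∈ SF Y, F m * (1 + Real.log Y) ≤ ∑ m ∈ SF Y, (F m * Real.log m + Y * (F m / m)) := by
    refine sum_le_sum fun m hm => ?_
    have hm' := mem_SF.mp hm
    have hm0 : (0 : ℝ) < m := by exact_mod_cast hm'.1.1
    have h1 : Real.log Y - Real.log m ≤ Y / m - 1 := by
      rw [← Real.log_div hY0.ne' hm0.ne']
      exact Real.log_le_sub_one_of_pos (by positivity)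
    have : F m * (1 + Real.log Y - Real.log m) ≤ F m * (Y / m) := mul_le_mul_of_nonneg_left (by linarith) (hF0 m)
    have e : F m * (Y / m) = Y * (F m / m) := by ring
    rw [e] at this
    linarith
  rw [sum_add_distrib, ← mul_sum, ← sum_mul] at hB
  have hC : ∑ m ∈ SF Y, F m / m ≤ Real.exp (∑ p ∈ PL Y, f p / p) := by
    calc ∑ m ∈ SF Y, F m / m = ∑ m ∈ SF Y, ∏ p ∈ m.primeFactors, (f p / p) := by
          refine sum_congr rfl fun m hm => ?_
          rw [prod_div_distrib, ← Nat.cast_prod, Nat.prod_primeFactors_of_squarefree (mem_SF.mp hm).2]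
      _ ≤ ∏ p ∈ PL Y, (1 + f p / p) := sum_SF_prod_le _ (fun p => div_nonneg (hf0 p) (by positivity)) Y
      _ ≤ ∏ p ∈ PL Y, Real.exp (f p / p) := by
          refine prod_le_prod (fun p _ => add_nonneg zero_le_one (div_nonneg (hf0 p) (by positivity))) fun p _ => ?_
          rw [add_comm]; exact Real.add_one_le_exp _
      _ = _ := by rw [Real.exp_sum]
  have hl4 : Real.log 4 ≤ 2 := by
    rw [show (4 : ℝ) = 2 ^ 2 by norm_num, Real.log_pow]
    have := Real.log_two_lt_d9
    push_cast; linarith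
  have hS0 : 0 ≤ ∑ m ∈ SF Y, F m / m := sum_nonneg fun m _ => div_nonneg (hF0 m) (by positivity)
  rw [div_mul_eq_mul_div, le_div_iff₀ (by linarith)]
  calc _ ≤ Real.log 4 * Y * ∑ m ∈ SF Y, F m / m + Y * ∑ m ∈ SF Y, F m / m := by linarith
    _ ≤ 4 * Y * ∑ m ∈ SF Y, F m / m := by nlinarith [mul_nonneg hY0.le hS0]
    _ ≤ _ := mul_le_mul_of_nonneg_left hC (by positivity)

end AC

namespace AC
open Finset Filter

lemma zeta_step (δ : ℝ) (hδ : 0 < δ) (k : ℕ) (hk : 1 ≤ k) :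
    ((k : ℝ) + 1) ^ (-(1 + δ)) ≤ ((k : ℝ) ^ (-δ) - ((k : ℝ) + 1) ^ (-δ)) / δ := by
  have hk0 : (0 : ℝ) < k := by exact_mod_cast hk
  have h1 : (0 : ℝ) < (k : ℝ) + 1 := by positivity
  have e : ((k : ℝ) + 1) ^ (-(1 + δ)) = ((k : ℝ) + 1) ^ (-δ) / (k + 1) := by
    rw [neg_add, Real.rpow_add h1, Real.rpow_neg_one]; field_simp
  have h2 : ((k : ℝ) + 1) ^ (-δ) * (1 + δ / (k + 1)) ≤ (k : ℝ) ^ (-δ) := by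
    have e2 : (k : ℝ) ^ (-δ) = ((k : ℝ) + 1) ^ (-δ) * Real.exp (δ * (Real.log (k + 1) - Real.log k)) := by
      rw [Real.rpow_def_of_pos hk0, Real.rpow_def_of_pos h1, ← Real.exp_add]
      congr 1; ring
    rw [e2]
    refine mul_le_mul_of_nonneg_left ?_ (by positivity)
    have h3 : 1 / ((k : ℝ) + 1) ≤ Real.log (k + 1) - Real.log k := by
      have := Real.log_le_sub_one_of_pos (show (0 : ℝ) < k / (k + 1) by positivity)
      rw [Real.log_div hk0.ne' h1.ne'] at this
      have e3 : (k : ℝ) / (k + 1) - 1 = - (1 / (k + 1)) := by field_simp; ring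
      linarith
    have h4 := Real.add_one_le_exp (δ * (Real.log (k + 1) - Real.log k))
    have h5 : δ / (k + 1) ≤ δ * (Real.log (k + 1) - Real.log k) := by
      rw [div_eq_mul_one_div]; exact mul_le_mul_of_nonneg_left h3 hδ.le
    linarith
  rw [e, le_div_iff₀ hδ]
  have : ((k : ℝ) + 1) ^ (-δ) / (k + 1) * δ = ((k : ℝ) + 1) ^ (-δ) * (δ / (k + 1)) := by ring
  rw [this]; linarith

lemma zeta_partial (δ : ℝ) (hδ : 0 < δ) (N : ℕ) :
    ∑ k ∈ range (N + 1), ((k : ℝ) + 1) ^ (-(1 + δ)) ≤ 1 + (1 - ((N : ℝ) + 1) ^ (-δ)) / δ := by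
  induction N with
  | zero => simp
  | succ N ih =>
    rw [sum_range_succ]
    have := zeta_step δ hδ (N + 1) (by omega)
    push_cast at this ⊢
    have e : (1 - ((N : ℝ) + 1 + 1) ^ (-δ)) / δ = (1 - ((N : ℝ) + 1) ^ (-δ)) / δ + (((N : ℝ) + 1) ^ (-δ) - ((N : ℝ) + 1 + 1) ^ (-δ)) / δ := by ring
    rw [e]; linarith

lemma zeta_range (δ : ℝ) (hδ : 0 < δ) (N : ℕ) :
    ∑ n ∈ range N, (n : ℝ) ^ (-(1 + δ)) ≤ 1 + 1 / δ := by
  have hm : ∀ n : ℕ, (0 : ℝ) ≤ (n : ℝ) ^ (-(1 + δ)) := fun n => by positivity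
  calc ∑ n ∈ range N, (n : ℝ) ^ (-(1 + δ)) ≤ ∑ n ∈ range (N + 1 + 1), (n : ℝ) ^ (-(1 + δ)) :=
        sum_le_sum_of_subset_of_nonneg (range_mono (by omega)) fun n _ _ => hm n
    _ = ∑ k ∈ range (N + 1), ((k : ℝ) + 1) ^ (-(1 + δ)) := by
        rw [sum_range_succ']
        simp only [Nat.cast_zero]
        rw [Real.zero_rpow (by linarith), add_zero]
        push_cast; rfl
    _ ≤ 1 + (1 - ((N : ℝ) + 1) ^ (-δ)) / δ := zeta_partial δ hδ N
    _ ≤ 1 + 1 / δ := by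
        have : 0 ≤ ((N : ℝ) + 1) ^ (-δ) := by positivity
        gcongr; linarith

lemma abel_nonneg (h a : ℕ → ℝ) (ha : Antitone a) (ha0 : ∀ n, 0 ≤ a n)
    (hH : ∀ N, 0 ≤ ∑ n ∈ range N, h n) (N : ℕ) : 0 ≤ ∑ n ∈ range N, h n * a n := by
  have key : ∀ N, a N * ∑ n ∈ range (N + 1), h n ≤ ∑ n ∈ range (N + 1), h n * a n := by
    intro N
    induction N with
    | zero => simp [mul_comm]
    | succ N ih =>
      rw [sum_range_succ, sum_range_succ (fun n => h n * a n)]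
      have := mul_le_mul_of_nonneg_right (ha (Nat.le_succ N)) (hH (N + 1))
      simp only [Nat.succ_eq_add_one] at this
      linarith
  cases N with
  | zero => simp
  | succ N => exact (mul_nonneg (ha0 N) (hH _)).trans (key N)

lemma psi_zero (i j E : ℕ) (hE : E ≠ 0) (hs : ¬ IsSquare E) : psi i j E 0 = 0 := by
  have : E ≠ 1 := fun h => hs (h ▸ ⟨1, rfl⟩)
  have h1 : jacobiSym ((0 : ℕ) : ℤ) E = 0 := by
    push_cast
    exact jacobiSym.zero_left (by omega)
  rw [psi, h1, mul_zero]

lemma L_partial (i j E : ℕ) (hE : Odd E) (hs : ¬ IsSquare E) (δ : ℝ) (hδ : 0 < δ) (N : ℕ) :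
    ∑ n ∈ range N, (psi i j E n : ℝ) * (n : ℝ) ^ (-(1 + δ)) ≤ 1 + Real.log (8 * E) := by
  have hE0 : E ≠ 0 := by rintro rfl; simp at hE
  have hp0 := psi_zero i j E hE0 hs
  have hlog : 0 ≤ Real.log ((8 * E : ℕ) : ℝ) := Real.log_natCast_nonneg _
  have hlog' : 0 ≤ Real.log (8 * (E : ℝ)) := by push_cast at hlog; exact hlog
  cases N with
  | zero => simp; linarith
  | succ N =>
    rw [sum_range_succ', hp0]
    simp only [Int.cast_zero, zero_mul, add_zero]
    set a : ℕ → ℝ := fun n => ((n : ℝ) + 1) ^ (-(1 + δ)) with ha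
    have ha0 : ∀ n, 0 ≤ a n := fun n => by simp only [ha]; positivity
    have haA : Antitone a := by
      intro m n hmn
      simp only [ha]
      refine Real.rpow_le_rpow_of_nonpos (by positivity) ?_ (by linarith)
      have : (m : ℝ) ≤ n := by exact_mod_cast hmn
      linarith
    have ha1 : ∀ n : ℕ, a n ≤ 1 / ((n + 1 : ℕ) : ℝ) := by
      intro n
      simp only [ha]
      rw [one_div, ← Real.rpow_neg_one]
      push_cast
      exact Real.rpow_le_rpow_of_exponent_le (by linarith [Nat.cast_nonneg (α := ℝ) n]) (by linarith)
    have hH : ∀ M, 0 ≤ ∑ n ∈ range M, ((if n < 8 * E then (1 : ℝ) else 0) - psi i j E (n + 1)) := by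
      intro M
      rw [sum_sub_distrib, sub_nonneg]
      have h1 : ∑ n ∈ range M, (psi i j E (n + 1) : ℝ) ≤ 8 * E := by
        have := psi_sum hE hs i j (M + 1)
        rw [sum_range_succ', hp0, add_zero] at this
        exact_mod_cast (abs_le.mp this).2
      have h2 : ∑ n ∈ range M, (psi i j E (n + 1) : ℝ) ≤ M := by
        calc _ ≤ ∑ n ∈ range M, (1 : ℝ) := sum_le_sum fun n _ => by
              exact_mod_cast (abs_le.mp (psi_abs i j E (n + 1))).2
          _ = M := by simp
      rw [← sum_filter]
      have h3 : (range M).filter (· < 8 * E) = range (min M (8 * E)) := by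
        ext n; simp
      rw [h3]; simp only [sum_const, card_range, nsmul_eq_mul, mul_one]
      rw [Nat.cast_min]
      exact le_min h2 (by push_cast; exact h1)
    have := abel_nonneg _ a haA ha0 hH N
    simp only [sub_mul, sum_sub_distrib, sub_nonneg] at this
    have e : ∀ n : ℕ, (psi i j E (n + 1) : ℝ) * ((n + 1 : ℕ) : ℝ) ^ (-(1 + δ)) = psi i j E (n + 1) * a n := by
      intro n; simp only [ha]; push_cast; rfl
    simp only [e]
    refine this.trans ?_
    calc ∑ n ∈ range N, (if n < 8 * E then (1 : ℝ) else 0) * a n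
        = ∑ n ∈ (range N).filter (· < 8 * E), a n := by
          rw [sum_filter]; exact sum_congr rfl fun n _ => by split_ifs <;> simp
      _ ≤ ∑ n ∈ range (8 * E), a n := by
          apply sum_le_sum_of_subset_of_nonneg
          · intro n; simp
          · intro n _ _; exact ha0 n
      _ ≤ ∑ n ∈ range (8 * E), 1 / ((n + 1 : ℕ) : ℝ) := sum_le_sum fun n _ => ha1 n
      _ = ∑ a ∈ Ico 1 (8 * E + 1), (1 : ℝ) / a := by
          rw [sum_Ico_eq_sum_range]
          simp [add_comm]
      _ ≤ 1 + Real.log ((8 * E : ℕ) : ℝ) := harm_le _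
      _ = _ := by push_cast; rfl

end AC

namespace AC
open Finset Filter Topology

/-- `n ↦ s(n) n^{-(1+δ)}` as a completely multiplicative function -/
noncomputable def nrp (δ : ℝ) (hδ : 0 < δ) : ℕ →*₀ ℝ where
  toFun n := (n : ℝ) ^ (-(1 + δ))
  map_zero' := by simp only [Nat.cast_zero]; exact Real.zero_rpow (by linarith)
  map_one' := by simp
  map_mul' a b := by push_cast; exact Real.mul_rpow (by positivity) (by positivity)

noncomputable def psR (i j E : ℕ) (hE : E ≠ 0) (hs : ¬ IsSquare E) : ℕ →*₀ ℝ where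
  toFun n := (psi i j E n : ℝ)
  map_zero' := by rw [psi_zero i j E hE hs]; simp
  map_one' := by rw [psi_one]; simp
  map_mul' a b := by rw [psi_mul]; push_cast; rfl

noncomputable def lrp (δ : ℝ) (hδ : 0 < δ) (i j E : ℕ) (hE : E ≠ 0) (hs : ¬ IsSquare E) : ℕ →*₀ ℝ where
  toFun n := (psi i j E n : ℝ) * (n : ℝ) ^ (-(1 + δ))
  map_zero' := by rw [psi_zero i j E hE hs]; simp
  map_one' := by rw [psi_one]; simp
  map_mul' a b := by
    rw [psi_mul]; push_cast
    rw [Real.mul_rpow (by positivity) (by positivity)]; ring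

lemma nrp_apply (δ : ℝ) (hδ : 0 < δ) (n : ℕ) : nrp δ hδ n = (n : ℝ) ^ (-(1 + δ)) := rfl
lemma lrp_apply (δ : ℝ) (hδ : 0 < δ) (i j E : ℕ) (hE : E ≠ 0) (hs : ¬ IsSquare E) (n : ℕ) :
    lrp δ hδ i j E hE hs n = (psi i j E n : ℝ) * (n : ℝ) ^ (-(1 + δ)) := rfl

lemma summ_nrp (δ : ℝ) (hδ : 0 < δ) : Summable (fun n : ℕ => (n : ℝ) ^ (-(1 + δ))) :=
  Real.summable_nat_rpow.mpr (by linarith)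

lemma psi_abs_real (i j E n : ℕ) : |(psi i j E n : ℝ)| ≤ 1 := by exact_mod_cast psi_abs i j E n

lemma summ_lrp (δ : ℝ) (hδ : 0 < δ) (i j E : ℕ) : Summable (fun n : ℕ => ‖(psi i j E n : ℝ) * (n : ℝ) ^ (-(1 + δ))‖) := by
  refine Summable.of_nonneg_of_le (fun n => norm_nonneg _) (fun n => ?_) (summ_nrp δ hδ)
  rw [norm_mul, Real.norm_eq_abs, Real.norm_of_nonneg (by positivity : (0 : ℝ) ≤ (n : ℝ) ^ (-(1 + δ)))]
  exact mul_le_of_le_one_left (by positivity) (psi_abs_real i j E n)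

lemma exp_le_inv (u : ℝ) (hu : u < 1) : Real.exp u ≤ (1 - u)⁻¹ := by
  have h := Real.add_one_le_exp (-u)
  rw [Real.exp_neg] at h
  rw [← inv_inv (Real.exp u)]
  exact inv_anti₀ (by linarith) (by linarith)

lemma prime_rpow_lt (δ : ℝ) (hδ : 0 < δ) {p : ℕ} (hp : p.Prime) : (p : ℝ) ^ (-(1 + δ)) < 1 := by
  apply Real.rpow_lt_one_of_one_lt_of_neg
  · exact_mod_cast hp.one_lt
  · linarith

lemma prod_primes_ge (Y : ℕ) (g w : ℕ → ℝ) (hg : ∀ p, p.Prime → 0 ≤ g p) (hw : ∀ p, p.Prime → Real.exp (g p) ≤ w p)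
    (n : ℕ) (hn : Y < n) : Real.exp (∑ p ∈ PL Y, g p) ≤ ∏ p ∈ Nat.primesBelow n, w p := by
  rw [Real.exp_sum]
  have hsub : PL Y ⊆ Nat.primesBelow n := by
    intro p hp
    have := mem_PL.mp hp
    exact Nat.mem_primesBelow.mpr ⟨by omega, this.1⟩
  calc ∏ p ∈ PL Y, Real.exp (g p) ≤ ∏ p ∈ Nat.primesBelow n, Real.exp (g p) := by
        refine prod_le_prod_of_subset_of_one_le hsub (fun p _ => (Real.exp_pos _).le) fun p hp _ => ?_
        exact Real.one_le_exp (hg p (Nat.mem_primesBelow.mp hp).2)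
    _ ≤ _ := prod_le_prod (fun p _ => (Real.exp_pos _).le) fun p hp => hw p (Nat.mem_primesBelow.mp hp).2

lemma zeta_tsum (δ : ℝ) (hδ : 0 < δ) : ∑' n : ℕ, (n : ℝ) ^ (-(1 + δ)) ≤ 1 + 1 / δ :=
  (summ_nrp δ hδ).tsum_le_of_sum_range_le (zeta_range δ hδ)

lemma exp1 (δ : ℝ) (hδ : 0 < δ) (Y : ℕ) : Real.exp (∑ p ∈ PL Y, (p : ℝ) ^ (-(1 + δ))) ≤ 1 + 1 / δ := by
  have hs : Summable (fun n => ‖nrp δ hδ n‖) := (summ_nrp δ hδ).norm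
  have T := EulerProduct.eulerProduct_completely_multiplicative hs
  refine le_trans (ge_of_tendsto T ?_) (zeta_tsum δ hδ)
  filter_upwards [eventually_gt_atTop Y] with n hn
  exact prod_primes_ge Y (fun p => (p : ℝ) ^ (-(1 + δ))) _ (fun p _ => by positivity) (fun p hp => exp_le_inv _ (prime_rpow_lt δ hδ hp)) n hn

lemma exp2 (δ : ℝ) (hδ : 0 < δ) (i j E : ℕ) (hE : Odd E) (hsq : ¬ IsSquare E) (Y : ℕ) :
    Real.exp (∑ p ∈ PL Y, (1 + psi i j E p) * (p : ℝ) ^ (-(1 + δ))) ≤ (1 + 1 / δ) * (1 + Real.log (8 * E)) := by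
  have hE0 : E ≠ 0 := by rintro rfl; simp at hE
  have hs : Summable (fun n => ‖nrp δ hδ n‖) := (summ_nrp δ hδ).norm
  have T := EulerProduct.eulerProduct_completely_multiplicative hs
  have hs2 : Summable (fun n => ‖lrp δ hδ i j E hE0 hsq n‖) := summ_lrp δ hδ i j E
  have T2 := EulerProduct.eulerProduct_completely_multiplicative hs2
  have T3 := T.mul T2
  have hL : ∑' n, lrp δ hδ i j E hE0 hsq n ≤ 1 + Real.log (8 * E) := by
    refine le_of_tendsto' hs2.of_norm.hasSum.tendsto_sum_nat fun N => ?_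
    exact L_partial i j E hE hsq δ hδ N
  have hZ0 : 0 ≤ ∑' n, nrp δ hδ n := tsum_nonneg fun n => by rw [nrp_apply]; positivity
  have hE1 : (1 : ℝ) ≤ E := by exact_mod_cast Nat.pos_of_ne_zero hE0
  have hl : 0 ≤ Real.log (8 * E) := Real.log_nonneg (by linarith)
  refine le_trans (ge_of_tendsto T3 ?_) ((mul_le_mul_of_nonneg_left hL hZ0).trans (mul_le_mul_of_nonneg_right (zeta_tsum δ hδ) (by linarith)))
  filter_upwards [eventually_gt_atTop Y] with n hn
  rw [← prod_mul_distrib]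
  refine prod_primes_ge Y _ _ (fun p _ => ?_) (fun p hp => ?_) n hn
  · have := (abs_le.mp (psi_abs_real i j E p)).1
    exact mul_nonneg (by linarith) (by positivity)
  · rw [nrp_apply, lrp_apply, add_mul, one_mul, Real.exp_add]
    have h1 := prime_rpow_lt δ hδ hp
    have h0 : 0 ≤ (p : ℝ) ^ (-(1 + δ)) := by positivity
    have := (abs_le.mp (psi_abs_real i j E p)).2
    have h2 : psi i j E p * (p : ℝ) ^ (-(1 + δ)) < 1 := by nlinarith
    exact mul_le_mul (exp_le_inv _ h1) (exp_le_inv _ h2) (Real.exp_pos _).le (inv_nonneg.mpr (by linarith))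

lemma shift_bound (Y : ℕ) (hY : 1 ≤ Y) (g : ℕ → ℝ) (hg0 : ∀ p, 0 ≤ g p) (c : ℝ) (hc : 0 ≤ c) (hg : ∀ p, g p ≤ c) :
    ∑ p ∈ PL Y, g p / p ≤ ∑ p ∈ PL Y, g p * (p : ℝ) ^ (-(1 + 1 / (1 + Real.log Y))) + 2 * c := by
  set l := 1 + Real.log Y with hl
  have hlog : 0 ≤ Real.log Y := Real.log_natCast_nonneg Y
  have hl0 : 0 < l := by linarith
  have h1 : ∀ p ∈ PL Y, g p / p ≤ g p * (p : ℝ) ^ (-(1 + 1 / l)) + c / l * (Real.log p / p) := by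
    intro p hp
    have hp0 : (0 : ℝ) < p := by exact_mod_cast (mem_PL.mp hp).1.pos
    have hlp : 0 ≤ Real.log p := Real.log_natCast_nonneg p
    have e : (p : ℝ) ^ (-(1 + 1 / l)) = Real.exp (-(Real.log p / l)) / p := by
      rw [neg_add, Real.rpow_add hp0, Real.rpow_neg_one, Real.rpow_def_of_pos hp0]
      rw [show Real.log p * -(1 / l) = -(Real.log p / l) by ring]
      field_simp
    rw [e]
    have h2 := Real.add_one_le_exp (-(Real.log p / l))
    have h3 : g p ≤ g p * Real.exp (-(Real.log p / l)) + c * (Real.log p / l) := by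
      have : 0 ≤ Real.log p / l := by positivity
      nlinarith [hg0 p, hg p]
    calc g p / p ≤ (g p * Real.exp (-(Real.log p / l)) + c * (Real.log p / l)) / p := by gcongr
      _ = _ := by ring
  refine (sum_le_sum h1).trans ?_
  rw [sum_add_distrib, ← mul_sum]
  have hm := mertens1 Y hY
  have hl4 : Real.log 4 ≤ 2 := by
    rw [show (4 : ℝ) = 2 ^ 2 by norm_num, Real.log_pow]
    have := Real.log_two_lt_d9
    push_cast; linarith
  have : c / l * ∑ p ∈ PL Y, Real.log p / p ≤ c / l * (2 * l) := by
    refine mul_le_mul_of_nonneg_left ?_ (by positivity)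
    linarith
  have e : c / l * (2 * l) = 2 * c := by field_simp
  linarith

lemma prime_sum1 (Y : ℕ) (hY : 1 ≤ Y) : ∑ p ∈ PL Y, (1 : ℝ) / p ≤ Real.log (1 + Real.log Y) + 3 := by
  have h := shift_bound Y hY (fun _ => 1) (by simp) 1 (by simp) (by simp)
  have hlog : 0 ≤ Real.log Y := Real.log_natCast_nonneg Y
  have h2 := exp1 (1 / (1 + Real.log Y)) (by positivity) Y
  rw [← Real.le_log_iff_exp_le (by positivity)] at h2
  simp only [one_mul, one_div_one_div] at h h2
  have h3 : Real.log (1 + (1 + Real.log Y)) ≤ Real.log (2 * (1 + Real.log Y)) := Real.log_le_log (by positivity) (by linarith)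
  rw [Real.log_mul (by norm_num) (by positivity)] at h3
  have := Real.log_two_lt_d9
  linarith

lemma prime_sum2 (i j E : ℕ) (hE : Odd E) (hsq : ¬ IsSquare E) (Y : ℕ) (hY : 1 ≤ Y) :
    ∑ p ∈ PL Y, (1 + psi i j E p : ℝ) / p ≤ Real.log (1 + Real.log Y) + Real.log (1 + Real.log (8 * E)) + 5 := by
  have hlog : 0 ≤ Real.log Y := Real.log_natCast_nonneg Y
  have h := shift_bound Y hY (fun p => 1 + psi i j E p) (fun p => by linarith [(abs_le.mp (psi_abs_real i j E p)).1]) 2 (by simp)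
    (fun p => by linarith [(abs_le.mp (psi_abs_real i j E p)).2])
  have h2 := exp2 (1 / (1 + Real.log Y)) (by positivity) i j E hE hsq Y
  have hE0 : E ≠ 0 := by rintro rfl; simp at hE
  have hE1 : (1 : ℝ) ≤ E := by exact_mod_cast Nat.pos_of_ne_zero hE0
  have hl : 0 ≤ Real.log (8 * E) := Real.log_nonneg (by linarith)
  rw [← Real.le_log_iff_exp_le (by positivity)] at h2
  rw [one_div_one_div, Real.log_mul (by positivity) (by positivity)] at h2
  have h3 : Real.log (1 + (1 + Real.log Y)) ≤ Real.log (2 * (1 + Real.log Y)) := Real.log_le_log (by positivity) (by linarith)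
  rw [Real.log_mul (by norm_num) (by positivity)] at h3
  have := Real.log_two_lt_d9
  linarith

lemma HT_conc (f : ℕ → ℝ) (hf0 : ∀ p, 0 ≤ f p) (hf1 : ∀ p, f p ≤ 1) (Y : ℕ) (hY : 1 ≤ Y) (η A : ℝ)
    (h : ∑ p ∈ PL Y, f p / p ≤ (1 - η) * Real.log (1 + Real.log Y) + A) :
    ∑ m ∈ SF Y, ∏ p ∈ m.primeFactors, f p ≤ 4 * Real.exp A * Y * (1 + Real.log Y) ^ (-η) := by
  have hlog : 0 ≤ Real.log Y := Real.log_natCast_nonneg Y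
  have hl : 0 < 1 + Real.log Y := by linarith
  refine (hall_tenenbaum f hf0 hf1 Y hY).trans ?_
  calc 4 * Y / (1 + Real.log Y) * Real.exp (∑ p ∈ PL Y, f p / p)
      ≤ 4 * Y / (1 + Real.log Y) * Real.exp ((1 - η) * Real.log (1 + Real.log Y) + A) := by gcongr
    _ = _ := by
      rw [Real.exp_add, mul_comm (1 - η), ← Real.rpow_def_of_pos hl, sub_eq_add_neg, Real.rpow_add hl, Real.rpow_one]
      field_simp

lemma HT1 (f : ℕ → ℝ) (hf0 : ∀ p, 0 ≤ f p) (Y : ℕ) (hY : 1 ≤ Y) (η : ℝ) (hη0 : 0 ≤ η) (hη : η ≤ 1)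
    (h : ∀ p, f p ≤ 1 - η) :
    ∑ m ∈ SF Y, ∏ p ∈ m.primeFactors, f p ≤ 4 * Real.exp 8 * Y * (1 + Real.log Y) ^ (-η) := by
  refine HT_conc f hf0 (fun p => by linarith [h p]) Y hY η 8 ?_
  have := prime_sum1 Y hY
  calc ∑ p ∈ PL Y, f p / p ≤ ∑ p ∈ PL Y, (1 - η) * (1 / p) := by
        refine sum_le_sum fun p _ => ?_
        rw [mul_one_div]
        exact div_le_div_of_nonneg_right (h p) (by positivity)
    _ = (1 - η) * ∑ p ∈ PL Y, (1 : ℝ) / p := by rw [mul_sum]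
    _ ≤ (1 - η) * (Real.log (1 + Real.log Y) + 3) := mul_le_mul_of_nonneg_left this (by linarith)
    _ ≤ _ := by linarith

lemma HT2 (f : ℕ → ℝ) (hf0 : ∀ p, 0 ≤ f p) (hf1 : ∀ p, f p ≤ 1) (Y : ℕ) (hY : 1 ≤ Y) (η : ℝ) (hη0 : 0 ≤ η) (hη : η ≤ 1 / 2)
    (i j E : ℕ) (hE : Odd E) (hsq : ¬ IsSquare E)
    (h : ∀ p, f p ≤ 1 - η + η * psi i j E p) :
    ∑ m ∈ SF Y, ∏ p ∈ m.primeFactors, f p ≤ 4 * Real.exp 8 * Y * (1 + Real.log Y) ^ (-η) * (1 + Real.log (8 * E)) := by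
  have hE0 : E ≠ 0 := by rintro rfl; simp at hE
  have hE1 : (1 : ℝ) ≤ E := by exact_mod_cast Nat.pos_of_ne_zero hE0
  have hl : 0 ≤ Real.log (8 * E) := Real.log_nonneg (by linarith)
  have hl2 : 0 ≤ Real.log (1 + Real.log (8 * E)) := Real.log_nonneg (by linarith)
  refine (HT_conc f hf0 hf1 Y hY η (8 + Real.log (1 + Real.log (8 * E))) ?_).trans (le_of_eq ?_)
  · have h1 := prime_sum1 Y hY
    have h2 := prime_sum2 i j E hE hsq Y hY
    calc ∑ p ∈ PL Y, f p / p ≤ ∑ p ∈ PL Y, ((1 - 2 * η) * (1 / p) + η * ((1 + psi i j E p) / p)) := by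
          refine sum_le_sum fun p _ => ?_
          have := div_le_div_of_nonneg_right (h p) (Nat.cast_nonneg (α := ℝ) p)
          refine this.trans (le_of_eq ?_)
          ring
      _ = (1 - 2 * η) * ∑ p ∈ PL Y, (1 : ℝ) / p + η * ∑ p ∈ PL Y, (1 + psi i j E p : ℝ) / p := by
          rw [sum_add_distrib, mul_sum, mul_sum]
      _ ≤ (1 - 2 * η) * (Real.log (1 + Real.log Y) + 3) + η * (Real.log (1 + Real.log Y) + Real.log (1 + Real.log (8 * E)) + 5) :=
          add_le_add (mul_le_mul_of_nonneg_left h1 (by linarith)) (mul_le_mul_of_nonneg_left h2 hη0)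
      _ ≤ _ := by nlinarith
  · rw [Real.exp_add, Real.exp_log (by linarith)]; ring

end AC

namespace AC
open Finset

section
variable {V : Type} [Fintype V] [DecidableEq V]

/-- tuples of positive integers up to `X` that are trivial on `U` -/
def RB (U : Finset V) (X : ℕ) : Finset (V → ℕ) :=
  Fintype.piFinset (fun x => if x ∈ U then {1} else Ioc 0 X)

lemma mem_RB {U : Finset V} {X : ℕ} (hX : 1 ≤ X) {r : V → ℕ} :
    r ∈ RB U X ↔ (∀ x, 0 < r x ∧ r x ≤ X) ∧ ∀ x ∈ U, r x = 1 := by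
  rw [RB, Fintype.mem_piFinset]
  constructor
  · intro h
    refine ⟨fun x => ?_, fun x hx => ?_⟩
    · have := h x
      split_ifs at this with hx
      · rw [mem_singleton.mp this]; omega
      · exact mem_Ioc.mp this
    · have := h x
      rw [if_pos hx] at this
      exact mem_singleton.mp this
  · rintro ⟨h1, h2⟩ x
    split_ifs with hx
    · exact mem_singleton.mpr (h2 x hx)
    · exact mem_Ioc.mpr (h1 x)

lemma RB_fubini (U : Finset V) {X : ℕ} (hX : 1 ≤ X) (F : (V → ℕ) → ℝ) :
    ∑ D ∈ RB (∅ : Finset V) X, F D = ∑ r ∈ RB U X, ∑ d ∈ RB Uᶜ X, F (r * d) := by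
  rw [← sum_product']
  refine sum_bij' (fun D _ => (fun x => if x ∈ U then 1 else D x, fun x => if x ∈ U then D x else 1))
    (fun rd _ => rd.1 * rd.2) ?_ ?_ ?_ ?_ ?_
  · intro D hD
    rw [mem_RB hX] at hD
    simp only [mem_product, mem_RB hX, mem_compl]
    refine ⟨⟨fun x => ?_, fun x hx => by simp [hx]⟩, ⟨fun x => ?_, fun x hx => by simp [hx]⟩⟩
    · split_ifs
      · omega
      · exact hD.1 x
    · split_ifs
      · exact hD.1 x
      · omega
  · rintro ⟨r, d⟩ h
    simp only [mem_product, mem_RB hX, mem_compl] at h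
    rw [mem_RB hX]
    refine ⟨fun x => ?_, by simp⟩
    simp only [Pi.mul_apply]
    by_cases hx : x ∈ U
    · rw [h.1.2 x hx, one_mul]; exact h.2.1 x
    · rw [h.2.2 x hx, mul_one]; exact h.1.1 x
  · intro D _
    ext x
    simp only [Pi.mul_apply]
    split_ifs <;> simp
  · rintro ⟨r, d⟩ h
    simp only [mem_product, mem_RB hX, mem_compl] at h
    ext x
    · simp only [Pi.mul_apply]
      split_ifs with hx
      · exact (h.1.2 x hx).symm
      · rw [h.2.2 x hx, mul_one]
    · simp only [Pi.mul_apply]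
      split_ifs with hx
      · rw [h.1.2 x hx, one_mul]
      · exact (h.2.2 x hx).symm
  · intro D _
    congr 1
    ext x
    simp only [Pi.mul_apply]
    split_ifs <;> simp

lemma RB_sum_inv (U : Finset V) (z : ℕ) :
    ∑ r ∈ RB U z, (1 : ℝ) / ((∏ x, r x : ℕ) : ℝ) ≤ (1 + Real.log z) ^ Fintype.card V := by
  have hz : 0 ≤ Real.log z := Real.log_natCast_nonneg z
  have e : ∑ r ∈ RB U z, (1 : ℝ) / ((∏ x, r x : ℕ) : ℝ) = ∏ x : V, ∑ a ∈ (if x ∈ U then {1} else Ioc 0 z), (1 : ℝ) / (a : ℝ) := by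
    rw [prod_univ_sum]
    refine sum_congr rfl fun r _ => ?_
    push_cast
    rw [prod_div_distrib]; simp
  rw [e, ← card_univ, ← prod_const]
  refine prod_le_prod (fun x _ => sum_nonneg fun a _ => by positivity) fun x _ => ?_
  split_ifs with hx
  · simp [hz]
  · have : Ioc 0 z = Ico 1 (z + 1) := by ext; simp; omega
    rw [this]; exact harm_le z

/-- the tuple attached to a colouring of the prime factors -/
def DM (m : ℕ) (f : m.primeFactors → V) (x : V) : ℕ := ∏ p : m.primeFactors with f p = x, (p : ℕ)

lemma pf_prime {m : ℕ} (p : m.primeFactors) : (p : ℕ).Prime := Nat.prime_of_mem_primeFactors p.2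

lemma DM_prod {m : ℕ} (hm : Squarefree m) (f : m.primeFactors → V) : ∏ x, DM m f x = m := by
  unfold DM
  rw [prod_fiberwise, prod_coe_sort (s := m.primeFactors) (f := fun p => p)]
  exact Nat.prod_primeFactors_of_squarefree hm

lemma DM_pos {m : ℕ} (f : m.primeFactors → V) (x : V) : 0 < DM m f x :=
  prod_pos fun p _ => (pf_prime p).pos

lemma dvd_DM {m : ℕ} (f : m.primeFactors → V) (x : V) (p : m.primeFactors) : (p : ℕ) ∣ DM m f x ↔ f p = x := by
  unfold DM
  rw [Prime.dvd_finsetProd_iff (pf_prime p).prime]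
  constructor
  · rintro ⟨q, hq, hpq⟩
    have := (Nat.prime_dvd_prime_iff_eq (pf_prime p) (pf_prime q)).mp hpq
    rw [Subtype.ext this]
    exact (mem_filter.mp hq).2
  · intro h
    exact ⟨p, by simp [h], dvd_rfl⟩

lemma sum_DM {m X : ℕ} (hm : Squarefree m) (hmX : m ≤ X) (G : (V → ℕ) → ℝ) :
    ∑ f : m.primeFactors → V, G (DM m f) = ∑ D ∈ RB (∅ : Finset V) X with ∏ x, D x = m, G D := by
  have hm0 : 0 < m := Nat.pos_of_ne_zero hm.ne_zero
  refine sum_bij (fun f _ => DM m f) ?_ ?_ ?_ (fun _ _ => rfl)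
  · intro f _
    rw [mem_filter, mem_RB (by omega)]
    refine ⟨⟨fun x => ⟨DM_pos f x, ?_⟩, by simp⟩, DM_prod hm f⟩
    refine (Nat.le_of_dvd hm0 ?_).trans hmX
    conv_rhs => rw [← DM_prod hm f]
    exact dvd_prod_of_mem _ (mem_univ x)
  · intro f _ g _ h
    ext p
    have : (p : ℕ) ∣ DM m f (f p) := (dvd_DM f _ p).mpr rfl
    rw [h, dvd_DM] at this
    exact this.symm
  · intro D hD
    rw [mem_filter, mem_RB (by omega)] at hD
    obtain ⟨⟨hD1, -⟩, hDm⟩ := hD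
    have hex : ∀ p : m.primeFactors, ∃ x, (p : ℕ) ∣ D x := by
      intro p
      have h1 : (p : ℕ) ∣ ∏ x, D x := by
        rw [hDm]; exact Nat.dvd_of_mem_primeFactors p.2
      obtain ⟨x, -, hx⟩ := (Prime.dvd_finsetProd_iff (pf_prime p).prime _).mp h1
      exact ⟨x, hx⟩
    choose f hf using hex
    refine ⟨f, mem_univ _, ?_⟩
    have hle : ∀ x, DM m f x ≤ D x := by
      intro x
      refine Nat.le_of_dvd (hD1 x).1 ?_
      unfold DM
      apply Finset.prod_dvd_of_isRelPrime
      · intro p _ q _ hpq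
        show IsRelPrime (p : ℕ) (q : ℕ)
        rw [← Nat.coprime_iff_isRelPrime]
        exact (Nat.coprime_primes (pf_prime p) (pf_prime q)).mpr fun h => hpq (Subtype.ext h)
      · intro p hp
        rw [← (mem_filter.mp hp).2]; exact hf p
    by_contra hne
    obtain ⟨x, hx⟩ := Function.ne_iff.mp hne
    have := prod_lt_prod (s := univ) (f := DM m f) (g := D) (fun x _ => DM_pos f x) (fun x _ => hle x) ⟨x, mem_univ _, lt_of_le_of_ne (hle x) hx⟩
    rw [DM_prod hm, hDm] at this
    exact lt_irrefl _ this

lemma mult_prod_primes {φ : ℕ → ℝ} (h1 : φ 1 = 1) (hφ : ∀ a b, Nat.Coprime a b → φ (a * b) = φ a * φ b) {m : ℕ}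
    (s : Finset m.primeFactors) : φ (∏ p ∈ s, (p : ℕ)) = ∏ p ∈ s, φ p := by
  induction s using Finset.induction_on with
  | empty => simp [h1]
  | insert p s hp ih =>
    rw [prod_insert hp, prod_insert hp, hφ, ih]
    apply Nat.Coprime.prod_right
    intro q hq
    exact (Nat.coprime_primes (pf_prime p) (pf_prime q)).mpr fun h => hp (Subtype.ext h ▸ hq)

lemma tup_fixed {m X : ℕ} (hm : Squarefree m) (hmX : m ≤ X) (φ : V → ℕ → ℝ) (h1 : ∀ x, φ x 1 = 1)
    (hφ : ∀ x a b, Nat.Coprime a b → φ x (a * b) = φ x a * φ x b) :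
    ∑ D ∈ RB (∅ : Finset V) X with ∏ x, D x = m, ∏ x, φ x (D x) = ∏ p ∈ m.primeFactors, ∑ x, φ x p := by
  rw [← sum_DM hm hmX (fun D => ∏ x, φ x (D x))]
  have e : ∀ f : m.primeFactors → V, ∏ x, φ x (DM m f x) = ∏ p : m.primeFactors, φ (f p) p := by
    intro f
    unfold DM
    rw [← prod_fiberwise univ f (fun p : m.primeFactors => φ (f p) p)]
    refine prod_congr rfl fun x _ => ?_
    rw [mult_prod_primes (h1 x) (hφ x)]
    exact prod_congr rfl fun p hp => by rw [(mem_filter.mp hp).2]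
  simp only [e]
  rw [← prod_coe_sort (s := m.primeFactors) (f := fun p => ∑ x, φ x p), prod_univ_sum]
  simp

lemma tup {X Y : ℕ} (hXY : Y ≤ X) (φ : V → ℕ → ℝ) (h1 : ∀ x, φ x 1 = 1)
    (hφ : ∀ x a b, Nat.Coprime a b → φ x (a * b) = φ x a * φ x b) :
    ∑ D ∈ RB (∅ : Finset V) X with (∏ x, D x ≤ Y ∧ Squarefree (∏ x, D x)), ∏ x, φ x (D x) =
      ∑ m ∈ SF Y, ∏ p ∈ m.primeFactors, ∑ x, φ x p := by
  rw [← sum_fiberwise_of_maps_to (t := SF Y) (g := fun D => ∏ x, D x)]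
  · refine sum_congr rfl fun m hm => ?_
    have hm' := mem_SF.mp hm
    rw [← tup_fixed hm'.2 (hm'.1.2.trans hXY) φ h1 hφ, filter_filter]
    refine sum_congr (filter_congr fun D _ => ?_) fun _ _ => rfl
    constructor
    · exact fun h => h.2
    · intro h; rw [h]; exact ⟨⟨hm'.1.2, hm'.2⟩, rfl⟩
  · intro D hD
    rw [mem_filter] at hD
    exact mem_SF.mpr ⟨⟨Nat.pos_of_ne_zero hD.2.2.ne_zero, hD.2.1⟩, hD.2.2⟩

/-- version supported on `U` -/
lemma tupU {X Y : ℕ} (hXY : Y ≤ X) (hX : 1 ≤ X) (U : Finset V) (φ : V → ℕ → ℝ) (h1 : ∀ x, φ x 1 = 1)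
    (hφ : ∀ x a b, Nat.Coprime a b → φ x (a * b) = φ x a * φ x b) :
    ∑ D ∈ RB Uᶜ X with (∏ x, D x ≤ Y ∧ Squarefree (∏ x, D x)), ∏ x, φ x (D x) =
      ∑ m ∈ SF Y, ∏ p ∈ m.primeFactors, ∑ x ∈ U, φ x p := by
  have h := tup hXY (fun x a => if x ∈ U then φ x a else if a = 1 then 1 else 0) (V := V)
    (fun x => by by_cases hx : x ∈ U <;> simp [h1, hx]) (fun x a b hab => by
      by_cases hx : x ∈ U
      · simp only [hx, if_true]; exact hφ x a b hab
      · simp only [hx, if_false]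
        by_cases ha : a = 1 <;> by_cases hb : b = 1 <;> simp [ha, hb])
  have e : ∀ m ∈ SF Y, ∏ p ∈ m.primeFactors, ∑ x ∈ U, φ x p =
      ∏ p ∈ m.primeFactors, ∑ x, (fun x a => if x ∈ U then φ x a else if a = 1 then 1 else 0) x p := by
    intro m _
    refine prod_congr rfl fun p hp => ?_
    have hp1 : p ≠ 1 := (Nat.prime_of_mem_primeFactors hp).ne_one
    simp only [hp1, if_false]
    rw [← sum_filter]
    simp
  rw [sum_congr rfl e, ← h]
  rw [sum_filter, sum_filter]
  have hsub : RB Uᶜ X ⊆ RB (∅ : Finset V) X := by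
    intro D hD
    rw [mem_RB hX] at hD ⊢
    exact ⟨hD.1, by simp⟩
  rw [← sum_subset hsub]
  · refine sum_congr rfl fun D hD => ?_
    rw [mem_RB hX] at hD
    congr 1
    refine prod_congr rfl fun x _ => ?_
    by_cases hx : x ∈ U
    · simp [hx]
    · simp [hx, hD.2 x (by simpa using hx), h1]
  · intro D hD hD2
    rw [mem_RB hX] at hD hD2
    have : ∃ x ∉ U, D x ≠ 1 := by
      by_contra hcon
      push Not at hcon
      exact hD2 ⟨hD.1, fun x hx => hcon x (by simpa using hx)⟩
    obtain ⟨x, hx, hx1⟩ := this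
    have h0 : ∏ x, (fun x a => if x ∈ U then φ x a else if a = 1 then 1 else 0) x (D x) = (0 : ℝ) :=
      prod_eq_zero (mem_univ x) (by simp [hx, hx1])
    rw [h0]
    simp

end
end AC

namespace AC
open Finset

section
variable {V : Type} [Fintype V] [DecidableEq V]

noncomputable def jr (a b : ℕ) : ℝ := ((jacobiSym (a : ℤ) b : ℤ) : ℝ)

lemma jr_abs (a b : ℕ) : |jr a b| ≤ 1 := by
  unfold jr
  rcases jacobiSym.trichotomy a b with h | h | h <;> rw [h] <;> norm_num

noncomputable def BB (ev : V → V → ℕ) (c d : V → ℕ) : ℝ := ∏ x, ∏ y, jr (d y) (c x) ^ ev x y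

noncomputable def kw (κ : ℝ) (a : ℕ) : ℝ := κ ^ a.primeFactors.card

lemma kw_one (κ : ℝ) : kw κ 1 = 1 := by simp [kw]
lemma kw_mul (κ : ℝ) {a b : ℕ} (h : Nat.Coprime a b) : kw κ (a * b) = kw κ a * kw κ b := by
  unfold kw
  rw [h.primeFactors_mul, card_union_of_disjoint h.disjoint_primeFactors, pow_add]
lemma kw_prime (κ : ℝ) {p : ℕ} (hp : p.Prime) : kw κ p = κ := by
  simp [kw, hp.primeFactors]
lemma kw_nonneg {κ : ℝ} (h : 0 ≤ κ) (a : ℕ) : 0 ≤ kw κ a := pow_nonneg h _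
lemma kw_le_one {κ : ℝ} (h : 0 ≤ κ) (h1 : κ ≤ 1) (a : ℕ) : kw κ a ≤ 1 := pow_le_one₀ h h1

noncomputable def hh (κ : ℝ) (i j : ℕ) (a : ℕ) : ℝ := kw κ a * psi i j 1 a

noncomputable def TT (κ : ℝ) (ii jj : V → ℕ) (ev : V → V → ℕ) (D : V → ℕ) : ℝ :=
  if Squarefree (∏ x, D x) ∧ Odd (∏ x, D x) then (∏ x, hh κ (ii x) (jj x) (D x)) * BB ev D D else 0

lemma prod_abs_le_one {ι : Type} (s : Finset ι) (f : ι → ℝ) (h : ∀ i ∈ s, |f i| ≤ 1) : |∏ i ∈ s, f i| ≤ 1 := by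
  rw [abs_prod]
  exact prod_le_one (fun i _ => abs_nonneg _) h

lemma BB_abs (ev : V → V → ℕ) (c d : V → ℕ) : |BB ev c d| ≤ 1 := by
  unfold BB
  refine prod_abs_le_one _ _ fun x _ => prod_abs_le_one _ _ fun y _ => ?_
  rw [abs_pow]
  exact pow_le_one₀ (abs_nonneg _) (jr_abs _ _)

lemma hh_abs {κ : ℝ} (h : 0 ≤ κ) (i j a : ℕ) : |hh κ i j a| ≤ kw κ a := by
  unfold hh
  rw [abs_mul, abs_of_nonneg (kw_nonneg h a)]
  exact mul_le_of_le_one_right (kw_nonneg h a) (psi_abs_real _ _ _ _)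

lemma TT_abs {κ : ℝ} (h : 0 ≤ κ) (ii jj : V → ℕ) (ev : V → V → ℕ) (D : V → ℕ) :
    |TT κ ii jj ev D| ≤ if Squarefree (∏ x, D x) then ∏ x, kw κ (D x) else 0 := by
  have h0 : 0 ≤ ∏ x, kw κ (D x) := prod_nonneg fun x _ => kw_nonneg h _
  unfold TT
  split_ifs with h1 h2 h2
  · rw [abs_mul]
    refine (mul_le_of_le_one_right (abs_nonneg _) (BB_abs _ _ _)).trans ?_
    rw [abs_prod]
    exact prod_le_prod (fun x _ => abs_nonneg _) fun x _ => hh_abs h _ _ _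
  · exact absurd h1.1 h2
  · simpa using h0
  · simp

def big (z : ℕ) (D : V → ℕ) : Finset V := univ.filter fun x => z < D x

lemma RB_filter (U : Finset V) {X z : ℕ} (hz : 1 ≤ z) (hzX : z ≤ X) :
    (RB U X).filter (fun r => ∀ x, r x ≤ z) = RB U z := by
  ext r
  rw [mem_filter, mem_RB (by omega), mem_RB hz]
  constructor
  · rintro ⟨⟨h1, h2⟩, h3⟩; exact ⟨fun x => ⟨(h1 x).1, h3 x⟩, h2⟩
  · rintro ⟨h1, h2⟩; exact ⟨⟨fun x => ⟨(h1 x).1, (h1 x).2.trans hzX⟩, h2⟩, fun x => (h1 x).2⟩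

lemma RB_prod_le {U : Finset V} {z : ℕ} (hz : 1 ≤ z) {r : V → ℕ} (hr : r ∈ RB U z) : ∏ x, r x ≤ z ^ Fintype.card V := by
  rw [mem_RB hz] at hr
  rw [← card_univ, ← prod_const]
  exact prod_le_prod (fun x _ => Nat.zero_le _) fun x _ => (hr.1 x).2

lemma RB_prod_pos {U : Finset V} {z : ℕ} (hz : 1 ≤ z) {r : V → ℕ} (hr : r ∈ RB U z) : 0 < ∏ x, r x := by
  rw [mem_RB hz] at hr
  exact prod_pos fun x _ => (hr.1 x).1

lemma floor_bound (X R : ℕ) (hR : 0 < R) (hX : R ^ 2 ≤ X) (κ : ℝ) (hκ0 : 0 ≤ κ) (hκ1 : κ ≤ 1) :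
    1 ≤ X / R ∧ ((X / R : ℕ) : ℝ) * (1 + Real.log (X / R : ℕ)) ^ (-κ) ≤ 4 * (X / R) * (1 + Real.log X) ^ (-κ) := by
  have hRX : R ≤ X := le_trans (by nlinarith) hX
  have h1 : 1 ≤ X / R := (Nat.one_le_div_iff hR).mpr hRX
  refine ⟨h1, ?_⟩
  have hX0 : (0 : ℝ) < X := by exact_mod_cast (lt_of_lt_of_le hR hRX)
  have hR0 : (0 : ℝ) < R := by exact_mod_cast hR
  have hlX : 0 ≤ Real.log X := Real.log_natCast_nonneg X
  set Y := X / R with hY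
  have hY0 : (0 : ℝ) < Y := by exact_mod_cast h1
  have hXY : (X : ℝ) ≤ 2 * (Y * R) := by
    have := Nat.lt_div_mul_add (a := X) hR
    have h2 : X ≤ 2 * (Y * R) := by nlinarith
    exact_mod_cast h2
  have hl : Real.log X ≤ Real.log 2 + (Real.log Y + Real.log R) := by
    rw [← Real.log_mul hY0.ne' hR0.ne', ← Real.log_mul (by norm_num) (by positivity)]
    exact Real.log_le_log hX0 hXY
  have hR2 : 2 * Real.log R ≤ Real.log X := by
    have : ((R : ℝ)) ^ 2 ≤ X := by exact_mod_cast hX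
    have := Real.log_le_log (by positivity) this
    rw [Real.log_pow] at this
    push_cast at this; exact this
  have h2 := Real.log_two_lt_d9
  have hk : (1 + Real.log X) / 4 ≤ 1 + Real.log Y := by linarith
  have hle : (1 + Real.log Y) ^ (-κ) ≤ 4 * (1 + Real.log X) ^ (-κ) := by
    calc (1 + Real.log Y) ^ (-κ) ≤ ((1 + Real.log X) / 4) ^ (-κ) := Real.rpow_le_rpow_of_nonpos (by positivity) hk (by linarith)
      _ = (1 + Real.log X) ^ (-κ) * 4 ^ κ := by
        rw [Real.div_rpow (by positivity) (by norm_num), Real.rpow_neg (by norm_num : (0 : ℝ) ≤ 4)]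
        field_simp
      _ ≤ (1 + Real.log X) ^ (-κ) * 4 := by
        refine mul_le_mul_of_nonneg_left ?_ (by positivity)
        calc (4 : ℝ) ^ κ ≤ 4 ^ (1 : ℝ) := Real.rpow_le_rpow_of_exponent_le (by norm_num) hκ1
          _ = 4 := by norm_num
      _ = _ := by ring
  have hYR : (Y : ℝ) ≤ X / R := by rw [hY]; exact Nat.cast_div_le
  calc (Y : ℝ) * (1 + Real.log Y) ^ (-κ) ≤ (X / R) * (4 * (1 + Real.log X) ^ (-κ)) := by gcongr
    _ = _ := by ring

lemma sum_kwU {X Y : ℕ} (hXY : Y ≤ X) (hX : 1 ≤ X) (U : Finset V) (κ : ℝ) :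
    ∑ D ∈ RB Uᶜ X with (∏ x, D x ≤ Y ∧ Squarefree (∏ x, D x)), ∏ x, kw κ (D x) =
      ∑ m ∈ SF Y, ∏ p ∈ m.primeFactors, (U.card * κ) := by
  rw [tupU hXY hX U (fun _ => kw κ) (fun _ => kw_one κ) (fun _ _ _ h => kw_mul κ h)]
  refine sum_congr rfl fun m _ => prod_congr rfl fun p hp => ?_
  rw [kw_prime κ (Nat.prime_of_mem_primeFactors hp)]
  simp

lemma rd_sqf {r d : V → ℕ} (h : Squarefree (∏ x, (r * d) x)) : Squarefree (∏ x, d x) := by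
  simp only [Pi.mul_apply, prod_mul_distrib] at h
  exact h.squarefree_of_dvd (dvd_mul_left _ _)

lemma rd_le {r d : V → ℕ} {X : ℕ} (hr : 0 < ∏ x, r x) : ∏ x, (r * d) x ≤ X ↔ ∏ x, d x ≤ X / ∏ x, r x := by
  simp only [Pi.mul_apply, prod_mul_distrib]
  rw [Nat.le_div_iff_mul_le hr, mul_comm]

lemma case2 {κ : ℝ} (h0 : 0 ≤ κ) (h1 : κ ≤ 1) (ii jj : V → ℕ) (ev : V → V → ℕ) (U : Finset V) (hU : U.card * κ ≤ 1 - κ)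
    {X z : ℕ} (hz : 1 ≤ z) (hzV : (z ^ Fintype.card V) ^ 2 ≤ X) (hzX : z ≤ X) :
    ∑ D ∈ RB (∅ : Finset V) X with (∏ x, D x ≤ X ∧ big z D = U), |TT κ ii jj ev D| ≤
      16 * Real.exp 8 * X * (1 + Real.log X) ^ (-κ) * (1 + Real.log z) ^ Fintype.card V := by
  have hX : 1 ≤ X := hz.trans hzX
  have hlX : 0 ≤ Real.log X := Real.log_natCast_nonneg X
  rw [sum_filter, RB_fubini U hX]
  have hin : ∀ r ∈ RB U X, ∑ d ∈ RB Uᶜ X, (if ∏ x, (r * d) x ≤ X ∧ big z (r * d) = U then |TT κ ii jj ev (r * d)| else 0) ≤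
      if ∀ x, r x ≤ z then 16 * Real.exp 8 * X * (1 + Real.log X) ^ (-κ) * (1 / ((∏ x, r x : ℕ) : ℝ)) else 0 := by
    intro r hr
    have hr' := (mem_RB hX).mp hr
    split_ifs with hrz
    · have hR0 : 0 < ∏ x, r x := RB_prod_pos hX hr
      have hrz' : r ∈ RB U z := by rw [← RB_filter U hz hzX]; exact mem_filter.mpr ⟨hr, hrz⟩
      have hR2 : (∏ x, r x) ^ 2 ≤ X := (Nat.pow_le_pow_left (RB_prod_le hz hrz') 2).trans hzV
      obtain ⟨hY1, hY2⟩ := floor_bound X _ hR0 hR2 κ h0 h1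
      set Y := X / ∏ x, r x with hY
      calc ∑ d ∈ RB Uᶜ X, (if ∏ x, (r * d) x ≤ X ∧ big z (r * d) = U then |TT κ ii jj ev (r * d)| else 0)
          ≤ ∑ d ∈ RB Uᶜ X, if (∏ x, d x ≤ Y ∧ Squarefree (∏ x, d x)) then ∏ x, kw κ (d x) else 0 := by
            refine sum_le_sum fun d hd => ?_
            have hd' := (mem_RB hX).mp hd
            have hnn : (0 : ℝ) ≤ if (∏ x, d x ≤ Y ∧ Squarefree (∏ x, d x)) then ∏ x, kw κ (d x) else 0 := by
              split_ifs
              · exact prod_nonneg fun x _ => kw_nonneg h0 _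
              · exact le_rfl
            split_ifs with ha hb hb
            · refine (TT_abs h0 ii jj ev _).trans ?_
              split_ifs with hc
              · refine prod_le_prod (fun x _ => kw_nonneg h0 _) fun x _ => ?_
                by_cases hx : x ∈ U
                · rw [Pi.mul_apply, hr'.2 x hx, one_mul]
                · rw [hd'.2 x (by simpa using hx), kw_one]; exact kw_le_one h0 h1 _
              · exact prod_nonneg fun x _ => kw_nonneg h0 _
            · refine (TT_abs h0 ii jj ev _).trans (le_of_eq ?_)
              rw [if_neg]
              intro hc
              exact hb ⟨(rd_le hR0).mp ha.1, rd_sqf hc⟩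
            · exact prod_nonneg fun x _ => kw_nonneg h0 _
            · exact le_rfl
        _ = ∑ m ∈ SF Y, ∏ p ∈ m.primeFactors, (U.card * κ) := by
            rw [← sum_filter, sum_kwU (Nat.div_le_self _ _) hX U κ]
        _ ≤ 4 * Real.exp 8 * Y * (1 + Real.log Y) ^ (-κ) := HT1 (fun _ => U.card * κ) (fun _ => by positivity) Y hY1 κ h0 h1 (fun _ => hU)
        _ = 4 * Real.exp 8 * (Y * (1 + Real.log Y) ^ (-κ)) := by ring
        _ ≤ 4 * Real.exp 8 * (4 * (X / (∏ x, r x : ℕ)) * (1 + Real.log X) ^ (-κ)) := mul_le_mul_of_nonneg_left hY2 (by positivity)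
        _ = _ := by ring
    · refine le_of_eq (sum_eq_zero fun d hd => ?_)
      have hd' := (mem_RB hX).mp hd
      rw [if_neg]
      rintro ⟨-, hb⟩
      apply hrz
      intro x
      by_cases hx : x ∈ U
      · rw [hr'.2 x hx]; exact hz
      · have : x ∉ big z (r * d) := by rw [hb]; exact hx
        simp only [big, mem_filter, mem_univ, true_and, Pi.mul_apply, hd'.2 x (by simpa using hx), mul_one, not_lt] at this
        exact this
  refine (sum_le_sum hin).trans ?_
  rw [← sum_filter, RB_filter U hz hzX, ← mul_sum]
  exact mul_le_mul_of_nonneg_left (RB_sum_inv U z) (by positivity)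

end
end AC

namespace AC
open Finset

section
variable {V : Type} [Fintype V] [DecidableEq V]

lemma jr_mul_left (a b c : ℕ) : jr (a * b) c = jr a c * jr b c := by
  unfold jr; push_cast; rw [jacobiSym.mul_left]; push_cast; rfl

lemma jr_mul_right (a : ℕ) {b c : ℕ} (hb : 0 < b) (hc : 0 < c) : jr a (b * c) = jr a b * jr a c := by
  unfold jr
  have := NeZero.mk hb.ne'
  have := NeZero.mk hc.ne'
  rw [jacobiSym.mul_right]; push_cast; rfl

lemma jr_one_left (b : ℕ) : jr 1 b = 1 := by simp [jr]
lemma jr_one_right (a : ℕ) : jr a 1 = 1 := by simp [jr]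

lemma BB_mul_right (ev : V → V → ℕ) (c d e : V → ℕ) : BB ev c (d * e) = BB ev c d * BB ev c e := by
  unfold BB
  simp only [Pi.mul_apply, jr_mul_left, mul_pow, prod_mul_distrib]

lemma BB_mul_left (ev : V → V → ℕ) (c d e : V → ℕ) (hc : ∀ x, 0 < c x) (hd : ∀ x, 0 < d x) :
    BB ev (c * d) e = BB ev c e * BB ev d e := by
  unfold BB
  rw [← prod_mul_distrib]
  refine prod_congr rfl fun x _ => ?_
  rw [← prod_mul_distrib]
  refine prod_congr rfl fun y _ => ?_
  rw [Pi.mul_apply, jr_mul_right _ (hc x) (hd x), mul_pow]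

lemma BB_single (ev : V → V → ℕ) (x y : V) (a b : ℕ) :
    BB ev (Pi.mulSingle x a) (Pi.mulSingle y b) = jr b a ^ ev x y := by
  unfold BB
  rw [prod_eq_single x]
  · rw [prod_eq_single y]
    · simp
    · intro w _ hw
      rw [Pi.mulSingle_eq_of_ne hw, jr_one_left, one_pow]
    · simp
  · intro w _ hw
    refine prod_eq_one fun v _ => ?_
    rw [Pi.mulSingle_eq_of_ne hw, jr_one_right, one_pow]
  · simp

lemma hh_one (κ : ℝ) (i j : ℕ) : hh κ i j 1 = 1 := by simp [hh, kw_one, psi_one]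

lemma prod_hh_mul (κ : ℝ) (ii jj : V → ℕ) (c d : V → ℕ) (h : ∀ x, c x = 1 ∨ d x = 1) :
    ∏ x, hh κ (ii x) (jj x) ((c * d) x) = (∏ x, hh κ (ii x) (jj x) (c x)) * ∏ x, hh κ (ii x) (jj x) (d x) := by
  rw [← prod_mul_distrib]
  refine prod_congr rfl fun x _ => ?_
  rw [Pi.mul_apply]
  rcases h x with h | h <;> rw [h, hh_one] <;> simp

lemma prod_hh_single (κ : ℝ) (ii jj : V → ℕ) (x : V) (a : ℕ) :
    ∏ w, hh κ (ii w) (jj w) ((Pi.mulSingle x a : V → ℕ) w) = hh κ (ii x) (jj x) a := by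
  rw [prod_eq_single x]
  · simp
  · intro w _ hw
    rw [Pi.mulSingle_eq_of_ne hw, hh_one]
  · simp

lemma mulSingle_pos (x : V) {a : ℕ} (ha : 0 < a) (w : V) : 0 < (Pi.mulSingle x a : V → ℕ) w := by
  by_cases h : w = x
  · subst h; simpa using ha
  · rw [Pi.mulSingle_eq_of_ne h]; norm_num

lemma RB_pair {x y : V} (hxy : x ≠ y) {X : ℕ} (hX : 1 ≤ X) (F : (V → ℕ) → ℝ) :
    ∑ d ∈ RB ({x, y} : Finset V)ᶜ X, F d = ∑ b ∈ Ioc 0 X, ∑ a ∈ Ioc 0 X, F (Pi.mulSingle x a * Pi.mulSingle y b) := by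
  rw [← sum_product']
  refine sum_bij' (fun d _ => (d y, d x)) (fun ab _ => Pi.mulSingle x ab.2 * Pi.mulSingle y ab.1) ?_ ?_ ?_ ?_ ?_
  · intro d hd
    rw [mem_RB hX] at hd
    simp only [mem_product, mem_Ioc]
    exact ⟨hd.1 y, hd.1 x⟩
  · rintro ⟨b, a⟩ h
    simp only [mem_product, mem_Ioc] at h
    rw [mem_RB hX]
    refine ⟨fun w => ?_, fun w hw => ?_⟩
    · simp only [Pi.mul_apply]
      by_cases h1 : w = x
      · subst h1; rw [Pi.mulSingle_eq_same, Pi.mulSingle_eq_of_ne hxy, mul_one]; exact h.2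
      · rw [Pi.mulSingle_eq_of_ne h1, one_mul]
        by_cases h2 : w = y
        · subst h2; rw [Pi.mulSingle_eq_same]; exact h.1
        · rw [Pi.mulSingle_eq_of_ne h2]; omega
    · simp only [mem_compl, mem_insert, mem_singleton, not_or] at hw
      rw [Pi.mul_apply, Pi.mulSingle_eq_of_ne hw.1, Pi.mulSingle_eq_of_ne hw.2, one_mul]
  · intro d hd
    rw [mem_RB hX] at hd
    ext w
    simp only [Pi.mul_apply]
    by_cases h1 : w = x
    · subst h1; rw [Pi.mulSingle_eq_same, Pi.mulSingle_eq_of_ne hxy, mul_one]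
    · rw [Pi.mulSingle_eq_of_ne h1, one_mul]
      by_cases h2 : w = y
      · subst h2; rw [Pi.mulSingle_eq_same]
      · rw [Pi.mulSingle_eq_of_ne h2, hd.2 w (by simp [h1, h2])]
  · rintro ⟨b, a⟩ _
    simp [hxy, hxy.symm]
  · intro d hd
    congr 1
    rw [mem_RB hX] at hd
    ext w
    simp only [Pi.mul_apply]
    by_cases h1 : w = x
    · subst h1; rw [Pi.mulSingle_eq_same, Pi.mulSingle_eq_of_ne hxy, mul_one]
    · rw [Pi.mulSingle_eq_of_ne h1, one_mul]
      by_cases h2 : w = y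
      · subst h2; rw [Pi.mulSingle_eq_same]
      · rw [Pi.mulSingle_eq_of_ne h2, hd.2 w (by simp [h1, h2])]

lemma box_eq {X Y z : ℕ} (hYX : Y ≤ X) (F : ℕ → ℕ → ℝ) :
    ∑ b ∈ Ioc 0 X, ∑ a ∈ Ioc 0 X, (if z < b ∧ z < a ∧ b * a ≤ Y then F b a else 0) =
      ∑ b ∈ Ioc z Y, ∑ a ∈ Ioc z Y with b * a ≤ Y, F b a := by
  have hsub : Ioc z Y ⊆ Ioc 0 X := Ioc_subset_Ioc (Nat.zero_le _) hYX
  rw [← sum_subset hsub]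
  · refine sum_congr rfl fun b hb => ?_
    rw [sum_filter, ← sum_subset hsub]
    · refine sum_congr rfl fun a ha => ?_
      have := mem_Ioc.mp ha
      have := mem_Ioc.mp hb
      congr 1
      apply propext
      constructor
      · exact fun h => h.2.2
      · exact fun h => ⟨by omega, by omega, h⟩
    · intro a ha ha2
      rw [if_neg]
      rintro ⟨h1, h2, h3⟩
      apply ha2
      rw [mem_Ioc] at *
      exact ⟨h2, le_trans (Nat.le_mul_of_pos_left _ (by omega)) h3⟩
  · intro b hb hb2
    refine sum_eq_zero fun a _ => ?_
    rw [if_neg]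
    rintro ⟨h1, h2, h3⟩
    apply hb2
    rw [mem_Ioc] at *
    exact ⟨h1, le_trans (Nat.le_mul_of_pos_right _ (by omega)) h3⟩

lemma GB_mono {Y X z : ℕ} (R : ℝ) (hR : 0 < R) (h : (Y : ℝ) ≤ X / R) (h2 : Y ≤ X) :
    GB Y z ≤ 32 * X * (z : ℝ) ^ (-(1 / 8) : ℝ) * ((Nat.log 2 X : ℝ) + 3) ^ 6 * (1 / R) := by
  unfold GB
  have hl : (Nat.log 2 Y : ℝ) ≤ Nat.log 2 X := by exact_mod_cast Nat.log_mono_right h2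
  calc _ ≤ 32 * (X / R) * (z : ℝ) ^ (-(1 / 8) : ℝ) * ((Nat.log 2 X : ℝ) + 3) ^ 6 := by gcongr
    _ = _ := by ring

/-- one variable coefficient -/
noncomputable def cf (κ : ℝ) (ii jj : V → ℕ) (ev : V → V → ℕ) (r : V → ℕ) (x : V) (a : ℕ) : ℝ :=
  if (Odd a ∧ Squarefree a) ∧ Nat.Coprime (∏ w, r w) a then
    hh κ (ii x) (jj x) a * (BB ev r (Pi.mulSingle x a) * BB ev (Pi.mulSingle x a) r) else 0

lemma cf_abs {κ : ℝ} (h0 : 0 ≤ κ) (h1 : κ ≤ 1) (ii jj : V → ℕ) (ev : V → V → ℕ) (r : V → ℕ) (x : V) (a : ℕ) :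
    |cf κ ii jj ev r x a| ≤ 1 := by
  unfold cf
  split_ifs
  · rw [abs_mul, abs_mul]
    exact mul_le_one₀ ((hh_abs h0 _ _ _).trans (kw_le_one h0 h1 _)) (by positivity) (mul_le_one₀ (BB_abs _ _ _) (by positivity) (BB_abs _ _ _))
  · simp

lemma cf_zero (κ : ℝ) (ii jj : V → ℕ) (ev : V → V → ℕ) (r : V → ℕ) (x : V) (a : ℕ) (h : ¬ (Odd a ∧ Squarefree a)) :
    cf κ ii jj ev r x a = 0 := by
  unfold cf
  rw [if_neg]
  exact fun hc => h hc.1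

lemma jr_eq_zero {a b : ℕ} (hb : 0 < b) (h : ¬ Nat.Coprime a b) : jr a b = 0 := by
  unfold jr
  have := NeZero.mk hb.ne'
  have : jacobiSym (a : ℤ) b = 0 := by
    rw [jacobiSym.eq_zero_iff_not_coprime]
    simpa [Int.gcd_natCast_natCast] using h
  rw [this]; simp

lemma TT_split {κ : ℝ} (ii jj : V → ℕ) (ev : V → V → ℕ) (hev : ∀ w, ev w w = 0) {x y : V} (hxy : x ≠ y)
    (h1 : ev x y = 1) (h2 : ev y x = 0) {r : V → ℕ} (hr : ∀ w, 0 < r w) (hrx : r x = 1) (hry : r y = 1) {a b : ℕ} (ha : 0 < a) (hb : 0 < b) :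
    TT κ ii jj ev (r * (Pi.mulSingle x a * Pi.mulSingle y b)) =
      TT κ ii jj ev r * (cf κ ii jj ev r y b * cf κ ii jj ev r x a * jr b a) := by
  have hP : ∏ w, (r * (Pi.mulSingle x a * Pi.mulSingle y b) : V → ℕ) w = (∏ w, r w) * (a * b) := by
    simp only [Pi.mul_apply, prod_mul_distrib]
    congr 1
    congr 1
    · exact Fintype.prod_pi_mulSingle' x a
    · exact Fintype.prod_pi_mulSingle' y b
  by_cases hco : Nat.Coprime b a
  swap
  · rw [jr_eq_zero ha hco, mul_zero, mul_zero]
    unfold TT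
    rw [if_neg]
    rw [hP]
    rintro ⟨hs, -⟩
    have := hs.squarefree_of_dvd (dvd_mul_left (a * b) _)
    exact hco (Nat.coprime_of_squarefree_mul this).symm
  have hcond : (Squarefree ((∏ w, r w) * (a * b)) ∧ Odd ((∏ w, r w) * (a * b))) ↔
      (Squarefree (∏ w, r w) ∧ Odd (∏ w, r w)) ∧ ((Odd b ∧ Squarefree b) ∧ Nat.Coprime (∏ w, r w) b) ∧ ((Odd a ∧ Squarefree a) ∧ Nat.Coprime (∏ w, r w) a) := by
    rw [Nat.squarefree_mul_iff, Nat.squarefree_mul_iff, Nat.odd_mul, Nat.odd_mul, Nat.coprime_mul_iff_right]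
    have := hco.symm
    tauto
  unfold TT cf
  rw [hP]
  by_cases hc : Squarefree ((∏ w, r w) * (a * b)) ∧ Odd ((∏ w, r w) * (a * b))
  · obtain ⟨c1, c2, c3⟩ := hcond.mp hc
    rw [if_pos hc, if_pos c1, if_pos c2, if_pos c3]
    have pa := mulSingle_pos x ha
    have pb := mulSingle_pos y hb
    rw [prod_hh_mul, prod_hh_mul, prod_hh_single, prod_hh_single]
    · rw [BB_mul_left _ _ _ _ hr (fun w => by rw [Pi.mul_apply]; exact Nat.mul_pos (pa w) (pb w)), BB_mul_left _ _ _ _ pa pb]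
      simp only [BB_mul_right, BB_single, hev, h1, h2, pow_zero, pow_one]
      ring
    · intro w
      by_cases hw : w = x
      · right; rw [hw, Pi.mulSingle_eq_of_ne hxy]
      · left; rw [Pi.mulSingle_eq_of_ne hw]
    · intro w
      by_cases hw : w = x
      · left; rw [hw, hrx]
      · by_cases hw2 : w = y
        · left; rw [hw2, hry]
        · right; rw [Pi.mul_apply, Pi.mulSingle_eq_of_ne hw, Pi.mulSingle_eq_of_ne hw2, one_mul]
  · rw [if_neg hc]
    rw [hcond] at hc
    by_cases c1 : Squarefree (∏ w, r w) ∧ Odd (∏ w, r w)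
    · by_cases c2 : (Odd b ∧ Squarefree b) ∧ Nat.Coprime (∏ w, r w) b
      · have c3 : ¬ ((Odd a ∧ Squarefree a) ∧ Nat.Coprime (∏ w, r w) a) := fun c3 => hc ⟨c1, c2, c3⟩
        rw [if_neg c3]; ring
      · rw [if_neg c2]; ring
    · rw [if_neg c1]; ring

lemma case1 {κ : ℝ} (h0 : 0 ≤ κ) (hk1 : κ ≤ 1) (ii jj : V → ℕ) (ev : V → V → ℕ) (hev : ∀ w, ev w w = 0) {x y : V} (hxy : x ≠ y)
    (h1 : ev x y = 1) (h2 : ev y x = 0) (U : Finset V) (hx : x ∈ U) (hy : y ∈ U) {X z : ℕ} (hz : 1 ≤ z) (hX : 1 ≤ X) :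
    |∑ D ∈ RB (∅ : Finset V) X with (∏ w, D w ≤ X ∧ big z D = U), TT κ ii jj ev D| ≤
      96 * X * (z : ℝ) ^ (-(1 / 8) : ℝ) * ((Nat.log 2 X : ℝ) + 3) ^ 6 * (1 + Real.log X) ^ Fintype.card V := by
  rw [sum_filter, RB_fubini {x, y} hX]
  refine (abs_sum_le_sum_abs _ _).trans ?_
  have hin : ∀ r ∈ RB ({x, y} : Finset V) X, |∑ d ∈ RB ({x, y} : Finset V)ᶜ X, (if ∏ w, (r * d) w ≤ X ∧ big z (r * d) = U then TT κ ii jj ev (r * d) else 0)| ≤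
      96 * X * (z : ℝ) ^ (-(1 / 8) : ℝ) * ((Nat.log 2 X : ℝ) + 3) ^ 6 * (1 / ((∏ w, r w : ℕ) : ℝ)) := by
    intro r hr
    have hr' := (mem_RB hX).mp hr
    have hrx : r x = 1 := hr'.2 x (by simp)
    have hry : r y = 1 := hr'.2 y (by simp)
    have hR0 : 0 < ∏ w, r w := RB_prod_pos hX hr
    set Y := X / ∏ w, r w with hY
    rw [RB_pair hxy hX]
    set Cr : Prop := ∀ w, w ≠ x → w ≠ y → (z < r w ↔ w ∈ U) with hCr
    have e : ∀ b ∈ Ioc 0 X, ∀ a ∈ Ioc 0 X, (if ∏ w, (r * (Pi.mulSingle x a * Pi.mulSingle y b) : V → ℕ) w ≤ X ∧ big z (r * (Pi.mulSingle x a * Pi.mulSingle y b) : V → ℕ) = U then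
        TT κ ii jj ev (r * (Pi.mulSingle x a * Pi.mulSingle y b)) else 0) =
        (open Classical in if Cr then TT κ ii jj ev r else 0) * (if z < b ∧ z < a ∧ b * a ≤ Y then cf κ ii jj ev r y b * cf κ ii jj ev r x a * jr b a else 0) := by
      intro b hb a ha
      rw [mem_Ioc] at ha hb
      rw [TT_split ii jj ev hev hxy h1 h2 (fun w => (hr'.1 w).1) hrx hry ha.1 hb.1]
      have hP : ∏ w, ((Pi.mulSingle x a * Pi.mulSingle y b : V → ℕ)) w = b * a := by
        simp only [Pi.mul_apply, prod_mul_distrib]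
        rw [mul_comm]
        congr 1
        · exact Fintype.prod_pi_mulSingle' y b
        · exact Fintype.prod_pi_mulSingle' x a
      have hle : (∏ w, (r * (Pi.mulSingle x a * Pi.mulSingle y b) : V → ℕ) w ≤ X) ↔ b * a ≤ Y := by
        rw [rd_le hR0, hP]
      have hbig : big z (r * (Pi.mulSingle x a * Pi.mulSingle y b) : V → ℕ) = U ↔ (z < b ∧ z < a) ∧ Cr := by
        rw [Finset.ext_iff]
        simp only [big, mem_filter, mem_univ, true_and, Pi.mul_apply]
        constructor
        · intro h
          refine ⟨⟨?_, ?_⟩, fun w hw1 hw2 => ?_⟩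
          · have := (h y).mpr hy
            rwa [hry, Pi.mulSingle_eq_same, Pi.mulSingle_eq_of_ne hxy.symm, one_mul, one_mul] at this
          · have := (h x).mpr hx
            rwa [hrx, Pi.mulSingle_eq_same, Pi.mulSingle_eq_of_ne hxy, one_mul, mul_one] at this
          · have := h w
            rwa [Pi.mulSingle_eq_of_ne hw1, Pi.mulSingle_eq_of_ne hw2, one_mul, mul_one] at this
        · rintro ⟨⟨hb', ha'⟩, hc⟩ w
          by_cases hw1 : w = x
          · rw [hw1, hrx, Pi.mulSingle_eq_same, Pi.mulSingle_eq_of_ne hxy, one_mul, mul_one]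
            exact ⟨fun _ => hx, fun _ => ha'⟩
          · by_cases hw2 : w = y
            · rw [hw2, hry, Pi.mulSingle_eq_same, Pi.mulSingle_eq_of_ne hxy.symm, one_mul, one_mul]
              exact ⟨fun _ => hy, fun _ => hb'⟩
            · rw [Pi.mulSingle_eq_of_ne hw1, Pi.mulSingle_eq_of_ne hw2, one_mul, mul_one]
              exact hc w hw1 hw2
      by_cases hc : Cr
      · by_cases hd : z < b ∧ z < a ∧ b * a ≤ Y
        · rw [if_pos ⟨hle.mpr hd.2.2, hbig.mpr ⟨⟨hd.1, hd.2.1⟩, hc⟩⟩, if_pos hc, if_pos hd]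
        · rw [if_neg (fun h => hd ⟨(hbig.mp h.2).1.1, (hbig.mp h.2).1.2, hle.mp h.1⟩), if_neg hd, mul_zero]
      · rw [if_neg (fun h => hc (hbig.mp h.2).2), if_neg hc, zero_mul]
    rw [sum_congr rfl fun b hb => sum_congr rfl fun a ha => e b hb a ha]
    simp only [← mul_sum]
    rw [box_eq (Nat.div_le_self _ _), abs_mul]
    have hT : |(open Classical in if Cr then TT κ ii jj ev r else 0)| ≤ 1 := by
      split_ifs
      · refine (TT_abs h0 ii jj ev r).trans ?_
        split_ifs
        · exact prod_le_one (fun w _ => kw_nonneg h0 _) fun w _ => kw_le_one h0 hk1 _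
        · norm_num
      · simp
    refine (mul_le_of_le_one_left (abs_nonneg _) hT).trans ?_
    have hb := bilinear (fun b => cf_abs h0 hk1 ii jj ev r y b) (fun a => cf_abs h0 hk1 ii jj ev r x a)
      (fun b => cf_zero κ ii jj ev r y b) (fun a => cf_zero κ ii jj ev r x a) Y z hz
    refine hb.trans ?_
    have hR0' : (0 : ℝ) < ((∏ w, r w : ℕ) : ℝ) := by exact_mod_cast hR0
    have := GB_mono (z := z) ((∏ w, r w : ℕ) : ℝ) hR0' (show (Y : ℝ) ≤ X / ((∏ w, r w : ℕ) : ℝ) from Nat.cast_div_le) (Nat.div_le_self _ _)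
    calc 3 * GB Y z ≤ 3 * (32 * X * (z : ℝ) ^ (-(1 / 8) : ℝ) * ((Nat.log 2 X : ℝ) + 3) ^ 6 * (1 / ((∏ w, r w : ℕ) : ℝ))) :=
          mul_le_mul_of_nonneg_left this (by norm_num)
      _ = _ := by ring
  refine (sum_le_sum hin).trans ?_
  rw [← mul_sum]
  exact mul_le_mul_of_nonneg_left (RB_sum_inv _ X) (by positivity)

end
end AC

namespace AC
open Finset

section
variable {V : Type} [Fintype V] [DecidableEq V]

noncomputable def ch (a : ℕ) : ℝ := ((ZMod.χ₄ a : ℤ) : ℝ)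
noncomputable def sg (a b : ℝ) : ℝ := (1 + a + b - a * b) / 2

lemma ch_odd {a : ℕ} (ha : Odd a) : ch a = 1 ∨ ch a = -1 := by
  unfold ch
  have h := ZMod.χ₄_nat_eq_if_mod_four a
  have h2 : a % 2 = 1 := Nat.odd_iff.mp ha
  rw [h, if_neg (by omega)]
  split_ifs <;> simp

lemma ch_one : ch 1 = 1 := by simp [ch]
lemma sg_one_left (a : ℝ) : sg 1 a = 1 := by unfold sg; ring
lemma sg_one_right (a : ℝ) : sg a 1 = 1 := by unfold sg; ring

lemma sg_pm {a b : ℝ} (ha : a = 1 ∨ a = -1) (hb : b = 1 ∨ b = -1) : sg a b = 1 ∨ sg a b = -1 := by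
  unfold sg
  rcases ha with rfl | rfl <;> rcases hb with rfl | rfl <;> norm_num

lemma jr_recip {a b : ℕ} (ha : Odd a) (hb : Odd b) : jr a b = jr b a * sg (ch a) (ch b) := by
  have := recip ha hb
  unfold jr sg ch
  linarith

lemma pm_abs {a : ℝ} (ha : a = 1 ∨ a = -1) : |a| ≤ 1 := by
  rcases ha with rfl | rfl <;> norm_num

lemma fourier (g : (V → ℝ) → ℝ) (hg : ∀ t, (∀ x, t x = 1 ∨ t x = -1) → |g t| ≤ 1) :
    ∃ c : Finset V → ℝ, (∀ s, |c s| ≤ 1) ∧ ∀ t, (∀ x, t x = 1 ∨ t x = -1) → g t = ∑ s, c s * ∏ x ∈ s, t x := by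
  let ε : Finset V → V → ℝ := fun T x => if x ∈ T then -1 else 1
  have hε : ∀ T x, ε T x = 1 ∨ ε T x = -1 := by
    intro T x
    simp only [ε]; split_ifs <;> simp
  refine ⟨fun s => (∑ T, g (ε T) * ∏ x ∈ s, ε T x) / 2 ^ Fintype.card V, fun s => ?_, fun t ht => ?_⟩
  · rw [abs_div, abs_of_pos (by positivity : (0 : ℝ) < 2 ^ Fintype.card V), div_le_one (by positivity)]
    refine (abs_sum_le_sum_abs _ _).trans ?_
    calc ∑ T : Finset V, |g (ε T) * ∏ x ∈ s, ε T x| ≤ ∑ T : Finset V, (1 : ℝ) := by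
          refine sum_le_sum fun T _ => ?_
          rw [abs_mul]
          exact mul_le_one₀ (hg _ (hε T)) (abs_nonneg _) (prod_abs_le_one _ _ fun x _ => pm_abs (hε T x))
      _ = 2 ^ Fintype.card V := by simp
  · have h1 : ∑ T, g (ε T) * (∏ x, (1 + ε T x * t x)) = g t * 2 ^ Fintype.card V := by
      rw [sum_eq_single (univ.filter fun x => t x = -1)]
      · have he : ε (univ.filter fun x => t x = -1) = t := by
          ext x
          simp only [ε, mem_filter, mem_univ, true_and]
          split_ifs with h
          · exact h.symm
          · exact ((ht x).resolve_right h).symm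
        rw [he]
        congr 1
        rw [← card_univ, ← prod_const]
        refine prod_congr rfl fun x _ => ?_
        rcases ht x with h | h <;> rw [h] <;> norm_num
      · intro T _ hT
        have : ∃ x, ¬ (x ∈ T ↔ t x = -1) := by
          by_contra hc
          push Not at hc
          apply hT
          ext x
          simp [hc x]
        obtain ⟨x, hx⟩ := this
        rw [prod_eq_zero (mem_univ x), mul_zero]
        simp only [ε]
        by_cases hxT : x ∈ T
        · have h := (ht x).resolve_right (fun h => hx ⟨fun _ => h, fun _ => hxT⟩)
          rw [if_pos hxT, h]; norm_num
        · have h : t x = -1 := by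
            by_contra h
            exact hx ⟨fun h => absurd h hxT, fun h' => absurd h' h⟩
          rw [if_neg hxT, h]; norm_num
      · simp
    have h2 : g t = (∑ T, g (ε T) * (∏ x, (1 + ε T x * t x))) / 2 ^ Fintype.card V := by
      rw [h1]; field_simp
    rw [h2]
    simp only [prod_one_add, powerset_univ, prod_mul_distrib, mul_sum, sum_div, sum_mul]
    rw [sum_comm]
    refine sum_congr rfl fun s _ => sum_congr rfl fun T _ => ?_
    ring

lemma prod_pairs (e : V ↪ ℕ) (F : V → V → ℝ) (hF : ∀ x, F x x = 1) :
    ∏ x, ∏ y, F x y = ∏ x, ∏ y, if e x < e y then F x y * F y x else 1 := by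
  have h1 : ∏ x, ∏ y, F x y = (∏ x, ∏ y, if e x < e y then F x y else 1) * ∏ x, ∏ y, if e y < e x then F x y else 1 := by
    simp only [← prod_mul_distrib]
    refine prod_congr rfl fun x _ => prod_congr rfl fun y _ => ?_
    rcases lt_trichotomy (e x) (e y) with h | h | h
    · rw [if_pos h, if_neg (by omega), mul_one]
    · rw [if_neg (by omega), if_neg (by omega), e.injective h, hF, one_mul]
    · rw [if_neg (by omega), if_pos h, one_mul]
  rw [h1, prod_comm (f := fun x y => if e y < e x then F x y else 1), ← prod_mul_distrib]
  refine prod_congr rfl fun x _ => ?_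
  rw [← prod_mul_distrib]
  refine prod_congr rfl fun y _ => ?_
  split_ifs <;> simp

def EE (ev : V → V → ℕ) (r : V → ℕ) (x : V) : ℕ := ∏ y, r y ^ (ev x y + ev y x)

lemma jr_prod_right (a : ℕ) (r n : V → ℕ) (hr : ∀ y, 0 < r y) (s : Finset V) : jr a (∏ y ∈ s, r y ^ n y) = ∏ y ∈ s, jr a (r y) ^ n y := by
  induction s using Finset.induction_on with
  | empty => simp [jr_one_right]
  | insert x s hx ih =>
    rw [prod_insert hx, prod_insert hx, jr_mul_right _ (pow_pos (hr _) _) (prod_pos fun y _ => pow_pos (hr _) _), ih]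
    congr 1
    unfold jr
    rw [jacobiSym.pow_right]
    push_cast; rfl

/-- the multiplicative coefficient -/
noncomputable def ph (κ : ℝ) (ii jj : V → ℕ) (ev : V → V → ℕ) (r : V → ℕ) (s : Finset V) (x : V) (a : ℕ) : ℝ :=
  if Nat.Coprime a (2 * ∏ w, r w) then kw κ a * psi (ii x + if x ∈ s then 1 else 0) (jj x) (EE ev r x) a else 0

lemma jr_sq {a b : ℕ} (h : Nat.Coprime a b) : jr a b * jr a b = 1 := by
  unfold jr
  have : jacobiSym (a : ℤ) b ^ 2 = 1 := jacobiSym.sq_one (by simpa [Int.gcd_natCast_natCast] using h)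
  rw [pow_two] at this
  exact_mod_cast this

lemma TT_rd {κ : ℝ} (ii jj : V → ℕ) (ev : V → V → ℕ) (hev : ∀ w, ev w w = 0) (U : Finset V)
    (hsym : ∀ x ∈ U, ∀ y ∈ U, ev x y = ev y x) {r : V → ℕ} (hr : ∀ w, 0 < r w) (hrU : ∀ x ∈ U, r x = 1)
    (hsq : Squarefree (∏ w, r w)) (hodd : Odd (∏ w, r w)) :
    ∃ c : Finset V → ℝ, (∀ s, |c s| ≤ 1) ∧ ∀ d : V → ℕ, (∀ x, 0 < d x) → (∀ x ∉ U, d x = 1) →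
      TT κ ii jj ev (r * d) = if Squarefree (∏ x, d x) then TT κ ii jj ev r * ∑ s, c s * ∏ x, ph κ ii jj ev r s x (d x) else 0 := by
  let e : V ↪ ℕ := ⟨fun x => (Fintype.equivFin V x : ℕ), fun x y h => (Fintype.equivFin V).injective (Fin.ext h)⟩
  let g : (V → ℝ) → ℝ := fun t => (∏ x, ∏ y, sg (ch (r y)) (t x) ^ ev x y) * ∏ x, ∏ y, if e x < e y then sg (t y) (t x) ^ ev x y else 1
  have hrodd : ∀ x, Odd (r x) := fun x => hodd.of_dvd_nat (dvd_prod_of_mem r (mem_univ x))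
  have hg : ∀ t, (∀ x, t x = 1 ∨ t x = -1) → |g t| ≤ 1 := by
    intro t ht
    simp only [g]
    rw [abs_mul]
    refine mul_le_one₀ (prod_abs_le_one _ _ fun x _ => prod_abs_le_one _ _ fun y _ => ?_) (abs_nonneg _)
      (prod_abs_le_one _ _ fun x _ => prod_abs_le_one _ _ fun y _ => ?_)
    · rw [abs_pow]
      exact pow_le_one₀ (abs_nonneg _) (pm_abs (sg_pm (ch_odd (hrodd y)) (ht x)))
    · split_ifs
      · rw [abs_pow]
        exact pow_le_one₀ (abs_nonneg _) (pm_abs (sg_pm (ht y) (ht x)))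
      · simp
  obtain ⟨c, hc, hcg⟩ := fourier g hg
  refine ⟨c, hc, fun d hd hdU => ?_⟩
  have hP : ∏ w, (r * d) w = (∏ w, r w) * ∏ w, d w := by
    simp only [Pi.mul_apply, prod_mul_distrib]
  by_cases hds : Squarefree (∏ x, d x)
  swap
  · rw [if_neg hds]
    unfold TT
    rw [if_neg]
    exact fun h => hds (rd_sqf h.1)
  rw [if_pos hds]
  by_cases hco : Nat.Coprime (∏ x, d x) (2 * ∏ w, r w)
  swap
  · have hx : ∃ x, ¬ Nat.Coprime (d x) (2 * ∏ w, r w) := by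
      by_contra hcon
      push Not at hcon
      exact hco (Nat.Coprime.prod_left fun x _ => hcon x)
    obtain ⟨x, hx⟩ := hx
    have h0 : ∀ s, ∏ x, ph κ ii jj ev r s x (d x) = 0 := fun s => prod_eq_zero (mem_univ x) (by unfold ph; rw [if_neg hx])
    simp only [h0, mul_zero, sum_const_zero]
    unfold TT
    rw [if_neg]
    rw [hP]
    rintro ⟨h1, h2⟩
    apply hco
    refine Nat.Coprime.mul_right ?_ (Nat.coprime_of_squarefree_mul h1).symm
    exact Nat.coprime_two_right.mpr (Nat.odd_mul.mp h2).2
  have hdo : Odd (∏ x, d x) := Nat.coprime_two_right.mp (Nat.Coprime.coprime_mul_right_right hco)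
  have hdR : Nat.Coprime (∏ x, d x) (∏ w, r w) := Nat.Coprime.coprime_mul_left_right hco
  have hdodd : ∀ x, Odd (d x) := fun x => hdo.of_dvd_nat (dvd_prod_of_mem d (mem_univ x))
  have hdx : ∀ x, Nat.Coprime (d x) (2 * ∏ w, r w) := fun x => Nat.Coprime.coprime_dvd_left (dvd_prod_of_mem d (mem_univ x)) hco
  have hcond : Squarefree (∏ w, (r * d) w) ∧ Odd (∏ w, (r * d) w) := by
    rw [hP]
    exact ⟨(Nat.squarefree_mul_iff).mpr ⟨hdR.symm, hsq, hds⟩, hodd.mul hdo⟩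
  -- Fourier form
  have hF : ∑ s, c s * ∏ x, ph κ ii jj ev r s x (d x) = (∏ x, kw κ (d x) * psi (ii x) (jj x) (EE ev r x) (d x)) * g (fun x => ch (d x)) := by
    rw [hcg _ (fun x => ch_odd (hdodd x)), mul_sum]
    refine sum_congr rfl fun s _ => ?_
    have : ∏ x, ph κ ii jj ev r s x (d x) = (∏ x, kw κ (d x) * psi (ii x) (jj x) (EE ev r x) (d x)) * ∏ x ∈ s, ch (d x) := by
      have hs : ∏ x ∈ s, ch (d x) = ∏ x, if x ∈ s then ch (d x) else 1 := by simp
      rw [hs, ← prod_mul_distrib]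
      refine prod_congr rfl fun x _ => ?_
      unfold ph
      rw [if_pos (hdx x)]
      split_ifs
      · unfold psi ch; push_cast; ring
      · unfold psi; push_cast; ring
    rw [this]; ring
  rw [hF]
  unfold TT
  rw [if_pos hcond, if_pos ⟨hsq, hodd⟩, prod_hh_mul, BB_mul_left _ _ _ _ hr hd, BB_mul_right, BB_mul_right]
  · have h1 : ∏ x, (kw κ (d x) * psi (ii x) (jj x) (EE ev r x) (d x)) =
        (∏ x, hh κ (ii x) (jj x) (d x)) * ∏ x, ∏ y, jr (d x) (r y) ^ (ev x y + ev y x) := by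
      rw [← prod_mul_distrib]
      refine prod_congr rfl fun x _ => ?_
      rw [← jr_prod_right _ _ _ hr]
      unfold hh psi EE jr
      simp only [jacobiSym.one_right]
      push_cast; ring
    have h2 : BB ev r d * BB ev d r = (∏ x, ∏ y, jr (d x) (r y) ^ (ev x y + ev y x)) * ∏ x, ∏ y, sg (ch (r y)) (ch (d x)) ^ ev x y := by
      unfold BB
      rw [prod_comm]
      simp only [← prod_mul_distrib]
      refine prod_congr rfl fun x _ => prod_congr rfl fun y _ => ?_
      rw [jr_recip (hrodd y) (hdodd x), mul_pow, pow_add]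
      ring
    have h3 : BB ev d d = ∏ x, ∏ y, if e x < e y then sg (ch (d y)) (ch (d x)) ^ ev x y else 1 := by
      unfold BB
      rw [prod_pairs e _ (fun x => by rw [hev, pow_zero])]
      refine prod_congr rfl fun x _ => prod_congr rfl fun y _ => ?_
      split_ifs with hxy
      · by_cases hx : x ∈ U
        · by_cases hy : y ∈ U
          · have hne : x ≠ y := by rintro rfl; exact lt_irrefl _ hxy
            have hcop : Nat.Coprime (d x) (d y) := by
              have h4 : d x * d y ∣ ∏ w, d w := by
                rw [← prod_pair hne]
                exact prod_dvd_prod_of_subset _ _ _ (subset_univ _)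
              exact Nat.coprime_of_squarefree_mul (hds.squarefree_of_dvd h4)
            rw [hsym y hy x hx, ← mul_pow, jr_recip (hdodd y) (hdodd x), mul_right_comm, jr_sq hcop, one_mul]
          · rw [hdU y hy, jr_one_left, jr_one_right]
            simp [ch_one, sg_one_left]
        · rw [hdU x hx, jr_one_left, jr_one_right]
          simp [ch_one, sg_one_right]
      · rfl
    simp only [g]
    rw [h1, h3]
    calc _ = (∏ x, hh κ (ii x) (jj x) (r x)) * (∏ x, hh κ (ii x) (jj x) (d x)) * (BB ev r r * (BB ev r d * BB ev d r) * 
              ∏ x, ∏ y, if e x < e y then sg (ch (d y)) (ch (d x)) ^ ev x y else 1) := by ring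
      _ = _ := by rw [h2]; ring
  · intro x
    by_cases hx : x ∈ U
    · exact Or.inl (hrU x hx)
    · exact Or.inr (hdU x hx)

end
end AC

namespace AC
open Finset

section
variable {V : Type} [Fintype V] [DecidableEq V]

lemma EE_pos (ev : V → V → ℕ) {r : V → ℕ} (hr : ∀ w, 0 < r w) (x : V) : 0 < EE ev r x :=
  prod_pos fun y _ => pow_pos (hr y) _

lemma EE_odd (ev : V → V → ℕ) {r : V → ℕ} (hodd : Odd (∏ w, r w)) (x : V) : Odd (EE ev r x) := by
  unfold EE
  refine prod_induction _ Odd (fun _ _ => Odd.mul) odd_one fun y _ => ?_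
  exact (hodd.of_dvd_nat (dvd_prod_of_mem r (mem_univ y))).pow

lemma EE_le (ev : V → V → ℕ) (hev1 : ∀ x y, ev x y ≤ 1) {r : V → ℕ} (hr : ∀ w, 0 < r w) (x : V) : EE ev r x ≤ (∏ w, r w) ^ 2 := by
  unfold EE
  rw [← prod_pow]
  refine prod_le_prod (fun _ _ => Nat.zero_le _) fun y _ => ?_
  exact Nat.pow_le_pow_right (hr y) (by have := hev1 x y; have := hev1 y x; omega)

lemma EE_nonsq (ev : V → V → ℕ) {r : V → ℕ} (hr : ∀ w, 0 < r w) (hsq : Squarefree (∏ w, r w)) {x x' y : V} (hy : r y ≠ 1)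
    (hn : (ev x y + ev y x) % 2 ≠ (ev x' y + ev y x') % 2) : ¬ IsSquare (EE ev r x * EE ev r x') := by
  rintro ⟨b, hb⟩
  obtain ⟨p, hp, hpy⟩ := Nat.exists_prime_and_dvd hy
  have hE : EE ev r x * EE ev r x' = ∏ w, r w ^ ((ev x w + ev w x) + (ev x' w + ev w x')) := by
    unfold EE
    rw [← prod_mul_distrib]
    exact prod_congr rfl fun w _ => (pow_add _ _ _).symm
  have h1 : (EE ev r x * EE ev r x').factorization p = (ev x y + ev y x) + (ev x' y + ev y x') := by
    rw [hE, Nat.factorization_prod (fun w _ => (pow_pos (hr w) _).ne'), Finsupp.finsetSum_apply, sum_eq_single y]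
    · rw [Nat.factorization_pow, Finsupp.smul_apply, smul_eq_mul]
      have : (r y).factorization p = 1 := by
        have hs : Squarefree (r y) := hsq.squarefree_of_dvd (dvd_prod_of_mem r (mem_univ y))
        exact le_antisymm (hs.natFactorization_le_one p) ((hp.dvd_iff_one_le_factorization (hr y).ne').mp hpy)
      rw [this, mul_one]
    · intro w _ hw
      rw [Nat.factorization_pow, Finsupp.smul_apply, smul_eq_mul]
      have : (r w).factorization p = 0 := by
        apply Nat.factorization_eq_zero_of_not_dvd
        intro hpw
        have h4 : r w * r y ∣ ∏ w, r w := by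
          rw [← prod_pair hw]
          exact prod_dvd_prod_of_subset _ _ _ (subset_univ _)
        have := Nat.coprime_of_squarefree_mul (hsq.squarefree_of_dvd h4)
        exact hp.one_lt.ne' (Nat.eq_one_of_dvd_coprimes this hpw hpy)
      rw [this, mul_zero]
    · simp
  have hb0 : b ≠ 0 := by
    rintro rfl
    have := Nat.mul_pos (EE_pos ev hr x) (EE_pos ev hr x')
    omega
  rw [hb, Nat.factorization_mul hb0 hb0, Finsupp.add_apply] at h1
  omega

lemma ph_one (κ : ℝ) (ii jj : V → ℕ) (ev : V → V → ℕ) (r : V → ℕ) (s : Finset V) (x : V) : ph κ ii jj ev r s x 1 = 1 := by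
  unfold ph
  rw [if_pos (Nat.coprime_one_left _), kw_one, psi_one]; simp

lemma ph_mul (κ : ℝ) (ii jj : V → ℕ) (ev : V → V → ℕ) (r : V → ℕ) (s : Finset V) (x : V) (a b : ℕ) (hab : Nat.Coprime a b) :
    ph κ ii jj ev r s x (a * b) = ph κ ii jj ev r s x a * ph κ ii jj ev r s x b := by
  unfold ph
  by_cases ha : Nat.Coprime a (2 * ∏ w, r w)
  · by_cases hb : Nat.Coprime b (2 * ∏ w, r w)
    · rw [if_pos (ha.mul_left hb), if_pos ha, if_pos hb, kw_mul κ hab, psi_mul]; push_cast; ring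
    · rw [if_neg hb, if_neg (fun h => hb (Nat.Coprime.coprime_mul_left h)), mul_zero]
  · rw [if_neg ha, if_neg (fun h => ha (Nat.Coprime.coprime_mul_right h)), zero_mul]

lemma psi_tri (i j E n : ℕ) : psi i j E n = 0 ∨ psi i j E n = 1 ∨ psi i j E n = -1 := by
  have := psi_abs i j E n
  rw [abs_le] at this
  omega

lemma psi_prod (i j i' j' : ℕ) {E E' : ℕ} (hE : 0 < E) (hE' : 0 < E') (n : ℕ) :
    psi (i + i') (j + j') (E * E') n = psi i j E n * psi i' j' E' n := by
  unfold psi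
  have := NeZero.mk hE.ne'
  have := NeZero.mk hE'.ne'
  rw [jacobiSym.mul_right]; ring

lemma inner3 {κ : ℝ} (h0 : 0 ≤ κ) (h1 : κ ≤ 1 / 2) (ii jj : V → ℕ) (ev : V → V → ℕ) (hev1 : ∀ x y, ev x y ≤ 1)
    (hev : ∀ w, ev w w = 0) (U : Finset V) (hU : U.card * κ = 1)
    (hsym : ∀ x ∈ U, ∀ y ∈ U, ev x y = ev y x) {r : V → ℕ} (hr : ∀ w, 0 < r w) (hrU : ∀ x ∈ U, r x = 1)
    {x x' y : V} (hx : x ∈ U) (hx' : x' ∈ U) (hy : r y ≠ 1) (hn : (ev x y + ev y x) % 2 ≠ (ev x' y + ev y x') % 2)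
    {X Y : ℕ} (hYX : Y ≤ X) (hY : 1 ≤ Y) :
    |∑ d ∈ RB Uᶜ X with ∏ x, d x ≤ Y, TT κ ii jj ev (r * d)| ≤
      2 ^ Fintype.card V * (4 * Real.exp 8 * Y * (1 + Real.log Y) ^ (-κ) * (1 + Real.log (8 * ((∏ w, r w : ℕ) : ℝ) ^ 4))) := by
  have hX : 1 ≤ X := hY.trans hYX
  have hlY : 0 ≤ Real.log Y := Real.log_natCast_nonneg Y
  have hR0 : 0 < ∏ w, r w := prod_pos fun w _ => hr w
  have hR1 : (1 : ℝ) ≤ ((∏ w, r w : ℕ) : ℝ) := by exact_mod_cast hR0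
  have hlog : 0 ≤ Real.log (8 * ((∏ w, r w : ℕ) : ℝ) ^ 4) := Real.log_nonneg (by nlinarith [one_le_pow₀ hR1 (n := 4)])
  by_cases hgood : Squarefree (∏ w, r w) ∧ Odd (∏ w, r w)
  swap
  · rw [sum_eq_zero, abs_zero]
    · positivity
    · intro d _
      unfold TT
      rw [if_neg]
      rintro ⟨g1, g2⟩
      simp only [Pi.mul_apply, prod_mul_distrib] at g1 g2
      exact hgood ⟨g1.squarefree_of_dvd (dvd_mul_right _ _), (Nat.odd_mul.mp g2).1⟩
  obtain ⟨hsq, hodd⟩ := hgood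
  obtain ⟨c, hc, hcT⟩ := TT_rd (κ := κ) ii jj ev hev U hsym hr hrU hsq hodd
  have hTr : |TT κ ii jj ev r| ≤ 1 := by
    refine (TT_abs h0 ii jj ev r).trans ?_
    split_ifs
    · exact prod_le_one (fun w _ => kw_nonneg h0 _) fun w _ => kw_le_one h0 (by linarith) _
  have hsum : ∑ d ∈ RB Uᶜ X with ∏ x, d x ≤ Y, TT κ ii jj ev (r * d) =
      TT κ ii jj ev r * ∑ s, c s * ∑ m ∈ SF Y, ∏ p ∈ m.primeFactors, ∑ x ∈ U, ph κ ii jj ev r s x p := by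
    have e1 : ∀ s : Finset V, _ := fun s => tupU hYX hX U (fun x => ph κ ii jj ev r s x) (ph_one κ ii jj ev r s) (ph_mul κ ii jj ev r s)
    simp only [← e1]
    have e2 : ∑ d ∈ RB Uᶜ X with ∏ x, d x ≤ Y, TT κ ii jj ev (r * d) =
        ∑ d ∈ RB Uᶜ X with (∏ x, d x ≤ Y ∧ Squarefree (∏ x, d x)), TT κ ii jj ev r * ∑ s, c s * ∏ x, ph κ ii jj ev r s x (d x) := by
      rw [← filter_filter, sum_filter (fun d : V → ℕ => Squarefree (∏ x, d x))]
      refine sum_congr rfl fun d hd => ?_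
      have hd' := (mem_RB hX).mp (mem_filter.mp hd).1
      exact hcT d (fun x => (hd'.1 x).1) (fun x hx => hd'.2 x (by simpa using hx))
    rw [e2, ← mul_sum, sum_comm]
    simp only [mul_sum]
  rw [hsum, abs_mul]
  refine (mul_le_of_le_one_left (abs_nonneg _) hTr).trans ((abs_sum_le_sum_abs _ _).trans ?_)
  have hs : ∀ s ∈ (univ : Finset (Finset V)), |c s * ∑ m ∈ SF Y, ∏ p ∈ m.primeFactors, ∑ x ∈ U, ph κ ii jj ev r s x p| ≤
      4 * Real.exp 8 * Y * (1 + Real.log Y) ^ (-κ) * (1 + Real.log (8 * ((∏ w, r w : ℕ) : ℝ) ^ 4)) := by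
    intro s _
    rw [abs_mul]
    refine (mul_le_of_le_one_left (abs_nonneg _) (hc s)).trans ((abs_sum_le_sum_abs _ _).trans ?_)
    set i := fun x => ii x + if x ∈ s then 1 else 0 with hi
    set f : ℕ → ℝ := fun p => if p.Prime ∧ Nat.Coprime p (2 * ∏ w, r w) then |∑ x ∈ U, κ * (psi (i x) (jj x) (EE ev r x) p : ℝ)| else 0 with hf
    have hf0 : ∀ p, 0 ≤ f p := by
      intro p; simp only [hf]; split_ifs
      · exact abs_nonneg _
      · exact le_rfl
    have hf2 : ∀ p, f p ≤ 1 := by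
      intro p
      simp only [hf]
      split_ifs
      · refine (abs_sum_le_sum_abs _ _).trans ?_
        calc ∑ x ∈ U, |κ * (psi (i x) (jj x) (EE ev r x) p : ℝ)| ≤ ∑ x ∈ U, κ := by
              refine sum_le_sum fun w _ => ?_
              rw [abs_mul, abs_of_nonneg h0]
              exact mul_le_of_le_one_right h0 (psi_abs_real _ _ _ _)
          _ = 1 := by rw [sum_const, nsmul_eq_mul, hU]
      · norm_num
    have hne : x ≠ x' := by rintro rfl; exact hn rfl
    have hf3 : ∀ p, f p ≤ 1 - κ + κ * psi (i x + i x') (jj x + jj x') (EE ev r x * EE ev r x') p := by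
      intro p
      have hab := abs_le.mp (psi_abs_real (i x + i x') (jj x + jj x') (EE ev r x * EE ev r x') p)
      simp only [hf]
      split_ifs with hp
      · have hsub : ({x, x'} : Finset V) ⊆ U := by
          intro w hw; rw [mem_insert, mem_singleton] at hw; rcases hw with rfl | rfl <;> assumption
        rw [← sum_sdiff hsub, sum_pair hne]
        refine (abs_add_le _ _).trans ?_
        have b1 : |∑ w ∈ U \ {x, x'}, κ * (psi (i w) (jj w) (EE ev r w) p : ℝ)| ≤ 1 - 2 * κ := by
          refine (abs_sum_le_sum_abs _ _).trans ?_
          calc ∑ w ∈ U \ {x, x'}, |κ * (psi (i w) (jj w) (EE ev r w) p : ℝ)| ≤ ∑ w ∈ U \ {x, x'}, κ := by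
                refine sum_le_sum fun w _ => ?_
                rw [abs_mul, abs_of_nonneg h0]
                exact mul_le_of_le_one_right h0 (psi_abs_real _ _ _ _)
            _ = 1 - 2 * κ := by
                have h2 : ∑ w ∈ U \ {x, x'}, κ + ∑ w ∈ ({x, x'} : Finset V), κ = ∑ w ∈ U, κ := sum_sdiff hsub
                rw [sum_pair hne, sum_const (s := U), nsmul_eq_mul, hU] at h2
                linarith
        have b2 : |κ * (psi (i x) (jj x) (EE ev r x) p : ℝ) + κ * (psi (i x') (jj x') (EE ev r x') p : ℝ)| ≤
            κ * (1 + psi (i x + i x') (jj x + jj x') (EE ev r x * EE ev r x') p) := by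
          rw [← mul_add, abs_mul, abs_of_nonneg h0]
          refine mul_le_mul_of_nonneg_left ?_ h0
          rw [psi_prod _ _ _ _ (EE_pos ev hr x) (EE_pos ev hr x')]
          rcases psi_tri (i x) (jj x) (EE ev r x) p with h | h | h <;> rcases psi_tri (i x') (jj x') (EE ev r x') p with h' | h' | h' <;>
            rw [h, h'] <;> norm_num
        linarith
      · nlinarith
    have hEodd : Odd (EE ev r x * EE ev r x') := (EE_odd ev hodd x).mul (EE_odd ev hodd x')
    have hH := HT2 f hf0 hf2 Y hY κ h0 h1 (i x + i x') (jj x + jj x') (EE ev r x * EE ev r x') hEodd (EE_nonsq ev hr hsq hy hn) hf3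
    calc ∑ m ∈ SF Y, |∏ p ∈ m.primeFactors, ∑ x ∈ U, ph κ ii jj ev r s x p| = ∑ m ∈ SF Y, ∏ p ∈ m.primeFactors, f p := by
          refine sum_congr rfl fun m _ => ?_
          rw [abs_prod]
          refine prod_congr rfl fun p hp => ?_
          have hp := Nat.prime_of_mem_primeFactors hp
          simp only [hf]
          by_cases hco : Nat.Coprime p (2 * ∏ w, r w)
          · rw [if_pos ⟨hp, hco⟩]
            congr 1
            refine sum_congr rfl fun w _ => ?_
            unfold ph
            rw [if_pos hco, kw_prime κ hp]
          · rw [if_neg (fun h => hco h.2), sum_eq_zero, abs_zero]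
            intro w _
            unfold ph
            rw [if_neg hco]
      _ ≤ _ := hH
      _ ≤ _ := by
          refine mul_le_mul_of_nonneg_left ?_ (by positivity)
          have hE0 : 0 < EE ev r x * EE ev r x' := Nat.mul_pos (EE_pos ev hr x) (EE_pos ev hr x')
          have hE1 : (0 : ℝ) < ((EE ev r x * EE ev r x' : ℕ) : ℝ) := by exact_mod_cast hE0
          have hE2 : ((EE ev r x * EE ev r x' : ℕ) : ℝ) ≤ ((∏ w, r w : ℕ) : ℝ) ^ 4 := by
            have : EE ev r x * EE ev r x' ≤ (∏ w, r w) ^ 4 := by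
              calc _ ≤ (∏ w, r w) ^ 2 * (∏ w, r w) ^ 2 := Nat.mul_le_mul (EE_le ev hev1 hr x) (EE_le ev hev1 hr x')
                _ = _ := by ring
            exact_mod_cast this
          have := Real.log_le_log (by positivity) (mul_le_mul_of_nonneg_left hE2 (by norm_num : (0 : ℝ) ≤ 8))
          linarith
  refine (sum_le_sum hs).trans (le_of_eq ?_)
  rw [sum_const, card_univ, Fintype.card_finset, nsmul_eq_mul]
  push_cast; rfl

lemma case3 {κ : ℝ} (h0 : 0 ≤ κ) (h1 : κ ≤ 1 / 2) (ii jj : V → ℕ) (ev : V → V → ℕ) (hev1 : ∀ x y, ev x y ≤ 1)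
    (hev : ∀ w, ev w w = 0) (U : Finset V) (hU : U.card * κ = 1)
    (hsym : ∀ x ∈ U, ∀ y ∈ U, ev x y = ev y x)
    (hlink : ∀ y ∉ U, ∃ x ∈ U, ∃ x' ∈ U, (ev x y + ev y x) % 2 ≠ (ev x' y + ev y x') % 2)
    {X z : ℕ} (hz : 1 ≤ z) (hzV : (z ^ Fintype.card V) ^ 2 ≤ X) (hzX : z ≤ X) :
    |∑ D ∈ RB (∅ : Finset V) X with (∏ x, D x ≤ X ∧ big z D ⊆ U), TT κ ii jj ev D| ≤
      X + 2 ^ Fintype.card V * 16 * Real.exp 8 * X * (1 + Real.log X) ^ (-κ) * (4 + 4 * Fintype.card V * Real.log z) * (1 + Real.log z) ^ Fintype.card V := by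
  have hX : 1 ≤ X := hz.trans hzX
  have hlX : 0 ≤ Real.log X := Real.log_natCast_nonneg X
  have hlz : 0 ≤ Real.log z := Real.log_natCast_nonneg z
  rw [sum_filter, RB_fubini U hX]
  set B : ℝ := 2 ^ Fintype.card V * 16 * Real.exp 8 * X * (1 + Real.log X) ^ (-κ) * (4 + 4 * Fintype.card V * Real.log z) with hB
  have hB0 : 0 ≤ B := by positivity
  have hin : ∀ r ∈ RB U X, |∑ d ∈ RB Uᶜ X, (if ∏ x, (r * d) x ≤ X ∧ big z (r * d) ⊆ U then TT κ ii jj ev (r * d) else 0)| ≤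
      if ∀ x, r x ≤ z then (if r = 1 then (X : ℝ) else 0) + B * (1 / ((∏ x, r x : ℕ) : ℝ)) else 0 := by
    intro r hr
    have hr' := (mem_RB hX).mp hr
    have hbig : ∀ d ∈ RB Uᶜ X, (big z (r * d) ⊆ U ↔ ∀ x, r x ≤ z) := by
      intro d hd
      have hd' := (mem_RB hX).mp hd
      constructor
      · intro hb x
        by_cases hx : x ∈ U
        · rw [hr'.2 x hx]; exact hz
        · have : x ∉ big z (r * d) := fun h => hx (hb h)
          simp only [big, mem_filter, mem_univ, true_and, Pi.mul_apply, hd'.2 x (by simpa using hx), mul_one, not_lt] at this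
          exact this
      · intro h x hxb
        by_contra hx
        simp only [big, mem_filter, mem_univ, true_and, Pi.mul_apply, hd'.2 x (by simpa using hx), mul_one] at hxb
        have := h x
        omega
    split_ifs with hrz hr1
    · -- main term
      subst hr1
      have : |∑ d ∈ RB Uᶜ X, (if ∏ x, (1 * d) x ≤ X ∧ big z (1 * d) ⊆ U then TT κ ii jj ev (1 * d) else 0)| ≤ X := by
        refine (abs_sum_le_sum_abs _ _).trans ?_
        calc ∑ d ∈ RB Uᶜ X, |if ∏ x, (1 * d) x ≤ X ∧ big z (1 * d) ⊆ U then TT κ ii jj ev (1 * d) else 0|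
            ≤ ∑ d ∈ RB Uᶜ X, if (∏ x, d x ≤ X ∧ Squarefree (∏ x, d x)) then ∏ x, kw κ (d x) else 0 := by
              refine sum_le_sum fun d _ => ?_
              rw [one_mul]
              have hp0 : 0 ≤ ∏ x, kw κ (d x) := prod_nonneg fun x _ => kw_nonneg h0 _
              by_cases ha : ∏ x, d x ≤ X ∧ big z d ⊆ U
              · rw [if_pos ha]
                refine (TT_abs h0 ii jj ev d).trans ?_
                by_cases hs : Squarefree (∏ x, d x)
                · rw [if_pos hs, if_pos ⟨ha.1, hs⟩]
                · rw [if_neg hs, if_neg (fun h => hs h.2)]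
              · rw [if_neg ha, abs_zero]
                split_ifs
                · exact hp0
                · exact le_rfl
          _ = ∑ m ∈ SF X, ∏ p ∈ m.primeFactors, (U.card * κ) := by
              rw [← sum_filter, sum_kwU le_rfl hX U κ]
          _ = (SF X).card := by simp [hU]
          _ ≤ X := by
              have : (SF X).card ≤ (Ioc 0 X).card := card_le_card (fun m hm => by
                rw [mem_SF] at hm; exact mem_Ioc.mpr hm.1)
              rw [Nat.card_Ioc] at this
              exact_mod_cast this
      have h2 : 0 ≤ B * (1 / ((∏ x, (1 : V → ℕ) x : ℕ) : ℝ)) := by positivity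
      linarith
    · have hR0 : 0 < ∏ x, r x := RB_prod_pos hX hr
      have hrz' : r ∈ RB U z := by rw [← RB_filter U hz hzX]; exact mem_filter.mpr ⟨hr, hrz⟩
      have hRz := RB_prod_le hz hrz'
      have hR2 : (∏ x, r x) ^ 2 ≤ X := (Nat.pow_le_pow_left hRz 2).trans hzV
      obtain ⟨hY1, hY2⟩ := floor_bound X _ hR0 hR2 κ h0 (by linarith)
      have hy : ∃ y, r y ≠ 1 := by
        by_contra hc
        push Not at hc
        exact hr1 (funext hc)
      obtain ⟨y, hy⟩ := hy
      obtain ⟨x, hx, x', hx', hn⟩ := hlink y (fun h => hy (hr'.2 y h))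
      have hI := inner3 h0 h1 ii jj ev hev1 hev U hU hsym (fun w => (hr'.1 w).1) hr'.2 hx hx' hy hn (Nat.div_le_self X (∏ x, r x)) hY1
      have hS : ∑ d ∈ RB Uᶜ X, (if ∏ x, (r * d) x ≤ X ∧ big z (r * d) ⊆ U then TT κ ii jj ev (r * d) else 0) =
          ∑ d ∈ RB Uᶜ X with ∏ x, d x ≤ X / ∏ x, r x, TT κ ii jj ev (r * d) := by
        rw [sum_filter]
        refine sum_congr rfl fun d hd => ?_
        by_cases hle : ∏ x, d x ≤ X / ∏ x, r x
        · rw [if_pos hle, if_pos ⟨(rd_le hR0).mpr hle, (hbig d hd).mpr hrz⟩]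
        · rw [if_neg hle, if_neg (fun h => hle ((rd_le hR0).mp h.1))]
      rw [hS, zero_add]
      refine hI.trans ?_
      set Y := X / ∏ x, r x with hY
      have hRr : (0 : ℝ) < ((∏ x, r x : ℕ) : ℝ) := by exact_mod_cast hR0
      have hlogR : Real.log (8 * ((∏ w, r w : ℕ) : ℝ) ^ 4) ≤ 3 + 4 * Fintype.card V * Real.log z := by
        rw [Real.log_mul (by norm_num) (by positivity), Real.log_pow]
        have l8 : Real.log 8 ≤ 3 := by
          have : (8 : ℝ) = 2 ^ 3 := by norm_num
          rw [this, Real.log_pow]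
          have := Real.log_two_lt_d9
          push_cast; linarith
        have lR : Real.log ((∏ w, r w : ℕ) : ℝ) ≤ Fintype.card V * Real.log z := by
          rw [← Real.log_pow]
          apply Real.log_le_log hRr
          exact_mod_cast hRz
        push_cast at lR ⊢
        linarith
      calc 2 ^ Fintype.card V * (4 * Real.exp 8 * Y * (1 + Real.log Y) ^ (-κ) * (1 + Real.log (8 * ((∏ w, r w : ℕ) : ℝ) ^ 4)))
          = 2 ^ Fintype.card V * (4 * Real.exp 8 * (Y * (1 + Real.log Y) ^ (-κ)) * (1 + Real.log (8 * ((∏ w, r w : ℕ) : ℝ) ^ 4))) := by ring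
        _ ≤ 2 ^ Fintype.card V * (4 * Real.exp 8 * (4 * (X / (∏ x, r x : ℕ)) * (1 + Real.log X) ^ (-κ)) * (4 + 4 * Fintype.card V * Real.log z)) := by
            refine mul_le_mul_of_nonneg_left ?_ (by positivity)
            refine mul_le_mul (mul_le_mul_of_nonneg_left hY2 (by positivity)) (by linarith) ?_ (by positivity)
            have h8 : (1 : ℝ) ≤ 8 * ((∏ w, r w : ℕ) : ℝ) ^ 4 := by
              have : (1 : ℝ) ≤ ((∏ w, r w : ℕ) : ℝ) := by exact_mod_cast hR0
              nlinarith [one_le_pow₀ this (n := 4)]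
            have := Real.log_nonneg h8
            linarith
        _ = _ := by rw [hB]; ring
    · rw [sum_eq_zero, abs_zero]
      intro d hd
      rw [if_neg]
      exact fun h => hrz ((hbig d hd).mp h.2)
  refine (abs_sum_le_sum_abs _ _).trans ((sum_le_sum hin).trans ?_)
  rw [← sum_filter, RB_filter U hz hzX, sum_add_distrib, ← mul_sum]
  refine add_le_add ?_ (mul_le_mul_of_nonneg_left (RB_sum_inv U z) hB0)
  rw [sum_ite_eq']
  split_ifs
  · exact le_rfl
  · positivity

end
end AC

namespace AC
open Finset Filter Topology

lemma ev_a (n : ℕ) {ε : ℝ} (h1 : ε < 1) : ∀ᶠ L : ℝ in atTop, (2 * n + 1) * L ^ ε ≤ L := by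
  have h := (tendsto_rpow_atTop (show 0 < 1 - ε by linarith)).eventually_ge_atTop ((2 * n + 1 : ℝ))
  filter_upwards [h, eventually_gt_atTop 0] with L hL hL0
  calc (2 * n + 1) * L ^ ε ≤ L ^ (1 - ε) * L ^ ε := by gcongr
    _ = L := by rw [← Real.rpow_add hL0]; simp

lemma ev_b (N : ℕ) {ε : ℝ} (h0 : 0 < ε) : ∀ᶠ L : ℝ in atTop, (1 + L) ^ N ≤ Real.exp (L ^ ε / 8) := by
  obtain ⟨m, hm⟩ := exists_nat_ge (1 / ε)
  have h1 := (isLittleO_pow_exp_pos_mul_atTop (m * N) (show (0 : ℝ) < 1 / 8 by norm_num)).bound (show (0 : ℝ) < (1 / 2) ^ N by positivity)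
  have h2 := (tendsto_rpow_atTop h0).eventually h1
  filter_upwards [h2, eventually_ge_atTop 1] with L hL hL1
  have hs1 : 1 ≤ L ^ ε := Real.one_le_rpow hL1 h0.le
  have hLs : L ≤ (L ^ ε) ^ m := by
    calc L = (L ^ ε) ^ (1 / ε) := by rw [← Real.rpow_mul (by linarith), mul_one_div_cancel h0.ne', Real.rpow_one]
      _ ≤ (L ^ ε) ^ (m : ℝ) := Real.rpow_le_rpow_of_exponent_le hs1 hm
      _ = _ := Real.rpow_natCast _ _
  rw [Real.norm_of_nonneg (by positivity), Real.norm_of_nonneg (by positivity)] at hL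
  calc (1 + L) ^ N ≤ (2 * (L ^ ε) ^ m) ^ N := by
        gcongr
        have : 1 ≤ (L ^ ε) ^ m := one_le_pow₀ hs1
        linarith
    _ = 2 ^ N * (L ^ ε) ^ (m * N) := by rw [mul_pow, pow_mul]
    _ ≤ 2 ^ N * ((1 / 2) ^ N * Real.exp (1 / 8 * L ^ ε)) := by gcongr
    _ = Real.exp (L ^ ε / 8) := by
        rw [← mul_assoc, ← mul_pow]
        norm_num
        ring

lemma params (n : ℕ) {κ : ℝ} (h0 : 0 < κ) (h1 : κ ≤ 1 / 2) : ∃ C : ℝ, 1 ≤ C ∧ ∀ X : ℕ, 1 ≤ X → ∃ z : ℕ, 1 ≤ z ∧ z ≤ X ∧ (z ^ n) ^ 2 ≤ X ∧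
    (1 + Real.log z) ^ (n + 1) ≤ C * (1 + Real.log X) ^ κ ∧ (z : ℝ) ^ (-(1 / 8) : ℝ) * (1 + Real.log X) ^ (n + 6) ≤ C := by
  set ε : ℝ := κ / (n + 1) with hε
  have hn1 : (1 : ℝ) ≤ n + 1 := by linarith [Nat.cast_nonneg (α := ℝ) n]
  have hε0 : 0 < ε := by positivity
  have hε1 : ε < 1 := by
    rw [hε, div_lt_one (by positivity)]; linarith
  obtain ⟨L0, hL0⟩ := eventually_atTop.mp ((ev_a n hε1).and (ev_b (n + 6) hε0))
  set M : ℝ := max L0 1 with hM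
  refine ⟨2 ^ (n + 1) + 2 + (1 + M) ^ (n + 6), ?_, fun X hX => ?_⟩
  · have : (0 : ℝ) < 2 ^ (n + 1) := by positivity
    have : (0 : ℝ) ≤ (1 + M) ^ (n + 6) := by positivity
    linarith
  have hX0 : (0 : ℝ) < X := by exact_mod_cast hX
  have hL : 0 ≤ Real.log X := Real.log_natCast_nonneg X
  have hp1 : (0 : ℝ) < 2 ^ (n + 1) := by positivity
  have hp2 : (0 : ℝ) ≤ (1 + M) ^ (n + 6) := by positivity
  by_cases hc : Real.log X ≤ M
  · refine ⟨1, le_rfl, hX, by simpa using hX, ?_, ?_⟩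
    · simp only [Nat.cast_one, Real.log_one, add_zero, one_pow]
      have : 1 ≤ (1 + Real.log X) ^ κ := Real.one_le_rpow (by linarith) h0.le
      nlinarith
    · simp only [Nat.cast_one, Real.one_rpow, one_mul]
      have : (1 + Real.log X) ^ (n + 6) ≤ (1 + M) ^ (n + 6) := by gcongr
      linarith
  · push Not at hc
    obtain ⟨ha, hb⟩ := hL0 (Real.log X) ((le_max_left _ _).trans hc.le)
    have hL1 : 1 ≤ Real.log X := (le_max_right _ _).trans hc.le
    set L := Real.log X with hLdef
    have hs1 : 1 ≤ L ^ ε := Real.one_le_rpow hL1 hε0.le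
    have hexp1 : 1 ≤ Real.exp (L ^ ε) := Real.one_le_exp (by linarith)
    have hz1 : 1 ≤ ⌊Real.exp (L ^ ε)⌋₊ := (Nat.one_le_floor_iff _).mpr hexp1
    have hzle : ((⌊Real.exp (L ^ ε)⌋₊ : ℕ) : ℝ) ≤ Real.exp (L ^ ε) := Nat.floor_le (by positivity)
    have hzge : Real.exp (L ^ ε) ≤ 2 * ((⌊Real.exp (L ^ ε)⌋₊ : ℕ) : ℝ) := by
      have := Nat.lt_floor_add_one (Real.exp (L ^ ε))
      have h3 : (1 : ℝ) ≤ ((⌊Real.exp (L ^ ε)⌋₊ : ℕ) : ℝ) := by exact_mod_cast hz1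
      linarith
    set z := ⌊Real.exp (L ^ ε)⌋₊ with hz
    have hz0 : (0 : ℝ) < z := by exact_mod_cast hz1
    have hXe : (X : ℝ) = Real.exp L := (Real.exp_log hX0).symm
    have hn0 : (0 : ℝ) ≤ n := Nat.cast_nonneg n
    have hlz : Real.log z ≤ L ^ ε := by
      have := Real.log_le_log hz0 hzle
      rwa [Real.log_exp] at this
    have hlz0 : 0 ≤ Real.log z := Real.log_natCast_nonneg z
    refine ⟨z, hz1, ?_, ?_, ?_, ?_⟩
    · have : (z : ℝ) ≤ X := by
        rw [hXe]
        exact hzle.trans (Real.exp_le_exp.mpr (by nlinarith))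
      exact_mod_cast this
    · have : ((z : ℝ) ^ n) ^ 2 ≤ X := by
        rw [hXe]
        calc ((z : ℝ) ^ n) ^ 2 ≤ ((Real.exp (L ^ ε)) ^ n) ^ 2 := by gcongr
          _ = Real.exp (2 * n * L ^ ε) := by
              rw [← Real.exp_nat_mul, ← Real.exp_nat_mul]; push_cast; ring_nf
          _ ≤ _ := Real.exp_le_exp.mpr (by nlinarith)
      exact_mod_cast this
    · have h3 : 1 + Real.log z ≤ 2 * (1 + L) ^ ε := by
        have : L ^ ε ≤ (1 + L) ^ ε := Real.rpow_le_rpow hL (by linarith) hε0.le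
        linarith
      calc (1 + Real.log z) ^ (n + 1) ≤ (2 * (1 + L) ^ ε) ^ (n + 1) := by gcongr
        _ = 2 ^ (n + 1) * (1 + L) ^ κ := by
            rw [mul_pow, ← Real.rpow_natCast ((1 + L) ^ ε), ← Real.rpow_mul (by linarith)]
            congr 2
            rw [hε]; push_cast; field_simp
        _ ≤ _ := by
            have : 0 ≤ (1 + L) ^ κ := by positivity
            gcongr
            linarith
    · have h3 : (z : ℝ) ^ (-(1 / 8) : ℝ) ≤ 2 * Real.exp (-(L ^ ε / 8)) := by
        calc (z : ℝ) ^ (-(1 / 8) : ℝ) ≤ (Real.exp (L ^ ε) / 2) ^ (-(1 / 8) : ℝ) :=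
              Real.rpow_le_rpow_of_nonpos (by positivity) (by linarith) (by norm_num)
          _ = Real.exp (-(L ^ ε / 8)) * 2 ^ (1 / 8 : ℝ) := by
              rw [Real.div_rpow (by positivity) (by norm_num), ← Real.exp_mul, Real.rpow_neg (by norm_num : (0 : ℝ) ≤ 2), div_inv_eq_mul]
              congr 2; ring
          _ ≤ Real.exp (-(L ^ ε / 8)) * 2 := by
              gcongr
              calc (2 : ℝ) ^ (1 / 8 : ℝ) ≤ 2 ^ (1 : ℝ) := Real.rpow_le_rpow_of_exponent_le (by norm_num) (by norm_num)
                _ = 2 := by norm_num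
          _ = _ := by ring
      calc (z : ℝ) ^ (-(1 / 8) : ℝ) * (1 + L) ^ (n + 6) ≤ (2 * Real.exp (-(L ^ ε / 8))) * Real.exp (L ^ ε / 8) := by gcongr
        _ = 2 := by rw [mul_assoc, ← Real.exp_add]; simp
        _ ≤ _ := by linarith

lemma natlog_le {X : ℕ} (hX : 1 ≤ X) : (Nat.log 2 X : ℝ) + 3 ≤ 3 * (1 + Real.log X) := by
  have h := Nat.pow_log_le_self 2 (show X ≠ 0 by omega)
  have h2 : ((2 : ℝ)) ^ Nat.log 2 X ≤ X := by exact_mod_cast h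
  have h3 := Real.log_le_log (by positivity) h2
  rw [Real.log_pow] at h3
  have := Real.log_two_gt_d9
  have h4 : (0 : ℝ) ≤ Nat.log 2 X := Nat.cast_nonneg _
  nlinarith

section
variable {V : Type} [Fintype V] [DecidableEq V]

theorem abstract_bound (ii jj : V → ℕ) (ev : V → V → ℕ) (hev1 : ∀ x y, ev x y ≤ 1)
    (hev : ∀ w, ev w w = 0) (w : ℕ) (hw : 2 ≤ w)
    (H : ∀ U : Finset V, (∀ x ∈ U, ∀ y ∈ U, ev x y = ev y x) → U.card ≤ w ∧ (U.card = w →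
      ∀ y ∉ U, ∃ x ∈ U, ∃ x' ∈ U, (ev x y + ev y x) % 2 ≠ (ev x' y + ev y x') % 2)) :
    ∃ C : ℝ, ∀ X : ℕ, 1 ≤ X → |∑ D ∈ RB (∅ : Finset V) X with ∏ x, D x ≤ X, TT (1 / w) ii jj ev D| ≤ C * X := by
  have hw0 : (0 : ℝ) < w := by exact_mod_cast (by omega : 0 < w)
  have hw2 : (2 : ℝ) ≤ w := by exact_mod_cast hw
  set κ : ℝ := 1 / w with hκ
  have h0 : 0 < κ := by positivity
  have h1 : κ ≤ 1 / 2 := one_div_le_one_div_of_le (by norm_num) hw2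
  have hwκ : w * κ = 1 := by rw [hκ]; field_simp
  obtain ⟨C, hC1, hC⟩ := params (Fintype.card V) h0 h1
  set n := Fintype.card V with hn
  set K1 : ℝ := 69984 * C with hK1
  set K2 : ℝ := 16 * Real.exp 8 * C with hK2
  set K3 : ℝ := 1 + 2 ^ n * 64 * Real.exp 8 * (n + 1) * C with hK3
  have hK1p : 0 ≤ K1 := by positivity
  have hK2p : 0 ≤ K2 := by positivity
  have hK3p : 0 ≤ K3 := by positivity
  refine ⟨2 ^ n * (K1 + (2 ^ n + 1) * K2 + K3), fun X hX => ?_⟩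
  obtain ⟨z, hz1, hzX, hzV, hp1, hp2⟩ := hC X hX
  have hX0 : (0 : ℝ) < X := by exact_mod_cast hX
  have hL : 0 ≤ Real.log X := Real.log_natCast_nonneg X
  have hlz : 0 ≤ Real.log z := Real.log_natCast_nonneg z
  have hn0 : (0 : ℝ) ≤ n := Nat.cast_nonneg n
  have hpw : (1 + Real.log X) ^ (-κ) * (1 + Real.log z) ^ (n + 1) ≤ C := by
    have h3 : (1 + Real.log X) ^ (-κ) * (1 + Real.log X) ^ κ = 1 := by
      rw [← Real.rpow_add (by linarith)]; simp
    calc (1 + Real.log X) ^ (-κ) * (1 + Real.log z) ^ (n + 1) ≤ (1 + Real.log X) ^ (-κ) * (C * (1 + Real.log X) ^ κ) := by gcongr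
      _ = C * ((1 + Real.log X) ^ (-κ) * (1 + Real.log X) ^ κ) := by ring
      _ = C := by rw [h3, mul_one]
  have hpw' : (1 + Real.log X) ^ (-κ) * (1 + Real.log z) ^ n ≤ C := by
    refine le_trans ?_ hpw
    gcongr
    · linarith
    · omega
  set S : Finset V → ℝ := fun A => ∑ D ∈ RB (∅ : Finset V) X with (∏ x, D x ≤ X ∧ big z D = A), TT κ ii jj ev D with hS
  have hc2 : ∀ A : Finset V, A.card < w → |S A| ≤ K2 * X := by
    intro A hA
    have hA' : A.card * κ ≤ 1 - κ := by
      have : (A.card : ℝ) + 1 ≤ w := by exact_mod_cast hA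
      nlinarith
    refine (abs_sum_le_sum_abs _ _).trans ((case2 h0.le (by linarith) ii jj ev A hA' hz1 hzV hzX).trans ?_)
    calc 16 * Real.exp 8 * X * (1 + Real.log X) ^ (-κ) * (1 + Real.log z) ^ n
        = 16 * Real.exp 8 * X * ((1 + Real.log X) ^ (-κ) * (1 + Real.log z) ^ n) := by ring
      _ ≤ 16 * Real.exp 8 * X * C := by gcongr
      _ = _ := by rw [hK2]; ring
  have hall : ∀ A : Finset V, |S A| ≤ (K1 + (2 ^ n + 1) * K2 + K3) * X := by
    intro A
    by_cases hun : ∀ x ∈ A, ∀ y ∈ A, ev x y = ev y x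
    · obtain ⟨H1, H2⟩ := H A hun
      rcases lt_or_eq_of_le H1 with hlt | heq
      · refine (hc2 A hlt).trans (mul_le_mul_of_nonneg_right ?_ hX0.le)
        have : 0 ≤ (2 : ℝ) ^ n * K2 := by positivity
        linarith
      · have hA' : A.card * κ = 1 := by rw [heq, hwκ]
        have h3 := case3 h0.le h1 ii jj ev hev1 hev A hA' hun (H2 heq) hz1 hzV hzX
        have hdec : ∑ D ∈ RB (∅ : Finset V) X with (∏ x, D x ≤ X ∧ big z D ⊆ A), TT κ ii jj ev D = ∑ A' ∈ A.powerset, S A' := by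
          rw [← sum_fiberwise_of_maps_to (s := (RB (∅ : Finset V) X).filter fun D => ∏ x, D x ≤ X ∧ big z D ⊆ A) (t := A.powerset) (g := big z)
            (fun D hD => mem_powerset.mpr (mem_filter.mp hD).2.2)]
          refine sum_congr rfl fun A' hA' => ?_
          rw [mem_powerset] at hA'
          simp only [hS]
          rw [filter_filter]
          refine sum_congr (filter_congr fun D _ => ?_) fun _ _ => rfl
          constructor
          · rintro ⟨⟨a, -⟩, b⟩; exact ⟨a, b⟩
          · rintro ⟨a, b⟩; exact ⟨⟨a, b ▸ hA'⟩, b⟩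
        rw [hdec, ← insert_erase (mem_powerset_self A), sum_insert (notMem_erase _ _)] at h3
        have h4 : |∑ A' ∈ A.powerset.erase A, S A'| ≤ 2 ^ n * K2 * X := by
          refine (abs_sum_le_sum_abs _ _).trans ?_
          calc ∑ A' ∈ A.powerset.erase A, |S A'| ≤ ∑ A' ∈ A.powerset.erase A, K2 * X := by
                refine sum_le_sum fun A' hA' => hc2 A' ?_
                rw [mem_erase, mem_powerset] at hA'
                rw [← heq]
                exact card_lt_card (hA'.2.ssubset_of_ne hA'.1)
            _ ≤ ∑ A' : Finset V, K2 * X := sum_le_sum_of_subset_of_nonneg (subset_univ _) fun _ _ _ => by positivity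
            _ = _ := by rw [sum_const, card_univ, Fintype.card_finset, nsmul_eq_mul]; push_cast; ring
        have h5 : (X : ℝ) + 2 ^ n * 16 * Real.exp 8 * X * (1 + Real.log X) ^ (-κ) * (4 + 4 * n * Real.log z) * (1 + Real.log z) ^ n ≤ K3 * X := by
          have : 4 + 4 * n * Real.log z ≤ 4 * (n + 1) * (1 + Real.log z) := by nlinarith
          calc (X : ℝ) + 2 ^ n * 16 * Real.exp 8 * X * (1 + Real.log X) ^ (-κ) * (4 + 4 * n * Real.log z) * (1 + Real.log z) ^ n
              ≤ (X : ℝ) + 2 ^ n * 16 * Real.exp 8 * X * (1 + Real.log X) ^ (-κ) * (4 * (n + 1) * (1 + Real.log z)) * (1 + Real.log z) ^ n := by gcongr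
            _ = (X : ℝ) + 2 ^ n * 16 * Real.exp 8 * X * (4 * (n + 1)) * ((1 + Real.log X) ^ (-κ) * (1 + Real.log z) ^ (n + 1)) := by ring
            _ ≤ (X : ℝ) + 2 ^ n * 16 * Real.exp 8 * X * (4 * (n + 1)) * C := by gcongr
            _ = _ := by rw [hK3]; ring
        have h6 := h3.trans h5
        rw [abs_le] at h6 h4 ⊢
        have : 0 ≤ K1 * X := by positivity
        have : 0 ≤ K2 * X := by positivity
        constructor <;> nlinarith
    · push Not at hun
      obtain ⟨x, hx, y, hy, hne⟩ := hun
      have key : ∀ x ∈ A, ∀ y ∈ A, ev x y = 1 → ev y x = 0 → |S A| ≤ (K1 + (2 ^ n + 1) * K2 + K3) * X := by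
        intro x hx y hy e1 e2
        have hxy : x ≠ y := by rintro rfl; omega
        refine (case1 h0.le (by linarith) ii jj ev hev hxy e1 e2 A hx hy hz1 hX).trans ?_
        calc 96 * X * (z : ℝ) ^ (-(1 / 8) : ℝ) * ((Nat.log 2 X : ℝ) + 3) ^ 6 * (1 + Real.log X) ^ n
            ≤ 96 * X * (z : ℝ) ^ (-(1 / 8) : ℝ) * (3 * (1 + Real.log X)) ^ 6 * (1 + Real.log X) ^ n := by
              gcongr
              exact natlog_le hX
          _ = 69984 * X * ((z : ℝ) ^ (-(1 / 8) : ℝ) * (1 + Real.log X) ^ (n + 6)) := by ring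
          _ ≤ 69984 * X * C := by gcongr
          _ = K1 * X := by rw [hK1]; ring
          _ ≤ _ := by
              refine mul_le_mul_of_nonneg_right ?_ hX0.le
              have : 0 ≤ ((2 : ℝ) ^ n + 1) * K2 := by positivity
              linarith
      have a1 := hev1 x y
      have a2 := hev1 y x
      by_cases hc : ev x y = 1
      · exact key x hx y hy hc (by omega)
      · exact key y hy x hx (by omega) (by omega)
  have htot : ∑ D ∈ RB (∅ : Finset V) X with ∏ x, D x ≤ X, TT κ ii jj ev D = ∑ A, S A := by
    rw [← sum_fiberwise_of_maps_to (s := (RB (∅ : Finset V) X).filter fun D => ∏ x, D x ≤ X) (t := univ) (g := big z) (fun D _ => mem_univ _)]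
    refine sum_congr rfl fun A' _ => ?_
    simp only [hS]
    rw [filter_filter]
  rw [htot]
  refine (abs_sum_le_sum_abs _ _).trans ((sum_le_sum fun A _ => hall A).trans (le_of_eq ?_))
  rw [sum_const, card_univ, Fintype.card_finset, nsmul_eq_mul]
  push_cast; ring

end
end AC

namespace AC
open Finset

section
variable {I : Type} [Fintype I] [DecidableEq I]

abbrev VV (I : Type) := (I → ZMod 2) × (I → ZMod 2)

/-- exponent form; first component `u`, second component `λ`. -/
def ef (x y : VV I) : ZMod 2 := ∑ i, x.2 i * (x.1 i + y.1 i)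
def evf (x y : VV I) : ℕ := (ef x y).val
def lk (x y : VV I) : ZMod 2 := ∑ i, (x.2 i + y.2 i) * (x.1 i + y.1 i)
def s2 (a : ZMod 2) : ℤ := if a = 0 then 1 else -1

lemma s2_add (a b : ZMod 2) : s2 (a + b) = s2 a * s2 b := by
  revert a b; decide

lemma s2_sq (a : ZMod 2) : s2 a * s2 a = 1 := by
  revert a; decide

lemma lk_eq (x y : VV I) : lk x y = ef x y + ef y x := by
  unfold lk ef
  rw [← sum_add_distrib]
  exact sum_congr rfl fun i _ => by ring

lemma evf_le (x y : VV I) : evf x y ≤ 1 := Nat.le_of_lt_succ (ZMod.val_lt (ef x y))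

lemma evf_self (x : VV I) : evf x x = 0 := by
  unfold evf ef
  rw [sum_eq_zero]
  · rfl
  · intro i _
    rw [CharTwo.add_self_eq_zero, mul_zero]

lemma lk_val (x y : VV I) : (lk x y).val = (evf x y + evf y x) % 2 := by
  rw [lk_eq, ZMod.val_add]; rfl

lemma lk_zero {x y : VV I} (h : evf x y = evf y x) : lk x y = 0 := by
  rw [← ZMod.val_eq_zero, lk_val, h]; omega

lemma lk_comm (x y : VV I) : lk x y = lk y x := by
  rw [lk_eq, lk_eq, add_comm]

lemma char_sum (v : VV I) (hv : v ≠ 0) : ∑ z : VV I, s2 (∑ i, (v.2 i * z.1 i + z.2 i * v.1 i)) = 0 := by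
  have hz : ∃ z0 : VV I, ∑ i, (v.2 i * z0.1 i + z0.2 i * v.1 i) = 1 := by
    have h1 : ∀ a : ZMod 2, a ≠ 0 → a = 1 := by decide
    by_cases h2 : v.2 = 0
    · have h3 : v.1 ≠ 0 := fun h => hv (Prod.ext h h2)
      obtain ⟨i, hi⟩ := Function.ne_iff.mp h3
      refine ⟨(0, Pi.single i 1), ?_⟩
      rw [sum_eq_single i]
      · simp [h1 _ hi]
      · intro j _ hj; simp [hj]
      · simp
    · obtain ⟨i, hi⟩ := Function.ne_iff.mp h2
      refine ⟨(Pi.single i 1, 0), ?_⟩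
      rw [sum_eq_single i]
      · simp [h1 _ hi]
      · intro j _ hj; simp [hj]
      · simp
  obtain ⟨z0, hz0⟩ := hz
  have h := Fintype.sum_equiv (Equiv.addRight z0) (fun z : VV I => s2 (∑ i, (v.2 i * (z + z0).1 i + (z + z0).2 i * v.1 i)))
    (fun z : VV I => s2 (∑ i, (v.2 i * z.1 i + z.2 i * v.1 i))) (fun z => rfl)
  have h2 : ∀ z : VV I, s2 (∑ i, (v.2 i * (z + z0).1 i + (z + z0).2 i * v.1 i)) = - s2 (∑ i, (v.2 i * z.1 i + z.2 i * v.1 i)) := by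
    intro z
    have : ∑ i, (v.2 i * (z + z0).1 i + (z + z0).2 i * v.1 i) = ∑ i, (v.2 i * z.1 i + z.2 i * v.1 i) + 1 := by
      rw [← hz0, ← sum_add_distrib]
      refine sum_congr rfl fun i _ => ?_
      simp only [Prod.fst_add, Prod.snd_add, Pi.add_apply]; ring
    rw [this, s2_add]
    have : s2 1 = -1 := by decide
    rw [this]; ring
  simp only [h2, sum_neg_distrib] at h
  linarith

lemma M_orth (x y : VV I) : ∑ z, s2 (lk x z) * s2 (lk z y) = if x = y then (Fintype.card (VV I) : ℤ) else 0 := by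
  split_ifs with h
  · subst h
    simp only [lk_comm _ x, s2_sq]
    simp
  · have e : ∀ z : VV I, s2 (lk x z) * s2 (lk z y) = s2 (∑ i, x.2 i * x.1 i + ∑ i, y.2 i * y.1 i) *
        s2 (∑ i, ((x + y).2 i * z.1 i + z.2 i * (x + y).1 i)) := by
      intro z
      rw [← s2_add, ← s2_add]
      congr 1
      unfold lk
      rw [← sum_add_distrib, ← sum_add_distrib, ← sum_add_distrib]
      refine sum_congr rfl fun i _ => ?_
      simp only [Prod.fst_add, Prod.snd_add, Pi.add_apply]
      generalize x.1 i = a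
      generalize x.2 i = b
      generalize y.1 i = c
      generalize y.2 i = d
      generalize z.1 i = f
      generalize z.2 i = g
      revert a b c d f g
      decide
    simp only [e, ← mul_sum]
    rw [char_sum, mul_zero]
    intro hc
    apply h
    have h1 := congrArg Prod.fst hc
    have h2 := congrArg Prod.snd hc
    refine Prod.ext (funext fun i => ?_) (funext fun i => ?_)
    · have := congrFun h1 i
      simp only [Prod.fst_add, Pi.add_apply, Prod.fst_zero, Pi.zero_apply] at this
      exact CharTwo.add_eq_zero.mp this
    · have := congrFun h2 i
      simp only [Prod.snd_add, Pi.add_apply, Prod.snd_zero, Pi.zero_apply] at this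
      exact CharTwo.add_eq_zero.mp this

lemma M_norm (U : Finset (VV I)) : ∑ y, (∑ x ∈ U, s2 (lk x y)) ^ 2 = (Fintype.card (VV I) : ℤ) * U.card := by
  have : ∀ y : VV I, (∑ x ∈ U, s2 (lk x y)) ^ 2 = ∑ x ∈ U, ∑ x' ∈ U, s2 (lk x y) * s2 (lk y x') := by
    intro y
    rw [pow_two, sum_mul_sum]
    simp only [lk_comm y]
  simp only [this]
  rw [sum_comm]
  have e : ∀ x ∈ U, ∑ y, ∑ x' ∈ U, s2 (lk x y) * s2 (lk y x') = (Fintype.card (VV I) : ℤ) := by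
    intro x hx
    rw [sum_comm]
    simp only [M_orth]
    rw [sum_ite_eq, if_pos hx]
  rw [sum_congr rfl e, sum_const, nsmul_eq_mul, mul_comm]

lemma comb (U : Finset (VV I)) (hU : ∀ x ∈ U, ∀ y ∈ U, evf x y = evf y x) : U.card ≤ Fintype.card (I → ZMod 2) ∧
    (U.card = Fintype.card (I → ZMod 2) → ∀ y ∉ U, ∃ x ∈ U, ∃ x' ∈ U, (evf x y + evf y x) % 2 ≠ (evf x' y + evf y x') % 2) := by
  set w := Fintype.card (I → ZMod 2) with hw
  have hw0 : 0 < w := Fintype.card_pos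
  have hV : Fintype.card (VV I) = w * w := Fintype.card_prod _ _
  have h := M_norm U
  rw [hV, ← sum_compl_add_sum U] at h
  have h1 : ∑ y ∈ U, (∑ x ∈ U, s2 (lk x y)) ^ 2 = (U.card : ℤ) ^ 3 := by
    have : ∀ y ∈ U, (∑ x ∈ U, s2 (lk x y)) ^ 2 = (U.card : ℤ) ^ 2 := by
      intro y hy
      have : ∑ x ∈ U, s2 (lk x y) = ∑ x ∈ U, 1 := sum_congr rfl fun x hx => by rw [lk_zero (hU x hx y hy)]; rfl
      rw [this]; simp
    rw [sum_congr rfl this, sum_const, nsmul_eq_mul]; ring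
  rw [h1] at h
  have hnn : 0 ≤ ∑ y ∈ Uᶜ, (∑ x ∈ U, s2 (lk x y)) ^ 2 := sum_nonneg fun _ _ => sq_nonneg _
  refine ⟨?_, fun heq y hy => ?_⟩
  · by_contra hc
    push Not at hc
    have hc' : (w : ℤ) < U.card := by exact_mod_cast hc
    have hw' : (0 : ℤ) < w := by exact_mod_cast hw0
    push_cast at h
    have : (w : ℤ) * w < U.card * U.card := by nlinarith
    have : (w : ℤ) * w * U.card < U.card * U.card * U.card := mul_lt_mul_of_pos_right this (by linarith)
    nlinarith
  · by_contra hc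
    push Not at hc
    rw [heq] at h
    have h0 : ∑ y ∈ Uᶜ, (∑ x ∈ U, s2 (lk x y)) ^ 2 = 0 := by push_cast at h; linarith
    have h2 := (sum_eq_zero_iff_of_nonneg fun _ _ => sq_nonneg _).mp h0 y (by simpa using hy)
    have h3 : ∑ x ∈ U, s2 (lk x y) = 0 := by simpa using h2
    obtain ⟨x0, hx0⟩ : U.Nonempty := card_pos.mp (by omega)
    have h4 : ∀ x ∈ U, s2 (lk x y) = s2 (lk x0 y) := by
      intro x hx
      congr 1
      apply ZMod.val_injective
      rw [lk_val, lk_val]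
      exact hc x hx x0 hx0
    rw [sum_congr rfl h4, sum_const, nsmul_eq_mul] at h3
    have h5 := s2_sq (lk x0 y)
    rcases mul_eq_zero.mp h3 with h6 | h6
    · have : U.card = 0 := by exact_mod_cast h6
      omega
    · rw [h6] at h5; norm_num at h5

end
end AC

namespace AC
open Finset

section
variable {V : Type} [Fintype V] [DecidableEq V]

lemma jr_prodL {ι : Type} (s : Finset ι) (a : ι → ℕ) (b : ℕ) : jr (∏ q ∈ s, a q) b = ∏ q ∈ s, jr (a q) b := by
  classical
  induction s using Finset.induction_on with
  | empty => simp [jr_one_left]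
  | insert x s hx ih => rw [prod_insert hx, prod_insert hx, jr_mul_left, ih]

lemma jr_prodR {ι : Type} (s : Finset ι) (a : ι → ℕ) (ha : ∀ i, 0 < a i) (b : ℕ) : jr b (∏ q ∈ s, a q) = ∏ q ∈ s, jr b (a q) := by
  classical
  induction s using Finset.induction_on with
  | empty => simp [jr_one_right]
  | insert x s hx ih => rw [prod_insert hx, prod_insert hx, jr_mul_right _ (ha x) (prod_pos fun i _ => ha i), ih]

lemma hh_mul (κ : ℝ) (i j : ℕ) {a b : ℕ} (h : Nat.Coprime a b) : hh κ i j (a * b) = hh κ i j a * hh κ i j b := by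
  unfold hh
  rw [kw_mul κ h, psi_mul]; push_cast; ring

lemma hh_prod (κ : ℝ) (i j : ℕ) {n : ℕ} (s : Finset n.primeFactors) : hh κ i j (∏ p ∈ s, (p : ℕ)) = ∏ p ∈ s, hh κ i j p := by
  induction s using Finset.induction_on with
  | empty => simp [hh_one]
  | insert x s hx ih =>
    rw [prod_insert hx, prod_insert hx, hh_mul, ih]
    refine Nat.Coprime.prod_right fun q hq => ?_
    rw [Nat.coprime_primes (pf_prime x) (pf_prime q)]
    intro h
    exact hx (Subtype.ext h ▸ hq)

lemma prod_fib {n : ℕ} (f : n.primeFactors → V) (F : V → n.primeFactors → ℝ) :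
    ∏ x, ∏ p with f p = x, F x p = ∏ p, F (f p) p := by
  simp only [prod_filter]
  rw [prod_comm]
  refine prod_congr rfl fun p _ => ?_
  rw [prod_ite_eq, if_pos (mem_univ _)]

lemma TT_DM {κ : ℝ} (ii jj : V → ℕ) (ev : V → V → ℕ) {n : ℕ} (hn : Squarefree n) (ho : Odd n) (f : n.primeFactors → V) :
    TT κ ii jj ev (DM n f) = ∏ p : n.primeFactors, (hh κ (ii (f p)) (jj (f p)) p * ∏ q : n.primeFactors, jr (q : ℕ) (p : ℕ) ^ ev (f p) (f q)) := by
  unfold TT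
  rw [DM_prod hn, if_pos ⟨hn, ho⟩, prod_mul_distrib]
  congr 1
  · rw [← prod_fib f fun x p => hh κ (ii x) (jj x) p]
    refine prod_congr rfl fun x _ => ?_
    unfold DM
    rw [hh_prod]
  · unfold BB
    rw [← prod_fib f fun x p => ∏ q : n.primeFactors, jr (q : ℕ) (p : ℕ) ^ ev x (f q)]
    refine prod_congr rfl fun x _ => ?_
    have : ∀ p : n.primeFactors, ∏ q : n.primeFactors, jr (q : ℕ) (p : ℕ) ^ ev x (f q) = ∏ y, ∏ q with f q = y, jr (q : ℕ) (p : ℕ) ^ ev x y :=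
      fun p => (prod_fib f fun y q => jr (q : ℕ) (p : ℕ) ^ ev x y).symm
    simp only [this]
    rw [prod_comm]
    refine prod_congr rfl fun y _ => ?_
    unfold DM
    rw [jr_prodR _ _ (fun p => (pf_prime p).pos), ← prod_pow]
    refine prod_congr rfl fun p _ => ?_
    rw [jr_prodL, ← prod_pow]

end

section
variable {I : Type} [Fintype I] [DecidableEq I]

def iif (ci : (I → ZMod 2) → I → ℕ) (x : VV I) : ℕ := ∑ i, ci x.1 i * (x.2 i).val

lemma cnd_pow (ci cj : (I → ZMod 2) → I → ℕ) {n : ℕ} (ho : Odd n) (u l : n.primeFactors → I → ZMod 2) (p : n.primeFactors) (κ : ℝ) :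
    κ * ∏ i, ((cnd ci cj n u p i : ℤ) : ℝ) ^ (l p i).val =
      hh κ (iif ci (u p, l p)) (iif cj (u p, l p)) p * ∏ q : n.primeFactors, jr (q : ℕ) (p : ℕ) ^ evf (u p, l p) (u q, l q) := by
  have hp := pf_prime p
  have hpo : Odd (p : ℕ) := ho.of_dvd_nat (Nat.dvd_of_mem_primeFactors p.2)
  have hcnd : ∀ i, ((cnd ci cj n u p i : ℤ) : ℝ) ^ (l p i).val = ((ZMod.χ₄ (p : ℕ) : ℤ) : ℝ) ^ (ci (u p) i * (l p i).val) *
      ((ZMod.χ₈ (p : ℕ) : ℤ) : ℝ) ^ (cj (u p) i * (l p i).val) * ∏ q : n.primeFactors, jr (q : ℕ) (p : ℕ) ^ ((u p i + u q i).val * (l p i).val) := by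
    intro i
    unfold cnd jr
    rw [jacobiSym.at_neg_one hpo, jacobiSym.at_two hpo]
    push_cast
    rw [mul_pow, mul_pow, ← prod_pow]
    simp only [← pow_mul]
  simp only [hcnd, prod_mul_distrib, prod_pow_eq_pow_sum]
  rw [prod_comm]
  unfold hh iif psi
  rw [kw_prime κ hp, jacobiSym.one_right]
  push_cast
  rw [mul_one, ← mul_assoc κ]
  congr 1
  refine prod_congr rfl fun q _ => ?_
  rw [prod_pow_eq_pow_sum]
  by_cases hq : q = p
  · subst hq
    rw [evf, ef]
    simp [CharTwo.add_self_eq_zero]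
  · have hco : Nat.Coprime (q : ℕ) (p : ℕ) := (Nat.coprime_primes (pf_prime q) hp).mpr fun h => hq (Subtype.ext h)
    have hs : jacobiSym ((q : ℕ) : ℤ) p ^ 2 = 1 := jacobiSym.sq_one (by simpa [Int.gcd_natCast_natCast] using hco)
    have := pm_val hs (∑ i, (u p i + u q i).val * (l p i).val)
    unfold jr evf ef
    have e : ((∑ i, (u p i + u q i).val * (l p i).val : ℕ) : ZMod 2) = ∑ i, (u p, l p).2 i * ((u p, l p).1 i + (u q, l q).1 i) := by
      push_cast
      refine sum_congr rfl fun i _ => ?_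
      rw [ZMod.natCast_zmod_val, ZMod.natCast_zmod_val, mul_comm]
    rw [e] at this
    exact_mod_cast this.symm

lemma cnd_pm (ci cj : (I → ZMod 2) → I → ℕ) {n : ℕ} (ho : Odd n) (u : n.primeFactors → I → ZMod 2) (p : n.primeFactors) (i : I) :
    cnd ci cj n u p i = 1 ∨ cnd ci cj n u p i = -1 := by
  have hp := pf_prime p
  have hpo : Odd (p : ℕ) := ho.of_dvd_nat (Nat.dvd_of_mem_primeFactors p.2)
  have hsq : cnd ci cj n u p i ^ 2 = 1 := by
    unfold cnd
    rw [mul_pow, mul_pow, ← prod_pow]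
    have a1 : jacobiSym (-1) p ^ 2 = 1 := jacobiSym.sq_one (by simp)
    have a2 : jacobiSym 2 p ^ 2 = 1 := jacobiSym.sq_one (by
      have := Nat.coprime_two_left.mpr hpo
      exact_mod_cast this)
    rw [← pow_mul, mul_comm, ← pow_mul, mul_comm (ci _ _), mul_comm (cj _ _), pow_mul, pow_mul, a1, a2, one_pow, one_pow, mul_one, mul_one]
    refine prod_eq_one fun q _ => ?_
    by_cases hq : q = p
    · subst hq
      simp [CharTwo.add_self_eq_zero]
    · have hco : Nat.Coprime (q : ℕ) (p : ℕ) := (Nat.coprime_primes (pf_prime q) hp).mpr fun h => hq (Subtype.ext h)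
      have hs : jacobiSym ((q : ℕ) : ℤ) p ^ 2 = 1 := jacobiSym.sq_one (by simpa [Int.gcd_natCast_natCast] using hco)
      rw [← pow_mul, mul_comm, pow_mul, hs, one_pow]
  exact mul_self_eq_one_iff.mp (by rw [← pow_two]; exact hsq)

lemma ind_expand (c : I → ℤ) (hc : ∀ i, c i = 1 ∨ c i = -1) :
    (1 / (Fintype.card (I → ZMod 2) : ℝ)) * ∑ l : I → ZMod 2, ∏ i, ((c i : ℤ) : ℝ) ^ (l i).val = if ∀ i, c i = 1 then 1 else 0 := by
  have h1 : ∑ l : I → ZMod 2, ∏ i, ((c i : ℤ) : ℝ) ^ (l i).val = ∏ i, (1 + (c i : ℝ)) := by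
    have : ∀ i, (1 + (c i : ℝ)) = ∑ a : ZMod 2, (c i : ℝ) ^ a.val := by
      intro i
      have : (univ : Finset (ZMod 2)) = {0, 1} := by decide
      rw [this, sum_pair (by decide)]
      have v1 : (1 : ZMod 2).val = 1 := rfl
      rw [v1]; simp
    simp only [this]
    rw [Fintype.prod_sum]
  rw [h1]
  have hcard : Fintype.card (I → ZMod 2) = 2 ^ Fintype.card I := by rw [Fintype.card_fun, ZMod.card]
  rw [hcard]
  split_ifs with h
  · simp only [h]
    push_cast
    norm_num
  · push Not at h
    obtain ⟨i, hi⟩ := h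
    rw [prod_eq_zero (mem_univ i), mul_zero]
    rw [(hc i).resolve_left hi]; norm_num

lemma Zc_eq (ci cj : (I → ZMod 2) → I → ℕ) {n : ℕ} (hn : Squarefree n) (ho : Odd n) :
    (Zc ci cj n : ℝ) = ∑ f : n.primeFactors → VV I, TT (1 / (Fintype.card (I → ZMod 2) : ℝ)) (iif ci) (iif cj) evf (DM n f) := by
  set κ : ℝ := 1 / (Fintype.card (I → ZMod 2) : ℝ) with hκ
  have h1 : (Zc ci cj n : ℝ) = ∑ u : n.primeFactors → I → ZMod 2, ∏ p, (if ∀ i, cnd ci cj n u p i = 1 then (1 : ℝ) else 0) := by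
    unfold Zc
    rw [card_eq_sum_ones]
    push_cast
    rw [← sum_filter_add_sum_filter_not univ (fun u => u ∈ Zset ci cj n), sum_eq_zero (s := filter (fun u => u ∉ Zset ci cj n) univ), add_zero]
    · rw [filter_mem_eq_inter, univ_inter]
      refine sum_congr rfl fun u hu => ?_
      rw [mem_Zset] at hu
      rw [prod_eq_one]
      intro p _
      rw [if_pos (hu p)]
    · intro u hu
      rw [mem_filter, mem_Zset] at hu
      have := hu.2
      push Not at this
      obtain ⟨p, i, h⟩ := this
      rw [prod_eq_zero (mem_univ p)]
      rw [if_neg]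
      exact fun hc => h (hc i)
  rw [h1]
  have h2 : ∀ u : n.primeFactors → I → ZMod 2, ∏ p, (if ∀ i, cnd ci cj n u p i = 1 then (1 : ℝ) else 0) =
      ∑ l : n.primeFactors → I → ZMod 2, ∏ p, (κ * ∏ i, ((cnd ci cj n u p i : ℤ) : ℝ) ^ (l p i).val) := by
    intro u
    rw [← Fintype.prod_sum (fun p (l : I → ZMod 2) => κ * ∏ i, ((cnd ci cj n u p i : ℤ) : ℝ) ^ (l i).val)]
    refine prod_congr rfl fun p _ => ?_
    rw [← mul_sum, ind_expand _ (cnd_pm ci cj ho u p)]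
  simp only [h2]
  rw [← sum_product']
  refine Fintype.sum_equiv (Equiv.arrowProdEquivProdArrow _ _ _).symm _ _ fun ul => ?_
  rw [TT_DM _ _ _ hn ho]
  refine prod_congr rfl fun p _ => ?_
  exact cnd_pow ci cj ho ul.1 ul.2 p κ

theorem Z_bound [Nonempty I] (ci cj : (I → ZMod 2) → I → ℕ) : ∃ C : ℝ, ∀ X : ℕ, 1 ≤ X →
    ∑ n ∈ Icc 1 X with (Odd n ∧ Squarefree n), (Zc ci cj n : ℝ) ≤ C * X := by
  have hw : 2 ≤ Fintype.card (I → ZMod 2) := by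
    rw [Fintype.card_fun, ZMod.card]
    calc 2 = 2 ^ 1 := rfl
      _ ≤ _ := Nat.pow_le_pow_right (by norm_num) Fintype.card_pos
  obtain ⟨C, hC⟩ := abstract_bound (iif ci) (iif cj) (evf (I := I)) evf_le evf_self _ hw comb
  refine ⟨C, fun X hX => le_trans (le_of_eq ?_) ((le_abs_self _).trans (hC X hX))⟩
  set κ : ℝ := 1 / (Fintype.card (I → ZMod 2) : ℝ) with hκ
  have h1 : ∀ n ∈ (Icc 1 X).filter (fun n => Odd n ∧ Squarefree n), (Zc ci cj n : ℝ) =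
      ∑ D ∈ RB (∅ : Finset (VV I)) X with ∏ x, D x = n, TT κ (iif ci) (iif cj) evf D := by
    intro n hn
    rw [mem_filter, mem_Icc] at hn
    rw [Zc_eq ci cj hn.2.2 hn.2.1, sum_DM hn.2.2 hn.1.2]
  rw [sum_congr rfl h1]
  have h2 : ∑ D ∈ RB (∅ : Finset (VV I)) X with ∏ x, D x ≤ X, TT κ (iif ci) (iif cj) evf D =
      ∑ D ∈ RB (∅ : Finset (VV I)) X with (∏ x, D x ∈ (Icc 1 X).filter (fun n => Odd n ∧ Squarefree n)), TT κ (iif ci) (iif cj) evf D := by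
    rw [sum_filter, sum_filter]
    refine sum_congr rfl fun D hD => ?_
    have hpos := RB_prod_pos hX hD
    by_cases hg : Squarefree (∏ x, D x) ∧ Odd (∏ x, D x)
    · by_cases hle : ∏ x, D x ≤ X
      · rw [if_pos hle, if_pos (mem_filter.mpr ⟨mem_Icc.mpr ⟨hpos, hle⟩, hg.2, hg.1⟩)]
      · rw [if_neg hle, if_neg (fun h => hle (mem_Icc.mp (mem_filter.mp h).1).2)]
    · have : TT κ (iif ci) (iif cj) evf D = 0 := by unfold TT; rw [if_neg hg]
      rw [this]; simp
  rw [h2, ← sum_fiberwise_of_maps_to (s := (RB (∅ : Finset (VV I)) X).filter fun D => ∏ x, D x ∈ (Icc 1 X).filter (fun n => Odd n ∧ Squarefree n))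
    (t := (Icc 1 X).filter (fun n => Odd n ∧ Squarefree n)) (g := fun D => ∏ x, D x) (fun D hD => (mem_filter.mp hD).2)]
  refine sum_congr rfl fun n hn => ?_
  rw [filter_filter]
  refine sum_congr (filter_congr fun D _ => ?_) fun _ _ => rfl
  constructor
  · intro h; exact ⟨h ▸ hn, h⟩
  · exact fun h => h.2

end
end AC

namespace AC
open Finset

/-- Product of `m` copies of a condition datum. -/
def pw {J : Type} (m : ℕ) (ci : (J → ZMod 2) → J → ℕ) (w : Fin m × J → ZMod 2) (a : Fin m × J) : ℕ :=
  ci (fun i => w (a.1, i)) a.2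

lemma Zc_pow {J : Type} [Fintype J] (ci cj : (J → ZMod 2) → J → ℕ) (m n : ℕ) :
    Zc ci cj n ^ m ≤ Zc (pw m ci) (pw m cj) n := by
  have h : (Fintype.piFinset (fun _ : Fin m => Zset ci cj n)).card = Zc ci cj n ^ m := by
    rw [Fintype.card_piFinset]
    simp [Zc]
  rw [← h]
  unfold Zc
  refine card_le_card_of_injOn (fun t p a => t a.1 p a.2) ?_ ?_
  · intro t ht
    rw [mem_coe, Fintype.mem_piFinset] at ht
    rw [mem_coe, mem_Zset]
    intro p a
    exact (mem_Zset ci cj n (t a.1)).mp (ht a.1) p a.2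
  · intro t _ t' _ htt
    funext a p i
    exact congrFun (congrFun htt p) (a, i)

/-- The odd squarefree integers up to `X`. -/
def Qs (X : ℕ) : Finset ℕ := (Icc 1 X).filter (fun n => Odd n ∧ Squarefree n)

lemma sum_inv_sq (Y : ℕ) (hY : 3 ≤ Y) : ∑ q ∈ Icc 3 Y, (1 / ((q : ℝ) * q)) ≤ 4 / 9 - 1 / Y := by
  induction Y, hY using Nat.le_induction with
  | base => norm_num
  | succ Y hY ih =>
    rw [Finset.sum_Icc_succ_top (by omega)]
    have hp : (0 : ℝ) < Y := by exact_mod_cast (by omega : 0 < Y)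
    have : 1 / (((Y + 1 : ℕ) : ℝ) * (Y + 1 : ℕ)) ≤ 1 / (Y : ℝ) - 1 / ((Y + 1 : ℕ) : ℝ) := by
      push_cast
      rw [div_sub_div _ _ hp.ne' (by positivity), div_le_div_iff₀ (by positivity) (by positivity)]
      nlinarith
    linarith

lemma density (X : ℕ) : (X : ℝ) / 18 ≤ ((Qs X).card : ℝ) := by
  have hodd : (X + 1) / 2 ≤ ((Icc 1 X).filter Odd).card := by
    have := card_le_card_of_injOn (s := range ((X + 1) / 2)) (t := (Icc 1 X).filter Odd) (fun k => 2 * k + 1) (by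
      intro k hk
      rw [mem_coe, mem_range] at hk
      rw [mem_coe, mem_filter, mem_Icc]
      beta_reduce
      exact ⟨⟨by omega, by omega⟩, ⟨k, rfl⟩⟩) (by
      intro a _ b _ h
      simp only at h
      omega)
    simpa using this
  have hsub : (Icc 1 X).filter Odd ⊆ Qs X ∪ (Icc 3 X).biUnion (fun q => (Ioc 0 X).filter (fun n => q * q ∣ n)) := by
    intro n hn
    rw [mem_filter, mem_Icc] at hn
    rw [mem_union]
    by_cases hs : Squarefree n
    · left
      unfold Qs
      rw [mem_filter, mem_Icc]
      exact ⟨hn.1, hn.2, hs⟩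
    · right
      rw [Nat.squarefree_iff_prime_squarefree] at hs
      push Not at hs
      obtain ⟨p, hp, hd⟩ := hs
      rw [mem_biUnion]
      have hp2 : p ≠ 2 := by
        rintro rfl
        have h2 : 2 ∣ n := (Dvd.intro 2 rfl).trans hd
        obtain ⟨k, hk⟩ := hn.2
        omega
      have h2 := hp.two_le
      have hle := Nat.le_of_dvd (by omega) hd
      have hle2 : p ≤ p * p := Nat.le_mul_self p
      refine ⟨p, mem_Icc.mpr ⟨by omega, by omega⟩, ?_⟩
      rw [mem_filter, mem_Ioc]
      exact ⟨⟨by omega, by omega⟩, hd⟩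
  have h1 := (card_le_card hsub).trans ((card_union_le _ _).trans (Nat.add_le_add_left card_biUnion_le _))
  have h2 : ∀ q : ℕ, (((Ioc 0 X).filter (fun n => q * q ∣ n)).card : ℝ) ≤ X * (1 / ((q : ℝ) * q)) := by
    intro q
    rw [Nat.Ioc_filter_dvd_card_eq_div]
    have := @Nat.cast_div_le ℝ _ _ _ X (q * q)
    push_cast at this
    rw [mul_one_div]
    exact this
  have h3 : (((Icc 1 X).filter Odd).card : ℝ) ≤ (Qs X).card + ∑ q ∈ Icc 3 X, (((Ioc 0 X).filter (fun n => q * q ∣ n)).card : ℝ) := by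
    exact_mod_cast h1
  have h4 : ∑ q ∈ Icc 3 X, (((Ioc 0 X).filter (fun n => q * q ∣ n)).card : ℝ) ≤ X * (4 / 9) := by
    refine (sum_le_sum fun q _ => h2 q).trans ?_
    rw [← mul_sum]
    refine mul_le_mul_of_nonneg_left ?_ (Nat.cast_nonneg _)
    by_cases hX : 3 ≤ X
    · have := sum_inv_sq X hX
      have h0 : (0 : ℝ) ≤ 1 / X := by positivity
      linarith
    · rw [Icc_eq_empty (by omega)]
      norm_num
  have h5 : (X : ℝ) / 2 ≤ ((Icc 1 X).filter Odd).card := by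
    have : X ≤ 2 * ((Icc 1 X).filter Odd).card := by omega
    have : (X : ℝ) ≤ 2 * ((Icc 1 X).filter Odd).card := by exact_mod_cast this
    linarith
  linarith

lemma Sel_pow_le (m n : ℕ) : ((Sel n : ℕ) : ℝ) ^ (m + 1) ≤
    2 ^ m * (16 ^ m * ∑ τ : Fin 4 → ZMod 2, (Zc (ciT τ) (cjT τ) n : ℝ) ^ (m + 1) + 4 ^ (m + 1)) := by
  have h1 : ((Sel n : ℕ) : ℝ) = (∑ τ : Fin 4 → ZMod 2, (Zc (ciT τ) (cjT τ) n : ℝ)) + 4 := by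
    unfold Sel
    push_cast
    rfl
  rw [h1]
  have h2 := add_pow_le (a := ∑ τ : Fin 4 → ZMod 2, (Zc (ciT τ) (cjT τ) n : ℝ)) (b := 4)
    (sum_nonneg fun _ _ => Nat.cast_nonneg _) (by norm_num) (m + 1)
  rw [Nat.add_sub_cancel] at h2
  refine h2.trans ?_
  refine mul_le_mul_of_nonneg_left ?_ (by positivity)
  refine add_le_add_left ?_ _
  have h3 := pow_sum_div_card_le_sum_pow (s := (univ : Finset (Fin 4 → ZMod 2))) (f := fun τ => (Zc (ciT τ) (cjT τ) n : ℝ)) (fun _ _ => Nat.cast_nonneg _) m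
  have hc : ((univ : Finset (Fin 4 → ZMod 2)).card : ℝ) = 16 := by
    rw [card_univ, Fintype.card_fun, ZMod.card]; norm_num
  rw [hc, div_le_iff₀ (by positivity)] at h3
  linarith

lemma Sel_moment (m : ℕ) : ∃ C : ℝ, 0 ≤ C ∧ ∀ X : ℕ, 1 ≤ X → ∑ n ∈ Qs X, ((Sel n : ℕ) : ℝ) ^ (m + 1) ≤ C * X := by
  have hZ := fun τ : Fin 4 → ZMod 2 => Z_bound (I := Fin (m + 1) × Fin 2) (pw (m + 1) (ciT τ)) (pw (m + 1) (cjT τ))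
  choose C hC using hZ
  have key : ∀ X : ℕ, 1 ≤ X → ∑ n ∈ Qs X, ((Sel n : ℕ) : ℝ) ^ (m + 1) ≤ (2 ^ m * (16 ^ m * ∑ τ, C τ + 4 ^ (m + 1))) * X := by
    intro X hX
    refine (sum_le_sum fun n _ => Sel_pow_le m n).trans ?_
    rw [← mul_sum, mul_assoc]
    refine mul_le_mul_of_nonneg_left ?_ (by positivity)
    rw [sum_add_distrib, ← mul_sum, sum_comm, add_mul, mul_assoc, sum_mul]
    refine add_le_add (mul_le_mul_of_nonneg_left (sum_le_sum fun τ _ => ?_) (by positivity)) ?_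
    · refine le_trans (sum_le_sum fun n _ => ?_) (hC τ X hX)
      exact_mod_cast Zc_pow (ciT τ) (cjT τ) (m + 1) n
    · rw [sum_const, nsmul_eq_mul, mul_comm]
      refine mul_le_mul_of_nonneg_left ?_ (by positivity)
      have : (Qs X).card ≤ X := (card_filter_le _ _).trans (by simp)
      exact_mod_cast this
  refine ⟨max (2 ^ m * (16 ^ m * ∑ τ, C τ + 4 ^ (m + 1))) 0, le_max_right _ _, fun X hX => (key X hX).trans ?_⟩
  exact mul_le_mul_of_nonneg_right (le_max_left _ _) (Nat.cast_nonneg _)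

lemma tsum_sub (P : ℕ → Prop) (Q : Finset ℕ) (h : ∀ n, P n ↔ n ∈ Q) (f : ℕ → ENNReal) :
    ∑' n : {n : ℕ // P n}, f n = ∑ n ∈ Q, f n := by
  obtain rfl : P = fun n => n ∈ Q := funext fun n => propext (h n)
  exact Finset.tsum_subtype Q f

theorem final (k : ℝ) (hk : 0 < k) : ∃ M : ℝ, 0 < M ∧ ∀ x : ℝ, 1 < x →
    ∑' n : {n : ℕ // Odd n ∧ Squarefree n ∧ 1 ≤ n ∧ (n : ℝ) ≤ x},
      (ENat.toENNReal (max (betaX (CongruentCurve n)) (betaY (CongruentCurve n)))) ^ k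
      < ENNReal.ofReal M * ({n : ℕ | Odd n ∧ Squarefree n ∧ 1 ≤ n ∧ (n : ℝ) ≤ x}.ncard : ENNReal) := by
  obtain ⟨K, j, hb⟩ := beta_bound
  obtain ⟨m, hm⟩ := exists_nat_ge ((j : ℝ) * k)
  obtain ⟨C, hC0, hC⟩ := Sel_moment m
  have hKk : (0 : ℝ) ≤ (K : ℝ) ^ k := by positivity
  have hM0 : (0 : ℝ) ≤ (K : ℝ) ^ k * (C * 18) := by positivity
  refine ⟨(K : ℝ) ^ k * (C * 18) + 1, by linarith, fun x hx => ?_⟩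
  set X := ⌊x⌋₊ with hXdef
  have hX1 : 1 ≤ X := Nat.le_floor (by simpa using hx.le)
  have hmem : ∀ n : ℕ, (Odd n ∧ Squarefree n ∧ 1 ≤ n ∧ (n : ℝ) ≤ x) ↔ n ∈ Qs X := by
    intro n
    unfold Qs
    rw [mem_filter, mem_Icc, hXdef, Nat.le_floor_iff (by linarith)]
    tauto
  have hset : {n : ℕ | Odd n ∧ Squarefree n ∧ 1 ≤ n ∧ (n : ℝ) ≤ x} = (Qs X : Set ℕ) := by
    ext n
    exact hmem n
  rw [hset, Set.ncard_coe_finset,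
    tsum_sub _ (Qs X) hmem (fun n => (ENat.toENNReal (max (betaX (CongruentCurve n)) (betaY (CongruentCurve n)))) ^ k)]
  have hcard : 1 ≤ (Qs X).card := by
    rw [Nat.one_le_iff_ne_zero, ← Nat.pos_iff_ne_zero, card_pos]
    refine ⟨1, ?_⟩
    unfold Qs
    rw [mem_filter, mem_Icc]
    exact ⟨⟨le_rfl, hX1⟩, odd_one, squarefree_one⟩
  have hterm : ∀ n ∈ Qs X, (ENat.toENNReal (max (betaX (CongruentCurve n)) (betaY (CongruentCurve n)))) ^ k
      ≤ ENNReal.ofReal ((K : ℝ) ^ k * ((Sel n : ℕ) : ℝ) ^ (m + 1)) := by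
    intro n hn
    have hn' := (hmem n).mpr hn
    have h1 := ENat.toENNReal_le.mpr (hb n hn'.2.1 hn'.1)
    refine (ENNReal.rpow_le_rpow h1 hk.le).trans ?_
    rw [ENat.toENNReal_coe, ← ENNReal.ofReal_natCast, ENNReal.ofReal_rpow_of_nonneg (Nat.cast_nonneg _) hk.le]
    refine ENNReal.ofReal_le_ofReal ?_
    push_cast
    rw [Real.mul_rpow (by positivity) (by positivity)]
    refine mul_le_mul_of_nonneg_left ?_ hKk
    have hS : (1 : ℝ) ≤ ((Sel n : ℕ) : ℝ) := by
      have : 1 ≤ Sel n := by unfold Sel; omega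
      exact_mod_cast this
    rw [← Real.rpow_natCast, ← Real.rpow_mul (by linarith), ← Real.rpow_natCast]
    refine Real.rpow_le_rpow_of_exponent_le hS ?_
    push_cast
    linarith
  refine (sum_le_sum hterm).trans_lt ?_
  rw [← ENNReal.ofReal_sum_of_nonneg (fun n _ => by positivity), ← ENNReal.ofReal_natCast, ← ENNReal.ofReal_mul (by linarith),
    ENNReal.ofReal_lt_ofReal_iff_of_nonneg (sum_nonneg fun n _ => by positivity), ← mul_sum]
  have h1 := hC X hX1
  have h2 := density X
  have h3 : (1 : ℝ) ≤ ((Qs X).card : ℝ) := by exact_mod_cast hcard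
  have h4 : C * X ≤ C * (18 * (Qs X).card) := mul_le_mul_of_nonneg_left (by linarith) hC0
  have h5 := mul_le_mul_of_nonneg_left (h1.trans h4) hKk
  nlinarith

end AC


/-- For every `k > 0` there is `M(k) > 0` such that for all `x > 1`, the sum over odd
squarefree `n` with `1 ≤ n ≤ x` of `max{βx(Bₙ), βy(Bₙ)}^k` is less than `M(k)` times the
number of such `n`. -/
theorem average_congruent (k : ℝ) (hk : 0 < k) :
    ∃ M : ℝ, 0 < M ∧
      ∀ x : ℝ, 1 < x →
        ∑' n : {n : ℕ // Odd n ∧ Squarefree n ∧ 1 ≤ n ∧ (n : ℝ) ≤ x},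
            (ENat.toENNReal (max (betaX (CongruentCurve n)) (betaY (CongruentCurve n)))) ^ k
          < ENNReal.ofReal M *
              ({n : ℕ | Odd n ∧ Squarefree n ∧ 1 ≤ n ∧ (n : ℝ) ≤ x}.ncard : ℝ≥0∞) := by
  exact AC.final k hk
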